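/- For every integer k ≥ 1 there exists a real ℓ_* > 1 with the following property (and when k ∈ {1,2} the property below holds for every ℓ > 1): for every real ℓ with 1 < ℓ < ℓ_* there exist a real β with 0 < β < k and a function v : [0,∞) → ℝ, infinitely differentiable on [0,∞), such that, setting m := βℓ/(ℓ+1) and Z₁ := k√ℓ/(ℓ(k−m) + m): v(0) = 0; |v(Z)| < 1 for all Z ≥ 0; v(Z) < Z for all Z > 0; Δ_Z(Z, v(Z))·v′(Z) = Δ_v(Z, v(Z)) for all Z ≥ 0; Δ_Z(Z, v(Z)) > 0 for all Z ∈ (0, Z₁); Δ_Z(Z, v(Z)) < 0 for all Z ∈ (Z₁, ∞); and v(Z₁) = m/((k−m)√ℓ). -/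

import Mathlib

open Real Set Filter Topology

/-- Numerator of the self-similar relativistic Euler ODE `dv/dZ = Δ_v / Δ_Z`. -/
noncomputable def Deltav (m k Z v : ℝ) : ℝ :=
  (1 - v ^ 2) * (m * (1 - v ^ 2) * Z - k * v * (1 - v * Z))

/-- Denominator of the self-similar relativistic Euler ODE `dv/dZ = Δ_v / Δ_Z`. -/
noncomputable def DeltaZ (ℓ Z v : ℝ) : ℝ :=
  Z * ((1 - Z * v) ^ 2 - ℓ * (v - Z) ^ 2)

lemma k1s (e g s : ℝ) (he : 0 < e) (h3 : 3*g ≤ 2+e) (h4 : 2+e ≤ 4*g) (hT : 0 ≤ (1-g)/2-e+s)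
  (hs : s*(1+g+2*s-e) = e*(g-1/2)) : 0 ≤ s ∧ s ≤ 15/100*e ∧ e ≤ 26/100 ∧ g ≤ 3/4:= by
  have h1 : 0 < 1+g+2*s-e := by linarith
  have h2 : 0 ≤ s := by
    by_contra h
    push Not at h
    nlinarith
  have h0: e ≤ 1/2 := by
    by_contra h; push Not at h
    nlinarith
  have h5 : g ≤ 3/4 := by
    by_contra h; push Not at h
    nlinarith
  have h6 : s ≤ 15/100*e := by
    by_contra h; push Not at h
    have : s*(2*g+e) ≤ e*(g-1/2) := by nlinarith
    nlinarith
  refine ⟨h2,h6,?_,h5⟩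
  nlinarith

lemma k1prods (e g s : ℝ) (he : 0 ≤ e) (h3 : 0 ≤ 2+e-3*g) (h4 : 0 ≤ 4*g-2-e)  (hs0 : 0 ≤ s) (hs1 : 0 ≤ 15/100*e-s)  (hT0 : 0 ≤ (1-g)/2+s-e) :
   0 ≤ e*e ∧ 0 ≤ e*(2+e-3*g) ∧ 0 ≤ e*(4*g-2-e) ∧ 0 ≤ e*s ∧ 0 ≤ e*(15/100*e-s) ∧ 0 ≤ e*((1-g)/2+s-e) ∧
   0 ≤ (2+e-3*g)*(2+e-3*g) ∧ 0 ≤ (2+e-3*g)*(4*g-2-e) ∧ 0 ≤ (2+e-3*g)*s ∧ 0 ≤ (2+e-3*g)*(15/100*e-s) ∧ 0 ≤ (2+e-3*g)*((1-g)/2+s-e) ∧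
   0 ≤ (4*g-2-e)*(4*g-2-e) ∧ 0 ≤ (4*g-2-e)*s ∧ 0 ≤ (4*g-2-e)*(15/100*e-s) ∧ 0 ≤ (4*g-2-e)*((1-g)/2+s-e) ∧
   0 ≤ s*s ∧ 0 ≤ s*(15/100*e-s) ∧ 0 ≤ s*((1-g)/2+s-e) := by
  refine ⟨?_,?_,?_,?_,?_,?_,?_,?_,?_,?_,?_,?_,?_,?_,?_,?_,?_,?_⟩ <;> positivity

lemma k1a (e g s a : ℝ) (he : 0 < e) (h3 : 3*g ≤ 2+e) (h4 : 2+e ≤ 4*g)  (hs0 : 0 ≤ s) (hs1 : s ≤ 15/100*e) (he1: e ≤ 26/100)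
  (hT0 : 0 ≤ (1-g)/2+s-e)
  (ha : a*(2+e-2*g) = 2*((1-g)/2-s+((1+g)/2+s)*(1-g-e)/2-e*(2-g)/4)+e*g-((1-g)/2-s)*g+((1-g)/2+s-e)+(1+((1-g)/2+s-e))*e) :
  55/100 ≤ a ∧ a ≤ 1-17/10*e ∧ 1-26/10*e ≤ a := by
  have hw : 0 < 2+e-2*g := by linarith
  have e1 := mul_nonneg hs0 he.le
  have e2 := mul_nonneg he.le (sub_nonneg.2 h4)
  have e3 := mul_nonneg he.le (sub_nonneg.2 h3)
  have e4 := mul_nonneg hs0 (sub_nonneg.2 h3)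
  have e5 := mul_nonneg hs0 (sub_nonneg.2 h4)
  have e6 := mul_nonneg he.le (sub_nonneg.2 hs1)
  refine ⟨le_of_mul_le_mul_right ?_ hw, le_of_mul_le_mul_right ?_ hw, le_of_mul_le_mul_right ?_ hw⟩
  · nlinarith
  · nlinarith
  · nlinarith

lemma k1b0 (e g s  : ℝ) (he : 0 ≤ e) (h3 : 0 ≤ 2+e-3*g) (h4 : 0 ≤ 4*g-2-e)  (hs0 : 0 ≤ s) (hs1 : 0 ≤ 15/100*e-s) (hT0 : 0 ≤ (1-g)/2+s-e)
  (q m T W β0 : ℝ) (hq : q = (1+g)/2+s) (hm : m=(1-g)/2-s) (hT : T=(1-g)/2+s-e) (hW : W = m+q*(1-g-e)/2-e*(2-g)/4)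
  (hβ0 : β0 = e*(1+T)+2*(T+(1+T)*e)+m*e-2*m*g+2*W+2*e+e*g) :  227/100-236/100*g+22/10*e ≤ β0 := by
  obtain ⟨_,_,_,_,_,_,_,_,_,_,_,_,_,_,_,_,_,_⟩ := k1prods e g s he h3 h4 hs0 hs1 hT0
  rw [hβ0,hW]; subst hq hm hT
  linarith
lemma k1b1 (e g s  : ℝ) (he : 0 ≤ e) (h3 : 0 ≤ 2+e-3*g) (h4 : 0 ≤ 4*g-2-e)  (hs0 : 0 ≤ s) (hs1 : 0 ≤ 15/100*e-s) (hT0 : 0 ≤ (1-g)/2+s-e)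
  (q m T W β1 : ℝ) (hq : q = (1+g)/2+s) (hm : m=(1-g)/2-s) (hT : T=(1-g)/2+s-e) (hW : W = m+q*(1-g-e)/2-e*(2-g)/4)
  (hβ1 : β1 = e*T+m*(T+(1+T)*e)+2*e*W) :  β1 ≤ (1-g)*(1-g)/4+e*(22/10-2*g-25/10*e) := by
  obtain ⟨_,_,_,_,_,_,_,_,_,_,_,_,_,_,_,_,_,_⟩ := k1prods e g s he h3 h4 hs0 hs1 hT0
  rw [hβ1,hW]; subst hq hm hT
  nlinarith

lemma k1fA (e g : ℝ) (he : 0 ≤ e) (h3 : 0 ≤ 2+e-3*g) (h4 : 0 ≤ 4*g-2-e) (he1 : 0 ≤ 26/100-e) (hT : 0 ≤ (1-g)/2-85/100*e):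
   0 ≤ (1-26/10*e)*(177/100-236/100*g+22/10*e-2*e*(1-26/10*e))-((1-g)*(1-g)/4+e*(22/10-2*g-25/10*e)) := by
  nlinarith [mul_nonneg he h3, mul_nonneg he h4, mul_nonneg he he, mul_nonneg he hT, mul_nonneg h3 h4, mul_nonneg (mul_nonneg he he) h3, mul_nonneg (mul_nonneg he he) h4, mul_nonneg (mul_nonneg he he) he1]
lemma k1gA (e g : ℝ) (he : 0 ≤ e) (h3 : 0 ≤ 2+e-3*g) (h4 : 0 ≤ 4*g-2-e) (he1 : 0 ≤ 26/100-e) (hT : 0 ≤ (1-g)/2-85/100*e):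
   1/1000 ≤ ((1-26/10*e)*(227/100-236/100*g+22/10*e-2*e*(1-26/10*e))-((1-g)*(1-g)/4+e*(22/10-2*g-25/10*e)))*(1+g) - 3*(1-26/10*e)*(1-26/10*e)*(2+e-3*g) := by
  nlinarith [mul_nonneg he h3, mul_nonneg he h4, mul_nonneg he he, mul_nonneg he hT, mul_nonneg h3 h4, mul_nonneg (mul_nonneg he he) h3, mul_nonneg (mul_nonneg he he) h4, mul_nonneg (mul_nonneg he he) he1]

lemma k1fB (e g : ℝ) (he : 0 ≤ e) (h3 : 0 ≤ 2+e-3*g) (h4 : 0 ≤ 4*g-2-e) (he1 : 0 ≤ 26/100-e) (hT : 0 ≤ (1-g)/2-85/100*e):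
   0 ≤ (1-17/10*e)*(177/100-236/100*g+22/10*e-2*e*(1-17/10*e))-((1-g)*(1-g)/4+e*(22/10-2*g-25/10*e)) := by
  nlinarith [mul_nonneg he h3, mul_nonneg he h4, mul_nonneg he he, mul_nonneg he hT, mul_nonneg h3 h4, mul_nonneg (mul_nonneg he he) h3, mul_nonneg (mul_nonneg he he) h4, mul_nonneg (mul_nonneg he he) he1]
lemma k1gB (e g : ℝ) (he : 0 ≤ e) (h3 : 0 ≤ 2+e-3*g) (h4 : 0 ≤ 4*g-2-e) (he1 : 0 ≤ 26/100-e) (hT : 0 ≤ (1-g)/2-85/100*e):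
   1/1000 ≤ ((1-17/10*e)*(227/100-236/100*g+22/10*e-2*e*(1-17/10*e))-((1-g)*(1-g)/4+e*(22/10-2*g-25/10*e)))*(1+g) - 3*(1-17/10*e)*(1-17/10*e)*(2+e-3*g) := by
  nlinarith [mul_nonneg he h3, mul_nonneg he h4, mul_nonneg he he, mul_nonneg he hT, mul_nonneg h3 h4, mul_nonneg (mul_nonneg he he) h3, mul_nonneg (mul_nonneg he he) h4, mul_nonneg (mul_nonneg he he) he1]

lemma k1c (e g s  : ℝ) (he : 0 ≤ e) (h3 : 0 ≤ 2+e-3*g) (h4 : 0 ≤ 4*g-2-e)  (hs0 : 0 ≤ s) (hs1 : 0 ≤ 15/100*e-s) (hT0 : 0 ≤ (1-g)/2+s-e)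
  (he1 : e ≤ 26/100)
  (q m T W a : ℝ) (hq : q = (1+g)/2+s) (hm : m=(1-g)/2-s) (hT : T=(1-g)/2+s-e) (hW : W = m+q*(1-g-e)/2-e*(2-g)/4)
  (ha0 : 55/100 ≤ a) (ha1 : a ≤ 1-17/10*e) :
   35/100 ≤ e*(6+4*T-5*a+g)+e*m+3*T-3*m*g+2*W ∧
   -2/10 ≤ -e*T+2*e*((1+T)*a-T)-e*m*(1+T)-2*m*(T+(1+T)*e-e*a)-4*e*W+2*e*a ∧ a*(1-g/2) ≤ 3*W*(1+g) := by
  obtain ⟨_,_,_,_,_,_,_,_,_,_,_,_,_,_,_,_,_,_⟩ := k1prods e g s he h3 h4 hs0 hs1 hT0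
  have i1 : e*a ≤ e*(1-17/10*e) := mul_le_mul_of_nonneg_left ha1 he
  refine ⟨?_,?_,?_⟩
  · clear ha0 ha1
    rw [hW]; subst hq hm hT
    linarith
  · have hm0 : 0 ≤ m := by linarith
    have hT0' : 0 ≤ T := by linarith
    have i2 : 0 ≤ (a-55/100)*(2*e*(1+T)+2*m*e+2*e) := by
      apply mul_nonneg (by linarith); positivity
    have : -2/10 ≤ -e*T+2*e*((1+T)*(55/100)-T)-e*m*(1+T)-2*m*(T+(1+T)*e-e*(55/100))-4*e*W+2*e*(55/100) := by
      clear i1 i2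
      have hmT : m*T ≤ (1-g)*(1-g)/4 - e*(1-g)/2+e*s := by subst hm hT; nlinarith [mul_nonneg hs0 hs0]
      have hmTe : e*(m*T) ≤ e*(1/16) := mul_le_mul_of_nonneg_left (by nlinarith) he
      have : -2/10 ≤ -e*T+2*e*((1+T)*(55/100)-T)-e*m-3*e*(1/16)-2*((1-g)*(1-g)/4 - e*(1-g)/2+e*s)-2*m*(e-e*(55/100))-4*e*W+2*e*(55/100) := by
        clear hmT hmTe
        rw [hW]; subst hq hm hT
        nlinarith
      linarith
    linarith
  · have i3 : (1-g/2)*a ≤ (1-g/2)*(1-17/10*e) := mul_le_mul_of_nonneg_left ha1 (by linarith)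
    have i4 : (1-g/2)*(1-17/10*e) ≤ 3*W*(1+g) := by
      rw [hW]; subst hq hm hT
      clear i1 i3 ha1 ha0
      nlinarith
    linarith

noncomputable def ca (k q e g : ℝ) : ℝ := (2*((k-q)+q*(q-e-g))+k*e*g-(k-q)*g+k*((q-e-g)+(1+(q-e-g))*e))/(k*(2+e-2*g))
noncomputable def cB (k q e g : ℝ) : ℝ := (k*e*(1+(q-e-g))+2*k*((q-e-g)+(1+(q-e-g))*e)+(k-q)*e-2*(k-q)*g+2*((k-q)+q*(q-e-g))+2*k*e+k*e*g) - 2*k*e*ca k q e g - (k*e*(q-e-g)+(k-q)*((q-e-g)+(1+(q-e-g))*e)+2*e*((k-q)+q*(q-e-g)))/ca k q e g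
noncomputable def cC1 (k q e g : ℝ) : ℝ := e*k*(6+4*(q-e-g)-5*ca k q e g+g)+e*(k-q)+3*k*(q-e-g)-3*(k-q)*g+2*((k-q)+q*(q-e-g))
noncomputable def cC0 (k q e g : ℝ) : ℝ := -e*k*(q-e-g)+e*(2*k-(k-q)/ca k q e g)*((1+(q-e-g))*ca k q e g-(q-e-g))-2*(k-q)*((q-e-g)+(1+(q-e-g))*e-e*ca k q e g)-4*e*((k-q)+q*(q-e-g))+2*e*k*ca k q e g
/-- the inequalities used later -/
def Ineq (k q e g : ℝ) : Prop := 0 < ca k q e g ∧ 0 < cB k q e g ∧ 3*ca k q e g*k*(2+e-3*g) < cB k q e g*(1+g) ∧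
  ca k q e g*k*(1-g/2) ≤ 3*((k-q)+q*(q-e-g))*(1+g) ∧
  0 < (4*g-2-e)*cB k q e g^2+cC1 k q e g*cB k q e g*(2+e-3*g)+cC0 k q e g*k*(2+e-3*g)^2

lemma concave_quad (α β γ A C x : ℝ) (hγ : 0 ≤ γ) (h1 : A ≤ x) (h2 : x ≤ C) (hA : 0 ≤ α+β*A-γ*(A*A)) (hC : 0 ≤ α+β*C-γ*(C*C)) :
    0 ≤ α+β*x-γ*(x*x) := by
  rcases h1.eq_or_lt with h | h
  · rw [← h]; exact hA
  · have hAC : 0 < C - A := by linarith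
    have : (C-A)*(α+β*x-γ*(x*x)) = (C-x)*(α+β*A-γ*(A*A))+(x-A)*(α+β*C-γ*(C*C))+γ*((x-A)*(C-x)*(C-A)) := by ring
    have h4 : 0 ≤ (C-A)*(α+β*x-γ*(x*x)) := by
      rw [this]
      have p1 := mul_nonneg (sub_nonneg.2 h2) hA
      have p2 := mul_nonneg (sub_nonneg.2 h1) hC
      have p3 := mul_nonneg hγ (mul_nonneg (mul_nonneg (sub_nonneg.2 h1) (sub_nonneg.2 h2)) hAC.le)
      linarith
    exact nonneg_of_mul_nonneg_right h4 hAC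

lemma k1last (e g B C1 C0 : ℝ) (he : 0 < e) (he1 : e ≤ 26/100) (h3 : 0 ≤ 2+e-3*g) (h4 : 0 ≤ 4*g-2-e) (hB : 1/2 ≤ B) (hC1 : 35/100 ≤ C1) (hC0 : -2/10 ≤ C0) :
    0 < (4*g-2-e)*B^2+C1*B*(2+e-3*g)+C0*1*(2+e-3*g)^2 := by
  have hu : 2+e-3*g ≤ 6/10 := by linarith
  have hB2 : 0 < B^2 := by positivity
  rcases h3.eq_or_lt with h | h
  · rw [← h]
    have : 0 < 4*g-2-e := by linarith
    have := mul_pos this hB2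
    linarith
  · have i1: 0 ≤ (4*g-2-e)*B^2 := by positivity
    have i2 : 35/100*(1/2) ≤ C1*B := by
      apply mul_le_mul hC1 hB <;> linarith
    have i3 : -2/10*(2+e-3*g) ≤ C0*(2+e-3*g) := mul_le_mul_of_nonneg_right hC0 h3
    have : 0 < C1*B+C0*(2+e-3*g) := by linarith
    have := mul_pos this h
    linarith

set_option maxHeartbeats 1000000 in
lemma k1ineq (q e g : ℝ) (he : 0 < e) (h3 : 3*g ≤ 2+e) (h4 : 2+e ≤ 4*g) (hT0 : 0 ≤ q-e-g)
   (hR : 2*q^2-q*(1+g+e)+e*(2-g)/2=0) : Ineq 1 q e g := by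
  obtain ⟨s, hq⟩ : ∃ s, q = (1+g)/2+s := ⟨q-(1+g)/2, by ring⟩
  have hs : s*(1+g+2*s-e) = e*(g-1/2) := by subst hq; linarith
  have hT : 0 ≤ (1-g)/2-e+s := by subst hq; linarith
  obtain ⟨hs0,hs1,he1,hg1⟩ := k1s e g s he h3 h4 hT hs
  have hW : (1-q)+q*(q-e-g) = ((1-g)/2-s)+q*(1-g-e)/2-e*(2-g)/4 := by subst hq; linarith
  have hm : 1-q = (1-g)/2-s := by subst hq; ring
  have hT' : q-e-g = (1-g)/2+s-e := by subst hq; ring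
  have hw : 0 < 2+e-2*g := by linarith
  have ha : ca 1 q e g*(2+e-2*g) = 2*((1-q)+q*(q-e-g))+e*g-(1-q)*g+(q-e-g)+(1+(q-e-g))*e := by
    unfold ca; field_simp; ring
  have hT2 : 0 ≤ (1-g)/2+s-e := by linarith
  have h3' : 0 ≤ 2+e-3*g := by linarith
  have h4' : 0 ≤ 4*g-2-e := by linarith
  have hs1' : 0 ≤ 15/100*e-s := by linarith
  obtain ⟨a1,a2,a3⟩ := k1a e g s (ca 1 q e g) he h3 h4 hs0 hs1 he1 hT2 (by rw [ha, hW, hm, hT',hq])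
  have b0 := k1b0 e g s he.le h3' h4' hs0 hs1' hT2 q (1-q) (q-e-g) ((1-q)+q*(q-e-g)) _ hq hm hT' (by rw [hW,hm]) rfl
  have b1 := k1b1 e g s he.le h3' h4' hs0 hs1' hT2 q (1-q) (q-e-g) ((1-q)+q*(q-e-g)) _ hq hm hT' (by rw [hW,hm]) rfl
  obtain ⟨c1,c2,c3⟩ := k1c e g s he.le h3' h4' hs0 hs1' hT2 he1 q (1-q) (q-e-g) ((1-q)+q*(q-e-g)) (ca 1 q e g) hq hm hT' (by rw [hW,hm]) a1 a2
  have hB : cB 1 q e g * ca 1 q e g = ca 1 q e g*((e * (1 + (q - e - g)) + 2 * (q - e - g + (1 + (q - e - g)) * e) + (1 - q) * e - 2 * (1 - q) * g +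
        2 * (1 - q + q * (q - e - g)) + 2 * e + e * g) - 2*e*ca 1 q e g) - (e * (q - e - g) + (1 - q) * (q - e - g + (1 + (q - e - g)) * e) + 2 * e * (1 - q + q * (q - e - g))) := by
    have : ca 1 q e g ≠ 0 := by linarith
    unfold cB
    field_simp
  have hC1 : 35/100 ≤ cC1 1 q e g := by unfold cC1; linarith
  have hm0 : 0 ≤ 1-q := by linarith
  have hC0 : -2/10 ≤ cC0 1 q e g := by
    have : (1-q)/ca 1 q e g *((1+(q-e-g))*ca 1 q e g-(q-e-g)) ≤ (1-q)*(1+(q-e-g)) := by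
      have h : (1-q)/ca 1 q e g *((1+(q-e-g))*ca 1 q e g-(q-e-g)) = (1-q)*(1+(q-e-g)) - (1-q)*(q-e-g)/ca 1 q e g := by
        have : ca 1 q e g ≠ 0 := by linarith
        field_simp
      rw [h]
      have : 0 ≤ (1-q)*(q-e-g)/ca 1 q e g := by
        apply div_nonneg (mul_nonneg hm0 hT0); linarith
      linarith
    have h2 := mul_le_mul_of_nonneg_left this he.le
    unfold cC0
    linarith
  unfold Ineq
  generalize ca 1 q e g = a at *
  generalize cB 1 q e g = B at *
  generalize cC1 1 q e g = C1 at *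
  generalize cC0 1 q e g = C0 at *
  generalize (e * (1 + (q - e - g)) + 2 * (q - e - g + (1 + (q - e - g)) * e) + (1 - q) * e - 2 * (1 - q) * g +
        2 * (1 - q + q * (q - e - g)) + 2 * e + e * g) = β0 at *
  generalize (e * (q - e - g) + (1 - q) * (q - e - g + (1 + (q - e - g)) * e) + 2 * e * (1 - q + q * (q - e - g))) = β1 at *
  have hTe : 0 ≤ (1-g)/2-85/100*e := by linarith
  have he1' : 0 ≤ 26/100-e := by linarith
  have hA := k1fA e g he.le h3' h4' he1' hTe
  have hB' := k1fB e g he.le h3' h4' he1' hTe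
  have gA := k1gA e g he.le h3' h4' he1' hTe
  have gB := k1gB e g he.le h3' h4' he1' hTe
  have a0 : 0 < a := by linarith
  have hab : a*(227/100-236/100*g+22/10*e - 2*e*a) ≤ a*(β0-2*e*a) := by
    apply mul_le_mul_of_nonneg_left _ a0.le; linarith
  have hBlow : 1/2 ≤ B := by
    have : 1/2*a ≤ B*a := by
      rw [hB]
      have := concave_quad (-((1-g)*(1-g)/4+e*(22/10-2*g-25/10*e))) (177/100-236/100*g+22/10*e) (2*e) (1-26/10*e) (1-17/10*e) a (by linarith) a3 a2 (by linarith) (by linarith)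
      linarith
    exact le_of_mul_le_mul_right this a0
  have hB3 : 3*a*1*(2+e-3*g) < B*(1+g) := by
    have h := concave_quad (-((1-g)*(1-g)/4+e*(22/10-2*g-25/10*e))*(1+g)-1/1000) ((227/100-236/100*g+22/10*e)*(1+g)) (2*e*(1+g)+3*(2+e-3*g)) (1-26/10*e) (1-17/10*e) a (by nlinarith) a3 a2 (by linarith) (by linarith)
    have h5 : 3*a*1*(2+e-3*g)*a < B*(1+g)*a := by
      have : B*(1+g)*a = (B*a)*(1+g) := by ring
      rw [this, hB]
      have h6 : (a*(227/100-236/100*g+22/10*e - 2*e*a) - ((1-g)*(1-g)/4+e*(22/10-2*g-25/10*e)))*(1+g) ≤ (a*(β0-2*e*a)-β1)*(1+g) := by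
        apply mul_le_mul_of_nonneg_right _ (by linarith); linarith
      linarith
    exact lt_of_mul_lt_mul_right h5 a0.le
  refine ⟨a0, by linarith, hB3, by linarith, ?_⟩
  exact k1last e g B C1 C0 he he1 h3' h4' hBlow hC1 hC0

set_option linter.unusedVariables false

/-- The monomials of the positivity certificates below. -/
def kM (e f t t' z z' : ℝ) (n i j k l p q : ℕ) : ℝ := (n:ℝ)*(e^i*f^j*t^k*t'^l*z^p*z'^q)
lemma kM_nonneg {e f t t' z z' : ℝ} (he : 0 ≤ e) (hf : 0 ≤ f) (ht : 0 ≤ t) (ht' : 0 ≤ t') (hz : 0 ≤ z) (hz' : 0 ≤ z')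
    (n i j k l p q : ℕ) : 0 ≤ kM e f t t' z z' n i j k l p q := by
  unfold kM; positivity

lemma addnn {a b : ℝ} (ha : 0 ≤ a) (hb : 0 ≤ b) : 0 ≤ a+b := add_nonneg ha hb

set_option maxHeartbeats 2000000 in
lemma k2F0 (e f t t' z z' g s : ℝ) (he : 0 ≤ e) (hf : 0 ≤ f) (ht : 0 ≤ t) (ht' : 0 ≤ t') (hz : 0 ≤ z) (hz' : 0 ≤ z')
    (hf1 : f = 7/10 - e) (ht1 : t' = 1-t) (hz1 : z' = 1-z) (hg : g = (2+e)*(3+t)/12) (hs : s = e*(3/5*g-41/100+3/100*z)) :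
    0 ≤ ((3-3/2*g+e*(135/100*g-91/100-106/100*e))*((8125/1000-5*g+85/10*e-5*(e*e))*(2+e-2*g)-4*e*(3-3/2*g+e*(135/100*g-91/100-106/100*e)))-((1-g/2)*(1-g/2)+e*(707/100-325/100*g)-49/10*(e*e))*((2+e-2*g)*(2+e-2*g)))*(1+g)-6*((3-3/2*g+e*(135/100*g-91/100-106/100*e))*(3-3/2*g+e*(135/100*g-91/100-106/100*e)))*(2+e-3*g)-1/100 := by
  let M : ℕ → ℕ → ℕ → ℕ → ℕ → ℕ → ℕ → ℝ := kM e f t t' z z'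
  have hM : ∀ n i j k l p q, 0 ≤ M n i j k l p q := kM_nonneg he hf ht ht' hz hz'
  refine le_of_le_of_eq ?_ (show (
      M 228857400000000 0 6 0 5 0 0 + M 1927962000000000 0 6 1 4 0 0 + M 5189589000000000 0 6 2 3 0 0 + M 6313104000000000 0 6 3 2 0 0 + M 3624252000000000 0 6 4 1 0 0 +
      M 801622400000000 0 6 5 0 0 0 + M 1012464360000000 1 5 0 5 0 0 + M 9543582000000000 1 5 1 4 0 0 + M 26647857900000000 1 5 2 3 0 0 + M 32951802240000000 1 5 3 2 0 0 +
      M 19067589480000000 1 5 4 1 0 0 + M 4232450000000000 1 5 5 0 0 0 + M 1934813909880000 2 4 0 5 0 0 + M 19939570198920000 2 4 1 4 0 0 + M 56991514767480000 2 4 2 3 0 0 +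
      M 71049134421720000 2 4 3 2 0 0 + M 41197940537280000 2 4 4 1 0 0 + M 9135314844000000 2 4 5 0 0 0 + M 2376704635902000 3 3 0 5 0 0 + M 23833313443008000 3 3 1 4 0 0 +
      M 67228869138642000 3 3 2 3 0 0 + M 82928295953748000 3 3 3 2 0 0 + M 47609890796592000 3 3 4 1 0 0 + M 10453426886880000 3 3 5 0 0 0 + M 2188700074279350 4 2 0 5 0 0 +
      M 18315766911441600 4 2 1 4 0 0 + M 48343261412122650 4 2 2 3 0 0 + M 57361920358283100 4 2 3 2 0 0 + M 32011075216130400 4 2 4 1 0 0 + M 6864937319995200 4 2 5 0 0 0 +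
      M 1282969392521535 5 1 0 5 0 0 + M 8673671340830070 5 1 1 4 0 0 + M 20740165985012130 5 1 2 3 0 0 + M 23135868654862320 5 1 3 2 0 0 + M 12333226585416480 5 1 4 1 0 0 +
      M 2546611051610880 5 1 5 0 0 0 + M 319122557630991 6 0 0 5 0 0 + M 1863297540676242 6 0 1 4 0 0 + M 4083012715525038 6 0 2 3 0 0 + M 4280671890510372 6 0 3 2 0 0 +
      M 2171053839948768 6 0 4 1 0 0 + M 429174841583808 6 0 5 0 0 0)/9148386240000 = _ from by
    simp only [M, kM]; subst hs hg hf1 ht1 hz1; push_cast; ring)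
  refine div_nonneg ?_ (Nat.ofNat_nonneg _)
  clear_value M
  repeat' apply addnn
  all_goals apply hM

set_option maxHeartbeats 2000000 in
lemma k2B0 (e f t t' z z' g s : ℝ) (he : 0 ≤ e) (hf : 0 ≤ f) (ht : 0 ≤ t) (ht' : 0 ≤ t') (hz : 0 ≤ z) (hz' : 0 ≤ z')
    (hf1 : f = 7/10 - e) (ht1 : t' = 1-t) (hz1 : z' = 1-z) (hg : g = (2+e)*(3+t)/12) (hs : s = e*(3/5*g-41/100+3/100*z)) :
    0 ≤ ((3-3/2*g+e*(135/100*g-91/100-106/100*e))*((8125/1000-5*g+85/10*e-5*(e*e))*(2+e-2*g)-4*e*(3-3/2*g+e*(135/100*g-91/100-106/100*e))-2*(2+e-2*g))-((1-g/2)*(1-g/2)+e*(707/100-325/100*g)-49/10*(e*e))*((2+e-2*g)*(2+e-2*g)))-1/100 := by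
  let M : ℕ → ℕ → ℕ → ℕ → ℕ → ℕ → ℕ → ℝ := kM e f t t' z z'
  have hM : ∀ n i j k l p q, 0 ≤ M n i j k l p q := kM_nonneg he hf ht ht' hz hz'
  refine le_of_le_of_eq ?_ (show (
      M 4914270000000 0 5 0 4 0 0 + M 16417080000000 0 5 1 3 0 0 + M 20402370000000 0 5 2 2 0 0 + M 11177580000000 0 5 3 1 0 0 + M 2277520000000 0 5 4 0 0 0 +
      M 20992162500000 1 4 0 4 0 0 + M 67659219000000 1 4 1 3 0 0 + M 80132296500000 1 4 2 2 0 0 + M 41111586000000 1 4 3 1 0 0 + M 7643146000000 1 4 4 0 0 0 +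
      M 34837956225000 2 3 0 4 0 0 + M 107689652550000 2 3 1 3 0 0 + M 119706627825000 2 3 2 2 0 0 + M 55496427900000 2 3 3 1 0 0 + M 8633328900000 2 3 4 0 0 0 +
      M 28718271898650 3 2 0 4 0 0 + M 85458011466600 3 2 1 3 0 0 + M 88679676211650 3 2 2 2 0 0 + M 35812357118100 3 2 3 1 0 0 + M 3862032224400 3 2 4 0 0 0 +
      M 12384831618585 4 1 0 4 0 0 + M 36525561362190 4 1 1 3 0 0 + M 36762058960560 4 1 2 2 0 0 + M 13585134302640 4 1 3 1 0 0 + M 957223582560 4 1 4 0 0 0 +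
      M 2395935510021 5 0 0 4 0 0 + M 7366926749274 5 0 1 3 0 0 + M 7803498310596 5 0 2 2 0 0 + M 3145685907204 5 0 3 1 0 0 + M 311518082736 5 0 4 0 0 0)/108909360000 = _ from by
    simp only [M, kM]; subst hs hg hf1 ht1 hz1; push_cast; ring)
  refine div_nonneg ?_ (Nat.ofNat_nonneg _)
  clear_value M
  repeat' apply addnn
  all_goals apply hM

set_option maxHeartbeats 2000000 in
lemma k2F1 (e f t t' z z' g s : ℝ) (he : 0 ≤ e) (hf : 0 ≤ f) (ht : 0 ≤ t) (ht' : 0 ≤ t') (hz : 0 ≤ z) (hz' : 0 ≤ z')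
    (hf1 : f = 7/10 - e) (ht1 : t' = 1-t) (hz1 : z' = 1-z) (hg : g = (2+e)*(3+t)/12) (hs : s = e*(3/5*g-41/100+3/100*z)) :
    0 ≤ ((3-3/2*g+e*(135/100*g-88/100-9/10*e))*((8125/1000-5*g+85/10*e-5*(e*e))*(2+e-2*g)-4*e*(3-3/2*g+e*(135/100*g-88/100-9/10*e)))-((1-g/2)*(1-g/2)+e*(707/100-325/100*g)-49/10*(e*e))*((2+e-2*g)*(2+e-2*g)))*(1+g)-6*((3-3/2*g+e*(135/100*g-88/100-9/10*e))*(3-3/2*g+e*(135/100*g-88/100-9/10*e)))*(2+e-3*g)-1/100 := by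
  let M : ℕ → ℕ → ℕ → ℕ → ℕ → ℕ → ℕ → ℝ := kM e f t t' z z'
  have hM : ∀ n i j k l p q, 0 ≤ M n i j k l p q := kM_nonneg he hf ht ht' hz hz'
  refine le_of_le_of_eq ?_ (show (
      M 9154296000000 0 6 0 5 0 0 + M 77118480000000 0 6 1 4 0 0 + M 207583560000000 0 6 2 3 0 0 + M 252524160000000 0 6 3 2 0 0 + M 144970080000000 0 6 4 1 0 0 +
      M 32064896000000 0 6 5 0 0 0 + M 40167900000000 1 5 0 5 0 0 + M 380865564000000 1 5 1 4 0 0 + M 1065609950400000 1 5 2 3 0 0 + M 1319121568800000 1 5 3 2 0 0 +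
      M 763858142400000 1 5 4 1 0 0 + M 169645760000000 1 5 5 0 0 0 + M 73879177636800 2 4 0 5 0 0 + M 786722192395200 2 4 1 4 0 0 + M 2270464816564800 2 4 2 3 0 0 +
      M 2844437545051200 2 4 3 2 0 0 + M 1654573711804800 2 4 4 1 0 0 + M 367747978560000 2 4 5 0 0 0 + M 82265768013600 3 3 0 5 0 0 + M 907877200662000 3 3 1 4 0 0 +
      M 2632796257867200 3 3 2 3 0 0 + M 3292865227839600 3 3 3 2 0 0 + M 1907128673157600 3 3 4 1 0 0 + M 421431139036800 3 3 5 0 0 0 + M 68108657088294 4 2 0 5 0 0 +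
      M 657617228979408 4 2 1 4 0 0 + M 1824817451306922 4 2 2 3 0 0 + M 2223585228420108 4 2 3 2 0 0 + M 1262541791858112 4 2 4 1 0 0 + M 274248958341312 4 2 5 0 0 0 +
      M 39020770847943 5 1 0 5 0 0 + M 296954246563830 5 1 1 4 0 0 + M 750772573920738 5 1 2 3 0 0 + M 866029060247904 5 1 3 2 0 0 + M 472539483949824 5 1 4 1 0 0 +
      M 99341085280896 5 1 5 0 0 0 + M 10325173054599 6 0 0 5 0 0 + M 64285423556562 6 0 1 4 0 0 + M 146366072133822 6 0 2 3 0 0 + M 157480358898996 6 0 3 2 0 0 +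
      M 81425163587904 6 0 4 1 0 0 + M 16348832707392 6 0 5 0 0 0)/365935449600 = _ from by
    simp only [M, kM]; subst hs hg hf1 ht1 hz1; push_cast; ring)
  refine div_nonneg ?_ (Nat.ofNat_nonneg _)
  clear_value M
  repeat' apply addnn
  all_goals apply hM

set_option maxHeartbeats 2000000 in
lemma k2B1 (e f t t' z z' g s : ℝ) (he : 0 ≤ e) (hf : 0 ≤ f) (ht : 0 ≤ t) (ht' : 0 ≤ t') (hz : 0 ≤ z) (hz' : 0 ≤ z')
    (hf1 : f = 7/10 - e) (ht1 : t' = 1-t) (hz1 : z' = 1-z) (hg : g = (2+e)*(3+t)/12) (hs : s = e*(3/5*g-41/100+3/100*z)) :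
    0 ≤ ((3-3/2*g+e*(135/100*g-88/100-9/10*e))*((8125/1000-5*g+85/10*e-5*(e*e))*(2+e-2*g)-4*e*(3-3/2*g+e*(135/100*g-88/100-9/10*e))-2*(2+e-2*g))-((1-g/2)*(1-g/2)+e*(707/100-325/100*g)-49/10*(e*e))*((2+e-2*g)*(2+e-2*g)))-1/100 := by
  let M : ℕ → ℕ → ℕ → ℕ → ℕ → ℕ → ℕ → ℝ := kM e f t t' z z'
  have hM : ∀ n i j k l p q, 0 ≤ M n i j k l p q := kM_nonneg he hf ht ht' hz hz'
  refine le_of_le_of_eq ?_ (show (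
      M 196570800000 0 5 0 4 0 0 + M 656683200000 0 5 1 3 0 0 + M 816094800000 0 5 2 2 0 0 + M 447103200000 0 5 3 1 0 0 + M 91100800000 0 5 4 0 0 0 +
      M 841659660000 1 4 0 4 0 0 + M 2713150080000 1 4 1 3 0 0 + M 3213948060000 1 4 2 2 0 0 + M 1649324520000 1 4 3 1 0 0 + M 306738880000 1 4 4 0 0 0 +
      M 1405371951000 2 3 0 4 0 0 + M 4345700220000 2 3 1 3 0 0 + M 4832760375000 2 3 2 2 0 0 + M 2241920094000 2 3 3 1 0 0 + M 349161288000 2 3 4 0 0 0 +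
      M 1160642357514 3 2 0 4 0 0 + M 3441948007896 3 2 1 3 0 0 + M 3549932624754 3 2 2 2 0 0 + M 1414748715876 3 2 3 1 0 0 + M 145706211504 3 2 4 0 0 0 +
      M 495411243633 4 1 0 4 0 0 + M 1435954300686 4 1 1 3 0 0 + M 1398682248480 4 1 2 2 0 0 + M 475081529184 4 1 3 1 0 0 + M 16679077632 4 1 4 0 0 0 +
      M 95664592269 5 0 0 4 0 0 + M 284628227130 5 0 1 3 0 0 + M 284334699492 5 0 2 2 0 0 + M 99672186420 5 0 3 1 0 0 + M 4234691664 5 0 4 0 0 0)/4356374400 = _ from by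
    simp only [M, kM]; subst hs hg hf1 ht1 hz1; push_cast; ring)
  refine div_nonneg ?_ (Nat.ofNat_nonneg _)
  clear_value M
  repeat' apply addnn
  all_goals apply hM

lemma k2Al (e f t t' z z' g s : ℝ) (he : 0 ≤ e) (hf : 0 ≤ f) (ht : 0 ≤ t) (ht' : 0 ≤ t') (hz : 0 ≤ z) (hz' : 0 ≤ z')
    (hf1 : f = 7/10 - e) (ht1 : t' = 1-t) (hz1 : z' = 1-z) (hg : g = (2+e)*(3+t)/12) (hs : s = e*(3/5*g-41/100+3/100*z)) :
    0 ≤ (3-3/2*g+e*(3/4*g-1/2-e)+(1+e/2)*s)-(3-3/2*g+e*(135/100*g-91/100-106/100*e)) := by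
  let M : ℕ → ℕ → ℕ → ℕ → ℕ → ℕ → ℕ → ℝ := kM e f t t' z z'
  have hM : ∀ n i j k l p q, 0 ≤ M n i j k l p q := kM_nonneg he hf ht ht' hz hz'
  refine le_of_le_of_eq ?_ (show (
      M 120 1 2 0 1 1 0 + M 120 1 2 1 0 1 0 + M 14 2 1 0 1 0 1 + M 296 2 1 0 1 1 0 + M 154 2 1 1 0 0 1 +
      M 436 2 1 1 0 1 0 + M 161 3 0 0 1 0 1 + M 323 3 0 0 1 1 0 + M 350 3 0 1 0 0 1 + M 512 3 0 1 0 1 0)/1960 = _ from by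
    simp only [M, kM]; subst hs hg hf1 ht1 hz1; push_cast; ring)
  refine div_nonneg ?_ (Nat.ofNat_nonneg _)
  clear_value M
  repeat' apply addnn
  all_goals apply hM

lemma k2Au (e f t t' z z' g s : ℝ) (he : 0 ≤ e) (hf : 0 ≤ f) (ht : 0 ≤ t) (ht' : 0 ≤ t') (hz : 0 ≤ z) (hz' : 0 ≤ z')
    (hf1 : f = 7/10 - e) (ht1 : t' = 1-t) (hz1 : z' = 1-z) (hg : g = (2+e)*(3+t)/12) (hs : s = e*(3/5*g-41/100+3/100*z)) :
    0 ≤ (3-3/2*g+e*(135/100*g-88/100-9/10*e))-(3-3/2*g+e*(3/4*g-1/2-e)+(1+e/2)*s) := by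
  let M : ℕ → ℕ → ℕ → ℕ → ℕ → ℕ → ℕ → ℝ := kM e f t t' z z'
  have hM : ∀ n i j k l p q, 0 ≤ M n i j k l p q := kM_nonneg he hf ht ht' hz hz'
  refine le_of_le_of_eq ?_ (show (
      M 120 1 2 0 1 0 1 + M 120 1 2 1 0 0 1 + M 674 2 1 0 1 0 1 + M 392 2 1 0 1 1 0 + M 534 2 1 1 0 0 1 +
      M 252 2 1 1 0 1 0 + M 407 3 0 0 1 0 1 + M 245 3 0 0 1 1 0 + M 218 3 0 1 0 0 1 + M 56 3 0 1 0 1 0)/1960 = _ from by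
    simp only [M, kM]; subst hs hg hf1 ht1 hz1; push_cast; ring)
  refine div_nonneg ?_ (Nat.ofNat_nonneg _)
  clear_value M
  repeat' apply addnn
  all_goals apply hM

lemma k2b0 (e f t t' z z' g s : ℝ) (he : 0 ≤ e) (hf : 0 ≤ f) (ht : 0 ≤ t) (ht' : 0 ≤ t') (hz : 0 ≤ z) (hz' : 0 ≤ z')
    (hf1 : f = 7/10 - e) (ht1 : t' = 1-t) (hz1 : z' = 1-z) (hg : g = (2+e)*(3+t)/12) (hs : s = e*(3/5*g-41/100+3/100*z)) :
    0 ≤ ((1-g/2)*(8-g)+e*(10-g)-6*e*e+(4+4*e+g)*s)-(8125/1000-5*g+85/10*e-5*(e*e)) := by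
  let M : ℕ → ℕ → ℕ → ℕ → ℕ → ℕ → ℕ → ℝ := kM e f t t' z z'
  have hM : ∀ n i j k l p q, 0 ≤ M n i j k l p q := kM_nonneg he hf ht ht' hz hz'
  refine le_of_le_of_eq ?_ (show (
      M 60000 0 3 1 1 0 1 + M 60000 0 3 1 1 1 0 + M 70000 0 3 2 0 0 1 + M 70000 0 3 2 0 1 0 + M 317520 1 2 0 2 0 1 +
      M 385560 1 2 0 2 1 0 + M 990600 1 2 1 1 0 1 + M 1129200 1 2 1 1 1 0 + M 718480 1 2 2 0 0 1 + M 789040 1 2 2 0 1 0 +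
      M 278271 2 1 0 2 0 1 + M 459333 2 1 0 2 1 0 + M 1300518 2 1 1 1 0 1 + M 1668564 2 1 1 1 1 0 + M 1090152 2 1 2 0 0 1 +
      M 1277136 2 1 2 0 1 0 + M 118188 3 0 0 2 0 1 + M 231210 3 0 0 2 1 0 + M 740358 3 0 1 1 0 1 + M 969804 3 0 1 1 1 0 +
      M 655704 3 0 2 0 0 1 + M 772128 3 0 2 0 1 0)/246960 = _ from by
    simp only [M, kM]; subst hs hg hf1 ht1 hz1; push_cast; ring)
  refine div_nonneg ?_ (Nat.ofNat_nonneg _)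
  clear_value M
  repeat' apply addnn
  all_goals apply hM

lemma k2b1 (e f t t' z z' g s : ℝ) (he : 0 ≤ e) (hf : 0 ≤ f) (ht : 0 ≤ t) (ht' : 0 ≤ t') (hz : 0 ≤ z) (hz' : 0 ≤ z')
    (hf1 : f = 7/10 - e) (ht1 : t' = 1-t) (hz1 : z' = 1-z) (hg : g = (2+e)*(3+t)/12) (hs : s = e*(3/5*g-41/100+3/100*z)) :
    0 ≤ ((1-g/2)*(1-g/2)+e*(707/100-325/100*g)-49/10*(e*e))-((1-g/2)*(1-g/2)+e*(1-g/2)*(7+g/2)-e*e*(6-g)+e*(2-g)*s) := by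
  let M : ℕ → ℕ → ℕ → ℕ → ℕ → ℕ → ℕ → ℝ := kM e f t t' z z'
  have hM : ∀ n i j k l p q, 0 ≤ M n i j k l p q := kM_nonneg he hf ht ht' hz hz'
  refine le_of_le_of_eq ?_ (show (
      M 10800 1 3 0 2 0 1 + M 10800 1 3 0 2 1 0 + M 21600 1 3 1 1 0 1 + M 21600 1 3 1 1 1 0 + M 20800 1 3 2 0 0 1 +
      M 20800 1 3 2 0 1 0 + M 803520 2 2 0 2 0 1 + M 758160 2 2 0 2 1 0 + M 1290360 2 2 1 1 0 1 + M 1204680 2 2 1 1 1 0 +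
      M 540640 2 2 2 0 0 1 + M 500320 2 2 2 0 1 0 + M 1231101 3 1 0 2 0 1 + M 1145673 3 1 0 2 1 0 + M 1753284 3 1 1 1 0 1 +
      M 1594272 3 1 1 1 1 0 + M 612768 3 1 2 0 0 1 + M 539184 3 1 2 0 1 0 + M 456903 4 0 0 2 0 1 + M 416835 4 0 0 2 1 0 +
      M 533916 4 0 1 1 0 1 + M 460584 4 0 1 1 1 0 + M 125856 4 0 2 0 0 1 + M 92592 4 0 2 0 1 0)/493920 = _ from by
    simp only [M, kM]; subst hs hg hf1 ht1 hz1; push_cast; ring)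
  refine div_nonneg ?_ (Nat.ofNat_nonneg _)
  clear_value M
  repeat' apply addnn
  all_goals apply hM

set_option maxHeartbeats 2000000 in
lemma k2C1 (e f t t' z z' g s : ℝ) (he : 0 ≤ e) (hf : 0 ≤ f) (ht : 0 ≤ t) (ht' : 0 ≤ t') (hz : 0 ≤ z) (hz' : 0 ≤ z')
    (hf1 : f = 7/10 - e) (ht1 : t' = 1-t) (hz1 : z' = 1-z) (hg : g = (2+e)*(3+t)/12) (hs : s = e*(3/5*g-41/100+3/100*z)) :
    0 ≤ (4*g-2-e)*2*(2+e-2*g)+((2*e*(6+4*(1-g/2-e+s)+g)+e*(1-g/2-s)+6*(1-g/2-e+s)-3*(1-g/2-s)*g+2*((1-g/2-s)+(1+g/2+s)*(2-g-e)/2-e*(2-g)/2)-8/10)*(2+e-2*g)-10*e*(3-3/2*g+e*(3/4*g-1/2-e)+(1+e/2)*s))*(2+e-3*g)-1/100 := by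
  let M : ℕ → ℕ → ℕ → ℕ → ℕ → ℕ → ℕ → ℝ := kM e f t t' z z'
  have hM : ∀ n i j k l p q, 0 ≤ M n i j k l p q := kM_nonneg he hf ht ht' hz hz'
  refine le_of_le_of_eq ?_ (show (
      M 2561760000 0 5 0 4 0 1 + M 2561760000 0 5 0 4 1 0 + M 7539840000 0 5 1 3 0 1 + M 7539840000 0 5 1 3 1 0 + M 8309760000 0 5 2 2 0 1 +
      M 8309760000 0 5 2 2 1 0 + M 4087040000 0 5 3 1 0 1 + M 4087040000 0 5 3 1 1 0 + M 759360000 0 5 4 0 0 1 + M 759360000 0 5 4 0 1 0 +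
      M 10444032000 1 4 0 4 0 1 + M 10507536000 1 4 0 4 1 0 + M 30358944000 1 4 1 3 0 1 + M 30531312000 1 4 1 3 1 0 + M 34636608000 1 4 2 2 0 1 +
      M 34789824000 1 4 2 2 1 0 + M 19027136000 1 4 3 1 0 1 + M 19071488000 1 4 3 1 1 0 + M 4334400000 1 4 4 0 0 1 + M 4334400000 1 4 4 0 1 0 +
      M 15516079200 2 3 0 4 0 1 + M 15792321600 2 3 0 4 1 0 + M 44275492800 2 3 1 3 0 1 + M 45006242400 2 3 1 3 1 0 + M 53929204800 2 3 2 2 0 1 +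
      M 54556886400 2 3 2 2 1 0 + M 34924387200 2 3 3 1 0 1 + M 35097561600 2 3 3 1 1 0 + M 9838080000 2 3 4 0 0 1 + M 9838080000 2 3 4 0 1 0 +
      M 10284014880 3 2 0 4 0 1 + M 10723938840 3 2 0 4 1 0 + M 28530689040 3 2 1 3 0 1 + M 29654278920 3 2 1 3 1 0 + M 39585875520 3 2 2 2 0 1 +
      M 40503689760 3 2 2 2 1 0 + M 32320793760 3 2 3 1 0 1 + M 32554942080 3 2 3 1 1 0 + M 11101440000 3 2 4 0 0 1 + M 11101440000 3 2 4 0 1 0 +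
      M 3172460553 4 1 0 4 0 1 + M 3474874539 4 1 0 4 1 0 + M 8513429400 4 1 1 3 0 1 + M 9248108310 4 1 1 3 1 0 + M 14891625792 4 1 2 2 0 1 +
      M 15445750356 4 1 2 2 1 0 + M 15694377480 4 1 3 1 0 1 + M 15816237120 4 1 3 1 1 0 + M 6229440000 4 1 4 0 0 1 + M 6229440000 4 1 4 0 1 0 +
      M 512723304 5 0 0 4 0 1 + M 587951730 5 0 0 4 1 0 + M 1401918462 5 0 1 3 0 1 + M 1571389092 5 0 1 3 1 0 + M 2860307964 5 0 2 2 0 1 +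
      M 2971083888 5 0 2 2 1 0 + M 3337706520 5 0 3 1 0 1 + M 3354240240 5 0 3 1 1 0 + M 1391040000 5 0 4 0 0 1 + M 1391040000 5 0 4 0 1 0)/145212480 = _ from by
    simp only [M, kM]; subst hs hg hf1 ht1 hz1; push_cast; ring)
  refine div_nonneg ?_ (Nat.ofNat_nonneg _)
  clear_value M
  repeat' apply addnn
  all_goals apply hM

lemma k2C0 (e f t t' z z' g s : ℝ) (he : 0 ≤ e) (hf : 0 ≤ f) (ht : 0 ≤ t) (ht' : 0 ≤ t') (hz : 0 ≤ z) (hz' : 0 ≤ z')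
    (hf1 : f = 7/10 - e) (ht1 : t' = 1-t) (hz1 : z' = 1-z) (hg : g = (2+e)*(3+t)/12) (hs : s = e*(3/5*g-41/100+3/100*z)) :
    0 ≤ -6*e*(1-g/2-e+s)-3*e*(1-g/2-s)-3*e*((1-g/2)*(1-g/2-e)+e*s)-2*((1-g/2)*(1-g/2-e)+e*s)-4*e*((1-g/2-s)+(1+g/2+s)*(2-g-e)/2-e*(2-g)/2)+e*(22/10-165/100*e)*(8+4*(1-g/2-e+s)+2*(1-g/2-s))+116/100-e/2 := by
  let M : ℕ → ℕ → ℕ → ℕ → ℕ → ℕ → ℕ → ℝ := kM e f t t' z z'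
  have hM : ∀ n i j k l p q, 0 ≤ M n i j k l p q := kM_nonneg he hf ht ht' hz hz'
  refine le_of_le_of_eq ?_ (show (
      M 2520000 0 4 0 2 0 1 + M 2520000 0 4 0 2 1 0 + M 23040000 0 4 1 1 0 1 + M 23040000 0 4 1 1 1 0 + M 19520000 0 4 2 0 0 1 +
      M 19520000 0 4 2 0 1 0 + M 699930000 1 3 0 2 0 1 + M 699930000 1 3 0 2 1 0 + M 1494120000 1 3 1 1 0 1 + M 1494120000 1 3 1 1 1 0 +
      M 789840000 1 3 2 0 0 1 + M 789840000 1 3 2 0 1 0 + M 1547964180 2 2 0 2 0 1 + M 1548387540 2 2 0 2 1 0 + M 3291552960 2 2 1 1 0 1 +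
      M 3292752480 2 2 1 1 1 0 + M 1737837280 2 2 2 0 0 1 + M 1738613440 2 2 2 0 1 0 + M 1196528823 3 1 0 2 0 1 + M 1194560199 3 1 0 2 1 0 +
      M 2570717676 3 1 1 1 0 1 + M 2567609508 3 1 1 1 1 0 + M 1372601928 3 1 2 0 0 1 + M 1371462384 3 1 2 0 1 0 + M 336120939 4 0 0 2 0 1 +
      M 333728955 4 0 0 2 1 0 + M 727684920 4 0 1 1 0 1 + M 723377232 4 0 1 1 1 0 + M 392522616 4 0 2 0 0 1 + M 390606912 4 0 2 0 1 0)/17287200 = _ from by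
    simp only [M, kM]; subst hs hg hf1 ht1 hz1; push_cast; ring)
  refine div_nonneg ?_ (Nat.ofNat_nonneg _)
  clear_value M
  repeat' apply addnn
  all_goals apply hM

lemma k2a (e f t t' z z' g s : ℝ) (he : 0 ≤ e) (hf : 0 ≤ f) (ht : 0 ≤ t) (ht' : 0 ≤ t') (hz : 0 ≤ z) (hz' : 0 ≤ z')
    (hf1 : f = 7/10 - e) (ht1 : t' = 1-t) (hz1 : z' = 1-z) (hg : g = (2+e)*(3+t)/12) (hs : s = e*(3/5*g-41/100+3/100*z)) :
    0 ≤ (3-3/2*g+e*(3/4*g-1/2-e)+(1+e/2)*s)-(22/10-165/100*e)*(2+e-2*g) := by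
  let M : ℕ → ℕ → ℕ → ℕ → ℕ → ℕ → ℕ → ℝ := kM e f t t' z z'
  have hM : ∀ n i j k l p q, 0 ≤ M n i j k l p q := kM_nonneg he hf ht ht' hz hz'
  refine le_of_le_of_eq ?_ (show (
      M 6000 0 3 0 1 0 1 + M 6000 0 3 0 1 1 0 + M 64000 0 3 1 0 0 1 + M 64000 0 3 1 0 1 0 + M 12960 1 2 0 1 0 1 +
      M 15480 1 2 0 1 1 0 + M 179960 1 2 1 0 0 1 + M 182480 1 2 1 0 1 0 + M 14241 2 1 0 1 0 1 + M 20163 2 1 0 1 1 0 +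
      M 167626 2 1 1 0 0 1 + M 173548 2 1 1 0 1 0 + M 10368 3 0 0 1 0 1 + M 13770 3 0 0 1 1 0 + M 55782 3 0 1 0 0 1 +
      M 59184 3 0 1 0 1 0)/41160 = _ from by
    simp only [M, kM]; subst hs hg hf1 ht1 hz1; push_cast; ring)
  refine div_nonneg ?_ (Nat.ofNat_nonneg _)
  clear_value M
  repeat' apply addnn
  all_goals apply hM

set_option maxHeartbeats 2000000 in
lemma k2F4 (e f t t' z z' g s : ℝ) (he : 0 ≤ e) (hf : 0 ≤ f) (ht : 0 ≤ t) (ht' : 0 ≤ t') (hz : 0 ≤ z) (hz' : 0 ≤ z')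
    (hf1 : f = 7/10 - e) (ht1 : t' = 1-t) (hz1 : z' = 1-z) (hg : g = (2+e)*(3+t)/12) (hs : s = e*(3/5*g-41/100+3/100*z)) :
    0 ≤ 3*((1-g/2-s)+(1+g/2+s)*(2-g-e)/2-e*(2-g)/2)*(1+g)*(2+e-2*g)-(3-3/2*g+e*(3/4*g-1/2-e)+(1+e/2)*s)*(2-g) := by
  let M : ℕ → ℕ → ℕ → ℕ → ℕ → ℕ → ℕ → ℝ := kM e f t t' z z'
  have hM : ∀ n i j k l p q, 0 ≤ M n i j k l p q := kM_nonneg he hf ht ht' hz hz'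
  refine le_of_le_of_eq ?_ (show (
      M 14580000000 0 5 0 4 0 1 + M 14580000000 0 5 0 4 1 0 + M 53136000000 0 5 1 3 0 1 + M 53136000000 0 5 1 3 1 0 + M 71136000000 0 5 2 2 0 1 +
      M 71136000000 0 5 2 2 1 0 + M 41280000000 0 5 3 1 0 1 + M 41280000000 0 5 3 1 1 0 + M 8704000000 0 5 4 0 0 1 + M 8704000000 0 5 4 0 1 0 +
      M 72010944000 1 4 0 4 0 1 + M 71820432000 1 4 0 4 1 0 + M 261956448000 1 4 1 3 0 1 + M 261197424000 1 4 1 3 1 0 + M 349845696000 1 4 2 2 0 1 +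
      M 348720768000 1 4 2 2 1 0 + M 202464768000 1 4 3 1 0 1 + M 201730944000 1 4 3 1 1 0 + M 42593536000 1 4 4 0 0 1 + M 42416128000 1 4 4 0 1 0 +
      M 137676780000 2 3 0 4 0 1 + M 136708344000 2 3 0 4 1 0 + M 497782209600 2 3 1 3 0 1 + M 493944904800 2 3 1 3 1 0 + M 659738808000 2 3 2 2 0 1 +
      M 654085440000 2 3 2 2 1 0 + M 378349382400 2 3 3 1 0 1 + M 374685907200 2 3 3 1 1 0 + M 78799488000 2 3 4 0 0 1 + M 77920512000 2 3 4 0 1 0 +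
      M 125514070560 3 2 0 4 0 1 + M 123686266680 3 2 0 4 1 0 + M 447494566320 3 2 1 3 0 1 + M 440281562760 3 2 1 3 1 0 + M 582719362560 3 2 2 2 0 1 +
      M 572141350080 3 2 2 2 1 0 + M 326944480320 3 2 3 1 0 1 + M 320125844160 3 2 3 1 1 0 + M 66325461120 3 2 4 0 0 1 + M 64699637760 3 2 4 0 1 0 +
      M 52948068525 4 1 0 4 0 1 + M 51429886335 4 1 0 4 1 0 + M 182947619304 4 1 1 3 0 1 + M 176973703902 4 1 1 3 1 0 + M 228583339092 4 1 2 2 0 1 +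
      M 219852180936 4 1 2 2 1 0 + M 121372945776 4 1 3 1 0 1 + M 115767638208 4 1 3 1 1 0 + M 22874876928 4 1 4 0 0 1 + M 21544994304 4 1 4 0 1 0 +
      M 7659413460 5 0 0 4 0 1 + M 7191111150 5 0 0 4 1 0 + M 24324964362 5 0 1 3 0 1 + M 22485771720 5 0 1 3 1 0 + M 26747876052 5 0 2 2 0 1 +
      M 24066290376 5 0 2 2 1 0 + M 11491431120 5 0 3 1 0 1 + M 9775108512 5 0 3 1 1 0 + M 1433552256 5 0 4 0 0 1 + M 1027924992 5 0 4 0 1 0)/580849920 = _ from by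
    simp only [M, kM]; subst hs hg hf1 ht1 hz1; push_cast; ring)
  refine div_nonneg ?_ (Nat.ofNat_nonneg _)
  clear_value M
  repeat' apply addnn
  all_goals apply hM

lemma k2y1 (e f t t' z z' g s : ℝ) (he : 0 ≤ e) (hf : 0 ≤ f) (ht : 0 ≤ t) (ht' : 0 ≤ t') (hz : 0 ≤ z) (hz' : 0 ≤ z')
    (hf1 : f = 7/10 - e) (ht1 : t' = 1-t) (hz1 : z' = 1-z) (hg : g = (2+e)*(3+t)/12) (hs : s = e*(3/5*g-41/100+3/100*z)) :
    0 ≤ (3/5*g-38/100)*(2+g-e+2*e*(3/5*g-38/100))-(3/2*g-1) := by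
  let M : ℕ → ℕ → ℕ → ℕ → ℕ → ℕ → ℕ → ℝ := kM e f t t' z z'
  have hM : ∀ n i j k l p q, 0 ≤ M n i j k l p q := kM_nonneg he hf ht ht' hz hz'
  refine le_of_le_of_eq ?_ (show (
      M 30000 0 3 0 2 0 0 + M 52000 0 3 1 1 0 0 + M 32000 0 3 2 0 0 0 + M 120576 1 2 0 2 0 0 + M 179912 1 2 1 1 0 0 +
      M 104736 1 2 2 0 0 0 + M 103965 2 1 0 2 0 0 + M 115036 2 1 1 1 0 0 + M 78976 2 1 2 0 0 0 + M 22650 3 0 0 2 0 0 +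
      M 11820 3 0 1 1 0 0 + M 22704 3 0 2 0 0 0)/205800 = _ from by
    simp only [M, kM]; subst hs hg hf1 ht1 hz1; push_cast; ring)
  refine div_nonneg ?_ (Nat.ofNat_nonneg _)
  clear_value M
  repeat' apply addnn
  all_goals apply hM

lemma k2y0 (e f t t' z z' g s : ℝ) (he : 0 ≤ e) (hf : 0 ≤ f) (ht : 0 ≤ t) (ht' : 0 ≤ t') (hz : 0 ≤ z) (hz' : 0 ≤ z')
    (hf1 : f = 7/10 - e) (ht1 : t' = 1-t) (hz1 : z' = 1-z) (hg : g = (2+e)*(3+t)/12) (hs : s = e*(3/5*g-41/100+3/100*z)) :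
    0 ≤ -(3/5*g-41/100)*(2+g-e+2*e*(3/5*g-41/100))+(3/2*g-1) := by
  let M : ℕ → ℕ → ℕ → ℕ → ℕ → ℕ → ℕ → ℝ := kM e f t t' z z'
  have hM : ∀ n i j k l p q, 0 ≤ M n i j k l p q := kM_nonneg he hf ht ht' hz hz'
  refine le_of_le_of_eq ?_ (show (
      M 15000 0 3 0 2 0 0 + M 41000 0 3 1 1 0 0 + M 16000 0 3 2 0 0 0 + M 186 1 2 0 2 0 0 + M 76702 1 2 1 1 0 0 +
      M 31116 1 2 2 0 0 0 + M 7851 2 1 0 2 0 0 + M 131540 2 1 1 1 0 0 + M 55784 2 1 2 0 0 0 + M 13404 3 0 0 2 0 0 +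
      M 71142 3 0 1 1 0 0 + M 24204 3 0 2 0 0 0)/205800 = _ from by
    simp only [M, kM]; subst hs hg hf1 ht1 hz1; push_cast; ring)
  refine div_nonneg ?_ (Nat.ofNat_nonneg _)
  clear_value M
  repeat' apply addnn
  all_goals apply hM

lemma k2s (q e g : ℝ) (he : 0 < e) (h3 : 3*g ≤ 2+e) (h4 : 2+e ≤ 4*g) (hT0 : 0 ≤ q-e-g)
   (hR : 2*q^2-q*(2+g+e)+2*e*(2-g)/2=0) : ∃ f t t' z z' s : ℝ, 0 ≤ f ∧ 0 ≤ t ∧ 0 ≤ t' ∧ 0 ≤ z ∧ 0 ≤ z' ∧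
   f = 7/10 - e ∧ t' = 1-t ∧ z' = 1-z ∧ g = (2+e)*(3+t)/12 ∧ s = e*(3/5*g-41/100+3/100*z) ∧ q = 1+g/2+s := by
  obtain ⟨s, hq⟩ : ∃ s, q = 1+g/2+s := ⟨q-(1+g/2), by ring⟩
  have hs : s*(2+g+2*s-e) = e*(3/2*g-1) := by subst hq; linarith
  have he1 : e ≤ 2/3 := by
    have h1 : 0 < 2+g+2*s-e := by subst hq; linarith
    have h2 : e - s ≤ 1-g/2 := by subst hq; linarith
    by_contra hc
    push Not at hc
    rcases le_or_gt s 0 with h | h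
    · linarith
    · have : s*(2*g+e) ≤ e*(3/2*g-1) := by
        rw [← hs]; apply mul_le_mul_of_nonneg_left _ h.le; linarith
      have : (e-(1-g/2))*(2*g+e) ≤ s*(2*g+e) := by
        apply mul_le_mul_of_nonneg_right _ (by linarith); linarith
      nlinarith [sq_nonneg (g-(2-e)/2)]
  obtain ⟨y, hy⟩ : ∃ y, s = e*y := ⟨s/e, by field_simp⟩
  have hy1 : y*(2+g-e+2*e*y) = 3/2*g-1 := by
    subst hy
    have : e*(y*(2+g-e+2*e*y)) = e*(3/2*g-1) := by linarith
    exact mul_left_cancel₀ he.ne' this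
  obtain ⟨t, ht⟩ : ∃ t, g = (2+e)*(3+t)/12 := ⟨12*g/(2+e)-3, by field_simp; ring⟩
  have ht0 : 0 ≤ t := by
    by_contra hc; push Not at hc; nlinarith
  have ht1 : t ≤ 1 := by
    by_contra hc; push Not at hc; nlinarith
  have g0 := k2y0 e (7/10-e) t (1-t) 0 1 g _ he.le (by linarith) ht0 (by linarith) le_rfl zero_le_one rfl rfl (by norm_num) ht rfl
  have g1 := k2y1 e (7/10-e) t (1-t) 0 1 g _ he.le (by linarith) ht0 (by linarith) le_rfl zero_le_one rfl rfl (by norm_num) ht rfl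
  have hp : 2*g+e ≤ 2+g-e+2*e*y := by subst hq hy; linarith
  have hA : 0 ≤ y - (3/5*g-41/100) := by
    by_contra hc; push Not at hc
    have : 0 < 2+g-e+2*e*(y+(3/5*g-41/100)) := by nlinarith
    have := mul_neg_of_neg_of_pos hc this
    linarith
  have hB : 0 ≤ (3/5*g-38/100) - y := by
    by_contra hc; push Not at hc
    have : 0 < 2+g-e+2*e*(y+(3/5*g-38/100)) := by nlinarith
    have := mul_neg_of_neg_of_pos hc this
    linarith
  refine ⟨7/10-e, t, 1-t, (y-(3/5*g-41/100))*(100/3), 1-(y-(3/5*g-41/100))*(100/3), s, by linarith, ht0, by linarith, by linarith, by linarith, rfl, rfl, rfl, ht, ?_, hq⟩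
  rw [hy]; ring

lemma k2last (e g B C1 C0 : ℝ) (he : 0 < e) (he1 : e ≤ 7/10) (h3 : 0 ≤ 2+e-3*g) (h4 : 0 ≤ 4*g-2-e) (hB : 2 ≤ B) (hC1 : 0 < (4*g-2-e)*2+(C1-8/10)*(2+e-3*g)) (hC0 : -116/100+e/2 ≤ C0) :
    0 < (4*g-2-e)*B^2+C1*B*(2+e-3*g)+C0*2*(2+e-3*g)^2 := by
  have hu : 2+e-3*g ≤ (2+e)/4 := by linarith
  have h1 : -(8/10)*2 ≤ 2*C0*(2+e-3*g) := by
    have i3 : (-116/100+e/2)*(2+e-3*g) ≤ C0*(2+e-3*g) := mul_le_mul_of_nonneg_right hC0 h3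
    have i4 : (116/100-e/2)*(2+e-3*g) ≤ (116/100-e/2)*((2+e)/4) := mul_le_mul_of_nonneg_left hu (by linarith)
    nlinarith
  have h2 : -(8/10)*B ≤ 2*C0*(2+e-3*g) := by linarith
  have h5 : -(8/10)*B*(2+e-3*g) ≤ 2*C0*(2+e-3*g)*(2+e-3*g) := mul_le_mul_of_nonneg_right h2 h3
  have h6 : 0 < B*((4*g-2-e)*2+(C1-8/10)*(2+e-3*g)) := mul_pos (by linarith) hC1
  have h7 : 0 ≤ (4*g-2-e)*(B*(B-2)) := mul_nonneg h4 (mul_nonneg (by linarith) (by linarith))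
  linarith

lemma ca_mul (k q e g : ℝ) (hk : k ≠ 0) (hw : 0 < 2+e-2*g) : ca k q e g * (k*(2+e-2*g)) = (2*((k-q)+q*(q-e-g))+k*e*g-(k-q)*g+k*((q-e-g)+(1+(q-e-g))*e)) :=
  div_mul_cancel₀ _ (mul_ne_zero hk hw.ne')

set_option maxHeartbeats 2000000 in
lemma k2ineq (q e g : ℝ) (he : 0 < e) (h3 : 3*g ≤ 2+e) (h4 : 2+e ≤ 4*g) (hT0 : 0 ≤ q-e-g)
   (hR : 2*q^2-q*(2+g+e)+2*e*(2-g)/2=0) : Ineq 2 q e g := by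
  obtain ⟨f,t,t',z,z',s,hf,ht,ht',hz,hz',hf1,ht1,hz1,hg,hs,hq⟩ := k2s q e g he h3 h4 hT0 hR
  have he1 : e ≤ 7/10 := by linarith
  have hg1 : g ≤ 9/10 := by linarith
  have hW : (2-q)+q*(q-e-g) = (1-g/2-s)+(1+g/2+s)*(2-g-e)/2-e*(2-g)/2 := by subst hq; linarith
  have hw : 0 < 2+e-2*g := by linarith
  obtain ⟨a, hadef⟩ : ∃ a, a = ca 2 q e g := ⟨_, rfl⟩
  have hA : a*(2+e-2*g) = (3-3/2*g+e*(3/4*g-1/2-e)+(1+e/2)*s) := by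
    have : a*(2+e-2*g) = (2*((2-q)+q*(q-e-g))+2*e*g-(2-q)*g+2*((q-e-g)+(1+(q-e-g))*e))/2 := by
      have := ca_mul 2 q e g two_ne_zero hw
      rw [hadef]; linarith
    rw [this, hW]; subst hq; ring
  obtain ⟨A, hAd⟩ : ∃ A, A = (3-3/2*g+e*(3/4*g-1/2-e)+(1+e/2)*s) := ⟨_, rfl⟩
  rw [← hAd] at hA
  have ham : 22/10-165/100*e ≤ a := by
    have ha := k2a e f t t' z z' g s he.le hf ht ht' hz hz' hf1 ht1 hz1 hg hs
    rw [← hAd] at ha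
    exact le_of_mul_le_mul_right (by linarith only [ha, hA]) hw
  have ha0 : 0 < a := by linarith only [ham, he1]
  have hm : 0 ≤ 2-q := by
    by_contra hc; push Not at hc
    have hq0 : 0 < q := by linarith
    have h5 : q*(2*q-2-g-e) = -e*(2-g) := by linarith
    have h6 : 0 ≤ q-2 := by linarith
    have : 0 ≤ q * (q-2) := by positivity
    have : 0 ≤ q*(q-g-e) := mul_nonneg hq0.le (by linarith)
    have : 0 < e*(2-g) := mul_pos he (by linarith)
    linarith
  have hA0 : 0 < A := by rw [← hA]; positivity
  -- beta0, beta1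
  obtain ⟨β0, hβ0⟩ : ∃ x, x = (2*e*(1+(q-e-g))+2*2*((q-e-g)+(1+(q-e-g))*e)+(2-q)*e-2*(2-q)*g+2*((2-q)+q*(q-e-g))+2*2*e+2*e*g) := ⟨_, rfl⟩
  obtain ⟨β1, hβ1⟩ : ∃ x, x = (2*e*(q-e-g)+(2-q)*((q-e-g)+(1+(q-e-g))*e)+2*e*((2-q)+q*(q-e-g))) := ⟨_, rfl⟩
  have hb0 : 8125/1000-5*g+85/10*e-5*(e*e) ≤ β0 := by
    rw [hβ0, hW, hq]; linarith only [k2b0 e f t t' z z' g s he.le hf ht ht' hz hz' hf1 ht1 hz1 hg hs]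
  have hb1 : β1 ≤ (1-g/2)*(1-g/2)+e*(707/100-325/100*g)-49/10*(e*e) := by
    rw [hβ1, hW, hq]
    have j1 := mul_nonneg he.le (sq_nonneg s)
    have j2 := sq_nonneg s
    linarith only [j1, j2, k2b1 e f t t' z z' g s he.le hf ht ht' hz hz' hf1 ht1 hz1 hg hs]
  have hB : cB 2 q e g * a = a*(β0-4*e*a) - β1 := by
    have : a ≠ 0 := ha0.ne'
    unfold cB
    rw [← hadef, ← hβ0, ← hβ1]
    field_simp; ring
  obtain ⟨B, hBd⟩ : ∃ x, x = cB 2 q e g := ⟨_, rfl⟩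
  rw [← hBd] at hB
  have hBw : B*A*(2+e-2*g) = A*(β0*(2+e-2*g)-4*e*A)-β1*((2+e-2*g)*(2+e-2*g)) := by
    rw [← hA]; linear_combination ((2+e-2*g)^2)*hB
  have i0 : A*((8125/1000-5*g+85/10*e-5*(e*e))*(2+e-2*g)-4*e*A)-((1-g/2)*(1-g/2)+e*(707/100-325/100*g)-49/10*(e*e))*((2+e-2*g)*(2+e-2*g)) ≤ B*A*(2+e-2*g) := by
    rw [hBw]
    have j1 := mul_le_mul_of_nonneg_left (mul_le_mul_of_nonneg_right hb0 hw.le) hA0.le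
    have j2 := mul_le_mul_of_nonneg_right hb1 (mul_nonneg hw.le hw.le)
    linarith only [j1, j2]
  clear hβ0 hβ1 hb0 hb1 hB hBw
  have hu0 : 0 ≤ 2+e-3*g := by linarith
  have hBl : 2 ≤ B := by
    have al := k2Al e f t t' z z' g s he.le hf ht ht' hz hz' hf1 ht1 hz1 hg hs
    have au := k2Au e f t t' z z' g s he.le hf ht ht' hz hz' hf1 ht1 hz1 hg hs
    rw [← hAd] at al au
    have h := concave_quad (-((1-g/2)*(1-g/2)+e*(707/100-325/100*g)-49/10*(e*e))*((2+e-2*g)*(2+e-2*g))) ((8125/1000-5*g+85/10*e-5*(e*e)-2)*(2+e-2*g)) (4*e) _ _ A (by linarith only [he]) (sub_nonneg.1 al) (sub_nonneg.1 au) (by linarith only [k2B0 e f t t' z z' g s he.le hf ht ht' hz hz' hf1 ht1 hz1 hg hs]) (by linarith only [k2B1 e f t t' z z' g s he.le hf ht ht' hz hz' hf1 ht1 hz1 hg hs])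
    have : 2*(A*(2+e-2*g)) ≤ B*(A*(2+e-2*g)) := by linarith only [h, i0]
    exact le_of_mul_le_mul_right this (mul_pos hA0 hw)
  have hB3 : 3*a*2*(2+e-3*g) < B*(1+g) := by
    have al := k2Al e f t t' z z' g s he.le hf ht ht' hz hz' hf1 ht1 hz1 hg hs
    have au := k2Au e f t t' z z' g s he.le hf ht ht' hz hz' hf1 ht1 hz1 hg hs
    rw [← hAd] at al au
    have h := concave_quad (-((1-g/2)*(1-g/2)+e*(707/100-325/100*g)-49/10*(e*e))*((2+e-2*g)*(2+e-2*g))*(1+g)-1/100) ((8125/1000-5*g+85/10*e-5*(e*e))*(2+e-2*g)*(1+g)) (4*e*(1+g)+6*(2+e-3*g)) _ _ A (add_nonneg (mul_nonneg (by linarith only [he]) (by linarith only [h4, he])) (mul_nonneg (by norm_num) hu0)) (sub_nonneg.1 al) (sub_nonneg.1 au) (by linarith only [k2F0 e f t t' z z' g s he.le hf ht ht' hz hz' hf1 ht1 hz1 hg hs]) (by linarith only [k2F1 e f t t' z z' g s he.le hf ht ht' hz hz' hf1 ht1 hz1 hg hs])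
    have j := mul_le_mul_of_nonneg_right i0 (by linarith : 0 ≤ 1+g)
    have : 3*a*2*(2+e-3*g)*(A*(2+e-2*g)) < B*(1+g)*(A*(2+e-2*g)) := by
      have : 3*a*2*(2+e-3*g)*(A*(2+e-2*g)) = 6*(A*A)*(2+e-3*g) := by
        linear_combination (6*(2+e-3*g)*A)*hA
      rw [this]; linarith only [h, j]
    exact lt_of_mul_lt_mul_right this (mul_pos hA0 hw).le
  have hC1' : 0 < (4*g-2-e)*2+(cC1 2 q e g-8/10)*(2+e-3*g) := by
    have hC1 := k2C1 e f t t' z z' g s he.le hf ht ht' hz hz' hf1 ht1 hz1 hg hs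
    rw [← hAd] at hC1
    have : 0 < ((4*g-2-e)*2+(cC1 2 q e g-8/10)*(2+e-3*g))*(2+e-2*g) := by
      unfold cC1; rw [← hadef, hW]
      have hh : e*(a*(2+e-2*g))*(2+e-3*g) = e*A*(2+e-3*g) := by rw [hA]
      rw [hq]
      linarith only [hh, hC1]
    exact pos_of_mul_pos_left this hw.le
  have hC0' : -116/100+e/2 ≤ cC0 2 q e g := by
    have hC0 := k2C0 e f t t' z z' g s he.le hf ht ht' hz hz' hf1 ht1 hz1 hg hs
    have h5 : (2-q)/a *((1+(q-e-g))*a-(q-e-g)) ≤ (2-q)*(1+(q-e-g)) := by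
      have h : (2-q)/a *((1+(q-e-g))*a-(q-e-g)) = (2-q)*(1+(q-e-g)) - (2-q)*(q-e-g)/a := by
        field_simp
      rw [h]
      have : 0 ≤ (2-q)*(q-e-g)/a := by
        apply div_nonneg (mul_nonneg hm hT0) ha0.le
      linarith
    have h2 := mul_le_mul_of_nonneg_left h5 he.le
    have h6 : e*(22/10-165/100*e)*(8+4*(q-e-g)+2*(2-q)) ≤ e*a*(8+4*(q-e-g)+2*(2-q)) := by
      apply mul_le_mul_of_nonneg_right (mul_le_mul_of_nonneg_left ham he.le); linarith
    have h7 : (2-q)*(q-e-g) ≤ (1-g/2)*(1-g/2-e)+e*s := by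
      have h9 : (1-g/2)*(1-g/2-e)+e*s - (2-q)*(q-e-g) = s^2 := by rw [hq]; ring
      have := sq_nonneg s
      linarith only [h9, this]
    have h8 := mul_le_mul_of_nonneg_left h7 he.le
    unfold cC0
    rw [← hadef]
    have e1 : q-e-g = 1-g/2-e+s := by subst hq; ring
    have e2 : 2-q = 1-g/2-s := by subst hq; ring
    rw [← e1, ← e2, show (1+g/2+s)=q from hq.symm] at hC0
    rw [← e2, ← hq] at hW
    rw [← hW] at hC0
    linarith only [hC0, h2, h6, h7, h8]
  have hF4' : a*2*(1-g/2) ≤ 3*((2-q)+q*(q-e-g))*(1+g) := by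
    have hF4 := k2F4 e f t t' z z' g s he.le hf ht ht' hz hz' hf1 ht1 hz1 hg hs
    rw [← hAd] at hF4
    have : a*2*(1-g/2)*(2+e-2*g) ≤ 3*((2-q)+q*(q-e-g))*(1+g)*(2+e-2*g) := by
      have : a*2*(1-g/2)*(2+e-2*g) = A*(2-g) := by linear_combination (2-g)*hA
      rw [this, hW]; linarith only [hF4]
    exact le_of_mul_le_mul_right this hw
  unfold Ineq
  rw [← hadef, ← hBd]
  exact ⟨ha0, by linarith, hB3, hF4', k2last e g B _ _ he he1 hu0 (by linarith) hBl hC1' hC0'⟩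

open Filter Topology

lemma k3pt (k g : ℝ) (hk : 3 ≤ k) (g0 : 1/2 ≤ g) (g1 : g ≤ 2/3) :
    0 < ca k ((k+g)/2) 0 g ∧ 0 < cB k ((k+g)/2) 0 g ∧ 3*ca k ((k+g)/2) 0 g*k*(2+0-3*g) < cB k ((k+g)/2) 0 g*(1+g) ∧
  ca k ((k+g)/2) 0 g*k*(1-g/2) < 3*((k-((k+g)/2))+((k+g)/2)*(((k+g)/2)-0-g))*(1+g) ∧
  0 < (4*g-2-0)*cB k ((k+g)/2) 0 g^2+cC1 k ((k+g)/2) 0 g*cB k ((k+g)/2) 0 g*(2+0-3*g)+cC0 k ((k+g)/2) 0 g*k*(2+0-3*g)^2 := by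
  have hk0 : 0 < k := by linarith
  have h1g : 0 < 1-g := by linarith
  have hk1 : 0 < k+1 := by linarith
  obtain ⟨m, hm⟩ : ∃ m, m = (k-g)/2 := ⟨_, rfl⟩
  have hm0 : 0 < m := by linarith
  have ha : ca k ((k+g)/2) 0 g = m*(k+1)/(k*(1-g)) := by
    unfold ca; subst hm; rw [div_eq_div_iff (by nlinarith) (by positivity)]; ring
  obtain ⟨b, hb⟩ : ∃ b, b = 3*k+2-g-k*(1-g)/(k+1) := ⟨_, rfl⟩
  have hB : cB k ((k+g)/2) 0 g = m*b := by
    have hkg : k - g ≠ 0 := by linarith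
    unfold cB; rw [ha, hb]; subst hm; field_simp; ring
  have hC1 : cC1 k ((k+g)/2) 0 g = m*(4*k-2*g+2) := by unfold cC1; subst hm; ring
  have hC0 : cC0 k ((k+g)/2) 0 g = -2*m^2 := by unfold cC0; subst hm; ring
  have hkk : k*(1-g)/(k+1) ≤ 1-g := by rw [div_le_iff₀ hk1]; nlinarith
  have hbl : 3*k+1 ≤ b := by linarith
  have hb0 : 0 < b := by linarith
  rw [hB, hC1, hC0, ha]
  refine ⟨by positivity, by positivity, ?_, ?_, ?_⟩
  · have : 3*(m*(k+1)/(k*(1-g)))*k*(2+0-3*g) = m*(3*(k+1)*(2-3*g)/(1-g)) := by field_simp; ring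
    rw [this, mul_assoc m b]
    apply mul_lt_mul_of_pos_left _ hm0
    rw [div_lt_iff₀ h1g]
    have : (3*k+1)*(1+g)*(1-g) ≤ b*(1+g)*(1-g) := by
      apply mul_le_mul_of_nonneg_right _ h1g.le
      apply mul_le_mul_of_nonneg_right hbl (by linarith)
    have x1 := mul_nonneg (sub_nonneg.2 g0) (sub_nonneg.2 g1)
    have x2 := mul_nonneg (sub_nonneg.2 hk) x1
    have x3 := mul_nonneg (sub_nonneg.2 hk) (sub_nonneg.2 g0)
    have x4 := mul_nonneg (sub_nonneg.2 hk) (sub_nonneg.2 g1)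
    have x5 := mul_nonneg (sub_nonneg.2 g0) x1
    nlinarith
  · have : m*(k+1)/(k*(1-g))*k*(1-g/2) = m*((k+1)*(1-g/2)/(1-g)) := by field_simp
    rw [this]
    have : 3*((k-((k+g)/2))+((k+g)/2)*(((k+g)/2)-0-g))*(1+g) = m*(3*(1+(k+g)/2)*(1+g)) := by subst hm; ring
    rw [this]
    apply mul_lt_mul_of_pos_left _ hm0
    rw [div_lt_iff₀ h1g]
    have x1 := mul_nonneg (sub_nonneg.2 g0) (sub_nonneg.2 g1)
    have x2 := mul_nonneg (sub_nonneg.2 hk) x1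
    have x3 := mul_nonneg (sub_nonneg.2 hk) (sub_nonneg.2 g0)
    have x4 := mul_nonneg (sub_nonneg.2 hk) (sub_nonneg.2 g1)
    have x5 := mul_nonneg (sub_nonneg.2 g0) x1
    nlinarith
  · have : (4*g-2-0)*(m*b)^2+m*(4*k-2*g+2)*(m*b)*(2+0-3*g)+-2*m^2*k*(2+0-3*g)^2 = m^2*((4*g-2)*b^2+(2-3*g)*((4*k-2*g+2)*b-2*k*(2-3*g))) := by ring
    rw [this]
    apply mul_pos (by positivity)
    have h1 : 0 < (4*k-2*g+2)*b-2*k*(2-3*g) := by nlinarith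
    rcases g1.eq_or_lt with h | h
    · have h2 : 0 < (4*g-2)*b^2 := mul_pos (by linarith) (by positivity)
      have h3 : 0 ≤ (2-3*g) := by linarith
      have := mul_nonneg h3 h1.le
      linarith
    · have h2 : 0 ≤ (4*g-2)*b^2 := mul_nonneg (by linarith) (by positivity)
      have := mul_pos (by linarith : 0 < 2-3*g) h1
      linarith

lemma k3ev (k g : ℝ) (hk : 3 ≤ k) (g0 : 1/2 ≤ g) (g1 : g ≤ 2/3) :
    ∀ᶠ x : ℝ × ℝ × ℝ in 𝓝 ((k+g)/2, 0, g), Ineq k x.1 x.2.1 x.2.2 := by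
  obtain ⟨p1,p2,p3,p4,p5⟩ := k3pt k g hk g0 g1
  have hk0 : 0 < k := by linarith
  set x0 : ℝ × ℝ × ℝ := ((k+g)/2, 0, g) with hx0
  have c1 : ContinuousAt (fun x : ℝ × ℝ × ℝ => ca k x.1 x.2.1 x.2.2) x0 := by
    unfold ca
    apply ContinuousAt.div (by fun_prop) (by fun_prop)
    simp only [hx0]
    apply mul_ne_zero hk0.ne'; linarith
  have c2 : ContinuousAt (fun x : ℝ × ℝ × ℝ => cB k x.1 x.2.1 x.2.2) x0 := by
    unfold cB
    apply ContinuousAt.sub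
    · apply ContinuousAt.sub (by fun_prop)
      exact ContinuousAt.mul (by fun_prop) c1
    · exact ContinuousAt.div (by fun_prop) c1 p1.ne'
  have c3 : ContinuousAt (fun x : ℝ × ℝ × ℝ => cC1 k x.1 x.2.1 x.2.2) x0 := by
    unfold cC1
    fun_prop
  have c4 : ContinuousAt (fun x : ℝ × ℝ × ℝ => cC0 k x.1 x.2.1 x.2.2) x0 := by
    unfold cC0
    have c5 : ContinuousAt (fun x : ℝ × ℝ × ℝ => (k-x.1)/ca k x.1 x.2.1 x.2.2) x0 := ContinuousAt.div (by fun_prop) c1 p1.ne'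
    fun_prop
  have f1 := c1.eventually (lt_mem_nhds p1)
  have f2 := c2.eventually (lt_mem_nhds p2)
  have f3 := ContinuousAt.eventually_lt (x₀ := x0) (f := fun x : ℝ × ℝ × ℝ => 3*ca k x.1 x.2.1 x.2.2*k*(2+x.2.1-3*x.2.2)) (g := fun x : ℝ × ℝ × ℝ => cB k x.1 x.2.1 x.2.2*(1+x.2.2)) (by fun_prop) (by fun_prop) p3
  have f4 := ContinuousAt.eventually_lt (x₀ := x0) (f := fun x : ℝ × ℝ × ℝ => ca k x.1 x.2.1 x.2.2*k*(1-x.2.2/2)) (g := fun x : ℝ × ℝ × ℝ => 3*((k-x.1)+x.1*(x.1-x.2.1-x.2.2))*(1+x.2.2)) (by fun_prop) (by fun_prop) p4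
  have f5 := ContinuousAt.eventually_lt (x₀ := x0) (f := fun x : ℝ × ℝ × ℝ => (0:ℝ)) (g := fun x : ℝ × ℝ × ℝ => (4*x.2.2-2-x.2.1)*cB k x.1 x.2.1 x.2.2^2+cC1 k x.1 x.2.1 x.2.2*cB k x.1 x.2.1 x.2.2*(2+x.2.1-3*x.2.2)+cC0 k x.1 x.2.1 x.2.2*k*(2+x.2.1-3*x.2.2)^2) (by fun_prop) (by fun_prop) p5
  filter_upwards [f1,f2,f3,f4,f5] with x h1 h2 h3 h4 h5
  exact ⟨h1,h2,h3,h4.le,h5⟩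

lemma k3ineq (k : ℝ) (hk : 3 ≤ k) : ∃ ε > 0, ∀ q e g : ℝ, 0 < e → e < ε → 3*g ≤ 2+e → 2+e ≤ 4*g → k/4 ≤ q → q ≤ k →
   2*q^2-q*(k+g+e)+k*e*(2-g)/2=0 → Ineq k q e g := by
  let K : Set (ℝ × ℝ × ℝ) := {x | 0 ≤ x.2.1 ∧ x.2.1 ≤ 1 ∧ 3*x.2.2 ≤ 2+x.2.1 ∧ 2+x.2.1 ≤ 4*x.2.2 ∧ k/4 ≤ x.1 ∧ x.1 ≤ k ∧ 2*x.1^2-x.1*(k+x.2.2+x.2.1)+k*x.2.1*(2-x.2.2)/2=0}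
  have hKc : IsClosed K := by
    simp only [K, Set.setOf_and]
    refine IsClosed.inter (isClosed_le (by fun_prop) (by fun_prop)) ?_
    refine IsClosed.inter (isClosed_le (by fun_prop) (by fun_prop)) ?_
    refine IsClosed.inter (isClosed_le (by fun_prop) (by fun_prop)) ?_
    refine IsClosed.inter (isClosed_le (by fun_prop) (by fun_prop)) ?_
    refine IsClosed.inter (isClosed_le (by fun_prop) (by fun_prop)) ?_
    refine IsClosed.inter (isClosed_le (by fun_prop) (by fun_prop)) ?_
    exact isClosed_eq (by fun_prop) (by fun_prop)
  have hK : IsCompact K := by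
    apply IsCompact.of_isClosed_subset (isCompact_Icc (a := ((0:ℝ),(0:ℝ),(0:ℝ))) (b := (k,1,1))) hKc
    rintro ⟨q,e,g⟩ ⟨h1,h2,h3,h4,h5,h6,h7⟩
    simp only at h1 h2 h3 h4 h5 h6 h7
    refine ⟨⟨?_,?_,?_⟩,⟨?_,?_,?_⟩⟩ <;> simp only <;> linarith
  let V : Set (ℝ × ℝ × ℝ) := K ∩ (interior {x | Ineq k x.1 x.2.1 x.2.2})ᶜ
  have hV : IsCompact V := hK.inter_right isOpen_interior.isClosed_compl
  have key : ∀ x ∈ V, 0 < x.2.1 := by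
    rintro ⟨q,e,g⟩ ⟨⟨h1,h2,h3,h4,h5,h6,h7⟩,hx⟩
    simp only at h1 h2 h3 h4 h5 h6 h7 ⊢
    rcases h1.eq_or_lt with h | h
    · exfalso
      subst h
      have hq : q = (k+g)/2 := by
        have : q*(2*q-(k+g)) = 0 := by linarith
        rcases mul_eq_zero.1 this with h | h <;> linarith
      apply hx
      rw [mem_interior_iff_mem_nhds, hq]
      exact k3ev k g hk (by linarith) (by linarith)
    · exact h
  rcases V.eq_empty_or_nonempty with hE | hE
  · refine ⟨1, one_pos, fun q e g h1 h2 h3 h4 h5 h6 h7 => ?_⟩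
    by_contra hc
    have hsub : (q,e,g) ∈ interior {x : ℝ×ℝ×ℝ | Ineq k x.1 x.2.1 x.2.2} → Ineq k q e g := fun h => by
      have h' : (q,e,g) ∈ {x : ℝ×ℝ×ℝ | Ineq k x.1 x.2.1 x.2.2} := interior_subset h
      exact h'
    have : (q,e,g) ∈ V := ⟨⟨h1.le,h2.le,h3,h4,h5,h6,h7⟩, fun h => hc (hsub h)⟩
    rw [hE] at this; exact this
  · obtain ⟨x, hx, hmin⟩ := hV.exists_isMinOn hE (f := fun x => x.2.1) (by fun_prop)
    refine ⟨min 1 x.2.1, lt_min one_pos (key x hx), fun q e g h1 h2 h3 h4 h5 h6 h7 => ?_⟩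
    by_contra hc
    have hsub : (q,e,g) ∈ interior {x : ℝ×ℝ×ℝ | Ineq k x.1 x.2.1 x.2.2} → Ineq k q e g := fun h => by
      have h' : (q,e,g) ∈ {x : ℝ×ℝ×ℝ | Ineq k x.1 x.2.1 x.2.2} := interior_subset h
      exact h'
    have hin : (q,e,g) ∈ V := ⟨⟨h1.le,(lt_of_lt_of_le h2 (min_le_left _ _)).le,h3,h4,h5,h6,h7⟩, fun h => hc (hsub h)⟩
    have := hmin hin
    have h8 := lt_of_lt_of_le h2 (min_le_right 1 x.2.1)
    simp only [Set.mem_setOf_eq] at this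
    linarith

open PowerSeries (coeff)

/-- evaluation of a real power series -/
noncomputable def pev (p : PowerSeries ℝ) (θ : ℝ) : ℝ := ∑' n, coeff n p * θ^n
/-- absolute summability at radius `r` -/
def AS (p : PowerSeries ℝ) (r : ℝ) : Prop := Summable fun n => |coeff n p| * r^n
/-- the Euler operator -/
noncomputable def Th (p : PowerSeries ℝ) : PowerSeries ℝ := PowerSeries.mk fun n => (n:ℝ) * coeff n p

lemma coeff_Th (p : PowerSeries ℝ) (n : ℕ) : coeff n (Th p) = n * coeff n p := by
  simp [Th]

lemma Th_add (p q) : Th (p+q) = Th p + Th q := by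
  ext n; simp [coeff_Th]; ring
lemma Th_sub (p q) : Th (p-q) = Th p - Th q := by
  ext n; simp [coeff_Th]; ring
lemma Th_C (c) : Th (PowerSeries.C c) = 0 := by
  ext n; simp [coeff_Th, PowerSeries.coeff_C]; exact Or.inl
lemma Th_mul (p q) : Th (p*q) = Th p * q + p * Th q := by
  ext n
  simp only [coeff_Th, map_add, PowerSeries.coeff_mul, Finset.mul_sum, ← Finset.sum_add_distrib]
  refine Finset.sum_congr rfl fun x hx => ?_
  rw [Finset.HasAntidiagonal.mem_antidiagonal] at hx
  rw [← hx]; push_cast; ring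
lemma Th_C_mul (c p) : Th (PowerSeries.C c*p) = PowerSeries.C c * Th p := by
  rw [Th_mul, Th_C]; ring

lemma AS.sum {p r} (h : AS p r) {θ : ℝ} (hθ : |θ| ≤ r) : Summable fun n => ‖coeff n p * θ^n‖ := by
  refine Summable.of_nonneg_of_le (fun n => norm_nonneg _) (fun n => ?_) h
  rw [norm_mul, norm_pow, Real.norm_eq_abs, Real.norm_eq_abs]
  gcongr

lemma AS.add {p q r} (hp : AS p r) (hq : AS q r) (hr : 0 ≤ r) : AS (p+q) r := by
  refine Summable.of_nonneg_of_le (fun n => by positivity) (fun n => ?_) (Summable.add hp hq)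
  rw [map_add, ← add_mul]; gcongr; exact abs_add_le _ _

lemma AS.C_mul {q r} (c) (hq : AS q r) : AS (PowerSeries.C c*q) r := by
  have := Summable.mul_left |c| hq
  refine this.congr fun n => ?_
  rw [PowerSeries.coeff_C_mul, abs_mul]; ring

lemma AS.sub {p q r} (hp : AS p r) (hq : AS q r) (hr : 0 ≤ r) : AS (p-q) r := by
  have : p - q = p + PowerSeries.C (-1) * q := by simp [sub_eq_add_neg]
  rw [this]; exact hp.add (hq.C_mul _) hr

lemma AS.C (c r) : AS (PowerSeries.C c) r := by
  refine summable_of_ne_finset_zero (s := {0}) fun n hn => ?_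
  rw [PowerSeries.coeff_C]; simp at hn; simp [hn]

lemma AS.mul {p q r} (hp : AS p r) (hq : AS q r) (hr : 0 ≤ r) : AS (p*q) r := by
  have h1 : Summable fun n => ‖|coeff n p| * r^n‖ := by simpa using hp.norm
  have h2 : Summable fun n => ‖|coeff n q| * r^n‖ := by simpa using hq.norm
  have := summable_norm_sum_mul_antidiagonal_of_summable_norm h1 h2
  refine Summable.of_nonneg_of_le (fun n => by positivity) (fun n => ?_) this
  refine le_trans ?_ (le_abs_self _)
  rw [PowerSeries.coeff_mul]
  refine (mul_le_mul_of_nonneg_right (Finset.abs_sum_le_sum_abs _ _) (by positivity)).trans ?_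
  rw [Finset.sum_mul]
  refine Finset.sum_le_sum fun x hx => ?_
  rw [Finset.HasAntidiagonal.mem_antidiagonal] at hx
  rw [← hx, pow_add, abs_mul]; apply le_of_eq; ring

lemma pev_add {p q r θ} (hp : AS p r) (hq : AS q r) (hθ : |θ| ≤ r) : pev (p+q) θ = pev p θ + pev q θ := by
  unfold pev
  rw [← (hp.sum hθ).of_norm.tsum_add (hq.sum hθ).of_norm]
  exact tsum_congr fun n => by rw [map_add]; ring

lemma pev_C_mul {q θ} (c)  : pev (PowerSeries.C c*q) θ = c * pev q θ := by
  unfold pev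
  rw [← tsum_mul_left]
  exact tsum_congr fun n => by rw [PowerSeries.coeff_C_mul]; ring

lemma pev_sub {p q r θ} (hp : AS p r) (hq : AS q r) (hθ : |θ| ≤ r) : pev (p-q) θ = pev p θ - pev q θ := by
  have : p - q = p + PowerSeries.C (-1) * q := by simp [sub_eq_add_neg]
  rw [this, pev_add hp (hq.C_mul _) hθ, pev_C_mul]; ring

lemma pev_C (c θ) : pev (PowerSeries.C c) θ = c := by
  unfold pev
  rw [tsum_eq_single 0]
  · simp
  · intro n hn; rw [PowerSeries.coeff_C]; simp [hn]

lemma pev_mul {p q r θ} (hp : AS p r) (hq : AS q r) (hθ : |θ| ≤ r) : pev (p*q) θ = pev p θ * pev q θ := by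
  unfold pev
  rw [tsum_mul_tsum_eq_tsum_sum_antidiagonal_of_summable_norm (hp.sum hθ) (hq.sum hθ)]
  refine tsum_congr fun n => ?_
  rw [PowerSeries.coeff_mul, Finset.sum_mul]
  refine Finset.sum_congr rfl fun x hx => ?_
  rw [Finset.HasAntidiagonal.mem_antidiagonal] at hx
  rw [← hx, pow_add]; ring

lemma pev_analytic {p r θ} (hp : AS p r) (hθ : |θ| < r) : AnalyticAt ℝ (pev p) θ := by
  have hr : 0 < r := lt_of_le_of_lt (abs_nonneg _) hθ
  let P := FormalMultilinearSeries.ofScalars ℝ (fun n => coeff n p)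
  have h1 : ENNReal.ofReal r ≤ P.radius := by
    have := P.le_radius_of_summable (r := r.toNNReal) (by
      refine hp.congr fun n => ?_
      simp only [P, FormalMultilinearSeries.ofScalars_norm, Real.coe_toNNReal r hr.le, Real.norm_eq_abs])
    simpa [ENNReal.ofReal] using this
  have h2 : 0 < P.radius := lt_of_lt_of_le (by simpa using hr) h1
  have h3 := (P.hasFPowerSeriesOnBall h2).analyticAt_of_mem (y := θ) (by
    rw [Metric.mem_eball]
    refine lt_of_lt_of_le ?_ h1
    rw [edist_dist, Real.dist_eq, sub_zero]
    exact (ENNReal.ofReal_lt_ofReal_iff hr).2 hθ)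
  convert h3 using 1
  ext t
  have := FormalMultilinearSeries.ofScalarsSum_eq_tsum (E := ℝ) (fun n => coeff n p)
  have h4 := congrFun this t
  unfold FormalMultilinearSeries.ofScalarsSum at h4
  simp only [P, h4, pev, smul_eq_mul]

lemma pev_deriv {p r θ} (hp : AS p r) (ht : AS (Th p) r) (hθ : |θ| < r) :
   θ * deriv (pev p) θ = pev (Th p) θ := by
  have hr : 0 < r := lt_of_le_of_lt (abs_nonneg _) hθ
  have h := hasDerivAt_tsum_of_isPreconnected (𝕜 := ℝ) (u := fun n => |coeff n (Th p)| * r^n * r⁻¹)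
    (g := fun n θ => coeff n p * θ^n) (g' := fun n θ => coeff n p * (n*θ^(n-1))) (t := Ioo (-r) r) (y₀ := 0) (y := θ)
    (Summable.mul_right _ ht) isOpen_Ioo isPreconnected_Ioo (fun n y hy => (hasDerivAt_pow n y).const_mul _)
    (fun n y hy => by
      rw [coeff_Th, abs_mul, Real.norm_eq_abs, abs_mul, abs_mul, abs_pow]
      have hy' : |y| ≤ r := (abs_lt.2 hy).le
      rcases n with _ | n
      · simp
      · rw [pow_succ, show ∀ A : ℝ, A * (r^n*r) * r⁻¹ = A * r^n from fun A => by field_simp]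
        simp only [Nat.add_sub_cancel]
        have : |y|^n ≤ r^n := by gcongr
        calc _ = |((n+1:ℕ):ℝ)| * |coeff (n+1) p| * |y|^n := by ring
          _ ≤ _ := by gcongr) ⟨by linarith, hr⟩ (hp.sum (by simpa using hr.le)).of_norm (abs_lt.1 hθ)
  have : deriv (pev p) θ = _ := h.deriv
  rw [this, pev, ← tsum_mul_left]
  refine tsum_congr fun n => ?_
  rw [coeff_Th]
  rcases n with _ | n
  · simp
  · simp only [Nat.add_sub_cancel]; rw [pow_succ]; ring

lemma pev_zero (p) : pev p 0 = coeff 0 p := by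
  unfold pev
  rw [tsum_eq_single 0]
  · simp
  · intro n hn; simp [hn]

lemma pev_deriv_zero {p r} (hr : 0 < r) (hp : AS p r)  :
   HasDerivAt (pev p) (coeff 1 p) 0 := by
  let P := FormalMultilinearSeries.ofScalars ℝ (fun n => coeff n p)
  have h1 : ENNReal.ofReal r ≤ P.radius := by
    have := P.le_radius_of_summable (r := r.toNNReal) (by
      refine hp.congr fun n => ?_
      simp only [P, FormalMultilinearSeries.ofScalars_norm, Real.coe_toNNReal r hr.le, Real.norm_eq_abs])
    simpa [ENNReal.ofReal] using this
  have h2 : 0 < P.radius := lt_of_lt_of_le (by simpa using hr) h1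
  have h3 := (P.hasFPowerSeriesOnBall h2).hasFPowerSeriesAt.hasDerivAt
  have hs : pev p = P.sum := by
    ext t
    have := FormalMultilinearSeries.ofScalarsSum_eq_tsum (E := ℝ) (fun n => coeff n p)
    have h4 := congrFun this t
    unfold FormalMultilinearSeries.ofScalarsSum at h4
    simp only [P, h4, pev, smul_eq_mul]
  have hs1 : (coeff 1) p = (P 1) fun x => 1 := by
    simp [P, FormalMultilinearSeries.ofScalars]
  rw [hs, hs1]; exact h3

/-- truncated weighted norm -/
noncomputable def nrm (r : ℝ) (N : ℕ) (p : PowerSeries ℝ) : ℝ := ∑ n ∈ Finset.range (N+1), |coeff n p| * r^n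

lemma nrm_nonneg {r : ℝ} (hr : 0 ≤ r) (N p) : 0 ≤ nrm r N p := Finset.sum_nonneg fun _ _ => by positivity
lemma nrm_add {r : ℝ} (hr : 0 ≤ r) (N p q) : nrm r N (p+q) ≤ nrm r N p + nrm r N q := by
  unfold nrm; rw [← Finset.sum_add_distrib]
  refine Finset.sum_le_sum fun n _ => ?_
  rw [map_add, ← add_mul]; gcongr; exact abs_add_le _ _
lemma nrm_C_mul (r : ℝ) (N c p) : nrm r N (PowerSeries.C c * p) = |c| * nrm r N p := by
  unfold nrm; rw [Finset.mul_sum]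
  refine Finset.sum_congr rfl fun n _ => ?_
  rw [PowerSeries.coeff_C_mul, abs_mul]; ring
lemma nrm_mono {r : ℝ} (hr : 0 ≤ r) {N M} (h : N ≤ M) (p) : nrm r N p ≤ nrm r M p := by
  unfold nrm
  refine Finset.sum_le_sum_of_subset_of_nonneg (Finset.range_subset_range.2 (by lia)) fun _ _ _ => by positivity
lemma nrm_mul_succ {r : ℝ} (hr : 0 ≤ r) (N p q) (hp : coeff 0 p = 0) (hq : coeff 0 q = 0) :
    nrm r (N+1) (p*q) ≤ nrm r N p * nrm r N q := by
  unfold nrm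
  rw [Finset.sum_mul_sum, ← Finset.sum_product']
  set f : ℕ × ℕ → ℝ := fun x => |coeff x.1 p| * r^x.1 * (|coeff x.2 q| * r^x.2) with hf
  have hf0 : ∀ x, 0 ≤ f x := fun x => by simp only [hf]; positivity
  set s := (Finset.range (N+1) ×ˢ Finset.range (N+1)) with hs
  set s' := s.filter (fun x => x.1+x.2 ∈ Finset.range (N+1+1)) with hs'
  have h1 : ∑ x ∈ s', f x ≤ ∑ x ∈ s, f x := Finset.sum_le_sum_of_subset_of_nonneg (Finset.filter_subset _ _) fun x _ _ => hf0 x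
  refine le_trans ?_ h1
  rw [← Finset.sum_fiberwise_of_maps_to (s := s') (t := Finset.range (N+1+1)) (g := fun x => x.1+x.2) (fun x hx => (Finset.mem_filter.1 hx).2)]
  refine Finset.sum_le_sum fun n hn => ?_
  rw [PowerSeries.coeff_mul]
  refine (mul_le_mul_of_nonneg_right (Finset.abs_sum_le_sum_abs _ _) (by positivity)).trans ?_
  rw [Finset.sum_mul]
  have h2 : ∀ x ∈ Finset.HasAntidiagonal.antidiagonal n, |coeff x.1 p * coeff x.2 q| * r^n = f x := by
    intro x hx
    rw [Finset.HasAntidiagonal.mem_antidiagonal] at hx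
    simp only [hf]; rw [← hx, pow_add, abs_mul]; ring
  rw [Finset.sum_congr rfl h2]
  have h3 : ∑ x ∈ (Finset.HasAntidiagonal.antidiagonal n), f x = ∑ x ∈ (Finset.HasAntidiagonal.antidiagonal n).filter (fun x => x.1 ≠ 0 ∧ x.2 ≠ 0), f x := by
    symm; apply Finset.sum_filter_of_ne
    intro x hx hne
    refine ⟨fun h => hne ?_, fun h => hne ?_⟩
    · simp only [hf]; rw [h, hp]; simp
    · simp only [hf]; rw [h, hq]; simp
  rw [h3]
  refine Finset.sum_le_sum_of_subset_of_nonneg (fun x hx => ?_) fun x _ _ => hf0 x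
  rw [Finset.mem_filter, Finset.HasAntidiagonal.mem_antidiagonal] at hx
  simp only [hs', hs, Finset.mem_filter, Finset.mem_product, Finset.mem_range] at hn ⊢
  obtain ⟨h1, h2, h3⟩ := hx
  refine ⟨⟨⟨?_, ?_⟩, ?_⟩, ?_⟩ <;> lia

abbrev POp := ℝ → PowerSeries ℝ → PowerSeries ℝ → PowerSeries ℝ

structure L1 (K : Set ℝ) (U : POp) (u : ℝ → ℝ → ℝ → ℝ) : Prop where
  c0 : ∀ m ∈ K, ∀ p q, coeff 0 p = 0 → coeff 0 q = 0 → coeff 0 (U m p q) = 0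
  bd : ∃ C ≥ 0, ∀ m ∈ K, ∀ p q, coeff 0 p = 0 → coeff 0 q = 0 → ∀ r ∈ Ioc (0:ℝ) 1, ∀ N,
    nrm r N p + nrm r N q ≤ 1 → nrm r N (U m p q) ≤ C * (nrm r N p + nrm r N q)
  ca : ∀ m ∈ K, ∀ p q p' q' n, (∀ i < n, coeff i p = coeff i p') →
    (∀ i < n, coeff i q = coeff i q') → ∀ i < n, coeff i (U m p q) = coeff i (U m p' q')
  co : ∀ p q : ℝ → PowerSeries ℝ, (∀ n, ContinuousOn (fun m => coeff n (p m)) K) →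
    (∀ n, ContinuousOn (fun m => coeff n (q m)) K) → ∀ n, ContinuousOn (fun m => coeff n (U m (p m) (q m))) K
  ev : ∀ m ∈ K, ∀ p q r, 0 ≤ r → AS p r → AS q r → AS (U m p q) r ∧ ∀ θ, |θ| ≤ r → pev (U m p q) θ = u m (pev p θ) (pev q θ)

structure L2 (K : Set ℝ) (U : POp) (u : ℝ → ℝ → ℝ → ℝ) : Prop where
  l1 : L1 K U u
  bd : ∃ C ≥ 0, ∀ m ∈ K, ∀ p q, coeff 0 p = 0 → coeff 0 q = 0 → ∀ r ∈ Ioc (0:ℝ) 1, ∀ N,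
    nrm r N p + nrm r N q ≤ 1 → nrm r (N+1) (U m p q) ≤ C * (nrm r N p + nrm r N q)^2
  ca : ∀ m ∈ K, ∀ p q p' q' n, coeff 0 p = 0 → coeff 0 q = 0 → coeff 0 p' = 0 → coeff 0 q' = 0 →
    (∀ i < n, coeff i p = coeff i p') →
    (∀ i < n, coeff i q = coeff i q') → ∀ i < n+1, coeff i (U m p q) = coeff i (U m p' q')

lemma L1.fst (K) : L1 K (fun _ p _ => p) (fun _ x _ => x) where
  c0 := fun m _ p q hp _ => hp
  bd := ⟨1, zero_le_one, fun m _ p q _ _ r hr N _ => by have := nrm_nonneg hr.1.le N q; linarith⟩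
  ca := fun m _ p q p' q' n h _ => h
  co := fun p q h _ => h
  ev := fun m _ p q r _ hp _ => ⟨hp, fun _ _ => rfl⟩

lemma L1.snd (K) : L1 K (fun _ _ q => q) (fun _ _ x => x) where
  c0 := fun m _ p q _ hp => hp
  bd := ⟨1, zero_le_one, fun m _ p q _ _ r hr N _ => by have := nrm_nonneg hr.1.le N p; linarith⟩
  ca := fun m _ p q p' q' n _ h => h
  co := fun p q _ h => h
  ev := fun m _ p q r _ _ hp => ⟨hp, fun _ _ => rfl⟩

lemma L1.add {K U u V v} (hU : L1 K U u) (hV : L1 K V v) : L1 K (fun m p q => U m p q + V m p q) (fun m x y => u m x y + v m x y) where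
  c0 := fun m hm p q hp hq => by rw [map_add, hU.c0 m hm p q hp hq, hV.c0 m hm p q hp hq, add_zero]
  bd := by
    obtain ⟨C, hC, h⟩ := hU.bd
    obtain ⟨D, hD, h'⟩ := hV.bd
    refine ⟨C+D, by positivity, fun m hm p q hp hq r hr N hN => (nrm_add hr.1.le _ _ _).trans ?_⟩
    have := h m hm p q hp hq r hr N hN
    have := h' m hm p q hp hq r hr N hN
    linarith
  ca := fun m hm p q p' q' n h h' i hi => by rw [map_add, map_add, hU.ca m hm p q p' q' n h h' i hi, hV.ca m hm p q p' q' n h h' i hi]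
  co := fun p q h h' n => by simp only [map_add]; exact (hU.co p q h h' n).add (hV.co p q h h' n)
  ev := fun m hm p q r hr hp hq => by
    obtain ⟨h1, h2⟩ := hU.ev m hm p q r hr hp hq
    obtain ⟨h3, h4⟩ := hV.ev m hm p q r hr hp hq
    exact ⟨h1.add h3 hr, fun θ hθ => by rw [pev_add h1 h3 hθ, h2 θ hθ, h4 θ hθ]⟩

lemma L1.smul {K U u} {c : ℝ → ℝ} (hc : ContinuousOn c K) (hb : ∃ M, ∀ m ∈ K, |c m| ≤ M) (hU : L1 K U u)  :
    L1 K (fun m p q => PowerSeries.C (c m) * U m p q) (fun m x y => c m * u m x y) where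
  c0 := fun m hm p q hp hq => by rw [PowerSeries.coeff_C_mul, hU.c0 m hm p q hp hq, mul_zero]
  bd := by
    obtain ⟨C, hC, h⟩ := hU.bd
    obtain ⟨M, hM⟩ := hb
    refine ⟨|M| * C, by positivity, fun m hm p q hp hq r hr N hN => ?_⟩
    rw [nrm_C_mul, mul_assoc]
    have := nrm_nonneg hr.1.le N (U m p q)
    exact mul_le_mul ((hM m hm).trans (le_abs_self _)) (h m hm p q hp hq r hr N hN) this (abs_nonneg _)
  ca := fun m hm p q p' q' n h h' i hi => by rw [PowerSeries.coeff_C_mul, PowerSeries.coeff_C_mul, hU.ca m hm p q p' q' n h h' i hi]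
  co := fun p q h h' n => by simp only [PowerSeries.coeff_C_mul]; exact hc.mul (hU.co p q h h' n)
  ev := fun m hm p q r hr hp hq => by
    obtain ⟨h1, h2⟩ := hU.ev m hm p q r hr hp hq
    exact ⟨h1.C_mul _, fun θ hθ => by rw [pev_C_mul, h2 θ hθ]⟩

lemma L2.add {K U u V v} (hU : L2 K U u) (hV : L2 K V v) : L2 K (fun m p q => U m p q + V m p q) (fun m x y => u m x y + v m x y) where
  l1 := hU.l1.add hV.l1
  bd := by
    obtain ⟨C, hC, h⟩ := hU.bd
    obtain ⟨D, hD, h'⟩ := hV.bd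
    refine ⟨C+D, by positivity, fun m hm p q hp hq r hr N hN => (nrm_add hr.1.le _ _ _).trans ?_⟩
    have := h m hm p q hp hq r hr N hN
    have := h' m hm p q hp hq r hr N hN
    linarith
  ca := fun m hm p q p' q' n h1 h2 h3 h4 h h' i hi => by
    rw [map_add, map_add, hU.ca m hm p q p' q' n h1 h2 h3 h4 h h' i hi, hV.ca m hm p q p' q' n h1 h2 h3 h4 h h' i hi]

lemma L2.smul {K U u} {c : ℝ → ℝ} (hc : ContinuousOn c K) (hb : ∃ M, ∀ m ∈ K, |c m| ≤ M) (hU : L2 K U u)  :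
    L2 K (fun m p q => PowerSeries.C (c m) * U m p q) (fun m x y => c m * u m x y) where
  l1 := hU.l1.smul hc hb
  bd := by
    obtain ⟨C, hC, h⟩ := hU.bd
    obtain ⟨M, hM⟩ := hb
    refine ⟨|M| * C, by positivity, fun m hm p q hp hq r hr N hN => ?_⟩
    rw [nrm_C_mul, mul_assoc]
    have := nrm_nonneg hr.1.le (N+1) (U m p q)
    exact mul_le_mul ((hM m hm).trans (le_abs_self _)) (h m hm p q hp hq r hr N hN) this (abs_nonneg _)
  ca := fun m hm p q p' q' n h1 h2 h3 h4 h h' i hi => by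
    rw [PowerSeries.coeff_C_mul, PowerSeries.coeff_C_mul, hU.ca m hm p q p' q' n h1 h2 h3 h4 h h' i hi]

lemma L1.mul {K U u V v} (hU : L1 K U u) (hV : L1 K V v) : L2 K (fun m p q => U m p q * V m p q) (fun m x y => u m x y * v m x y) := by
  have hbd : ∃ C ≥ 0, ∀ m ∈ K, ∀ p q, coeff 0 p = 0 → coeff 0 q = 0 → ∀ r ∈ Ioc (0:ℝ) 1, ∀ N,
    nrm r N p + nrm r N q ≤ 1 → nrm r (N+1) (U m p q * V m p q) ≤ C * (nrm r N p + nrm r N q)^2 := by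
    obtain ⟨C, hC, h⟩ := hU.bd
    obtain ⟨D, hD, h'⟩ := hV.bd
    refine ⟨C*D, by positivity, fun m hm p q hp hq r hr N hN => (nrm_mul_succ hr.1.le _ _ _ (hU.c0 m hm p q hp hq) (hV.c0 m hm p q hp hq)).trans ?_⟩
    have e1 := h m hm p q hp hq r hr N hN
    have e2 := h' m hm p q hp hq r hr N hN
    refine (mul_le_mul e1 e2 (nrm_nonneg hr.1.le _ _) ((nrm_nonneg hr.1.le _ _).trans e1)).trans (le_of_eq (by ring))
  refine ⟨⟨?_, ?_, ?_, ?_, ?_⟩, hbd, ?_⟩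
  · intro m hm p q hp hq
    rw [PowerSeries.coeff_mul]; simp [hU.c0 m hm p q hp hq]
  · obtain ⟨C, hC, h⟩ := hbd
    refine ⟨C, hC, fun m hm p q hp hq r hr N hN => ?_⟩
    have e1 := h m hm p q hp hq r hr N hN
    have e2 := nrm_mono hr.1.le (Nat.le_succ N) (U m p q * V m p q)
    have e3 := add_nonneg (nrm_nonneg hr.1.le N p) (nrm_nonneg hr.1.le N q)
    refine e2.trans (e1.trans ?_)
    gcongr; nlinarith
  · intro m hm p q p' q' n h h' i hi
    rw [PowerSeries.coeff_mul, PowerSeries.coeff_mul]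
    refine Finset.sum_congr rfl fun x hx => ?_
    rw [Finset.HasAntidiagonal.mem_antidiagonal] at hx
    rw [hU.ca m hm p q p' q' n h h' x.1 (by lia), hV.ca m hm p q p' q' n h h' x.2 (by lia)]
  · intro p q h h' n
    simp only [PowerSeries.coeff_mul]
    exact continuousOn_finsetSum _ fun x _ => (hU.co p q h h' _).mul (hV.co p q h h' _)
  · intro m hm p q r hr hp hq
    obtain ⟨h1, h2⟩ := hU.ev m hm p q r hr hp hq
    obtain ⟨h3, h4⟩ := hV.ev m hm p q r hr hp hq
    exact ⟨h1.mul h3 hr, fun θ hθ => by rw [pev_mul h1 h3 hθ, h2 θ hθ, h4 θ hθ]⟩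
  · intro m hm p q p' q' n h1 h2 h3 h4 h h' i hi
    rw [PowerSeries.coeff_mul, PowerSeries.coeff_mul]
    refine Finset.sum_congr rfl fun x hx => ?_
    rw [Finset.HasAntidiagonal.mem_antidiagonal] at hx
    have e1 := hU.c0 m hm p q h1 h2
    have e2 := hU.c0 m hm p' q' h3 h4
    have e3 := hV.c0 m hm p q h1 h2
    have e4 := hV.c0 m hm p' q' h3 h4
    rcases Nat.eq_zero_or_pos x.1 with hx1 | hx1
    · rw [hx1, e1, e2]; ring
    rcases Nat.eq_zero_or_pos x.2 with hx2 | hx2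
    · rw [hx2, e3, e4]; ring
    rw [hU.ca m hm p q p' q' n h h' x.1 (by lia), hV.ca m hm p q p' q' n h h' x.2 (by lia)]

noncomputable def Gf (Uf : POp) (m : ℝ) (z : PowerSeries ℝ × PowerSeries ℝ) : PowerSeries ℝ :=
  PowerSeries.mk fun n => if n = 0 then 0 else if n = 1 then 1 else coeff n (Uf m z.1 z.2) / ((n:ℝ)-1)
noncomputable def Gh (Uh : POp) (R : ℝ → ℝ) (m : ℝ) (z : PowerSeries ℝ × PowerSeries ℝ) : PowerSeries ℝ :=
  PowerSeries.mk fun n => if n ≤ 1 then 0 else coeff n (Uh m z.1 z.2) / ((n:ℝ)-R m)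
noncomputable def Git (Uf Uh : POp) (R : ℝ → ℝ) (m : ℝ) : ℕ → PowerSeries ℝ × PowerSeries ℝ
  | 0 => (0, 0)
  | (j+1) => (Gf Uf m (Git Uf Uh R m j), Gh Uh R m (Git Uf Uh R m j))

lemma L2.c1 {K U u} (h : L2 K U u) {m} (hm : m ∈ K) {p q} (hp : coeff 0 p = 0) (hq : coeff 0 q = 0) :
    coeff 1 (U m p q) = 0 := by
  obtain ⟨C, hC, h⟩ := h.bd
  have := h m hm p q hp hq 1 ⟨one_pos, le_rfl⟩ 0 (by simp [nrm, hp, hq])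
  simp only [nrm, hp, hq, Finset.sum_range_succ, Finset.sum_range_zero] at this
  simp at this
  have h1 := abs_nonneg (coeff 1 (U m p q))
  have h2 := abs_nonneg (PowerSeries.constantCoeff (U m p q))
  exact abs_nonpos_iff.1 (by linarith)

lemma Git_zero (Uf Uh R m j) : coeff 0 (Git Uf Uh R m j).1 = 0 ∧ coeff 0 (Git Uf Uh R m j).2 = 0 := by
  cases j <;> simp [Git, Gf, Gh]

lemma Gf_ca {K Uf uf} (hf : L2 K Uf uf) {m} (hm : m ∈ K) {z w : PowerSeries ℝ × PowerSeries ℝ} {n : ℕ}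
    (hz : coeff 0 z.1 = 0 ∧ coeff 0 z.2 = 0) (hw : coeff 0 w.1 = 0 ∧ coeff 0 w.2 = 0)
    (h : ∀ i < n, coeff i z.1 = coeff i w.1 ∧ coeff i z.2 = coeff i w.2) :
    ∀ i < n+1, coeff i (Gf Uf m z) = coeff i (Gf Uf m w) := by
  intro i hi
  simp only [Gf, PowerSeries.coeff_mk]
  rw [hf.ca m hm _ _ _ _ n hz.1 hz.2 hw.1 hw.2 (fun i hi => (h i hi).1) (fun i hi => (h i hi).2) i hi]

lemma Gh_ca {K Uf uf R} (hf : L2 K Uf uf) {m} (hm : m ∈ K) {z w : PowerSeries ℝ × PowerSeries ℝ} {n : ℕ}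
    (hz : coeff 0 z.1 = 0 ∧ coeff 0 z.2 = 0) (hw : coeff 0 w.1 = 0 ∧ coeff 0 w.2 = 0)
    (h : ∀ i < n, coeff i z.1 = coeff i w.1 ∧ coeff i z.2 = coeff i w.2) :
    ∀ i < n+1, coeff i (Gh Uf R m z) = coeff i (Gh Uf R m w) := by
  intro i hi
  simp only [Gh, PowerSeries.coeff_mk]
  rw [hf.ca m hm _ _ _ _ n hz.1 hz.2 hw.1 hw.2 (fun i hi => (h i hi).1) (fun i hi => (h i hi).2) i hi]

lemma Git_step {K Uf uf Uh uh R} (hf : L2 K Uf uf) (hh : L2 K Uh uh) {m} (hm : m ∈ K) (j : ℕ) :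
    ∀ i < j+1, coeff i (Git Uf Uh R m j).1 = coeff i (Git Uf Uh R m (j+1)).1 ∧
     coeff i (Git Uf Uh R m j).2 = coeff i (Git Uf Uh R m (j+1)).2 := by
  induction j with
  | zero => intro i hi; obtain rfl : i = 0 := by lia
            simp [Git, Gf, Gh]
  | succ j ih =>
    intro i hi
    exact ⟨Gf_ca hf hm (Git_zero ..) (Git_zero ..) ih i hi, Gh_ca hh hm (Git_zero ..) (Git_zero ..) ih i hi⟩

lemma Git_stab {K Uf uf Uh uh R} (hf : L2 K Uf uf) (hh : L2 K Uh uh) {m} (hm : m ∈ K) (j l : ℕ) :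
    ∀ i < j+1, coeff i (Git Uf Uh R m j).1 = coeff i (Git Uf Uh R m (j+l)).1 ∧
     coeff i (Git Uf Uh R m j).2 = coeff i (Git Uf Uh R m (j+l)).2 := by
  induction l with
  | zero => intro i _; exact ⟨rfl, rfl⟩
  | succ l ih =>
    intro i hi
    have h1 := Git_step (R := R) hf hh hm (j+l) i (by lia)
    exact ⟨(ih i hi).1.trans h1.1, (ih i hi).2.trans h1.2⟩

lemma Git_cont {K Uf uf Uh uh R} (hf : L2 K Uf uf) (hh : L2 K Uh uh) (hRc : ContinuousOn R K) (hR : ∀ m ∈ K, ∀ n : ℕ, 2 ≤ n → (n:ℝ) ≠ R m) (j : ℕ) :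
    (∀ n, ContinuousOn (fun m => coeff n (Git Uf Uh R m j).1) K) ∧ (∀ n, ContinuousOn (fun m => coeff n (Git Uf Uh R m j).2) K) := by
  induction j with
  | zero => simp [Git, continuousOn_const]
  | succ j ih =>
    have h1 := hf.l1.co _ _ ih.1 ih.2
    have h2 := hh.l1.co _ _ ih.1 ih.2
    constructor
    · intro n
      simp only [Git, Gf, PowerSeries.coeff_mk]
      split_ifs
      · exact continuousOn_const
      · exact continuousOn_const
      · exact (h1 n).div_const _
    · intro n
      simp only [Git, Gh, PowerSeries.coeff_mk]
      split_ifs with h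
      · exact continuousOn_const
      · exact (h2 n).div (continuousOn_const.sub hRc) fun m hm => sub_ne_zero.2 (hR m hm n (by lia))

lemma PSform {K Uf uf Uh uh R} (hf : L2 K Uf uf) (hh : L2 K Uh uh) (hRc : ContinuousOn R K) (hR : ∀ m ∈ K, ∀ n : ℕ, 2 ≤ n → (n:ℝ) ≠ R m) :
   ∃ η ξ : ℝ → PowerSeries ℝ, (∀ n, ContinuousOn (fun m => coeff n (η m)) K) ∧ (∀ n, ContinuousOn (fun m => coeff n (ξ m)) K) ∧
    ∀ m ∈ K, coeff 0 (η m) = 0 ∧ coeff 1 (η m) = 1 ∧ coeff 0 (ξ m) = 0 ∧ coeff 1 (ξ m) = 0 ∧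
     Th (η m) = η m + Uf m (η m) (ξ m) ∧ Th (ξ m) = PowerSeries.C (R m) * ξ m + Uh m (η m) (ξ m) := by
  let η : ℝ → PowerSeries ℝ := fun m => PowerSeries.mk fun n => coeff n (Git Uf Uh R m n).1
  let ξ : ℝ → PowerSeries ℝ := fun m => PowerSeries.mk fun n => coeff n (Git Uf Uh R m n).2
  refine ⟨η, ξ, fun n => ?_, fun n => ?_, fun m hm => ?_⟩
  · simp only [η, PowerSeries.coeff_mk]; exact (Git_cont hf hh hRc hR n).1 n
  · simp only [ξ, PowerSeries.coeff_mk]; exact (Git_cont hf hh hRc hR n).2 n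
  have hag : ∀ j, ∀ i < j+1, coeff i (η m, ξ m).1 = coeff i (Git Uf Uh R m j).1 ∧
     coeff i (η m, ξ m).2 = coeff i (Git Uf Uh R m j).2 := by
    intro j i hi
    obtain ⟨l, rfl⟩ : ∃ l, j = i + l := ⟨j - i, by lia⟩
    simp only [η, ξ, PowerSeries.coeff_mk]
    exact Git_stab hf hh hm i l i (by lia)
  have h0 : coeff 0 (η m, ξ m).1 = 0 ∧ coeff 0 (η m, ξ m).2 = 0 := by
    have := hag 0 0 (by lia)
    exact ⟨this.1.trans (Git_zero ..).1, this.2.trans (Git_zero ..).2⟩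
  have hη : η m = Gf Uf m (η m, ξ m) := by
    ext n
    rw [Gf_ca (n := n) hf hm h0 (Git_zero ..) (fun i hi => hag n i (by lia)) n (by lia)]
    exact (hag (n+1) n (by lia)).1
  have hξ : ξ m = Gh Uh R m (η m, ξ m) := by
    ext n
    rw [Gh_ca (n := n) hh hm h0 (Git_zero ..) (fun i hi => hag n i (by lia)) n (by lia)]
    exact (hag (n+1) n (by lia)).2
  have h1 : coeff 1 (η m) = 1 := by rw [hη]; simp [Gf]
  have h2 : coeff 1 (ξ m) = 0 := by rw [hξ]; simp [Gh]
  refine ⟨h0.1, h1, h0.2, h2, ?_, ?_⟩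
  · ext n
    rw [coeff_Th, map_add]
    rcases n with _ | _ | n
    · have := hf.l1.c0 m hm _ _ h0.1 h0.2
      simp only at this h0
      rw [this, h0.1]; simp
    · have := hf.c1 hm h0.1 h0.2
      simp only at this h0
      rw [zero_add, this, h1]; simp
    · have : coeff (n+1+1) (η m) = coeff (n+1+1) (Uf m (η m) (ξ m)) / (((n+1+1:ℕ):ℝ)-1) := by
        conv_lhs => rw [hη]
        simp [Gf]
      have h3 : (((n+1+1:ℕ):ℝ)-1) ≠ 0 := by push_cast; have : (0:ℝ) ≤ n := n.cast_nonneg; intro h; linarith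
      rw [eq_div_iff h3] at this
      linarith
  · ext n
    rw [coeff_Th, map_add, PowerSeries.coeff_C_mul]
    rcases n with _ | _ | n
    · have := hh.l1.c0 m hm _ _ h0.1 h0.2
      simp only at this h0
      rw [this, h0.2]; simp
    · have := hh.c1 hm h0.1 h0.2
      simp only at this h0
      rw [zero_add, this, h2]; simp
    · have : coeff (n+1+1) (ξ m) = coeff (n+1+1) (Uh m (η m) (ξ m)) / (((n+1+1:ℕ):ℝ)-R m) := by
        conv_lhs => rw [hξ]
        simp [Gh]
      have h3 : (((n+1+1:ℕ):ℝ)-R m) ≠ 0 := sub_ne_zero.2 (hR m hm _ (by lia))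
      rw [eq_div_iff h3] at this
      linarith

lemma nrm_le_of_coeff {r : ℝ} (hr : 0 ≤ r) (N : ℕ) {p q : PowerSeries ℝ} {κ : ℝ} (h : ∀ n, |coeff n p| ≤ κ * |coeff n q|) :
    nrm r N p ≤ κ * nrm r N q := by
  unfold nrm; rw [Finset.mul_sum]
  refine Finset.sum_le_sum fun n _ => ?_
  rw [← mul_assoc]
  exact mul_le_mul_of_nonneg_right (h n) (by positivity)

lemma nrm_monomial {r : ℝ} (hr : 0 ≤ r) (N n0 : ℕ) (c : ℝ) : nrm r N (PowerSeries.monomial n0 c) ≤ |c| * r^n0 := by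
  unfold nrm
  by_cases h : n0 ∈ Finset.range (N+1)
  · rw [Finset.sum_eq_single n0]
    · simp
    · intro b _ hb; simp [PowerSeries.coeff_monomial, hb]
    · exact fun h' => absurd h h'
  · rw [Finset.sum_eq_zero]
    · positivity
    · intro b hb
      have : b ≠ n0 := fun h' => h (h' ▸ hb)
      simp [PowerSeries.coeff_monomial, this]

lemma nrm_monomial_zero {r : ℝ} (N n0 : ℕ) (c : ℝ) (h : N < n0) : nrm r N (PowerSeries.monomial n0 c) = 0 := by
  unfold nrm
  rw [Finset.sum_eq_zero]
  intro b hb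
  have : b ≠ n0 := by rw [Finset.mem_range] at hb; lia
  simp [PowerSeries.coeff_monomial, this]

lemma AS_of_nrm {r A : ℝ} (hr : 0 ≤ r) {p : PowerSeries ℝ} (h : ∀ N, nrm r N p ≤ A) : AS p r := by
  refine summable_of_sum_range_le (c := A) (fun n => by positivity) fun n => ?_
  refine le_trans ?_ (h n)
  unfold nrm
  rw [Finset.sum_range_succ]
  have : 0 ≤ |coeff n p| * r^n := by positivity
  linarith

lemma pev_quad {r A θ : ℝ} (hr : 0 < r) {p : PowerSeries ℝ} (h : ∀ N, nrm r N p ≤ A) (h0 : coeff 0 p = 0)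
    (h1 : coeff 1 p = 0) (hθ : |θ| ≤ r) : |pev p θ| ≤ A / r^2 * θ^2 := by
  have hs := (AS_of_nrm hr.le h).sum hθ
  have hA : 0 ≤ A := (nrm_nonneg hr.le 0 p).trans (h 0)
  unfold pev
  rw [← Real.norm_eq_abs]
  have hS := AS_of_nrm hr.le h
  have h2 : HasSum (fun n => |coeff n p| * r^n * (θ^2/r^2)) ((∑' n, |coeff n p| * r^n) * (θ^2/r^2)) :=
    hS.hasSum.mul_right _
  have h3 : ∑' n, |coeff n p| * r^n ≤ A := by
    refine Real.tsum_le_of_sum_range_le (fun n => by positivity) fun n => ?_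
    refine le_trans ?_ (h n)
    unfold nrm
    rw [Finset.sum_range_succ]
    have : 0 ≤ |coeff n p| * r^n := by positivity
    linarith
  refine (tsum_of_norm_bounded h2 fun n => ?_).trans ?_
  · rw [norm_mul, norm_pow, Real.norm_eq_abs, Real.norm_eq_abs]
    rcases n with _ | _ | n
    · rw [h0]; simp
    · rw [zero_add, h1]; simp
    · rw [mul_assoc]
      gcongr
      have e1 : |θ|^n ≤ r^n := by gcongr
      calc |θ|^(n+1+1) = |θ|^n * θ^2 := by rw [← sq_abs θ]; ring
        _ ≤ r^n * θ^2 := by gcongr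
        _ = _ := by field_simp; ring
  · calc _ ≤ A * (θ^2/r^2) := by gcongr
      _ = _ := by ring

theorem PSmain {K : Set ℝ} {Uf uf Uh uh} {R : ℝ → ℝ} (hf : L2 K Uf uf) (hh : L2 K Uh uh) (hRc : ContinuousOn R K) (n0 : ℕ) (hn0 : 2 ≤ n0) (κ : ℝ) (hκ : 0 ≤ κ)
    (hR : ∀ m ∈ K, ∀ n : ℕ, 2 ≤ n → n ≠ n0 → 1 ≤ κ * |(n:ℝ) - R m|) (hR0 : ∀ m ∈ K, (n0:ℝ) ≠ R m) :
   ∃ η ξ : ℝ → PowerSeries ℝ, (∀ n, ContinuousOn (fun m => coeff n (η m)) K) ∧ (∀ n, ContinuousOn (fun m => coeff n (ξ m)) K) ∧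
    (∀ m ∈ K, coeff 0 (η m) = 0 ∧ coeff 1 (η m) = 1 ∧ coeff 0 (ξ m) = 0 ∧ coeff 1 (ξ m) = 0 ∧
     Th (η m) = η m + Uf m (η m) (ξ m) ∧ Th (ξ m) = PowerSeries.C (R m) * ξ m + Uh m (η m) (ξ m)) ∧
    ∃ C > 1, ∀ m ∈ K, (∀ i < n0, |coeff i (η m)| ≤ C ∧ |coeff i (ξ m)| ≤ C) ∧
      ∀ r ∈ Ioc (0:ℝ) 1, ∀ ρ : ℝ, r + |coeff n0 (ξ m)| * r^n0 ≤ ρ → C * ρ ≤ 1 →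
       ∀ N, nrm r N (η m) + nrm r N (ξ m) ≤ 2*ρ ∧ nrm r N (η m - PowerSeries.X) ≤ C * ρ^2 ∧
         nrm r N (ξ m - PowerSeries.monomial n0 (coeff n0 (ξ m))) ≤ C * ρ^2 := by
  have hRR : ∀ m ∈ K, ∀ n : ℕ, 2 ≤ n → (n:ℝ) ≠ R m := by
    intro m hm n hn
    by_cases h : n = n0
    · rw [h]; exact hR0 m hm
    · intro h'
      have := hR m hm n hn h
      rw [h'] at this; simp at this; linarith
  obtain ⟨η, ξ, h1, h2, h3⟩ := PSform hf hh hRc hRR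
  refine ⟨η, ξ, h1, h2, h3, ?_⟩
  obtain ⟨Cf, hCf, hf⟩ := hf.bd
  obtain ⟨Ch, hCh, hh⟩ := hh.bd
  set C0 := Cf + κ*Ch with hC0
  have hκCh : 0 ≤ κ*Ch := by positivity
  have hC0' : 0 ≤ C0 := by positivity
  -- coefficient comparison
  have hcη : ∀ m ∈ K, ∀ n, |coeff n (η m - PowerSeries.X)| ≤ 1 * |coeff n (Uf m (η m) (ξ m))| := by
    intro m hm n
    obtain ⟨a0, a1, b0, b1, e1, e2⟩ := h3 m hm
    rw [map_sub, one_mul]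
    rcases n with _ | _ | n
    · rw [a0]; simp
    · rw [zero_add, a1]; simp
    · have := congrArg (coeff (n+1+1)) e1
      rw [coeff_Th, map_add] at this
      have h4 : coeff (n+1+1) (Uf m (η m) (ξ m)) = ((n:ℝ)+1) * coeff (n+1+1) (η m) := by push_cast at this; linarith
      rw [h4, abs_mul, PowerSeries.coeff_X]
      simp
      have h5 : (1:ℝ) ≤ |(n:ℝ)+1| := by rw [abs_of_nonneg (by positivity)]; have : (0:ℝ) ≤ n := n.cast_nonneg; linarith
      exact le_mul_of_one_le_left (abs_nonneg _) h5
  have hcξ : ∀ m ∈ K, ∀ n, |coeff n (ξ m - PowerSeries.monomial n0 (coeff n0 (ξ m)))| ≤ κ * |coeff n (Uh m (η m) (ξ m))| := by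
    intro m hm n
    obtain ⟨a0, a1, b0, b1, e1, e2⟩ := h3 m hm
    rw [map_sub]
    by_cases hn : n = n0
    · rw [hn]; simp; positivity
    rw [PowerSeries.coeff_monomial, if_neg hn, sub_zero]
    rcases n with _ | _ | n
    · rw [b0]; simp; positivity
    · rw [zero_add, b1]; simp; positivity
    · have := congrArg (coeff (n+1+1)) e2
      rw [coeff_Th, map_add, PowerSeries.coeff_C_mul] at this
      have h4 : coeff (n+1+1) (Uh m (η m) (ξ m)) = (((n+1+1:ℕ):ℝ)-R m) * coeff (n+1+1) (ξ m) := by linarith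
      rw [h4, abs_mul, ← mul_assoc]
      exact le_mul_of_one_le_left (abs_nonneg _) (hR m hm _ (by lia) hn)
  have hX : ∀ r : ℝ, 0 ≤ r → ∀ N, nrm r N (PowerSeries.X : PowerSeries ℝ) ≤ r := by
    intro r hr N
    have := nrm_monomial hr N 1 1
    rw [← PowerSeries.X_eq] at this; simpa using this
  have hstep : ∀ m ∈ K, ∀ r ∈ Ioc (0:ℝ) 1, ∀ N, nrm r N (η m) + nrm r N (ξ m) ≤ 1 →
      nrm r (N+1) (η m) + nrm r (N+1) (ξ m) ≤ r + nrm r (N+1) (PowerSeries.monomial n0 (coeff n0 (ξ m))) + C0 * (nrm r N (η m) + nrm r N (ξ m))^2 ∧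
      nrm r (N+1) (η m - PowerSeries.X) ≤ C0 * (nrm r N (η m) + nrm r N (ξ m))^2 ∧
      nrm r (N+1) (ξ m - PowerSeries.monomial n0 (coeff n0 (ξ m))) ≤ C0 * (nrm r N (η m) + nrm r N (ξ m))^2 := by
    intro m hm r hr N hN
    obtain ⟨a0, a1, b0, b1, e1, e2⟩ := h3 m hm
    have f1 := nrm_le_of_coeff hr.1.le (N+1) (hcη m hm)
    have f2 := nrm_le_of_coeff hr.1.le (N+1) (hcξ m hm)
    have f3 := hf m hm _ _ a0 b0 r hr N hN
    have f4 := hh m hm _ _ a0 b0 r hr N hN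
    have f5 := nrm_add hr.1.le (N+1) (η m - PowerSeries.X) PowerSeries.X
    have f6 := nrm_add hr.1.le (N+1) (ξ m - PowerSeries.monomial n0 (coeff n0 (ξ m))) (PowerSeries.monomial n0 (coeff n0 (ξ m)))
    rw [sub_add_cancel] at f5 f6
    have f7 := hX r hr.1.le (N+1)
    set S := nrm r N (η m) + nrm r N (ξ m)
    have f8 := mul_le_mul_of_nonneg_left f4 hκ
    have f9 : 0 ≤ Cf*S^2 := by positivity
    have f10 : 0 ≤ κ*Ch*S^2 := by positivity
    have f11 : C0*S^2 = Cf*S^2 + κ*Ch*S^2 := by rw [hC0]; ring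
    rw [f11]
    refine ⟨?_, ?_, ?_⟩ <;> linarith
  have hS0 : ∀ m ∈ K, ∀ r : ℝ, nrm r 0 (η m) + nrm r 0 (ξ m) = 0 := by
    intro m hm r
    obtain ⟨a0, a1, b0, b1, e1, e2⟩ := h3 m hm
    simp only [nrm, Finset.sum_range_succ, Finset.sum_range_zero, a0, b0]; simp
  have hSn : ∀ m, ∀ r : ℝ, 0 ≤ r → ∀ N, 0 ≤ nrm r N (η m) + nrm r N (ξ m) := fun m r hr N => add_nonneg (nrm_nonneg hr _ _) (nrm_nonneg hr _ _)
  set C1 := 4*C0+2 with hC1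
  set rs := 1/C1 with hrs
  have hC1' : 2 ≤ C1 := by linarith
  have hrs0 : 0 < rs := by positivity
  have hrs1 : rs ≤ 1 := by rw [hrs, div_le_one (by linarith)]; linarith
  refine ⟨max C1 (2*rs/rs^n0), lt_max_of_lt_left (by linarith), fun m hm => ⟨?_, ?_⟩⟩
  · have hb : ∀ N < n0, nrm rs N (η m) + nrm rs N (ξ m) ≤ 2*rs := by
      intro N
      induction N with
      | zero => intro _; rw [hS0 m hm]; positivity
      | succ N ih =>
        intro hN
        have h5 := ih (by lia)
        have h8 : C1*rs = 1 := by rw [hrs]; field_simp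
        have h6 := (hstep m hm rs ⟨hrs0, hrs1⟩ N (by nlinarith)).1
        rw [nrm_monomial_zero _ _ _ hN] at h6
        have h7 : (nrm rs N (η m) + nrm rs N (ξ m))^2 ≤ (2*rs)^2 := by
          have := hSn m rs hrs0.le N
          gcongr
        have := mul_le_mul_of_nonneg_left h7 hC0'
        nlinarith
    intro i hi
    have h5 := hb i hi
    have g1 : |coeff i (η m)| * rs^i ≤ nrm rs i (η m) := Finset.single_le_sum (f := fun n => |coeff n (η m)| * rs^n) (fun n _ => by positivity) (by simp)
    have g2 : |coeff i (ξ m)| * rs^i ≤ nrm rs i (ξ m) := Finset.single_le_sum (f := fun n => |coeff n (ξ m)| * rs^n) (fun n _ => by positivity) (by simp)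
    have g3 : rs^n0 ≤ rs^i := pow_le_pow_of_le_one hrs0.le hrs1 hi.le
    have g4 := nrm_nonneg hrs0.le i (η m)
    have g5 := nrm_nonneg hrs0.le i (ξ m)
    have g6 : ∀ c : ℝ, |c| * rs^i ≤ 2*rs → |c| ≤ 2*rs/rs^n0 := by
      intro c hc
      rw [le_div_iff₀ (by positivity)]
      exact (mul_le_mul_of_nonneg_left g3 (abs_nonneg c)).trans hc
    exact ⟨(g6 _ (by linarith)).trans (le_max_right _ _), (g6 _ (by linarith)).trans (le_max_right _ _)⟩
  · intro r hr ρ hρ hCρ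
    have hρ0 : 0 < ρ := lt_of_lt_of_le (by have := hr.1; positivity) hρ
    have h8 : C1*ρ ≤ 1 := (mul_le_mul_of_nonneg_right (le_max_left _ _) hρ0.le).trans hCρ
    have hb : ∀ N, nrm r N (η m) + nrm r N (ξ m) ≤ 2*ρ := by
      intro N
      induction N with
      | zero => rw [hS0 m hm]; positivity
      | succ N ih =>
        have h6 := (hstep m hm r hr N (by nlinarith)).1
        have h5 := nrm_monomial hr.1.le (N+1) n0 (coeff n0 (ξ m))
        have h7 : (nrm r N (η m) + nrm r N (ξ m))^2 ≤ (2*ρ)^2 := by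
          have := hSn m r hr.1.le N
          gcongr
        have := mul_le_mul_of_nonneg_left h7 hC0'
        nlinarith
    intro N
    have h7 : (nrm r N (η m) + nrm r N (ξ m))^2 ≤ (2*ρ)^2 := by
      have := hSn m r hr.1.le N
      have := hb N
      gcongr
    have h9 := mul_le_mul_of_nonneg_left h7 hC0'
    obtain ⟨_, g1, g2⟩ := hstep m hm r hr N (by have := hb N; nlinarith)
    have g3 := nrm_mono hr.1.le (Nat.le_succ N) (η m - PowerSeries.X)
    have g4 := nrm_mono hr.1.le (Nat.le_succ N) (ξ m - PowerSeries.monomial n0 (coeff n0 (ξ m)))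
    have g5 : C0 * (2*ρ)^2 ≤ max C1 (2*rs/rs^n0) * ρ^2 := by
      have : C1*ρ^2 ≤ max C1 (2*rs/rs^n0) * ρ^2 := by gcongr; exact le_max_left _ _
      nlinarith [sq_nonneg ρ]
    exact ⟨hb N, by linarith, by linarith⟩

def BC (K : Set ℝ) (c : ℝ → ℝ) : Prop := ContinuousOn c K ∧ ∃ M, ∀ m ∈ K, |c m| ≤ M
lemma BC.add {K c d} (hc : BC K c) (hd : BC K d) : BC K (fun m => c m + d m) := by
  obtain ⟨hc, M, hM⟩ := hc; obtain ⟨hd, N, hN⟩ := hd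
  exact ⟨hc.add hd, M+N, fun m hm => (abs_add_le _ _).trans (add_le_add (hM m hm) (hN m hm))⟩
lemma BC.mul {K c d} (hc : BC K c) (hd : BC K d) : BC K (fun m => c m * d m) := by
  obtain ⟨hc, M, hM⟩ := hc; obtain ⟨hd, N, hN⟩ := hd
  refine ⟨hc.mul hd, M*N, fun m hm => ?_⟩
  rw [abs_mul]; exact mul_le_mul (hM m hm) (hN m hm) (abs_nonneg _) ((abs_nonneg _).trans (hM m hm))
lemma BC.const (K) (c : ℝ) : BC K (fun _ => c) := ⟨continuousOn_const, |c|, fun _ _ => le_rfl⟩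
lemma BC.neg {K c} (hc : BC K c) : BC K (fun m => - c m) := by
  obtain ⟨hc, M, hM⟩ := hc
  exact ⟨hc.neg, M, fun m hm => by rw [abs_neg]; exact hM m hm⟩
lemma BC.of_compact {K K' c} (hK : IsCompact K') (h : K ⊆ K') (hc : ContinuousOn c K') : BC K c := by
  obtain ⟨M, hM⟩ := hK.exists_bound_of_continuousOn hc
  exact ⟨hc.mono h, M, fun m hm => hM m (h hm)⟩

section P1
variable (k : ℝ) (e g T W σ ω : ℝ → ℝ)

noncomputable def oX : POp := fun m p q => p + PowerSeries.C (-ω m) * q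
noncomputable def oL : POp := fun m p q => q + PowerSeries.C (e m) * oX ω m p q
/-- nonlinear part of the x equation, times 1/k -/
noncomputable def oNx : POp := fun m p q =>
  PowerSeries.C (T m) * (oX ω m p q * oX ω m p q) + PowerSeries.C (1 + T m) * (oX ω m p q * oL e ω m p q)
  + PowerSeries.C (-T m) * (oX ω m p q * oX ω m p q * oL e ω m p q)
  + PowerSeries.C (-(m * k⁻¹)) * (oX ω m p q * (PowerSeries.C (e m + g m) * oX ω m p q + PowerSeries.C (-1) * oL e ω m p q
    + PowerSeries.C (T m) * (oX ω m p q * oX ω m p q) + PowerSeries.C (1 + T m) * (oX ω m p q * oL e ω m p q)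
    + PowerSeries.C (-T m) * (oX ω m p q * oX ω m p q * oL e ω m p q)))
noncomputable def oNL : POp := fun m p q =>
  PowerSeries.C (-(2 * k⁻¹ * W m)) * (oX ω m p q * oL e ω m p q) + PowerSeries.C (-(2 * k⁻¹)) * (oL e ω m p q * (PowerSeries.C k * oL e ω m p q
    + PowerSeries.C (-σ m) * oX ω m p q + PowerSeries.C (-W m) * (oX ω m p q * oL e ω m p q)))
noncomputable def oh : POp := fun m p q => PowerSeries.C ((g m)⁻¹) * (oNL k e W σ ω m p q + PowerSeries.C (-e m) * oNx k e g T ω m p q)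
noncomputable def of : POp := fun m p q => PowerSeries.C ((g m)⁻¹) * (oNx k e g T ω m p q) + PowerSeries.C (ω m) * oh k e g T W σ ω m p q

variable {k e g T W σ ω}
lemma oX_L1 {K} (hω : BC K ω) : ∃ u, L1 K (oX ω) u := ⟨_, (L1.fst K).add ((L1.snd K).smul hω.neg.1 hω.neg.2)⟩
lemma oL_L1 {K} (he : BC K e) (hω : BC K ω) : ∃ u, L1 K (oL e ω) u := by
  obtain ⟨u, hu⟩ := oX_L1 hω
  exact ⟨_, (L1.snd K).add (hu.smul he.1 he.2)⟩
lemma oNx_L2 {K} (he : BC K e) (hg : BC K g) (hT : BC K T) (hω : BC K ω) (hm : BC K fun m => m) : ∃ u, L2 K (oNx k e g T ω) u := by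
  obtain ⟨u, hX⟩ := oX_L1 hω
  obtain ⟨v, hL⟩ := oL_L1 he hω
  have t1 := (BC.const K 1).add hT
  have t2 := (hm.mul (BC.const K k⁻¹)).neg
  have c1 := BC.const K (-1)
  have eg := he.add hg
  exact ⟨_, ((((hX.mul hX).smul hT.1 hT.2).add ((hX.mul hL).smul t1.1 t1.2)).add (((hX.mul hX).l1.mul hL).smul hT.neg.1 hT.neg.2)).add
    ((hX.mul (((((hX.smul eg.1 eg.2).add (hL.smul c1.1 c1.2)).add ((hX.mul hX).smul hT.1 hT.2).l1).add ((hX.mul hL).smul t1.1 t1.2).l1).add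
      (((hX.mul hX).l1.mul hL).smul hT.neg.1 hT.neg.2).l1)).smul t2.1 t2.2)⟩
lemma oNL_L2 {K} (he : BC K e) (hW : BC K W) (hσ : BC K σ) (hω : BC K ω) : ∃ u, L2 K (oNL k e W σ ω) u := by
  obtain ⟨u, hX⟩ := oX_L1 hω
  obtain ⟨v, hL⟩ := oL_L1 he hω
  have c1 := ((BC.const K (2 * k⁻¹)).mul hW).neg
  have c2 := (BC.const K (2 * k⁻¹)).neg
  have c3 := BC.const K k
  exact ⟨_, ((hX.mul hL).smul c1.1 c1.2).add ((hL.mul (((hL.smul c3.1 c3.2).add (hX.smul hσ.neg.1 hσ.neg.2)).add ((hX.mul hL).smul hW.neg.1 hW.neg.2).l1)).smul c2.1 c2.2)⟩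
lemma oh_L2 {K} (he : BC K e) (hg : BC K g) (hg' : BC K fun m => (g m)⁻¹) (hT : BC K T) (hW : BC K W) (hσ : BC K σ) (hω : BC K ω) (hm : BC K fun m => m) :
    ∃ u, L2 K (oh k e g T W σ ω) u := by
  obtain ⟨u, h1⟩ := oNx_L2 (k := k) he hg hT hω hm
  obtain ⟨v, h2⟩ := oNL_L2 (k := k) he hW hσ hω
  exact ⟨_, (h2.add (h1.smul he.neg.1 he.neg.2)).smul hg'.1 hg'.2⟩
lemma of_L2 {K} (he : BC K e) (hg : BC K g) (hg' : BC K fun m => (g m)⁻¹) (hT : BC K T) (hW : BC K W) (hσ : BC K σ) (hω : BC K ω) (hm : BC K fun m => m) :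
    ∃ u, L2 K (of k e g T W σ ω) u := by
  obtain ⟨u, h1⟩ := oNx_L2 (k := k) he hg hT hω hm
  obtain ⟨v, h2⟩ := oh_L2 (k := k) he hg hg' hT hW hσ hω hm
  exact ⟨_, (h1.smul hg'.1 hg'.2).add (h2.smul hω.1 hω.2)⟩
end P1

/-- The x-field and L-field (so that `k g Θ x = FX`, `k g Θ L = FL`), over any ring. -/
def FX {A : Type*} [CommRing A] (k m eg T x L : A) : A := (k - m*x)*(eg*x - L + T*x^2 + (1+T)*x*L - T*x^2*L)
def FL {A : Type*} [CommRing A] (k σ W x L : A) : A := 2*(1-L)*(k*L - σ*x - W*x*L)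

lemma ring_x {A : Type*} [CommRing A] {k ki g gi m e T ω η ξ Uh Uf x L Nx tη tξ : A} (h1 : k*ki=1) (h2 : g*gi=1) (h3 : ω*(2+e-g)=1)
    (hx : x = η + (-ω)*ξ) (hL : L = ξ + e*x)
    (hNx : Nx = T*(x*x) + (1+T)*(x*L) + (-T)*(x*x*L) + (-(m*ki))*(x*((e+g)*x + (-1)*L + T*(x*x) + (1+T)*(x*L)+(-T)*(x*x*L))))
    (hUf : Uf = gi*Nx + ω*Uh) (hη : tη = η + Uf) (hξ : tξ = ((2+e)*gi)*ξ + Uh) :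
    k*g*(tη + (-ω)*tξ) = FX k m (e+g) T x L := by
  have e1 : k*g*(tη + (-ω)*tξ) = k*(g*η - ω*(2+e)*ξ + Nx) := by
    rw [hη, hξ, hUf]; linear_combination (k*(Nx - ω*(2+e)*ξ))*h2
  have e2 : k*Nx = k*(T*(x*x) + (1+T)*(x*L) + (-T)*(x*x*L)) - m*(x*((e+g)*x + (-1)*L + T*(x*x) + (1+T)*(x*L)+(-T)*(x*x*L))) := by
    rw [hNx]; linear_combination (- m*(x*((e+g)*x + (-1)*L + T*(x*x) + (1+T)*(x*L)+(-T)*(x*x*L))))*h1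
  rw [e1, mul_add, e2, FX]
  have e3 : g*η - ω*(2+e)*ξ = (e+g)*x - L := by
    rw [hL, hx]; linear_combination (-ξ)*h3
  linear_combination k*e3
lemma ring_L {A : Type*} [CommRing A] {k ki g gi e W σ ω η ξ Uh Uf x L Nx NL tη tξ : A} (h1 : k*ki=1) (h2 : g*gi=1) (h3 : ω*(2+e-g)=1)
    (hs : 2*σ = k*e*(2-g)) (hx : x = η + (-ω)*ξ) (hL : L = ξ + e*x)
    (hNL : NL = (-(2*ki*W))*(x*L) + (-(2*ki))*(L*(k*L + (-σ)*x + (-W)*(x*L))))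
    (hUh : Uh = gi*(NL + (-e)*Nx)) (hUf : Uf = gi*Nx + ω*Uh) (hη : tη = η + Uf) (hξ : tξ = ((2+e)*gi)*ξ + Uh) :
    k*g*(tξ + e*(tη + (-ω)*tξ)) = FL k σ W x L := by
  have e1 : k*g*(tξ + e*(tη + (-ω)*tξ)) = k*((2+e)*ξ + e*(g*η - ω*(2+e)*ξ) + NL) := by
    rw [hη, hξ, hUf, hUh]; linear_combination (k*(NL+(2+e)*ξ - e*ω*(2+e)*ξ))*h2
  have e2 : k*NL = (-(2*W))*(x*L) + (-2)*(L*(k*L + (-σ)*x + (-W)*(x*L))) := by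
    rw [hNL]; linear_combination ((-(2*W))*(x*L) + (-2)*(L*(k*L + (-σ)*x + (-W)*(x*L))))*h1
  rw [e1, mul_add, e2, FL]
  have e3 : g*η - ω*(2+e)*ξ = (e+g)*x - L := by
    rw [hL, hx]; linear_combination (-ξ)*h3
  rw [e3]
  linear_combination x*hs - k*(2+e)*hL

theorem P1series {K : Set ℝ} {k : ℝ} (hk : 0 < k) {e g T W σ ω : ℝ → ℝ} (he : BC K e) (hg : BC K g) (hg' : BC K fun m => (g m)⁻¹) (hT : BC K T)
    (hW : BC K W) (hσ : BC K σ) (hω : BC K ω) (hm : BC K fun m => m) (hg0 : ∀ m ∈ K, 0 < g m) (hω1 : ∀ m ∈ K, ω m * (2 + e m - g m) = 1)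
    (hσ1 : ∀ m ∈ K, σ m = k * e m * (2 - g m) / 2)
    (n0 : ℕ) (hn0 : 2 ≤ n0) (κ : ℝ) (hκ : 0 ≤ κ)
    (hR : ∀ m ∈ K, ∀ n : ℕ, 2 ≤ n → n ≠ n0 → 1 ≤ κ * |(n:ℝ) - (2 + e m) * (g m)⁻¹|) (hR0 : ∀ m ∈ K, (n0:ℝ) ≠ (2 + e m) * (g m)⁻¹) :
    ∃ x L : ℝ → PowerSeries ℝ, (∀ n, ContinuousOn (fun m => coeff n (x m)) K) ∧ (∀ n, ContinuousOn (fun m => coeff n (L m)) K) ∧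
     (∀ m ∈ K, coeff 0 (x m) = 0 ∧ coeff 1 (x m) = 1 ∧ coeff 0 (L m) = 0 ∧ coeff 1 (L m) = e m ∧
      PowerSeries.C (k * g m) * Th (x m) = FX (PowerSeries.C k) (PowerSeries.C m) (PowerSeries.C (e m + g m)) (PowerSeries.C (T m)) (x m) (L m) ∧
      PowerSeries.C (k * g m) * Th (L m) = FL (PowerSeries.C k) (PowerSeries.C (σ m)) (PowerSeries.C (W m)) (x m) (L m)) ∧
     ∃ C > 1, ∀ m ∈ K, (∀ i < n0, |coeff i (x m)| ≤ C ∧ |coeff i (L m)| ≤ C) ∧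
      ∀ c, c = coeff n0 (L m) - e m * coeff n0 (x m) → ∀ r ∈ Ioc (0:ℝ) 1, ∀ ρ : ℝ, r + |c| * r^n0 ≤ ρ → C * ρ ≤ 1 →
       AS (x m) r ∧ AS (L m) r ∧ (∀ N, nrm r N (x m) ≤ 2 ∧ nrm r N (L m) ≤ 2) ∧ (∀ θ, |θ| ≤ r → |pev (x m) θ - θ + ω m * (c * θ^n0)| ≤ C * (ρ/r)^2 * θ^2 ∧
         |pev (L m) θ - e m * pev (x m) θ - c * θ^n0| ≤ C * (ρ/r)^2 * θ^2) := by
  obtain ⟨uf, hf⟩ := of_L2 (k := k) he hg hg' hT hW hσ hω hm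
  obtain ⟨uh, hh⟩ := oh_L2 (k := k) he hg hg' hT hW hσ hω hm
  have hRc : ContinuousOn (fun m => (2 + e m) * (g m)⁻¹) K := (((BC.const K 2).add he).mul hg').1
  obtain ⟨η, ξ, h1, h2, h3, C, hC1, h4⟩ := PSmain hf hh hRc n0 hn0 κ hκ hR hR0
  obtain ⟨hωc, Mω, hMω⟩ := hω
  obtain ⟨hec, Me, hMe⟩ := he
  have cx : ∀ n m, coeff n (oX ω m (η m) (ξ m)) = coeff n (η m) + (-ω m) * coeff n (ξ m) := by
    intro n m; simp only [oX, map_add, PowerSeries.coeff_C_mul]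
  have cL : ∀ n m, coeff n (oL e ω m (η m) (ξ m)) = coeff n (ξ m) + e m * coeff n (oX ω m (η m) (ξ m)) := by
    intro n m; simp only [oL, map_add, PowerSeries.coeff_C_mul]
  have cxc : ∀ n, ContinuousOn (fun m => coeff n (oX ω m (η m) (ξ m))) K := by
    intro n; simp only [cx]; exact (h1 n).add (hωc.neg.mul (h2 n))
  refine ⟨fun m => oX ω m (η m) (ξ m), fun m => oL e ω m (η m) (ξ m), cxc, ?_, ?_, ?_⟩
  · intro n; simp only [cL]; exact (h2 n).add (hec.mul (cxc n))
  · intro m hm'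
    obtain ⟨a1, a2, a3, a4, a5, a6⟩ := h3 m hm'
    have k1 : PowerSeries.C k * PowerSeries.C k⁻¹ = 1 := by rw [← map_mul, mul_inv_cancel₀ hk.ne', map_one]
    have k2 : PowerSeries.C (g m) * PowerSeries.C (g m)⁻¹ = 1 := by rw [← map_mul, mul_inv_cancel₀ (hg0 m hm').ne', map_one]
    have k3 : PowerSeries.C (ω m) * (2 + PowerSeries.C (e m) - PowerSeries.C (g m)) = 1 := by
      rw [← map_one PowerSeries.C, ← hω1 m hm']; simp only [map_mul, map_sub, map_add, map_ofNat]
    have k4 : 2 * PowerSeries.C (σ m) = PowerSeries.C k * PowerSeries.C (e m) * (2 - PowerSeries.C (g m)) := by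
      have : 2 * σ m = k * e m * (2 - g m) := by rw [hσ1 m hm']; ring
      have := congrArg (PowerSeries.C (R := ℝ)) this
      simpa only [map_mul, map_sub, map_ofNat] using this
    refine ⟨?_, ?_, ?_, ?_, ?_, ?_⟩
    · rw [cx, a1, a3]; ring
    · rw [cx, a2, a4]; ring
    · rw [cL, cx, a1, a3]; ring
    · rw [cL, cx, a2, a4]; ring
    · have t : Th (oX ω m (η m) (ξ m)) = Th (η m) + (-PowerSeries.C (ω m)) * Th (ξ m) := by
        rw [oX, Th_add, Th_C_mul, map_neg]
      rw [t, map_mul, map_add]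
      refine ring_x (ξ := ξ m) (Uh := oh k e g T W σ ω m (η m) (ξ m)) (ki := PowerSeries.C k⁻¹) (gi := PowerSeries.C (g m)⁻¹) (Nx := oNx k e g T ω m (η m) (ξ m)) k1 k2 k3 ?_ ?_ ?_ ?_ a5 ?_
      rotate_right
      · rw [a6, map_mul, map_add, map_ofNat]
      · show oX ω m (η m) (ξ m) = _; rw [oX, map_neg]
      · show oL e ω m (η m) (ξ m) = _; rw [oL]
      · simp only [oNx, map_mul, map_sub, map_add, map_ofNat, map_one, map_neg]
      · rw [of]
    · have t : Th (oL e ω m (η m) (ξ m)) = Th (ξ m) + PowerSeries.C (e m) * (Th (η m) + (-PowerSeries.C (ω m)) * Th (ξ m)) := by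
        rw [oL, oX, Th_add, Th_C_mul, Th_add, Th_C_mul, map_neg]
      rw [t, map_mul]
      refine ring_L (ξ := ξ m) (Uh := oh k e g T W σ ω m (η m) (ξ m)) (ki := PowerSeries.C k⁻¹) (gi := PowerSeries.C (g m)⁻¹) (Nx := oNx k e g T ω m (η m) (ξ m)) (NL := oNL k e W σ ω m (η m) (ξ m)) k1 k2 k3 k4 ?_ ?_ ?_ ?_ ?_ a5 ?_
      rotate_right
      · rw [a6, map_mul, map_add, map_ofNat]
      · show oX ω m (η m) (ξ m) = _; rw [oX, map_neg]
      · show oL e ω m (η m) (ξ m) = _; rw [oL]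
      · simp only [oNL, map_mul, map_sub, map_add, map_ofNat, map_one, map_neg]
      · rw [oh, map_neg]
      · rw [of]
  · have hK : ∃ D, 1 ≤ D ∧ ∀ m ∈ K, |ω m| ≤ D ∧ |e m| ≤ D :=
      ⟨max 1 (max Mω Me), le_max_left _ _, fun m hm' => ⟨(hMω m hm').trans ((le_max_left _ _).trans (le_max_right _ _)), (hMe m hm').trans ((le_max_right _ _).trans (le_max_right _ _))⟩⟩
    obtain ⟨D, hD, hDm⟩ := hK
    refine ⟨C * (1+D)^2, ?_, ?_⟩
    · nlinarith
    intro m hm'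
    obtain ⟨hω', he'⟩ := hDm m hm'
    obtain ⟨b1, b2⟩ := h4 m hm'
    have bx : ∀ i < n0, |coeff i (oX ω m (η m) (ξ m))| ≤ C * (1+D) := by
      intro i hi
      obtain ⟨c1, c2⟩ := b1 i hi
      rw [cx]
      calc _ ≤ |coeff i (η m)| + |(-ω m) * coeff i (ξ m)| := abs_add_le _ _
        _ ≤ C + D * C := by rw [abs_mul, abs_neg]; gcongr
        _ = _ := by ring
    refine ⟨fun i hi => ⟨(bx i hi).trans ?_, ?_⟩, ?_⟩
    · have : 0 ≤ C * (1+D) * D := by positivity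
      nlinarith
    · rw [cL]
      calc _ ≤ |coeff i (ξ m)| + |e m * coeff i (oX ω m (η m) (ξ m))| := abs_add_le _ _
        _ ≤ C + D * (C * (1+D)) := by
          rw [abs_mul]
          exact add_le_add (b1 i hi).2 (mul_le_mul he' (bx i hi) (abs_nonneg _) (by linarith))
        _ ≤ _ := by nlinarith [mul_pos (by linarith : 0 < C) (by linarith : 0 < D)]
    · intro c hc r hr ρ hρ hCρ
      have hc' : c = coeff n0 (ξ m) := by rw [hc, cL]; ring
      have hρ0 : 0 < ρ := by
        have : 0 ≤ |c| * r^n0 := by have := hr.1; positivity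
        linarith [hr.1]
      rw [hc'] at hρ
      have hC' : C ≤ C * (1+D)^2 := by nlinarith [mul_pos (by linarith : 0 < C) (by linarith : 0 < D), mul_pos (mul_pos (by linarith : 0 < C) (by linarith : 0 < D)) (by linarith : 0 < D)]
      have h5 := b2 r hr ρ hρ (by nlinarith)
      have Aη : AS (η m) r := AS_of_nrm hr.1.le fun N => (le_add_of_nonneg_right (nrm_nonneg hr.1.le N _)).trans (h5 N).1
      have Aξ : AS (ξ m) r := AS_of_nrm hr.1.le fun N => (le_add_of_nonneg_left (nrm_nonneg hr.1.le N _)).trans (h5 N).1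
      have Ax : AS (oX ω m (η m) (ξ m)) r := Aη.add (AS.C_mul _ Aξ) hr.1.le
      have AL : AS (oL e ω m (η m) (ξ m)) r := Aξ.add (AS.C_mul _ Ax) hr.1.le
      obtain ⟨a1, a2, a3, a4, -, -⟩ := h3 m hm'
      refine ⟨Ax, AL, fun N => ?_, fun θ hθ => ?_⟩
      · have n1 := (h5 N).1
        have n2 := nrm_nonneg hr.1.le N (η m)
        have n3 := nrm_nonneg hr.1.le N (ξ m)
        have n4 : nrm r N (oX ω m (η m) (ξ m)) ≤ 2 * ρ * (1 + D) := by
          refine (nrm_add hr.1.le _ _ _).trans ?_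
          rw [nrm_C_mul, abs_neg]
          have := mul_le_mul_of_nonneg_right hω' n3
          nlinarith
        have n5 : nrm r N (oL e ω m (η m) (ξ m)) ≤ 2 * ρ + D * (2 * ρ * (1 + D)) := by
          refine (nrm_add hr.1.le _ _ _).trans ?_
          rw [nrm_C_mul]
          have := mul_le_mul he' n4 (nrm_nonneg hr.1.le _ _) (by linarith)
          linarith
        have n6 : (1 + D)^2 * ρ ≤ 1 := by
          have : 1 * ((1 + D)^2 * ρ) ≤ C * ((1 + D)^2 * ρ) := mul_le_mul_of_nonneg_right hC1.le (by positivity)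
          linarith
        constructor
        · nlinarith [mul_pos hρ0 (by linarith : 0 < D), mul_pos (mul_pos hρ0 (by linarith : 0 < D)) (by linarith : 0 < D)]
        · nlinarith [mul_pos hρ0 (by linarith : 0 < D), mul_pos (mul_pos hρ0 (by linarith : 0 < D)) (by linarith : 0 < D)]
      have AX : AS (PowerSeries.X) r := by
        have : AS (PowerSeries.monomial 1 1) r := AS_of_nrm hr.1.le (nrm_monomial hr.1.le · 1 1)
        exact this
      have pm : ∀ n (c:ℝ), pev (PowerSeries.monomial n c) θ = c * θ^n := by
        intro n c
        unfold pev
        rw [tsum_eq_single n]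
        · rw [PowerSeries.coeff_monomial_same]
        · intro j hj; rw [PowerSeries.coeff_monomial, if_neg hj, zero_mul]
      have AM : AS (PowerSeries.monomial n0 (coeff n0 (ξ m))) r := AS_of_nrm hr.1.le (nrm_monomial hr.1.le · _ _)
      have q1 := pev_quad hr.1 (fun N => (h5 N).2.1) (by rw [map_sub, a1]; simp) (by rw [map_sub, a2]; simp) hθ
      have q2 := pev_quad hr.1 (fun N => (h5 N).2.2) (by rw [map_sub, a3, PowerSeries.coeff_monomial, if_neg (by lia)]; simp)
        (by rw [map_sub, a4, PowerSeries.coeff_monomial, if_neg (by lia)]; simp) hθ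
      rw [pev_sub Aη AX hθ] at q1
      rw [pev_sub Aξ AM hθ, pm] at q2
      have pX : pev PowerSeries.X θ = θ := by
        have := pm 1 1; rw [pow_one, one_mul] at this; exact this
      rw [pX] at q1
      have px : pev (oX ω m (η m) (ξ m)) θ = pev (η m) θ + (-ω m) * pev (ξ m) θ := by
        rw [oX, pev_add Aη (AS.C_mul _ Aξ) hθ, pev_C_mul]
      have pL : pev (oL e ω m (η m) (ξ m)) θ = pev (ξ m) θ + e m * pev (oX ω m (η m) (ξ m)) θ := by
        rw [oL, pev_add Aξ (AS.C_mul _ Ax) hθ, pev_C_mul]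
      rw [← hc'] at q2
      have e0 : C * ρ^2 / r^2 * θ^2 = C * (ρ/r)^2 * θ^2 := by rw [div_pow]; ring
      rw [e0] at q1 q2
      have e1 : 0 ≤ (ρ/r)^2 * θ^2 := by positivity
      constructor
      · rw [px]
        calc _ = |(pev (η m) θ - θ) + (-ω m) * (pev (ξ m) θ - c * θ^n0)| := by congr 1; ring
          _ ≤ C * (ρ/r)^2 * θ^2 + D * (C * (ρ/r)^2 * θ^2) := by
            refine (abs_add_le _ _).trans (add_le_add q1 ?_)
            rw [abs_mul, abs_neg]
            exact mul_le_mul hω' q2 (abs_nonneg _) (by linarith)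
          _ = (C*(1+D)) * ((ρ/r)^2 * θ^2) := by ring
          _ ≤ (C*(1+D)^2) * ((ρ/r)^2 * θ^2) := by
            refine mul_le_mul_of_nonneg_right ?_ e1
            have : 0 ≤ C * (1+D) * D := by positivity
            nlinarith
          _ = _ := by ring
      · rw [pL]
        calc _ = |pev (ξ m) θ - c * θ^n0| := by congr 1; ring
          _ ≤ _ := q2
          _ = C * ((ρ/r)^2 * θ^2) := by ring
          _ ≤ (C*(1+D)^2) * ((ρ/r)^2 * θ^2) := mul_le_mul_of_nonneg_right hC' e1
          _ = _ := by ring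

section GI
variable {A : Type*} [CommRing A]
def GG (e ρ p x L : A) : A := L*(1-ρ*x) - x*(e+p*x)
def KK (k g m e T W ρ p x L : A) : A :=
  (1-ρ*x)*((2*k+(k*e*(2-g)-2*W)*x)*(1-ρ*x) - (k-m*x)*(-1+(1+T)*x-T*x^2)*(e+2*p*x) - ρ*((k-m*x)*((e+g)*x+T*x^2)))
  + (-2*(k-W*x)*(1-ρ*x) - ρ*((k-m*x)*(-1+(1+T)*x-T*x^2)))*(GG e ρ p x L+2*(x*(e+p*x)))
def Q1 (k g m e T W ρ p : A) : A := e*k*(-ρ*(e+g)+T-p+(1+T)*e) + (2*p*k-e*m)*g - ((2*k*p+k*e*(2-g)*ρ-2*W*e) - (2*ρ+e)*(k*e*g))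
def Q2 (k g m e T W ρ p : A) : A := e*k*(-ρ*T+(1+T)*p-T*e) + (2*p*k-e*m)*(-ρ*(e+g)+T-p+(1+T)*e) + (-ρ*p*k-2*p*m)*g
  - (-2*W*p - (2*ρ+e)*(2*k*p+k*e*(2-g)*ρ-2*W*e) + (ρ^2+ρ*e-p)*(k*e*g))
def Q3 (k g m e T W ρ p : A) : A := e*k*(-T*p)+(2*p*k-e*m)*(-ρ*T+(1+T)*p-T*e)+(-ρ*p*k-2*p*m)*(-ρ*(e+g)+T-p+(1+T)*e)+ρ*p*m*g
  - (-(2*ρ+e)*(-2*W*p)+(ρ^2+ρ*e-p)*(2*k*p+k*e*(2-g)*ρ-2*W*e)+ρ*p*(k*e*g))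
def Q4 (k g m e T W ρ p : A) : A := (2*p*k-e*m)*(-T*p)+(-ρ*p*k-2*p*m)*(-ρ*T+(1+T)*p-T*e)+ρ*p*m*(-ρ*(e+g)+T-p+(1+T)*e)
  - ((ρ^2+ρ*e-p)*(-2*W*p)+ρ*p*(2*k*p+k*e*(2-g)*ρ-2*W*e))
def Q5 (k m e T W ρ p : A) : A := (-ρ*p*k-2*p*m)*(-T*p)+ρ*p*m*(-ρ*T+(1+T)*p-T*e)-ρ*p*(-2*W*p)
def Q6 (m T ρ p : A) : A := ρ*p*m*(-T*p)

lemma G_ident (k g m e T W σ ρ p x L : A) (hσ : 2*σ = k*e*(2-g)) :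
    (1-ρ*x)^2*(FL k σ W x L*(1-ρ*x) - FX k m (e+g) T x L*(ρ*L+e+2*p*x)) =
     -(x*(Q1 k g m e T W ρ p*x+Q2 k g m e T W ρ p*x^2+Q3 k g m e T W ρ p*x^3+Q4 k g m e T W ρ p*x^4+Q5 k m e T W ρ p*x^5+Q6 m T ρ p*x^6))
      + GG e ρ p x L * KK k g m e T W ρ p x L := by
  unfold FL FX GG KK Q1 Q2 Q3 Q4 Q5 Q6 GG
  linear_combination (-(1-ρ*x)^3*(1-L)*x)*hσ
end GI

section GR
variable {k q e g m T W a B ρ p : ℝ}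
lemma Q1_zero (ha : k*(2+e-2*g)*a = 2*W+k*e*g-m*g+k*(T+(1+T)*e)) (hp : p = e*(a-ρ)) : Q1 k g m e T W ρ p = 0 := by
  rw [hp]; unfold Q1; linear_combination (-e)*ha
lemma Q2_zero (ha : k*(2+e-2*g)*a = 2*W+k*e*g-m*g+k*(T+(1+T)*e)) (hp : p = e*(a-ρ))
   (hr : a*(ρ*k*(2+e-3*g)) = (k*e*(1+T)+2*k*(T+(1+T)*e)+m*e-2*m*g+2*W+2*k*e+k*e*g)*a - 2*k*e*a*a - (k*e*T+m*(T+(1+T)*e)+2*e*W)) :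
    Q2 k g m e T W ρ p = 0 := by
  rw [hp]; unfold Q2; linear_combination (-e)*hr + (3*ρ*e)*ha
lemma Q3_eq (ha0 : a ≠ 0) (ha : k*(2+e-2*g)*a = 2*W+k*e*g-m*g+k*(T+(1+T)*e)) (hp : p = e*(a-ρ))
   (hr : a*(ρ*k*(2+e-3*g)) = (k*e*(1+T)+2*k*(T+(1+T)*e)+m*e-2*m*g+2*W+2*k*e+k*e*g)*a - 2*k*e*a*a - (k*e*T+m*(T+(1+T)*e)+2*e*W)) :
    Q3 k g m e T W ρ p = e*a*(k*(4*g-2-e)*ρ^2+(e*k*(6+4*T-5*a+g)+e*m+3*k*T-3*m*g+2*W)*ρ+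
      (-e*k*T+e*(2*k-m/a)*((1+T)*a-T)-2*m*(T+(1+T)*e-e*a)-4*e*W+2*e*k*a)) := by
  have h : a*(m/a) = m := by field_simp
  rw [hp]; unfold Q3; linear_combination (3*ρ*e)*hr - (3*ρ^2*e)*ha + (e*e*((1+T)*a-T))*h

noncomputable def rh (k q e g : ℝ) : ℝ := cB k q e g/(k*(2+e-3*g))
noncomputable def pp (k q e g : ℝ) : ℝ := e*(ca k q e g - rh k q e g)

lemma H_pos (k e g W a ρ : ℝ) (hk : 0 < k) (hg : 1/2 ≤ g) (hg2 : g < 2) (hW : 0 < W) (ha : 0 < a) (hρ : 3*a < ρ*(1+g)) (hY : a*k*(1-g/2) ≤ 3*W*(1+g))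
    (t : ℝ) (ht : 0 ≤ t) : 0 < k*g/2 + t*(k*g*ρ/2+W-a*k)+W*(ρ-a)*t^2 := by
  obtain ⟨Y, hYd⟩ : ∃ Y, Y*(1+g) = a*k*(1-g/2) := ⟨a*k*(1-g/2)/(1+g), by field_simp⟩
  have hY0 : 0 < Y := by
    by_contra h
    have : Y*(1+g) ≤ 0 := mul_nonpos_of_nonpos_of_nonneg (by linarith) (by linarith)
    have : 0 < a*k*(1-g/2) := by apply mul_pos (by positivity); linarith
    linarith
  have hY3 : Y ≤ 3*W := by
    by_contra h
    have : 3*W*(1+g) < Y*(1+g) := mul_lt_mul_of_pos_right (by linarith) (by linarith)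
    linarith
  have hb : W - Y ≤ k*g*ρ/2+W-a*k := by
    have : 0 ≤ (k*g*ρ/2+Y-a*k)*(1+g) := by
      have : (k*g*ρ/2+Y-a*k)*(1+g) = k*g/2*(ρ*(1+g)-3*a) := by linear_combination hYd
      rw [this]; apply mul_nonneg (by positivity) (by linarith)
    have := nonneg_of_mul_nonneg_left this (by linarith)
    linarith
  have hc : 2*W*Y/k ≤ W*(ρ-a) := by
    rw [div_le_iff₀ hk]
    have : 0 ≤ ((ρ-a)*k - 2*Y)*(1+g) := by
      have : ((ρ-a)*k-2*Y)*(1+g) = k*(ρ*(1+g)-3*a) := by linear_combination (-2)*hYd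
      rw [this]; apply mul_nonneg (by positivity) (by linarith)
    have := nonneg_of_mul_nonneg_left this (by linarith)
    nlinarith
  have h1 : k*g/2 + t*(W-Y)+2*W*Y/k*t^2 ≤ k*g/2 + t*(k*g*ρ/2+W-a*k)+W*(ρ-a)*t^2 := by gcongr
  refine lt_of_lt_of_le ?_ h1
  obtain ⟨s, rfl⟩ : ∃ s, t = k*s := ⟨t/k, by field_simp⟩
  have hs : 0 ≤ s := by by_contra h; nlinarith
  have h2 : k*g/2 + k*s*(W-Y)+2*W*Y/k*(k*s)^2 = k*(g/2 + s*(W-Y)+2*W*Y*s^2) := by field_simp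
  rw [h2]
  apply mul_pos hk
  have hWY := mul_pos hW hY0
  rcases le_total Y W with h | h
  · have : 0 ≤ s*(W-Y) := mul_nonneg hs (by linarith)
    have : 0 ≤ 2*W*Y*s^2 := by positivity
    linarith
  · have h4 : (Y-W)^2 < 2*(W*Y) := by nlinarith
    have h3 : 0 < (8*(W*Y))*(g/2 + s*(W-Y)+2*W*Y*s^2) := by
      have : (8*(W*Y))*(g/2 + s*(W-Y)+2*W*Y*s^2) = (4*(W*Y)*s-(Y-W))^2 + (4*g*(W*Y)-(Y-W)^2) := by ring
      rw [this]; nlinarith [sq_nonneg (4*(W*Y)*s-(Y-W))]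
    exact pos_of_mul_pos_right h3 (by positivity)

set_option maxHeartbeats 1000000 in
theorem Qsigns {k q e g m T W ρ p : ℝ} (hI : Ineq k q e g) (hk : 0 < k) (he : 0 < e) (h3 : 3*g < 2+e) (h4 : 2+e ≤ 4*g) (hT : 0 ≤ T) (hq0 : 0 ≤ q) (hq : q < k)
    (heg : e+g ≤ 2) (hm' : m = k-q) (hT' : T = q-e-g) (hW' : W = m+q*T) (hρ' : ρ = rh k q e g) (hp' : p = pp k q e g) :
    0 < ca k q e g ∧ 0 < cB k q e g ∧ 0 < ρ ∧ p < 0 ∧ p = e*(ca k q e g - ρ) ∧ Q1 k g m e T W ρ p = 0 ∧ Q2 k g m e T W ρ p = 0 ∧ 0 < Q3 k g m e T W ρ p ∧ Q4 k g m e T W ρ p ≤ 0 ∧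
     0 ≤ Q5 k m e T W ρ p ∧ Q6 m T ρ p ≤ 0 ∧ ∀ x ≤ 0, 0 < k*e*g/2 + (k*p+k*e*(2-g)/2*ρ-W*e)*x - W*p*x^2 := by
  obtain ⟨ha, hB, i1, i2, i3⟩ := hI
  have hu : 0 < 2+e-3*g := by linarith
  have hg : 1/2 ≤ g := by linarith
  have hg1 : g ≤ 1 := by linarith
  have hm : 0 < m := by linarith
  have hW : m ≤ W := by rw [hW']; nlinarith
  have hW0 : 0 < W := by linarith
  have hd : 0 < 2+e-2*g := by linarith
  have hρB : ρ*(k*(2+e-3*g)) = cB k q e g := by rw [hρ', rh]; field_simp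
  have hae : k*(2+e-2*g)*ca k q e g = 2*W+k*e*g-m*g+k*(T+(1+T)*e) := by
    rw [ca, hW', hm', hT']; field_simp
  have hBe : cB k q e g = (k*e*(1+T)+2*k*(T+(1+T)*e)+m*e-2*m*g+2*W+2*k*e+k*e*g) - 2*k*e*ca k q e g - (k*e*T+m*(T+(1+T)*e)+2*e*W)/ca k q e g := by
    rw [hW', hm', hT', cB]
  have hC1 : cC1 k q e g = e*k*(6+4*T-5*ca k q e g+g)+e*m+3*k*T-3*m*g+2*W := by rw [hW', hm', hT', cC1]
  have hC0 : cC0 k q e g = -e*k*T+e*(2*k-m/ca k q e g)*((1+T)*ca k q e g-T)-2*m*(T+(1+T)*e-e*ca k q e g)-4*e*W+2*e*k*ca k q e g := by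
    rw [hW', hm', hT', cC0]
  have i2' : ca k q e g*k*(1-g/2) ≤ 3*W*(1+g) := by rw [hW', hm', hT']; exact i2
  have hp2 : p = e*(ca k q e g - ρ) := by rw [hp', pp, hρ']
  rw [hC1, hC0] at i3
  clear hC1 hC0 hp' hρ' hm' hT' i2
  generalize ca k q e g = a at *
  generalize cB k q e g = B at *
  have hρ : 0 < ρ := by
    have : 0 < ρ*(k*(2+e-3*g)) := by rw [hρB]; exact hB
    exact pos_of_mul_pos_left this (by positivity)
  have hr : a*(ρ*k*(2+e-3*g)) = (k*e*(1+T)+2*k*(T+(1+T)*e)+m*e-2*m*g+2*W+2*k*e+k*e*g)*a - 2*k*e*a*a - (k*e*T+m*(T+(1+T)*e)+2*e*W) := by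
    rw [show a*(ρ*k*(2+e-3*g)) = a*(ρ*(k*(2+e-3*g))) by ring, hρB, hBe]; field_simp
  have h3a : 3*a < ρ*(1+g) := by
    by_contra h
    have : ρ*(1+g)*(k*(2+e-3*g)) ≤ 3*a*(k*(2+e-3*g)) := mul_le_mul_of_nonneg_right (by linarith) (by positivity)
    have : ρ*(1+g)*(k*(2+e-3*g)) = B*(1+g) := by rw [← hρB]; ring
    linarith
  have hδ : a < ρ := by
    have : ρ*(1+g) ≤ ρ*2 := mul_le_mul_of_nonneg_left (by linarith only [hg1]) hρ.le
    linarith only [this, h3a, ha]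
  have hpn : p < 0 := by rw [hp2]; exact mul_neg_of_pos_of_neg he (by linarith only [hδ])
  refine ⟨ha, hB, hρ, hpn, hp2, Q1_zero hae hp2, Q2_zero hae hp2 hr, ?_, ?_, ?_, ?_, ?_⟩
  · rw [Q3_eq ha.ne' hae hp2 hr]
    apply mul_pos (by positivity)
    generalize e*k*(6+4*T-5*a+g)+e*m+3*k*T-3*m*g+2*W = c1 at *
    generalize -e*k*T+e*(2*k-m/a)*((1+T)*a-T)-2*m*(T+(1+T)*e-e*a)-4*e*W+2*e*k*a = c0 at *
    have : (4*g-2-e)*B^2+c1*B*(2+e-3*g)+c0*k*(2+e-3*g)^2 = (k*(2+e-3*g)^2)*(k*(4*g-2-e)*ρ^2+c1*ρ+c0) := by rw [← hρB]; ring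
    rw [this] at i3
    exact pos_of_mul_pos_right i3 (by positivity)
  · have : Q4 k g m e T W ρ p = (-p)*(ρ^2*(m*(e+g)-2*W) - ρ*m*T-ρ*m*e*(ρ-a)-ρ*m*(1+T)*e-(2*m)*(ρ*T+(1+T)*e*(ρ-a)+T*e)-ρ*k*(ρ*T+T*e*(ρ-a)+T*e)-T*(2*k*e*(ρ-a)+e*m)
        +k*e*ρ*(3*a-ρ*(1+g))-2*W*(2*ρ*e+e*(ρ-a))) := by
      rw [hp2]; unfold Q4; ring
    rw [this]
    apply mul_nonpos_of_nonneg_of_nonpos (by linarith)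
    have d0 : 0 ≤ ρ-a := by linarith
    have t1 : 0 ≤ ρ^2*(2*W-m*(e+g)) := mul_nonneg (by positivity) (by
      have : m*(e+g) ≤ m*2 := mul_le_mul_of_nonneg_left heg hm.le
      linarith only [this, hW])
    have t2 : 0 ≤ k*e*ρ*(ρ*(1+g)-3*a) := mul_nonneg (by positivity) (by linarith)
    have t3 : 0 ≤ ρ*m*T+ρ*m*e*(ρ-a)+ρ*m*(1+T)*e+(2*m)*(ρ*T+(1+T)*e*(ρ-a)+T*e)+ρ*k*(ρ*T+T*e*(ρ-a)+T*e)+T*(2*k*e*(ρ-a)+e*m)+2*W*(2*ρ*e+e*(ρ-a)) := by positivity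
    linarith
  · have : Q5 k m e T W ρ p = T*p^2*(ρ*k+2*m)+ρ*m*((-p)*(ρ*T+T*e)+(1+T)*p^2)+2*ρ*W*p^2 := by unfold Q5; ring
    rw [this]
    have : 0 ≤ -p := by linarith
    positivity
  · have : Q6 m T ρ p = -(ρ*m*T*p^2) := by unfold Q6; ring
    rw [this]
    have : 0 ≤ ρ*m*T*p^2 := by positivity
    linarith
  · intro x hx
    have := H_pos k e g W a ρ hk hg (by linarith) hW0 ha h3a i2' (-x) (by linarith)
    have e1 : k*e*g/2 + (k*p+k*e*(2-g)/2*ρ-W*e)*x - W*p*x^2 = e*(k*g/2 + (-x)*(k*g*ρ/2+W-a*k)+W*(ρ-a)*(-x)^2) := by rw [hp2]; ring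
    rw [e1]; positivity
end GR

lemma coeff_low {n : ℕ} {p : PowerSeries ℝ} (h : ∀ i < n, coeff i p = 0) (q : PowerSeries ℝ) :
    (∀ i < n, coeff i (p*q) = 0) ∧ coeff n (p*q) = coeff n p * coeff 0 q := by
  constructor
  · intro i hi
    rw [PowerSeries.coeff_mul]
    refine Finset.sum_eq_zero fun x hx => ?_
    have := Finset.HasAntidiagonal.mem_antidiagonal.1 hx
    rw [h x.1 (by lia), zero_mul]
  · rw [PowerSeries.coeff_mul]
    refine Finset.sum_eq_single_of_mem (n, 0) (by simp) ?_
    rintro ⟨i, j⟩ hx hne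
    have hx' : i + j = n := Finset.HasAntidiagonal.mem_antidiagonal.1 hx
    have : i < n := by
      by_contra hi
      apply hne
      have : i = n := by lia
      have : j = 0 := by lia
      simp [*]
    simp only
    rw [h i this, zero_mul]

lemma coeff_mul2 (p q : PowerSeries ℝ) : coeff 2 (p*q) = coeff 0 p * coeff 2 q + coeff 1 p * coeff 1 q + coeff 2 p * coeff 0 q := by
  rw [PowerSeries.coeff_mul, Finset.Nat.sum_antidiagonal_eq_sum_range_succ_mk]; simp [Finset.sum_range_succ]
lemma coeff_mul1 (p q : PowerSeries ℝ) : coeff 1 (p*q) = coeff 0 p * coeff 1 q + coeff 1 p * coeff 0 q := by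
  rw [PowerSeries.coeff_mul, Finset.Nat.sum_antidiagonal_eq_sum_range_succ_mk]; simp [Finset.sum_range_succ]
lemma coeff_mul0 (p q : PowerSeries ℝ) : coeff 0 (p*q) = coeff 0 p * coeff 0 q := by
  rw [PowerSeries.coeff_mul, Finset.Nat.sum_antidiagonal_eq_sum_range_succ_mk]; simp
lemma coeff_mul3 (p q : PowerSeries ℝ) : coeff 3 (p*q) = coeff 0 p * coeff 3 q + coeff 1 p * coeff 2 q + coeff 2 p * coeff 1 q
    + coeff 3 p * coeff 0 q := by
  rw [PowerSeries.coeff_mul, Finset.Nat.sum_antidiagonal_eq_sum_range_succ_mk]; simp [Finset.sum_range_succ]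
lemma coeff_mul4 (p q : PowerSeries ℝ) : coeff 4 (p*q) = coeff 0 p * coeff 4 q + coeff 1 p * coeff 3 q + coeff 2 p * coeff 2 q
    + coeff 3 p * coeff 1 q + coeff 4 p * coeff 0 q := by
  rw [PowerSeries.coeff_mul, Finset.Nat.sum_antidiagonal_eq_sum_range_succ_mk]; simp [Finset.sum_range_succ]

lemma coeff_pow4 {x : PowerSeries ℝ} (h0 : coeff 0 x = 0) (h1 : coeff 1 x = 1) :
    (∀ i < 4, coeff i (x^4) = 0) ∧ coeff 4 (x^4) = 1 := by
  have e : x^4 = (x*x)*(x*x) := by ring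
  have a0 : coeff 0 (x*x) = 0 := by rw [coeff_mul0, h0]; ring
  have a1 : coeff 1 (x*x) = 0 := by rw [coeff_mul1, h0]; ring
  have a2 : coeff 2 (x*x) = 1 := by rw [coeff_mul2, h0, h1]; ring
  rw [e]
  constructor
  · intro i hi
    interval_cases i
    · rw [coeff_mul0, a0]; ring
    · rw [coeff_mul1, a0, a1]; ring
    · rw [coeff_mul2, a0, a1]; ring
    · rw [coeff_mul3, a0, a1]; ring
  · rw [coeff_mul4, a0, a1, a2]; ring

open PowerSeries in
theorem G_series {k g m e T W σ ρ p : ℝ} (hσ : 2*σ = k*e*(2-g)) {x L : PowerSeries ℝ} (x0 : coeff 0 x = 0) (x1 : coeff 1 x = 1)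
    (l0 : coeff 0 L = 0) (l1 : coeff 1 L = e) (hx : C (k*g) * Th x = FX (C k) (C m) (C (e+g)) (C T) x L)
    (hL : C (k*g) * Th L = FL (C k) (C σ) (C W) x L) (q1 : Q1 k g m e T W ρ p = 0) (q2 : Q2 k g m e T W ρ p = 0)
    (r2 : k*g*2 ≠ k*(2+e)) (r3 : k*g*3 ≠ k*(2+e)) :
    (∀ i < 4, coeff i (GG (C e) (C ρ) (C p) x L) = 0) ∧ (k*g*4 - k*(2+e)) * coeff 4 (GG (C e) (C ρ) (C p) x L) = - Q3 k g m e T W ρ p := by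
  have hσ' : 2 * C σ = C k * C e * (2 - C g) := by
    have := congrArg (C (R := ℝ)) hσ
    simpa only [map_mul, map_sub, map_ofNat] using this
  have id := G_ident (C k) (C g) (C m) (C e) (C T) (C W) (C σ) (C ρ) (C p) x L hσ'
  have hQ1 : Q1 (C k) (C g) (C m) (C e) (C T) (C W) (C ρ) (C p) = (0 : PowerSeries ℝ) := by
    have := congrArg (C (R := ℝ)) q1
    simpa only [Q1, map_mul, map_sub, map_ofNat, map_add, map_neg, map_one, map_pow, map_zero] using this
  have hQ2 : Q2 (C k) (C g) (C m) (C e) (C T) (C W) (C ρ) (C p) = (0 : PowerSeries ℝ) := by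
    have := congrArg (C (R := ℝ)) q2
    simpa only [Q2, map_mul, map_sub, map_ofNat, map_add, map_neg, map_one, map_pow, map_zero] using this
  have hQ3 : Q3 (C k) (C g) (C m) (C e) (C T) (C W) (C ρ) (C p) = C (Q3 k g m e T W ρ p) := by
    simp only [Q3, map_mul, map_sub, map_ofNat, map_add, map_neg, map_one, map_pow]
  rw [hQ1, hQ2, hQ3] at id
  have hTh : C (k*g) * Th (GG (C e) (C ρ) (C p) x L) = FL (C k) (C σ) (C W) x L*(1-C ρ*x) - FX (C k) (C m) (C e+C g) (C T) x L*(C ρ*L+C e+2*C p*x) := by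
    rw [← map_add, ← hx, ← hL, GG]
    have t1 : Th (1 - C ρ * x) = - C ρ * Th x := by
      rw [Th_sub, Th_C_mul, ← map_one (C (R := ℝ)), Th_C]; ring
    rw [Th_sub, Th_mul, t1, Th_mul, Th_add, Th_C_mul, Th_C]; ring
  rw [← hTh] at id
  set G := GG (C e) (C ρ) (C p) x L with hG
  set KK' := KK (C k) (C g) (C m) (C e) (C T) (C W) (C ρ) (C p) x L with hK
  set S := C (Q3 k g m e T W ρ p) + Q4 (C k) (C g) (C m) (C e) (C T) (C W) (C ρ) (C p) * x + Q5 (C k) (C m) (C e) (C T) (C W) (C ρ) (C p) * x^2 + Q6 (C m) (C T) (C ρ) (C p)*x^3 with hS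
  have id2 : (C (k*g) * Th G) * (1-C ρ*x)^2 = -(x^4*S) + G * KK' := by rw [hS]; linear_combination id
  have x0' : constantCoeff x = 0 := by simpa using x0
  have l0' : constantCoeff L = 0 := by simpa using l0
  have S0 : coeff 0 S = Q3 k g m e T W ρ p := by
    rw [hS, coeff_zero_eq_constantCoeff_apply]; simp [x0']
  have D0 : coeff 0 ((1-C ρ*x)^2) = 1 := by
    rw [coeff_zero_eq_constantCoeff_apply]; simp [x0']
  have K0 : coeff 0 KK' = k*(2+e) := by
    rw [hK, coeff_zero_eq_constantCoeff_apply, KK, GG]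
    simp [x0', l0']; rw [show constantCoeff (2 : PowerSeries ℝ) = 2 from map_ofNat _ 2]; ring
  have px := coeff_pow4 x0 x1
  have step : ∀ n ≤ 4, (∀ i < n, coeff i G = 0) → (k*g*n - k*(2+e))*coeff n G = - (coeff n (x^4) * Q3 k g m e T W ρ p) := by
    intro n hn h
    have h' : ∀ i < n, coeff i (C (k*g) * Th G) = 0 := by
      intro i hi; rw [coeff_C_mul, coeff_Th, h i hi]; ring
    have a1 := (coeff_low h' ((1-C ρ*x)^2)).2
    have a2 := (coeff_low h KK').2
    have a3 := (coeff_low (n := n) (p := x^4) (fun i hi => px.1 i (by lia)) S).2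
    rw [id2, map_add, map_neg, a2, a3, D0, K0, S0, coeff_C_mul, coeff_Th] at a1
    linear_combination -a1
  have g0 : coeff 0 G = 0 := by
    rw [hG, GG, map_sub, coeff_mul0, coeff_mul0, x0, l0]; ring
  have g1 : coeff 1 G = 0 := by
    rw [hG, GG, map_sub, coeff_mul1, coeff_mul1, x0, l0, x1, l1, coeff_zero_eq_constantCoeff_apply, coeff_zero_eq_constantCoeff_apply]; simp [x0']
  have g2 : coeff 2 G = 0 := by
    have := step 2 (by lia) (by intro i hi; interval_cases i <;> assumption)
    rw [px.1 2 (by lia), zero_mul, neg_zero] at this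
    refine (mul_eq_zero.1 this).resolve_left ?_
    intro h; apply r2; push_cast at h; linarith
  have g3 : coeff 3 G = 0 := by
    have := step 3 (by lia) (by intro i hi; interval_cases i <;> assumption)
    rw [px.1 3 (by lia), zero_mul, neg_zero] at this
    refine (mul_eq_zero.1 this).resolve_left ?_
    intro h; apply r3; push_cast at h; linarith
  have g : ∀ i < 4, coeff i G = 0 := by intro i hi; interval_cases i <;> assumption
  refine ⟨g, ?_⟩
  have := step 4 le_rfl g
  rw [px.2, one_mul] at this; exact_mod_cast this

open PowerSeries in
theorem xi_formulas {e ρ p : ℝ} {x L : PowerSeries ℝ} (x0 : coeff 0 x = 0) (x1 : coeff 1 x = 1)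
    (l0 : coeff 0 L = 0) (l1 : coeff 1 L = e) (h : ∀ i < 4, coeff i (GG (C e) (C ρ) (C p) x L) = 0) :
    coeff 2 L = e * coeff 2 x + ρ*e+p ∧ coeff 3 L - e * coeff 3 x = ρ*(e*coeff 2 x + coeff 2 L)+2*p*coeff 2 x ∧
    coeff 4 L - e * coeff 4 x = coeff 4 (GG (C e) (C ρ) (C p) x L) + ρ*(coeff 3 L + coeff 2 L*coeff 2 x+e*coeff 3 x)+p*(2*coeff 3 x+(coeff 2 x)^2) := by
  have e1 : GG (C e) (C ρ) (C p) x L = L - C ρ * (L*x) - C e * x - C p * (x*x) := by unfold GG; ring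
  have h2 := h 2 (by lia)
  have h3 := h 3 (by lia)
  rw [e1] at h2 h3 ⊢
  simp only [map_sub, coeff_C_mul, coeff_mul2, coeff_mul3, coeff_mul4, x0, x1, l0, l1] at h2 h3 ⊢
  refine ⟨by linarith, by linarith, by ring⟩

theorem flow_solution {E : Type*} [NormedAddCommGroup E] [NormedSpace ℝ E] [CompleteSpace E]
    (G : E → E) (K M : NNReal) (hG : LipschitzWith K G) (hM : ∀ x, ‖G x‖ ≤ M) (y : E) :
    ∃ α : ℝ → E, α 0 = y ∧ ∀ t, HasDerivAt α (G (α t)) t := by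
  have h1 : ∀ n : ℕ, ∃ α : ℝ → E, α 0 = y ∧
      ∀ t ∈ Ioo (-((n:ℝ)+1)) ((n:ℝ)+1), HasDerivAt α (G (α t)) t := by
    intro n
    have hn : (0:ℝ) < (n:ℝ) + 1 := by positivity
    have h0 : (0:ℝ) ∈ Icc (-((n:ℝ)+1)) ((n:ℝ)+1) := ⟨by linarith, by linarith⟩
    have hp : IsPicardLindelof (fun _ => G) (⟨0, h0⟩ : Icc (-((n:ℝ)+1)) ((n:ℝ)+1)) y
        (M * ((n:NNReal)+1)) 0 M K := by
      apply IsPicardLindelof.of_time_independent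
      · intro x _; exact hM x
      · exact hG.lipschitzOnWith
      · simp
    obtain ⟨α, ha, hd⟩ := hp.exists_eq_forall_mem_Icc_hasDerivWithinAt₀
    refine ⟨α, ha, fun t ht => ?_⟩
    exact (hd t (Ioo_subset_Icc_self ht)).hasDerivAt (Icc_mem_nhds ht.1 ht.2)
  choose β hβ0 hβ using h1
  have hag : ∀ n p : ℕ, n ≤ p → EqOn (β n) (β p) (Ioo (-((n:ℝ)+1)) ((n:ℝ)+1)) := by
    intro n p hnp
    have hn : (0:ℝ) < (n:ℝ) + 1 := by positivity
    have hnp' : (n:ℝ) ≤ p := by exact_mod_cast hnp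
    apply ODE_solution_unique_of_mem_Ioo (v := fun _ => G) (s := fun _ => univ) (K := K) (t₀ := 0)
    · intro t _; exact hG.lipschitzOnWith
    · exact ⟨by linarith, hn⟩
    · intro t ht; exact ⟨hβ n t ht, trivial⟩
    · intro t ht; exact ⟨hβ p t ⟨by linarith [ht.1], by linarith [ht.2]⟩, trivial⟩
    · rw [hβ0, hβ0]
  refine ⟨fun t => β ⌈|t|⌉₊ t, by simp [hβ0], fun t => ?_⟩
  have hc : ∀ t : ℝ, ∀ n : ℕ, |t| < n + 1 → β ⌈|t|⌉₊ t = β n t := by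
    intro t n ht
    have h2 : t ∈ Ioo (-((n:ℝ)+1)) ((n:ℝ)+1) := abs_lt.mp ht
    have h3 : t ∈ Ioo (-((⌈|t|⌉₊:ℝ)+1)) ((⌈|t|⌉₊:ℝ)+1) :=
      abs_lt.mp (by linarith [Nat.le_ceil |t|])
    rcases le_total n ⌈|t|⌉₊ with h | h
    · exact (hag _ _ h h2).symm
    · exact hag _ _ h h3
  set n := ⌈|t|⌉₊ with hn
  have ht : |t| < n + 1 := by linarith [Nat.le_ceil |t|]
  have := hβ n t (abs_lt.mp ht)
  refine this.congr_of_eventuallyEq ?_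
  filter_upwards [(continuous_abs.tendsto t).eventually (gt_mem_nhds ht)] with s hs
  exact hc s n hs

theorem flow_exists {E : Type*} [NormedAddCommGroup E] [NormedSpace ℝ E] [CompleteSpace E]
    (G : E → E) (K M : NNReal) (hG : LipschitzWith K G) (hM : ∀ x, ‖G x‖ ≤ M) :
    ∃ Φ : E → ℝ → E, (∀ y, Φ y 0 = y) ∧ (∀ y t, HasDerivAt (Φ y) (G (Φ y t)) t) ∧
      ContinuousOn (fun p : E × ℝ => Φ p.1 p.2) (univ ×ˢ Ici 0) := by
  choose Φ h0 hd using flow_solution G K M hG hM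
  refine ⟨Φ, h0, hd, ?_⟩
  have hcont : ∀ y, Continuous (Φ y) := fun y =>
    continuous_iff_continuousAt.mpr fun t => (hd y t).continuousAt
  rintro ⟨y, t⟩ ⟨-, ht⟩
  have key : ∀ z s, 0 ≤ s → dist (Φ z s) (Φ y s) ≤ dist z y * exp (K * s) := by
    intro z s hs
    have := dist_le_of_trajectories_ODE (v := fun _ => G) (f := Φ z) (g := Φ y) (a := 0) (b := s)
      (δ := dist z y) (K := K) (fun _ => hG) (hcont z).continuousOn
      (fun t _ => (hd z t).hasDerivWithinAt) (hcont y).continuousOn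
      (fun t _ => (hd y t).hasDerivWithinAt) (by rw [h0, h0]) s ⟨hs, le_rfl⟩
    simpa using this
  rw [ContinuousWithinAt, tendsto_iff_dist_tendsto_zero]
  have hb : Tendsto (fun p : E × ℝ => dist p.1 y * exp (K * p.2) + dist (Φ y p.2) (Φ y t))
      (𝓝[univ ×ˢ Ici 0] (y, t)) (𝓝 0) := by
    have hc : Continuous (fun p : E × ℝ =>
        dist p.1 y * exp (K * p.2) + dist (Φ y p.2) (Φ y t)) := by
      have := hcont y
      fun_prop
    have := (hc.tendsto (y, t)).mono_left (nhdsWithin_le_nhds (s := univ ×ˢ Ici 0))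
    simpa using this
  refine squeeze_zero' (Eventually.of_forall fun _ => dist_nonneg) ?_ hb
  filter_upwards [self_mem_nhdsWithin] with p hp
  calc dist (Φ p.1 p.2) (Φ y t) ≤ dist (Φ p.1 p.2) (Φ y p.2) + dist (Φ y p.2) (Φ y t) :=
        dist_triangle _ _ _
    _ ≤ _ := by gcongr; exact key _ _ hp.2

def clp (M x : ℝ) : ℝ := max (-M) (min x M)

theorem clp_mem {M x : ℝ} (hM : 0 ≤ M) : clp M x ∈ Icc (-M) M :=
  ⟨le_max_left _ _, max_le (by linarith) (min_le_right _ _)⟩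

theorem clp_eq {M x : ℝ} (h : |x| ≤ M) : clp M x = x := by
  have := abs_le.mp h
  rw [clp, min_eq_left this.2, max_eq_right this.1]

theorem clp_lip (M : ℝ) : LipschitzWith 1 (clp M) :=
  (LipschitzWith.id.min_const M).const_max (-M)

/-- Flow of a smooth planar field depending on a parameter, cut off outside a large box. -/
theorem planar_flow (F : ℝ × ℝ × ℝ → ℝ × ℝ) (hF : ContDiff ℝ 1 F) (M : ℝ) (hM : 0 < M) :
    ∃ (G : ℝ → ℝ × ℝ → ℝ × ℝ) (K : NNReal) (Φ : ℝ → ℝ × ℝ → ℝ → ℝ × ℝ),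
      (∀ m, LipschitzWith K (G m)) ∧
      (∀ m a b, |m| ≤ M → |a| ≤ M → |b| ≤ M → G m (a, b) = F (m, a, b)) ∧
      (∀ m y, Φ m y 0 = y) ∧ (∀ m y t, HasDerivAt (Φ m y) (G m (Φ m y t)) t) ∧
      ContinuousOn (fun p : ℝ × (ℝ × ℝ) × ℝ => Φ p.1 p.2.1 p.2.2) (univ ×ˢ univ ×ˢ Ici 0) := by
  set B : Set (ℝ × ℝ × ℝ) := Icc (-M) M ×ˢ (Icc (-M) M ×ˢ Icc (-M) M) with hB
  have hBc : IsCompact B := isCompact_Icc.prod (isCompact_Icc.prod isCompact_Icc)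
  obtain ⟨K0, hK0⟩ := (hF.locallyLipschitz.locallyLipschitzOn (s := B)).exists_lipschitzOnWith_of_compact hBc
  obtain ⟨M0, hM0⟩ := hBc.exists_bound_of_continuousOn hF.continuous.continuousOn
  set c : ℝ × ℝ × ℝ → ℝ × ℝ × ℝ := fun p => (clp M p.1, clp M p.2.1, clp M p.2.2) with hc
  have hcB : ∀ p, c p ∈ B := fun p => ⟨clp_mem hM.le, clp_mem hM.le, clp_mem hM.le⟩
  have hcl : LipschitzWith 1 c := by
    have h1 : LipschitzWith 1 (fun p : ℝ × ℝ × ℝ => clp M p.1) := by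
      simpa [Function.comp_def] using (clp_lip M).comp (LipschitzWith.prod_fst (α := ℝ) (β := ℝ × ℝ))
    have h2 : LipschitzWith 1 (fun p : ℝ × ℝ × ℝ => clp M p.2.1) := by
      simpa [Function.comp_def] using (clp_lip M).comp ((LipschitzWith.prod_fst (α := ℝ) (β := ℝ)).comp (LipschitzWith.prod_snd (α := ℝ) (β := ℝ × ℝ)))
    have h3 : LipschitzWith 1 (fun p : ℝ × ℝ × ℝ => clp M p.2.2) := by
      simpa [Function.comp_def] using (clp_lip M).comp ((LipschitzWith.prod_snd (α := ℝ) (β := ℝ)).comp (LipschitzWith.prod_snd (α := ℝ) (β := ℝ × ℝ)))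
    simpa using h1.prodMk (h2.prodMk h3)
  have hFc : LipschitzWith K0 (F ∘ c) := by
    intro p q
    refine (hK0 (hcB p) (hcB q)).trans ?_
    gcongr
    simpa using hcl p q
  set H : ℝ × ℝ × ℝ → ℝ × ℝ × ℝ := fun p => (0, F (c p)) with hH
  have hHl : LipschitzWith K0 H := by
    have := (LipschitzWith.const (α := ℝ × ℝ × ℝ) (0:ℝ)).prodMk hFc
    simpa using this
  have hHb : ∀ p, ‖H p‖ ≤ (M0.toNNReal : ℝ) := by
    intro p
    have := (hM0 (c p) (hcB p)).trans (Real.le_coe_toNNReal M0)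
    simp only [hH, Prod.norm_mk, norm_zero]
    exact max_le (by positivity) this
  obtain ⟨Ψ, h0, hd, hcont⟩ := flow_exists H K0 _ hHl hHb
  have hconst : ∀ m y t, (Ψ (m, y) t).1 = m := by
    intro m y t
    have h1 : ∀ s, HasDerivAt (fun s => (Ψ (m, y) s).1) 0 s := fun s => by
      exact (hasFDerivAt_fst.comp_hasDerivAt s (hd (m, y) s))
    have := is_const_of_deriv_eq_zero (fun s => (h1 s).differentiableAt) (fun s => (h1 s).deriv) t 0
    simp only [h0] at this
    exact this
  refine ⟨fun m y => F (c (m, y)), K0, fun m y t => (Ψ (m, y) t).2, ?_, ?_, ?_, ?_, ?_⟩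
  · intro m
    simpa [Function.comp_def] using hFc.comp (LipschitzWith.prodMk_left m)
  · intro m a b h1 h2 h3
    simp only [hc, clp_eq h1, clp_eq h2, clp_eq h3]
  · intro m y; simp [h0]
  · intro m y t
    have h1 : HasDerivAt (fun s => (Ψ (m, y) s).2) (H (Ψ (m, y) t)).2 t := by
      exact (hasFDerivAt_snd.comp_hasDerivAt t (hd (m, y) t))
    have h2 : Ψ (m, y) t = (m, (Ψ (m, y) t).2) := Prod.ext (hconst m y t) rfl
    rw [h2] at h1
    exact h1
  · have h1 : ContinuousOn (fun p : ℝ × (ℝ × ℝ) × ℝ => ((p.1, p.2.1), p.2.2)) (univ ×ˢ univ ×ˢ Ici 0) := by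
      fun_prop
    have h2 := hcont.comp h1 (fun p hp => ⟨trivial, hp.2.2⟩)
    exact continuous_snd.comp_continuousOn h2

def NN (k m a b : ℝ) : ℝ := m * a - (k - m) * b
def DD (k τ m a b : ℝ) : ℝ := (a + b) * (1 - a ^ 2) - NN k m a b * (1 - τ * a ^ 2)
/-- The (rescaled) backward polynomial field in the variables `(a, b)`. -/
def bF (k τ : ℝ) (p : ℝ × ℝ × ℝ) : ℝ × ℝ :=
  (-((k - p.1) * DD k τ p.1 p.2.1 p.2.2),
   -((k - p.1) * ((1 - τ * p.2.2 ^ 2) * NN k p.1 p.2.1 p.2.2)))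

theorem bF_contDiff (k τ : ℝ) : ContDiff ℝ 1 (bF k τ) := by
  unfold bF DD NN
  fun_prop

theorem hd_fst {c : ℝ → ℝ × ℝ} {c' : ℝ × ℝ} {t : ℝ} (hc : HasDerivAt c c' t) :
    HasDerivAt (fun s => (c s).1) c'.1 t :=
  (hasFDerivAt_fst (𝕜 := ℝ) (E := ℝ) (F := ℝ) (p := c t)).comp_hasDerivAt t hc

theorem hd_snd {c : ℝ → ℝ × ℝ} {c' : ℝ × ℝ} {t : ℝ} (hc : HasDerivAt c c' t) :
    HasDerivAt (fun s => (c s).2) c'.2 t :=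
  (hasFDerivAt_snd (𝕜 := ℝ) (E := ℝ) (F := ℝ) (p := c t)).comp_hasDerivAt t hc

theorem first_exit (h : ℝ → ℝ) (hc : Continuous h) (h0 : 0 < h 0) (hex : ∃ t, 0 ≤ t ∧ h t ≤ 0) :
    ∃ t1, 0 < t1 ∧ h t1 = 0 ∧ ∀ s ∈ Ico 0 t1, 0 < h s := by
  set S := Ici (0:ℝ) ∩ {t | h t ≤ 0} with hS
  have hcl : IsClosed S := isClosed_Ici.inter (isClosed_le hc continuous_const)
  have hne : S.Nonempty := hex
  have hbd : BddBelow S := ⟨0, fun t ht => ht.1⟩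
  have hmem := hcl.csInf_mem hne hbd
  set t1 := sInf S
  have hlt : ∀ s ∈ Ico 0 t1, 0 < h s := by
    intro s hs
    by_contra hh
    exact absurd (csInf_le hbd ⟨hs.1, not_lt.mp hh⟩) (not_le.mpr hs.2)
  have hpos : 0 < t1 := by
    rcases (show (0:ℝ) ≤ t1 from hmem.1).lt_or_eq with hh | hh
    · exact hh
    · have h2 : h t1 ≤ 0 := hmem.2
      rw [← hh] at h2; linarith
  refine ⟨t1, hpos, le_antisymm hmem.2 ?_, hlt⟩
  have hcw : Tendsto h (𝓝[<] t1) (𝓝 (h t1)) := (hc.tendsto t1).mono_left nhdsWithin_le_nhds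
  refine ge_of_tendsto hcw ?_
  filter_upwards [Ico_mem_nhdsLT hpos] with s hs
  exact (hlt s hs).le

theorem neg_after {f : ℝ → ℝ} {f' t : ℝ} (hf : HasDerivAt f f' t) (h0 : f t = 0) (hn : f' < 0) :
    ∀ᶠ s in 𝓝[>] t, f s < 0 := by
  have h1 := hf.tendsto_slope.mono_left (nhdsWithin_mono t (fun s (hs : s ∈ Ioi t) => ne_of_gt hs))
  filter_upwards [h1.eventually (gt_mem_nhds hn), self_mem_nhdsWithin] with s hs hst
  rw [slope_def_field, h0, sub_zero, div_neg_iff] at hs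
  have : 0 < s - t := sub_pos.mpr hst
  rcases hs with h | h
  · linarith [h.2]
  · exact h.1

/-- Derivative of `N` and `D` along the backward field. -/
theorem N_deriv {k τ m : ℝ} {c : ℝ → ℝ × ℝ} {t : ℝ} (hc : HasDerivAt c (bF k τ (m, c t)) t) :
    HasDerivAt (fun s => NN k m (c s).1 (c s).2)
      (-(m * (k - m) * DD k τ m (c t).1 (c t).2) +
        (k - m) * ((k - m) * ((1 - τ * (c t).2 ^ 2) * NN k m (c t).1 (c t).2))) t := by
  have h1 : HasDerivAt (fun s => (c s).1) (bF k τ (m, c t)).1 t :=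
    hd_fst hc
  have h2 : HasDerivAt (fun s => (c s).2) (bF k τ (m, c t)).2 t :=
    hd_snd hc
  unfold NN
  refine ((h1.const_mul m).sub (h2.const_mul (k - m))).congr_deriv ?_
  simp only [bF, NN]; ring

theorem D_deriv {k τ m : ℝ} {c : ℝ → ℝ × ℝ} {t : ℝ} (hc : HasDerivAt c (bF k τ (m, c t)) t) :
    HasDerivAt (fun s => DD k τ m (c s).1 (c s).2)
      (-((k - m) * ((1 - τ * (c t).2 ^ 2) * NN k m (c t).1 (c t).2)) *
        (1 - (c t).1 ^ 2 + (k - m) * (1 - τ * (c t).1 ^ 2)) +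
      -((k - m) * DD k τ m (c t).1 (c t).2) * ((1 - (c t).1 ^ 2) - ((c t).1 + (c t).2) * (2 * (c t).1)
        - m * (1 - τ * (c t).1 ^ 2) + NN k m (c t).1 (c t).2 * (τ * (2 * (c t).1)))) t := by
  have h1 : HasDerivAt (fun s => (c s).1) (bF k τ (m, c t)).1 t :=
    hd_fst hc
  have h2 : HasDerivAt (fun s => (c s).2) (bF k τ (m, c t)).2 t :=
    hd_snd hc
  have hN : HasDerivAt (fun s => NN k m (c s).1 (c s).2) (m * (bF k τ (m, c t)).1 - (k - m) * (bF k τ (m, c t)).2) t :=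
    (h1.const_mul m).sub (h2.const_mul (k - m))
  unfold DD
  refine (((h1.add h2).mul ((h1.pow 2).const_sub 1)).sub
    (hN.mul (((h1.pow 2).const_mul τ).const_sub 1))).congr_deriv ?_
  simp only [bF, DD, NN, Pi.add_apply, Pi.pow_apply]; push_cast; ring

theorem shooting (k τ ma mb : ℝ) (hτ0 : 0 < τ) (hτ1 : τ < 1) (hab : ma ≤ mb) (hma : 0 < ma) (hmb : mb < k)
    (hbr : ∀ m ∈ Icc ma mb, τ * m ^ 2 < (k - m) ^ 2)
    (y0 : ℝ → ℝ × ℝ) (hy : Continuous y0)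
    (hini : ∀ m ∈ Icc ma mb, 0 < NN k m (y0 m).1 (y0 m).2 ∧ 0 < DD k τ m (y0 m).1 (y0 m).2 ∧
      0 < (y0 m).2 ∧ (y0 m).1 < 1)
    (hA : ∃ c : ℝ → ℝ × ℝ, ∃ T, 0 ≤ T ∧ c 0 = y0 ma ∧
      (∀ t ∈ Icc 0 T, HasDerivAt c (bF k τ (ma, c t)) t ∧ 0 < DD k τ ma (c t).1 (c t).2 ∧
        0 < (c t).2) ∧ NN k ma (c T).1 (c T).2 < 0)
    (hB : ∃ c : ℝ → ℝ × ℝ, ∃ T, 0 ≤ T ∧ c 0 = y0 mb ∧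
      (∀ t ∈ Icc 0 T, HasDerivAt c (bF k τ (mb, c t)) t ∧ 0 < NN k mb (c t).1 (c t).2) ∧
        (DD k τ mb (c T).1 (c T).2 < 0 ∨ (c T).2 < 0)) :
    ∃ m ∈ Icc ma mb, ∃ c : ℝ → ℝ × ℝ, c 0 = y0 m ∧ ∀ t, 0 ≤ t →
      HasDerivAt c (bF k τ (m, c t)) t ∧ 0 < NN k m (c t).1 (c t).2 ∧
      0 < DD k τ m (c t).1 (c t).2 ∧ 0 < (c t).2 ∧ (c t).1 < 1 := by
  obtain ⟨cA, TA, hTA, hcA0, hcA, hcA1⟩ := hA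
  obtain ⟨cB, TB, hTB, hcB0, hcB, hcB1⟩ := hB
  have hctA : ContinuousOn cA (Icc 0 TA) := fun t ht => (hcA t ht).1.continuousAt.continuousWithinAt
  have hctB : ContinuousOn cB (Icc 0 TB) := fun t ht => (hcB t ht).1.continuousAt.continuousWithinAt
  obtain ⟨CA, hCA⟩ := isCompact_Icc.exists_bound_of_continuousOn hctA
  obtain ⟨CB, hCB⟩ := isCompact_Icc.exists_bound_of_continuousOn hctB
  have hkb : 0 < k - mb := by linarith
  obtain ⟨M, hM1, hMk, hMq, hMA, hMB⟩ : ∃ M : ℝ, 1 ≤ M ∧ k ≤ M ∧ k / (k - mb) ≤ M ∧ CA ≤ M ∧ CB ≤ M :=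
    ⟨1 + |k| + |k / (k - mb)| + |CA| + |CB|, by
      linarith [abs_nonneg k, abs_nonneg (k / (k - mb)), abs_nonneg CA, abs_nonneg CB], by
      linarith [le_abs_self k, abs_nonneg (k / (k - mb)), abs_nonneg CA, abs_nonneg CB], by
      linarith [abs_nonneg k, le_abs_self (k / (k - mb)), abs_nonneg CA, abs_nonneg CB], by
      linarith [abs_nonneg k, abs_nonneg (k / (k - mb)), le_abs_self CA, abs_nonneg CB], by
      linarith [abs_nonneg k, abs_nonneg (k / (k - mb)), abs_nonneg CA, le_abs_self CB]⟩
  obtain ⟨G, K, Φ, hGl, hGF, hΦ0, hΦd, hΦc⟩ := planar_flow (bF k τ) (bF_contDiff k τ) M (by linarith)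
  have habsm : ∀ m ∈ Icc ma mb, |m| ≤ M := fun m hm => by
    rw [abs_of_pos (by linarith [hm.1])]; linarith [hm.2]
  set Ψ : ℝ × ℝ → ℝ × ℝ := fun p => Φ p.1 (y0 p.1) |p.2| with hΨ
  have hΨc : Continuous Ψ := by
    have h1 : Continuous (fun p : ℝ × ℝ => (p.1, y0 p.1, |p.2|)) := by fun_prop
    rw [← continuousOn_univ] at h1 ⊢
    exact hΦc.comp h1 (fun p _ => ⟨trivial, trivial, abs_nonneg p.2⟩)
  have hNc : Continuous (fun p : ℝ × ℝ => NN k p.1 (Ψ p).1 (Ψ p).2) := by unfold NN; fun_prop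
  have hDc : Continuous (fun p : ℝ × ℝ => DD k τ p.1 (Ψ p).1 (Ψ p).2) := by unfold DD NN; fun_prop
  have hbc : Continuous (fun p : ℝ × ℝ => (Ψ p).2) := by fun_prop
  set U : Set ℝ := {m | ∃ T, 0 ≤ T ∧ (∀ t ∈ Icc 0 T, 0 < DD k τ m (Ψ (m, t)).1 (Ψ (m, t)).2 ∧
      0 < (Ψ (m, t)).2) ∧ NN k m (Ψ (m, T)).1 (Ψ (m, T)).2 < 0} with hU
  set V : Set ℝ := {m | ∃ T, 0 ≤ T ∧ (∀ t ∈ Icc 0 T, 0 < NN k m (Ψ (m, t)).1 (Ψ (m, t)).2) ∧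
      (DD k τ m (Ψ (m, T)).1 (Ψ (m, T)).2 < 0 ∨ (Ψ (m, T)).2 < 0)} with hV
  have hUo : IsOpen U := by
    rw [isOpen_iff_mem_nhds]
    rintro m ⟨T, hT, h1, h2⟩
    have e1 : ∀ᶠ m' in 𝓝 m, ∀ t ∈ Icc 0 T, 0 < DD k τ m' (Ψ (m', t)).1 (Ψ (m', t)).2 ∧
      0 < (Ψ (m', t)).2 := by
      apply isCompact_Icc.eventually_forall_of_forall_eventually
      intro t ht
      exact ((hDc.tendsto (m, t)).eventually (lt_mem_nhds (h1 t ht).1)).and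
        ((hbc.tendsto (m, t)).eventually (lt_mem_nhds (h1 t ht).2))
    have e2 : ∀ᶠ m' in 𝓝 m, NN k m' (Ψ (m', T)).1 (Ψ (m', T)).2 < 0 :=
      ((hNc.comp (by fun_prop : Continuous fun m' : ℝ => (m', T))).tendsto m).eventually (gt_mem_nhds h2)
    filter_upwards [e1, e2] with m' h1' h2'
    exact ⟨T, hT, h1', h2'⟩
  have hVo : IsOpen V := by
    rw [isOpen_iff_mem_nhds]
    rintro m ⟨T, hT, h1, h2⟩
    have e1 : ∀ᶠ m' in 𝓝 m, ∀ t ∈ Icc 0 T, 0 < NN k m' (Ψ (m', t)).1 (Ψ (m', t)).2 := by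
      apply isCompact_Icc.eventually_forall_of_forall_eventually
      intro t ht
      exact ((hNc.tendsto (m, t)).eventually (lt_mem_nhds (h1 t ht)))
    have e2 : ∀ᶠ m' in 𝓝 m, (DD k τ m' (Ψ (m', T)).1 (Ψ (m', T)).2 < 0 ∨ (Ψ (m', T)).2 < 0) := by
      rcases h2 with h2 | h2
      · exact (((hDc.comp (by fun_prop : Continuous fun m' : ℝ => (m', T))).tendsto m).eventually (gt_mem_nhds h2)).mono fun _ h => Or.inl h
      · exact (((hbc.comp (by fun_prop : Continuous fun m' : ℝ => (m', T))).tendsto m).eventually (gt_mem_nhds h2)).mono fun _ h => Or.inr h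
    filter_upwards [e1, e2] with m' h1' h2'
    exact ⟨T, hT, h1', h2'⟩
  have hdisj : ∀ m, m ∈ U → m ∈ V → False := by
    rintro m ⟨T, hT, h1, h2⟩ ⟨T', hT', h1', h2'⟩
    rcases le_total T T' with h | h
    · linarith [h1' T ⟨hT, h⟩]
    · have := h1 T' ⟨hT', h⟩
      rcases h2' with h2' | h2' <;> linarith [this.1, this.2]
  have hΦct : ∀ m y, Continuous (Φ m y) := fun m y =>
    continuous_iff_continuousAt.mpr fun t => (hΦd m y t).continuousAt
  have hmA : ma ∈ U := by
    have heq : EqOn cA (Φ ma (y0 ma)) (Icc 0 TA) := by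
      apply ODE_solution_unique (v := fun _ => G ma) (K := K) (fun _ => hGl ma) hctA ?_
        (hΦct _ _).continuousOn (fun t _ => (hΦd ma (y0 ma) t).hasDerivWithinAt) (by rw [hcA0, hΦ0])
      intro t ht
      have hb := hCA t (Ico_subset_Icc_self ht)
      have := hGF ma (cA t).1 (cA t).2 (habsm ma ⟨le_rfl, hab⟩)
        (((norm_fst_le _).trans hb).trans hMA) (((norm_snd_le _).trans hb).trans hMA)
      have h2 := (hcA t (Ico_subset_Icc_self ht)).1.hasDerivWithinAt (s := Ici t)
      rw [show (ma, cA t) = (ma, (cA t).1, (cA t).2) from rfl, ← this] at h2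
      exact h2
    have heq' : ∀ t ∈ Icc 0 TA, Ψ (ma, t) = cA t := fun t ht => by
      simp only [hΨ, abs_of_nonneg ht.1]; exact (heq ht).symm
    refine ⟨TA, hTA, fun t ht => ?_, ?_⟩
    · rw [heq' t ht]; exact (hcA t ht).2
    · rw [heq' TA ⟨hTA, le_rfl⟩]; exact hcA1
  have hmB : mb ∈ V := by
    have heq : EqOn cB (Φ mb (y0 mb)) (Icc 0 TB) := by
      apply ODE_solution_unique (v := fun _ => G mb) (K := K) (fun _ => hGl mb) hctB ?_
        (hΦct _ _).continuousOn (fun t _ => (hΦd mb (y0 mb) t).hasDerivWithinAt) (by rw [hcB0, hΦ0])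
      intro t ht
      have hb := hCB t (Ico_subset_Icc_self ht)
      have := hGF mb (cB t).1 (cB t).2 (habsm mb ⟨hab, le_rfl⟩)
        (((norm_fst_le _).trans hb).trans hMB) (((norm_snd_le _).trans hb).trans hMB)
      have h2 := (hcB t (Ico_subset_Icc_self ht)).1.hasDerivWithinAt (s := Ici t)
      rw [show (mb, cB t) = (mb, (cB t).1, (cB t).2) from rfl, ← this] at h2
      exact h2
    have heq' : ∀ t ∈ Icc 0 TB, Ψ (mb, t) = cB t := fun t ht => by
      simp only [hΨ, abs_of_nonneg ht.1]; exact (heq ht).symm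
    refine ⟨TB, hTB, fun t ht => ?_, ?_⟩
    · rw [heq' t ht]; exact (hcB t ht).2
    · rw [heq' TB ⟨hTB, le_rfl⟩]; exact hcB1
  obtain ⟨m, hm, hmU, hmV⟩ : ∃ m ∈ Icc ma mb, m ∉ U ∧ m ∉ V := by
    by_contra! hcon
    have hsub : Icc ma mb ⊆ U ∪ V := fun m hm => by
      by_cases h : m ∈ U
      · exact Or.inl h
      · exact Or.inr (hcon m hm h)
    obtain ⟨m, -, h1, h2⟩ := isPreconnected_Icc U V hUo hVo hsub ⟨ma, ⟨le_rfl, hab⟩, hmA⟩ ⟨mb, ⟨hab, le_rfl⟩, hmB⟩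
    exact hdisj m h1 h2
  have hm0 : 0 < m := by linarith [hm.1]
  have hq : 0 < k - m := by linarith [hm.2]
  have hbr' := hbr m hm
  obtain ⟨i1, i2, i3, i4⟩ := hini m hm
  set c := Φ m (y0 m) with hc
  have hcc : Continuous c := hΦct _ _
  have hc0 : c 0 = y0 m := hΦ0 _ _
  have hΨe : ∀ t, 0 ≤ t → Ψ (m, t) = c t := fun t ht => by simp only [hΨ, abs_of_nonneg ht, hc]
  -- the good region lies in the box
  have hreg : ∀ a b, 0 ≤ NN k m a b → 0 ≤ b → a ≤ 1 → 0 ≤ a ∧ |a| ≤ M ∧ |b| ≤ M ∧ τ * b ^ 2 < 1 := by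
    intro a b h1 h2 h3
    unfold NN at h1
    have ha : 0 ≤ a := by
      by_contra hn
      have := mul_pos hm0 (neg_pos.mpr (not_le.mp hn))
      have := mul_nonneg hq.le h2
      linarith
    have hb1 : (k - m) * b ≤ m := by nlinarith
    have hb2 : b ≤ k / (k - mb) := by
      rw [le_div_iff₀ hkb]
      have : b * (k - mb) ≤ b * (k - m) := mul_le_mul_of_nonneg_left (by linarith [hm.2]) h2
      linarith [hm.2]
    refine ⟨ha, by rw [abs_of_nonneg ha]; linarith, by rw [abs_of_nonneg h2]; linarith, ?_⟩
    have h4 : ((k - m) * b) ^ 2 ≤ m ^ 2 := pow_le_pow_left₀ (mul_nonneg hq.le h2) hb1 2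
    have h5 : τ * ((k - m) * b) ^ 2 ≤ τ * m ^ 2 := mul_le_mul_of_nonneg_left h4 hτ0.le
    have h6 : (k - m) ^ 2 * (τ * b ^ 2) < (k - m) ^ 2 * 1 := by nlinarith
    exact lt_of_mul_lt_mul_left h6 (by positivity)
  have hGF' : ∀ t, 0 ≤ NN k m (c t).1 (c t).2 → 0 ≤ (c t).2 → (c t).1 ≤ 1 →
      HasDerivAt c (bF k τ (m, c t)) t := by
    intro t h1 h2 h3
    have h4 := hreg _ _ h1 h2 h3
    have := hΦd m (y0 m) t
    rw [show Φ m (y0 m) t = ((c t).1, (c t).2) from rfl, hGF m _ _ (habsm m hm) h4.2.1 h4.2.2.1] at this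
    exact this
  set h : ℝ → ℝ := fun t => min (min (NN k m (c t).1 (c t).2) (DD k τ m (c t).1 (c t).2)) (min (c t).2 (1 - (c t).1)) with hh
  have hhc : Continuous h := by simp only [hh]; unfold DD NN; fun_prop
  have hh0 : 0 < h 0 := by
    simp only [hh, hc0, lt_min_iff]; exact ⟨⟨i1, i2⟩, i3, by linarith⟩
  have hall : ∀ t, 0 ≤ t → 0 < h t := by
    by_contra hcon
    push Not at hcon
    obtain ⟨t1, ht1, hz, hlt⟩ := first_exit h hhc hh0 hcon
    simp only [hh, lt_min_iff] at hlt
    have hge : 0 ≤ h t1 := hz.ge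
    have hzl : ¬ (0 < h t1) := by rw [hz]; exact lt_irrefl _
    simp only [hh, le_min_iff] at hge
    simp only [hh, lt_min_iff] at hzl
    obtain ⟨⟨g1, g2⟩, g3, g4⟩ := hge
    have ha1 : (c t1).1 < 1 := by
      have hanti : AntitoneOn (fun t => (c t).1) (Icc 0 t1) := by
        have hd : ∀ t ∈ Ico 0 t1, HasDerivAt (fun t => (c t).1) (-((k - m) * DD k τ m (c t).1 (c t).2)) t := by
          intro t ht
          obtain ⟨⟨l1, l2⟩, l3, l4⟩ := hlt t ht
          exact hd_fst (hGF' t l1.le l3.le (by linarith))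
        apply antitoneOn_of_deriv_nonpos (convex_Icc _ _) (by fun_prop)
        · intro t ht
          rw [interior_Icc] at ht
          exact (hd t (Ioo_subset_Ico_self ht)).differentiableAt.differentiableWithinAt
        · intro t ht
          rw [interior_Icc] at ht
          rw [(hd t (Ioo_subset_Ico_self ht)).deriv]
          have := mul_pos hq (hlt t (Ioo_subset_Ico_self ht)).1.2
          linarith
      have := hanti ⟨le_rfl, ht1.le⟩ ⟨ht1.le, le_rfl⟩ ht1.le
      simp only [hc0] at this
      linarith
    have hd1 := hGF' t1 g1 g3 ha1.le
    obtain ⟨ra, -, -, rb⟩ := hreg _ _ g1 g3 ha1.le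
    -- equilibria are excluded
    have heqm : ¬ (bF k τ (m, c t1) = 0) := by
      intro hz0
      have hG0 : G m (c t1) = 0 := by
        obtain ⟨_, r1, r2, _⟩ := hreg _ _ g1 g3 ha1.le
        rw [← hz0]; exact hGF m _ _ (habsm m hm) r1 r2
      have hcst : c = fun _ => c t1 := by
        apply ODE_solution_unique_univ (v := fun _ => G m) (s := fun _ => univ) (K := K) (t₀ := t1)
        · intro t; exact (hGl m).lipschitzOnWith
        · intro t; exact ⟨hΦd m (y0 m) t, trivial⟩
        · intro t; refine ⟨?_, trivial⟩
          simp only [hG0]; exact hasDerivAt_const t (c t1)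
        · rfl
      have e0 : c 0 = c t1 := congrFun hcst 0
      have : 0 < h t1 := by
        have e1 : h t1 = h 0 := by simp only [hh, e0]
        rw [e1]; exact hh0
      linarith
    have htube : ∀ f : ℝ → ℝ, Continuous f → (∀ s ∈ Ico 0 t1, 0 < f s) → 0 < f t1 →
        ∀ᶠ s in 𝓝[>] t1, ∀ u ∈ Icc 0 s, 0 < f u := by
      intro f hf hf1 hf2
      obtain ⟨δ, hδ, hball⟩ := Metric.eventually_nhds_iff.mp ((hf.tendsto t1).eventually (lt_mem_nhds hf2))
      filter_upwards [Ioo_mem_nhdsGT (show t1 < t1 + δ by linarith)] with s hs u hu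
      rcases lt_or_ge u t1 with h' | h'
      · exact hf1 u ⟨hu.1, h'⟩
      · apply hball
        rw [Real.dist_eq, abs_of_nonneg (by linarith)]
        linarith [hu.2, hs.2]
    have hNct : Continuous (fun t => NN k m (c t).1 (c t).2) := by unfold NN; fun_prop
    have hDct : Continuous (fun t => DD k τ m (c t).1 (c t).2) := by unfold DD NN; fun_prop
    rcases g1.lt_or_eq with hN | hN
    · -- N > 0
      have evN := htube _ hNct (fun s hs => (hlt s hs).1.1) hN
      have hfin : ∀ᶠ s in 𝓝[>] t1, (DD k τ m (c s).1 (c s).2 < 0 ∨ (c s).2 < 0) := by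
        rcases g3.lt_or_eq with hb | hb
        · have hD : DD k τ m (c t1).1 (c t1).2 = 0 := by
            by_contra hne
            exact hzl ⟨⟨hN, lt_of_le_of_ne g2 (Ne.symm hne)⟩, hb, by linarith⟩
          refine (neg_after (D_deriv hd1) hD ?_).mono fun _ h => Or.inl h
          rw [hD]
          have hA : 0 < 1 - (c t1).1 ^ 2 + (k - m) * (1 - τ * (c t1).1 ^ 2) := by
            have q1 : (c t1).1 ^ 2 < 1 := by nlinarith
            have q2 : τ * (c t1).1 ^ 2 < 1 := by nlinarith
            have := mul_pos hq (sub_pos.mpr q2)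
            linarith
          have := mul_pos (mul_pos hq (mul_pos (sub_pos.mpr rb) hN)) hA
          linarith
        · have h2 : HasDerivAt (fun s => (c s).2) (bF k τ (m, c t1)).2 t1 :=
            hd_snd hd1
          refine (neg_after h2 hb.symm ?_).mono fun _ h => Or.inr h
          simp only [bF]
          have := mul_pos hq (mul_pos (sub_pos.mpr rb) hN)
          linarith
      obtain ⟨s, s1, s2, s3⟩ := (evN.and (hfin.and self_mem_nhdsWithin)).exists
      have hs : 0 ≤ s := ht1.le.trans (le_of_lt s3)
      apply hmV
      refine ⟨s, hs, fun t ht => ?_, ?_⟩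
      · rw [hΨe t ht.1]; exact s1 t ht
      · rw [hΨe s hs]; exact s2
    · rcases g2.lt_or_eq with hD | hD
      · have hb : 0 < (c t1).2 := by
          rcases g3.lt_or_eq with hb | hb
          · exact hb
          · exfalso
            unfold NN at hN
            rw [← hb] at hN
            have ha0 : (c t1).1 = 0 := by
              have : m * (c t1).1 = 0 := by linarith
              exact (mul_eq_zero.mp this).resolve_left hm0.ne'
            unfold DD NN at hD
            rw [← hb, ha0] at hD
            norm_num at hD
        have evD := htube _ hDct (fun s hs => (hlt s hs).1.2) hD
        have evb := htube _ (by fun_prop : Continuous fun t => (c t).2) (fun s hs => (hlt s hs).2.1) hb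
        have evN : ∀ᶠ s in 𝓝[>] t1, NN k m (c s).1 (c s).2 < 0 := by
          refine neg_after (N_deriv hd1) hN.symm ?_
          rw [← hN]
          have := mul_pos (mul_pos hm0 hq) hD
          linarith
        obtain ⟨s, s1, s2, s3, s4⟩ := (evD.and (evb.and (evN.and self_mem_nhdsWithin))).exists
        have hs : 0 ≤ s := ht1.le.trans (le_of_lt s4)
        apply hmU
        refine ⟨s, hs, fun t ht => ?_, ?_⟩
        · rw [hΨe t ht.1]; exact ⟨s1 t ht, s2 t ht⟩
        · rw [hΨe s hs]; exact s3
      · apply heqm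
        simp only [bF]
        rw [← hN, ← hD]; simp
  refine ⟨m, hm, c, hc0, fun t ht => ?_⟩
  have := hall t ht
  simp only [hh, lt_min_iff] at this
  obtain ⟨⟨l1, l2⟩, l3, l4⟩ := this
  exact ⟨hGF' t l1.le l3.le (by linarith), l1, l2, l3, by linarith⟩

/-- Parameter relations at the sonic point. -/
structure PP (k τ m q e g T W σ : ℝ) : Prop where
  hk : 0 < k
  hτ0 : 0 < τ
  hτ1 : τ < 1
  hm : 0 < m
  hq : q = k - m
  hq0 : 0 < q
  hT : T = τ * m
  he : 0 < e
  hg : 0 < g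
  heg : e + g = q - T
  hW : W = m + q * T
  hσ : σ = m * q * (1 - τ)
  hσe : 2 * σ = k * e * (2 - g)
  hgg : g * (2 + e) * k = 2 * (q ^ 2 - τ * m ^ 2)

/-- Formal power series solutions of the desingularised system at the sonic point. -/
structure SER (k m e g T W σ : ℝ) (x L : PowerSeries ℝ) : Prop where
  x0 : coeff 0 x = 0
  x1 : coeff 1 x = 1
  l0 : coeff 0 L = 0
  l1 : coeff 1 L = e
  hx : PowerSeries.C (k * g) * Th x =
    FX (PowerSeries.C k) (PowerSeries.C m) (PowerSeries.C (e + g)) (PowerSeries.C T) x L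
  hL : PowerSeries.C (k * g) * Th L = FL (PowerSeries.C k) (PowerSeries.C σ) (PowerSeries.C W) x L

theorem SER.unique {k m e g T W σ : ℝ} {x L x' L' : PowerSeries ℝ} (hk : k ≠ 0) (hg : g ≠ 0)
    (hσ : 2 * σ = k * e * (2 - g)) (hn : ∀ n : ℕ, 2 ≤ n → g * n ≠ 2 + e)
    (h : SER k m e g T W σ x L) (h' : SER k m e g T W σ x' L') : x = x' ∧ L = L' := by
  have key : ∀ n, coeff n (x - x') = 0 ∧ coeff n (L - L') = 0 := by
    intro n
    induction n using Nat.strong_induction_on with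
    | _ n ih =>
    rcases n with _ | _ | n
    · rw [map_sub, map_sub, h.x0, h'.x0, h.l0, h'.l0]; simp
    · simp [h.x1, h'.x1, h.l1, h'.l1]
    set N := n + 2 with hN
    have lx := fun P => (coeff_low (p := x - x') (n := N) (fun i hi => (ih i hi).1) P).2
    have lL := fun P => (coeff_low (p := L - L') (n := N) (fun i hi => (ih i hi).2) P).2
    have e1 : PowerSeries.C (k * g) * Th (x - x') =
        (x - x') * (PowerSeries.C k * PowerSeries.C (e + g)
          + (PowerSeries.C k * PowerSeries.C T - PowerSeries.C m * PowerSeries.C (e + g)) * (x + x')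
          + (PowerSeries.C k * (1 + PowerSeries.C T) + PowerSeries.C m) * L
          - (PowerSeries.C k * PowerSeries.C T + PowerSeries.C m * (1 + PowerSeries.C T)) * ((x + x') * L)
          + PowerSeries.C m * PowerSeries.C T * ((x ^ 2 + x * x' + x' ^ 2) * (L - 1)))
        + (L - L') * (- PowerSeries.C k + (PowerSeries.C k * (1 + PowerSeries.C T) + PowerSeries.C m) * x'
          - (PowerSeries.C k * PowerSeries.C T + PowerSeries.C m * (1 + PowerSeries.C T)) * x' ^ 2
          + PowerSeries.C m * PowerSeries.C T * x' ^ 3) := by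
      rw [Th_sub, mul_sub, h.hx, h'.hx]; unfold FX; ring
    have e2 : PowerSeries.C (k * g) * Th (L - L') =
        (x - x') * (- 2 * PowerSeries.C σ + (2 * PowerSeries.C σ - 2 * PowerSeries.C W) * L
           + 2 * PowerSeries.C W * L ^ 2)
        + (L - L') * (2 * PowerSeries.C k - 2 * PowerSeries.C k * (L + L')
           + (2 * PowerSeries.C σ - 2 * PowerSeries.C W) * x' + 2 * PowerSeries.C W * (x' * (L + L'))) := by
      rw [Th_sub, mul_sub, h.hL, h'.hL]; unfold FL; ring
    have z : ∀ p : PowerSeries ℝ, coeff 0 p = PowerSeries.constantCoeff p := fun p => by simp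
    have a0 : PowerSeries.constantCoeff x = 0 := by rw [← z]; exact h.x0
    have a1 : PowerSeries.constantCoeff x' = 0 := by rw [← z]; exact h'.x0
    have a2 : PowerSeries.constantCoeff L = 0 := by rw [← z]; exact h.l0
    have a3 : PowerSeries.constantCoeff L' = 0 := by rw [← z]; exact h'.l0
    have c1 := congrArg (coeff N) e1
    have c2 := congrArg (coeff N) e2
    rw [map_add, lx, lL, PowerSeries.coeff_C_mul, coeff_Th, z, z] at c1 c2
    set dx := coeff N (x - x')
    set dL := coeff N (L - L')
    simp only [map_add, map_sub, map_mul, map_pow, map_neg, map_one, map_ofNat, a0, a1, a2, a3,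
      PowerSeries.constantCoeff_C] at c1 c2
    have d1 : dL = (e + g - g * N) * dx := by
      have : k * dL = k * ((e + g - g * N) * dx) := by linear_combination c1
      exact mul_left_cancel₀ hk this
    have d2 : k * ((g * N - g) * (g * N - (2 + e)) * dx) = 0 := by
      rw [d1] at c2
      linear_combination -c2 + dx * hσ
    have d3 : (g * N - g) ≠ 0 := by
      have : (N:ℝ) - 1 ≠ 0 := by
        have : (0:ℝ) ≤ n := n.cast_nonneg
        have : (N:ℝ) = n + 2 := by rw [hN]; push_cast; ring
        intro h0; linarith
      intro h0
      exact (mul_ne_zero hg this) (by linarith)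
    have d4 := sub_ne_zero.mpr (hn N (by lia))
    have dx0 : dx = 0 := by
      have := (mul_eq_zero.mp d2).resolve_left hk
      exact (mul_eq_zero.mp this).resolve_left (mul_ne_zero d3 d4)
    exact ⟨dx0, by rw [d1, dx0, mul_zero]⟩
  constructor
  · ext n; have := (key n).1; rw [map_sub] at this; linarith
  · ext n; have := (key n).2; rw [map_sub] at this; linarith

def EV (p : PowerSeries ℝ) (r θ y : ℝ) : Prop := AS p r ∧ pev p θ = y

section
variable {p p' : PowerSeries ℝ} {r θ y y' : ℝ}
theorem EV.add (hθ : |θ| ≤ r) (h : EV p r θ y) (h' : EV p' r θ y') : EV (p + p') r θ (y + y') :=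
  ⟨h.1.add h'.1 ((abs_nonneg _).trans hθ), by rw [pev_add h.1 h'.1 hθ, h.2, h'.2]⟩
theorem EV.sub (hθ : |θ| ≤ r) (h : EV p r θ y) (h' : EV p' r θ y') : EV (p - p') r θ (y - y') :=
  ⟨h.1.sub h'.1 ((abs_nonneg _).trans hθ), by rw [pev_sub h.1 h'.1 hθ, h.2, h'.2]⟩
theorem EV.mul (hθ : |θ| ≤ r) (h : EV p r θ y) (h' : EV p' r θ y') : EV (p * p') r θ (y * y') :=
  ⟨h.1.mul h'.1 ((abs_nonneg _).trans hθ), by rw [pev_mul h.1 h'.1 hθ, h.2, h'.2]⟩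
theorem EV.C (c : ℝ) : EV (PowerSeries.C c) r θ c := ⟨AS.C c r, pev_C c θ⟩
theorem EV.one : EV 1 r θ 1 := by simpa using EV.C (r := r) (θ := θ) 1
theorem EV.two : EV 2 r θ 2 := by
  have := EV.C (r := r) (θ := θ) 2
  rwa [map_ofNat] at this
theorem EV.sq (hθ : |θ| ≤ r) (h : EV p r θ y) : EV (p ^ 2) r θ (y ^ 2) := by
  rw [pow_two, pow_two]; exact EV.mul hθ h h
end

theorem SER.ode {k m e g T W σ r θ : ℝ} {x L : PowerSeries ℝ} (h : SER k m e g T W σ x L)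
    (hkg : k * g ≠ 0) (ax : AS x r) (aL : AS L r) (hθ : |θ| < r) :
    k * g * (θ * deriv (pev x) θ) = FX k m (e + g) T (pev x θ) (pev L θ) ∧
    k * g * (θ * deriv (pev L) θ) = FL k σ W (pev x θ) (pev L θ) := by
  have hx : EV x r θ (pev x θ) := ⟨ax, rfl⟩
  have hL : EV L r θ (pev L θ) := ⟨aL, rfl⟩
  have hi : (PowerSeries.C (k * g)⁻¹ : PowerSeries ℝ) * PowerSeries.C (k * g) = 1 := by
    rw [← map_mul, inv_mul_cancel₀ hkg, map_one]
  have e1 : EV (FX (PowerSeries.C k) (PowerSeries.C m) (PowerSeries.C (e + g)) (PowerSeries.C T) x L) r θ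
      (FX k m (e + g) T (pev x θ) (pev L θ)) := by
    have hθ' := hθ.le
    unfold FX
    exact ((EV.C k).sub hθ' ((EV.C m).mul hθ' hx)).mul hθ' (((((EV.C _).mul hθ' hx).sub hθ' hL).add hθ'
      ((EV.C T).mul hθ' (hx.sq hθ'))).add hθ' (((EV.one.add hθ' (EV.C T)).mul hθ' hx).mul hθ' hL) |>.sub hθ'
      (((EV.C T).mul hθ' (hx.sq hθ')).mul hθ' hL))
  have e2 : EV (FL (PowerSeries.C k) (PowerSeries.C σ) (PowerSeries.C W) x L) r θ
      (FL k σ W (pev x θ) (pev L θ)) := by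
    have hθ' := hθ.le
    unfold FL
    exact (EV.two.mul hθ' (EV.one.sub hθ' hL)).mul hθ' ((((EV.C k).mul hθ' hL).sub hθ' ((EV.C σ).mul hθ' hx)).sub hθ'
      (((EV.C W).mul hθ' hx).mul hθ' hL))
  have t1 : Th x = PowerSeries.C (k * g)⁻¹ * FX (PowerSeries.C k) (PowerSeries.C m) (PowerSeries.C (e + g)) (PowerSeries.C T) x L := by
    rw [← h.hx, ← mul_assoc, hi, one_mul]
  have t2 : Th L = PowerSeries.C (k * g)⁻¹ * FL (PowerSeries.C k) (PowerSeries.C σ) (PowerSeries.C W) x L := by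
    rw [← h.hL, ← mul_assoc, hi, one_mul]
  constructor
  · rw [pev_deriv ax (by rw [t1]; exact e1.1.C_mul _) hθ, t1, pev_C_mul, e1.2, mul_inv_cancel_left₀ hkg]
  · rw [pev_deriv aL (by rw [t2]; exact e2.1.C_mul _) hθ, t2, pev_C_mul, e2.2, mul_inv_cancel_left₀ hkg]

/-- The analytic curve through the sonic point. -/
noncomputable def cP (m q : ℝ) (x L : PowerSeries ℝ) (θ : ℝ) : ℝ × ℝ :=
  (√(1 - pev L θ), m / q * √(1 - pev L θ) * (1 - pev x θ))

theorem qN_eq {k τ m q e g T W σ a b x : ℝ} (P : PP k τ m q e g T W σ) (hb : b = m / q * a * (1 - x)) :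
    q * NN k m a b = q * m * a * x := by
  have hqb : q * b = m * a * (1 - x) := by rw [hb]; field_simp [P.hq0.ne']
  unfold NN; rw [← P.hq]; linear_combination -q * hqb

theorem qD_eq {k τ m q e g T W σ a b x L : ℝ} (P : PP k τ m q e g T W σ) (hL : L = 1 - a ^ 2)
    (hb : b = m / q * a * (1 - x)) :
    q * DD k τ m a b = a * (k * L - σ * x - W * x * L) := by
  have hqb : q * b = m * a * (1 - x) := by rw [hb]; field_simp [P.hq0.ne']
  have hN := qN_eq P hb
  have hk : k = q + m := by linarith [P.hq]
  unfold DD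
  rw [hL, P.hσ, P.hW, P.hT]
  rw [hk] at hN ⊢
  linear_combination (1 - a ^ 2) * hqb - (1 - τ * a ^ 2) * hN

theorem b_alg {k τ m q e g T W σ a X Y : ℝ} (hq0 : q ≠ 0) (hk : k = q + m) (heg : e + g = q - T)
    (hT : T = τ * m) (hW : W = m + q * T) (hσ : σ = m * q * (1 - τ)) (hY : Y = 1 - a ^ 2) :
    m / q * -(a * (k * Y - σ * X - W * X * Y)) * (1 - X) +
      m / q * a * -FX k m (e + g) T X Y =
    -((1 - τ * (m / q * a * (1 - X)) ^ 2) * (q * m * a * X)) := by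
  rw [hW, hσ, FX, heg, hT, hk, hY]
  field_simp
  ring

theorem cP_flow {k τ m q e g T W σ r : ℝ} (P : PP k τ m q e g T W σ) {x L : PowerSeries ℝ}
    (h : SER k m e g T W σ x L) (ax : AS x r) (aL : AS L r) {s t : ℝ}
    (hs : |s * exp (k * g * t)| < r) (hL1 : pev L (s * exp (k * g * t)) < 1) :
    HasDerivAt (fun t => cP m q x L (s * exp (k * g * t)))
      (bF k τ (m, cP m q x L (s * exp (k * g * t)))) t := by
  set θ := s * exp (k * g * t) with hθ
  have hkg : k * g ≠ 0 := (mul_pos P.hk P.hg).ne'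
  obtain ⟨o1, o2⟩ := h.ode hkg ax aL hs
  have hθd : HasDerivAt (fun t => s * exp (k * g * t)) (k * g * θ) t := by
    have := (((hasDerivAt_id t).const_mul (k * g)).exp).const_mul s
    refine this.congr_deriv ?_
    simp only [hθ, id]; ring
  have dx : HasDerivAt (fun t => pev x (s * exp (k * g * t))) (FX k m (e + g) T (pev x θ) (pev L θ)) t := by
    have := (pev_analytic ax hs).differentiableAt.hasDerivAt.comp t hθd
    refine this.congr_deriv ?_
    rw [← o1]; ring
  have dL : HasDerivAt (fun t => pev L (s * exp (k * g * t))) (FL k σ W (pev x θ) (pev L θ)) t := by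
    have := (pev_analytic aL hs).differentiableAt.hasDerivAt.comp t hθd
    refine this.congr_deriv ?_
    rw [← o2]; ring
  set X := pev x θ with hX
  set Y := pev L θ with hY
  have hpos : 0 < 1 - Y := by linarith
  set a := √(1 - Y) with ha
  have ha0 : 0 < a := Real.sqrt_pos.mpr hpos
  have ha2 : a ^ 2 = 1 - Y := Real.sq_sqrt hpos.le
  have da : HasDerivAt (fun t => √(1 - pev L (s * exp (k * g * t)))) (-(a * (k * Y - σ * X - W * X * Y))) t := by
    have := (dL.const_sub 1).sqrt hpos.ne'
    refine this.congr_deriv ?_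
    rw [← hθ, ← hY, ← ha, div_eq_iff (by positivity)]
    unfold FL
    linear_combination (-2 * (k * Y - σ * X - W * X * Y)) * (-ha2)
  have hDe := qD_eq P (a := a) (L := Y) (x := X) (b := m / q * a * (1 - X)) (by linarith) rfl
  have hNe := qN_eq P (a := a) (x := X) (b := m / q * a * (1 - X)) rfl
  have db := (da.const_mul (m / q)).mul (dx.const_sub 1)
  refine (da.prodMk db).congr_deriv ?_
  have hval : cP m q x L θ = (a, m / q * a * (1 - X)) := rfl
  simp only [hval, bF, ← P.hq]
  refine Prod.ext ?_ ?_
  · simp only; rw [hDe]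
  · simp only [← hθ, ← hX, ← hY, ← ha]
    have hqN : q * ((1 - τ * (m / q * a * (1 - X)) ^ 2) * NN k m a (m / q * a * (1 - X)))
       = (1 - τ * (m / q * a * (1 - X)) ^ 2) * (q * m * a * X) := by rw [← hNe]; ring
    rw [hqN]
    exact b_alg P.hq0.ne' (by linarith [P.hq]) P.heg P.hT P.hW P.hσ (by linarith)

noncomputable def eF (k τ m : ℝ) : ℝ :=
  (-(2 - (k - m) + τ * m) + √((2 - (k - m) + τ * m) ^ 2 + 8 * (m * (k - m) * (1 - τ)) / k)) / 2
noncomputable def gF (k τ m : ℝ) : ℝ := (k - m) - τ * m - eF k τ m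
def PPm (k τ m : ℝ) : Prop :=
  PP k τ m (k - m) (eF k τ m) (gF k τ m) (τ * m) (m + (k - m) * (τ * m)) (m * (k - m) * (1 - τ))

theorem eF_cont (k τ : ℝ) : Continuous (eF k τ) := by unfold eF; fun_prop
theorem gF_cont (k τ : ℝ) : Continuous (gF k τ) := by
  have := eF_cont k τ
  unfold gF; fun_prop

theorem eF_eq {k τ m : ℝ} (hk : 0 < k) (hτ1 : τ < 1) (hm : 0 ≤ m) (hmk : m ≤ k) :
    0 ≤ eF k τ m ∧ k * (eF k τ m * (eF k τ m + (2 - (k - m) + τ * m))) = 2 * (m * (k - m) * (1 - τ)) ∧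
    0 ≤ eF k τ m + (2 - (k - m) + τ * m) ∧ (0 < m → m < k → 0 < eF k τ m) := by
  set c := 2 - (k - m) + τ * m with hc
  set σ := m * (k - m) * (1 - τ) with hσ
  have hσ0 : 0 ≤ σ := mul_nonneg (mul_nonneg hm (by linarith)) (by linarith)
  have hd : 0 ≤ 8 * σ / k := by positivity
  have hs := Real.sq_sqrt (show 0 ≤ c ^ 2 + 8 * σ / k by positivity)
  have hsc : |c| ≤ √(c ^ 2 + 8 * σ / k) := Real.abs_le_sqrt (by linarith)
  have he : eF k τ m = (-c + √(c ^ 2 + 8 * σ / k)) / 2 := rfl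
  set S := √(c ^ 2 + 8 * σ / k)
  refine ⟨?_, ?_, ?_, ?_⟩
  · rw [he]; linarith [le_abs_self c]
  · rw [he]
    have : k * S ^ 2 = k * c ^ 2 + 8 * σ := by rw [hs]; field_simp
    linear_combination this / 4
  · rw [he]; linarith [neg_abs_le c]
  · intro h1 h2
    have : 0 < σ := mul_pos (mul_pos h1 (by linarith)) (by linarith)
    have hd : 0 < 8 * σ / k := by positivity
    have : |c| < S := by
      rw [← Real.sqrt_sq_eq_abs]
      exact Real.sqrt_lt_sqrt (by positivity) (by linarith)
    rw [he]; linarith [le_abs_self c]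

theorem PPm_of {k τ m : ℝ} (hk : 0 < k) (hτ0 : 0 < τ) (hτ1 : τ < 1) (hm : 0 < m) (hmk : m < k)
    (hg : 0 < gF k τ m) : PPm k τ m := by
  obtain ⟨h1, h2, h3, h4⟩ := eF_eq hk hτ1 hm.le hmk.le
  refine ⟨hk, hτ0, hτ1, hm, rfl, by linarith, rfl, h4 hm hmk, hg, by unfold gF; ring, rfl, rfl, ?_, ?_⟩
  · unfold gF; linear_combination -h2
  · unfold gF; linear_combination -h2

theorem gF_rel {k τ m : ℝ} (hk : 0 < k) (hτ1 : τ < 1) (hm : 0 ≤ m) (hmk : m ≤ k) :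
    gF k τ m * (2 + eF k τ m) * k = 2 * ((k - m) ^ 2 - τ * m ^ 2) ∧
    2 * (k - m) ^ 2 - (k - m) * (k + gF k τ m + eF k τ m) + k * eF k τ m * (2 - gF k τ m) / 2 = 0 := by
  obtain ⟨h1, h2, h3, h4⟩ := eF_eq hk hτ1 hm hmk
  constructor
  · unfold gF; linear_combination -h2
  · unfold gF; linear_combination h2 / 2

/-- Locating the window `3 ≤ R ≤ 4`. -/
theorem window {k τ ms : ℝ} (hk : 0 < k) (hτ0 : 0 < τ) (hτ1 : τ < 1) (hms : 0 ≤ ms)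
    (hms' : ms ≤ k / (1 + √τ))
    (h3 : 2 + eF k τ ms - 3 * gF k τ ms < 0) (h4 : 0 < 4 * gF k τ ms - 2 - eF k τ ms) :
    ∃ m3 m4, ms < m3 ∧ m3 < m4 ∧ m4 < k / (1 + √τ) ∧ 2 + eF k τ m3 - 3 * gF k τ m3 = 0 ∧
      4 * gF k τ m4 - 2 - eF k τ m4 = 0 ∧
      (∀ m ∈ Ioc m3 m4, 0 < 2 + eF k τ m - 3 * gF k τ m) ∧
      (∀ m ∈ Ico m3 m4, 0 < 4 * gF k τ m - 2 - eF k τ m) ∧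
      (∀ m ∈ Icc m3 m4, PPm k τ m) := by
  have hr : 0 < √τ := Real.sqrt_pos.mpr hτ0
  have hr2 : √τ ^ 2 = τ := Real.sq_sqrt hτ0.le
  set M := k / (1 + √τ) with hM
  have hMe : M * (1 + √τ) = k := by rw [hM]; field_simp
  have hM0 : 0 < M := by positivity
  have hMk : M < k := by nlinarith
  have hgM : gF k τ M = 0 := by
    have h1 := (gF_rel hk hτ1 hM0.le hMk.le).1
    have h2 : (k - M) ^ 2 - τ * M ^ 2 = 0 := by
      have : k - M = M * √τ := by linarith
      rw [this, mul_pow, hr2]; ring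
    rw [h2, mul_zero] at h1
    have h3 := (eF_eq hk hτ1 hM0.le hMk.le).1
    rcases mul_eq_zero.mp h1 with h | h
    · rcases mul_eq_zero.mp h with h | h
      · exact h
      · linarith
    · linarith
  have hce := eF_cont k τ
  have hcg := gF_cont k τ
  obtain ⟨t4, ht4, hz4, hl4⟩ := first_exit (fun t => 4 * gF k τ (ms + t) - 2 - eF k τ (ms + t))
    (by fun_prop) (by simpa using h4)
    ⟨M - ms, by linarith, by
      have := (eF_eq hk hτ1 hM0.le hMk.le).1
      simp only [add_sub_cancel, hgM]; linarith⟩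
  have ht4M : ms + t4 < M := by
    by_contra hcon
    push Not at hcon
    rcases hcon.lt_or_eq with hc | hc
    · have := hl4 (M - ms) ⟨by linarith, by linarith⟩
      simp only [add_sub_cancel, hgM] at this
      linarith [(eF_eq hk hτ1 hM0.le hMk.le).1]
    · have := hz4
      simp only [← hc, hgM] at this
      linarith [(eF_eq hk hτ1 hM0.le hMk.le).1]
  obtain ⟨t3, ht3, hz3, hl3⟩ := first_exit (fun t => 2 + eF k τ (ms + t4 - t) - 3 * gF k τ (ms + t4 - t))
    (by fun_prop) (by
      have := (eF_eq hk hτ1 (show 0 ≤ ms + t4 by linarith) (by linarith)).1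
      simp only [sub_zero]; linarith)
    ⟨t4, ht4.le, by simp only [add_sub_cancel_right]; exact h3.le⟩
  have ht34 : t3 < t4 := by
    by_contra hcon
    push Not at hcon
    rcases hcon.lt_or_eq with hc | hc
    · have := hl3 t4 ⟨ht4.le, hc⟩
      simp only [add_sub_cancel_right] at this; linarith
    · simp only [← hc, add_sub_cancel_right] at hz3; linarith
  have p3 : ∀ m ∈ Ioc (ms + t4 - t3) (ms + t4), 0 < 2 + eF k τ m - 3 * gF k τ m := by
    intro m hm
    have := hl3 (ms + t4 - m) ⟨by linarith [hm.2], by linarith [hm.1]⟩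
    simpa using this
  have p4 : ∀ m ∈ Ico (ms + t4 - t3) (ms + t4), 0 < 4 * gF k τ m - 2 - eF k τ m := by
    intro m hm
    have := hl4 (m - ms) ⟨by linarith [hm.1], by linarith [hm.2]⟩
    simpa using this
  refine ⟨ms + t4 - t3, ms + t4, by linarith, by linarith, ht4M, hz3, hz4, p3, p4, ?_⟩
  intro m hm
  have hm0 : 0 < m := by linarith [hm.1]
  have hmk : m < k := by linarith [hm.2]
  apply PPm_of hk hτ0 hτ1 hm0 hmk
  have he := (eF_eq hk hτ1 hm0.le hmk.le).1
  rcases hm.2.lt_or_eq with h | h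
  · linarith [p4 m ⟨hm.1, h⟩]
  · rw [h] at he ⊢; linarith

/-- The data needed for the shooting argument. -/
structure WIN (k τ m3 m4 : ℝ) : Prop where
  lt : m3 < m4
  z3 : 2 + eF k τ m3 - 3 * gF k τ m3 = 0
  z4 : 4 * gF k τ m4 - 2 - eF k τ m4 = 0
  p3 : ∀ m ∈ Ioc m3 m4, 0 < 2 + eF k τ m - 3 * gF k τ m
  p4 : ∀ m ∈ Ico m3 m4, 0 < 4 * gF k τ m - 2 - eF k τ m
  pp : ∀ m ∈ Icc m3 m4, PPm k τ m
  iq : ∀ m ∈ Icc m3 m4, Ineq k (k - m) (eF k τ m) (gF k τ m)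
  eg : ∀ m ∈ Icc m3 m4, eF k τ m + gF k τ m ≤ 2

theorem win_exists (k : ℕ) (hk1 : 1 ≤ k) : ∃ δ > 0, δ < 1 ∧ ∀ τ : ℝ, 0 < τ → τ < 1 →
    (1 - δ < τ ∨ k = 1 ∨ k = 2) → ∃ m3 m4, WIN k τ m3 m4 := by
  have hkk : (1:ℝ) ≤ k := by exact_mod_cast hk1
  have hk0 : (0:ℝ) < k := by linarith
  -- closing argument
  have fin : ∀ τ ms : ℝ, 0 < τ → τ < 1 → 0 ≤ ms → ms ≤ k / (1 + √τ) →
      2 + eF k τ ms - 3 * gF k τ ms < 0 → 0 < 4 * gF k τ ms - 2 - eF k τ ms →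
      (∀ m, ms ≤ m → m ≤ k / (1 + √τ) → PPm k τ m → 3 * gF k τ m ≤ 2 + eF k τ m → 2 + eF k τ m ≤ 4 * gF k τ m →
        2 * (k - m) ^ 2 - (k - m) * (k + gF k τ m + eF k τ m) + k * eF k τ m * (2 - gF k τ m) / 2 = 0 →
        Ineq k (k - m) (eF k τ m) (gF k τ m) ∧ eF k τ m + gF k τ m ≤ 2) →
      ∃ m3 m4, WIN k τ m3 m4 := by
    intro τ ms h0 h1 h2 h3 h4 h5 h6
    obtain ⟨m3, m4, a1, a2, a3, a4, a5, a6, a7, a8⟩ := window hk0 h0 h1 h2 h3 h4 h5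
    have both : ∀ m ∈ Icc m3 m4, Ineq k (k - m) (eF k τ m) (gF k τ m) ∧ eF k τ m + gF k τ m ≤ 2 := by
      intro m hm
      have P := a8 m hm
      refine h6 m (by linarith [hm.1]) (by linarith [hm.2]) P ?_ ?_ ?_
      · rcases hm.1.lt_or_eq with h | h
        · linarith [a6 m ⟨h, hm.2⟩]
        · rw [← h]; linarith
      · rcases hm.2.lt_or_eq with h | h
        · linarith [a7 m ⟨hm.1, h⟩]
        · rw [h]; linarith
      · exact (gF_rel hk0 h1 P.hm.le (by have := P.hq0; linarith)).2
    exact ⟨m3, m4, a2, a4, a5, a6, a7, a8, fun m hm => (both m hm).1, fun m hm => (both m hm).2⟩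
  have base : ∀ τ : ℝ, 0 < τ → τ < 1 → (k:ℝ) ≤ 2 → eF k τ 0 = 0 ∧ gF k τ 0 = k := by
    intro τ h0 h1 hk2
    have : eF k τ 0 = 0 := by
      unfold eF
      simp only [sub_zero, mul_zero, add_zero, zero_mul, zero_div]
      rw [Real.sqrt_sq (by linarith)]; ring
    refine ⟨this, ?_⟩
    unfold gF; rw [this]; ring
  have hks : ∀ τ : ℝ, 0 < τ → (0:ℝ) ≤ k / (1 + √τ) := fun τ h => by positivity
  rcases Nat.lt_or_ge k 3 with hk3 | hk3
  · refine ⟨1 / 2, by norm_num, by norm_num, ?_⟩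
    intro τ h0 h1 _
    have h12 : k = 1 ∨ k = 2 := by lia
    rcases h12 with h | h <;> subst h
    · obtain ⟨b1, b2⟩ := base τ h0 h1 (by norm_num)
      refine fin τ 0 h0 h1 le_rfl (hks τ h0) (by rw [b1, b2]; norm_num) (by rw [b1, b2]; norm_num) ?_
      intro m hm hm' P g3 g4 hrel
      have hT : (0:ℝ) < τ * m := mul_pos h0 P.hm
      have heg := P.heg
      push_cast at *
      refine ⟨k1ineq _ _ _ P.he g3 g4 (by linarith) (by linarith), by linarith⟩
    · obtain ⟨b1, b2⟩ := base τ h0 h1 (by norm_num)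
      refine fin τ 0 h0 h1 le_rfl (hks τ h0) (by rw [b1, b2]; norm_num) (by rw [b1, b2]; norm_num) ?_
      intro m hm hm' P g3 g4 hrel
      have hT : (0:ℝ) < τ * m := mul_pos h0 P.hm
      have heg := P.heg
      push_cast at *
      refine ⟨k2ineq _ _ _ P.he g3 g4 (by linarith) (by linarith), by linarith⟩
  · have hk3' : (3:ℝ) ≤ k := by exact_mod_cast hk3
    obtain ⟨ε, hε, hI⟩ := k3ineq (k:ℝ) hk3'
    refine ⟨min (1 / (32 * (k:ℝ))) (ε / (4 * (k:ℝ))), by positivity, ?_, ?_⟩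
    · refine lt_of_le_of_lt (min_le_left _ _) ?_
      rw [div_lt_one (by positivity)]; linarith
    intro τ h0 h1 hc
    have hδ : 1 - τ < min (1 / (32 * (k:ℝ))) (ε / (4 * (k:ℝ))) := by
      rcases hc with h | h | h
      · linarith
      · lia
      · lia
    have hδ1 : (1 - τ) * (32 * k) < 1 := by
      have := lt_of_lt_of_le hδ (min_le_left _ _)
      rwa [lt_div_iff₀ (by positivity)] at this
    have hδ2 : (1 - τ) * (4 * k) < ε := by
      have := lt_of_lt_of_le hδ (min_le_right _ _)
      rwa [lt_div_iff₀ (by positivity)] at this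
    have hδ3 : 1 - τ < 1 / 32 := by nlinarith
    have hr1 : √τ < 1 := by rw [Real.sqrt_lt' one_pos]; linarith
    have hr2 : 1 / 3 ≤ √τ := Real.le_sqrt_of_sq_le (by norm_num; linarith)
    have hebd : ∀ m, ((k:ℝ) - 1) / 2 ≤ m → m ≤ k → eF k τ m ≤ 4 * k * (1 - τ) := by
      intro m hm hm'
      have hm0 : 0 ≤ m := by linarith
      obtain ⟨e1, e2, -, -⟩ := eF_eq hk0 h1 hm0 hm'
      have c1 : 1 / 2 ≤ 2 - (k - m) + τ * m := by nlinarith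
      have c2 : eF k τ m * (1 / 2) ≤ eF k τ m * (eF k τ m + (2 - (k - m) + τ * m)) :=
        mul_le_mul_of_nonneg_left (by linarith) e1
      have c3 : m * (k - m) ≤ k * k := by nlinarith
      have c4 : m * (k - m) * (1 - τ) ≤ k * k * (1 - τ) := mul_le_mul_of_nonneg_right c3 (by linarith)
      have c5 : k * (eF k τ m * (1 / 2)) ≤ k * (2 * k * (1 - τ)) := by
        have := mul_le_mul_of_nonneg_left c2 hk0.le
        linarith
      have := le_of_mul_le_mul_left c5 hk0
      linarith
    have hms : ((k:ℝ) - 1) / 2 ≤ k / (1 + √τ) := by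
      rw [le_div_iff₀ (by positivity)]; nlinarith
    have hmk : (k:ℝ) / (1 + √τ) ≤ 3 / 4 * k := by
      rw [div_le_iff₀ (by positivity)]; nlinarith
    have hb := hebd (((k:ℝ) - 1) / 2) le_rfl (by linarith)
    have hgm : 1 - eF k τ (((k:ℝ) - 1) / 2) ≤ gF k τ (((k:ℝ) - 1) / 2) := by
      unfold gF; nlinarith
    refine fin τ (((k:ℝ) - 1) / 2) h0 h1 (by linarith) hms (by linarith) (by linarith) ?_
    intro m hm hm' P g3 g4 hrel
    have he := hebd m hm (by linarith)
    refine ⟨hI _ _ _ P.he (by linarith) g3 g4 (by linarith) (by linarith [P.hm]) hrel, by linarith⟩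

/-- The system of identities for the series at the parameter `m`. -/
abbrev SERm (k τ m : ℝ) (x L : PowerSeries ℝ) : Prop :=
  SER k m (eF k τ m) (gF k τ m) (τ * m) (m + (k - m) * (τ * m)) (m * (k - m) * (1 - τ)) x L

/-- Quantity whose sign is the sign of `D` along the curve. -/
def Dq (k τ m x L : ℝ) : ℝ := k * L - m * (k - m) * (1 - τ) * x - (m + (k - m) * (τ * m)) * x * L

lemma est {k e g ω σ W Wm E θ x L y : ℝ} (hk : 0 < k) (he : 0 < e) (hg : 1/2 ≤ g) (hg1 : g ≤ 1) (heg : e + g ≤ 2)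
    (hω : ω * (2 + e - g) = 1) (hσ : 2 * σ = k * e * (2 - g)) (hW : |W| ≤ Wm) (hθ : 0 < θ) (hE : E * θ ≤ 1)
    (hy : |y| ≤ 8) (h1 : |x - θ + ω * (y * θ)| ≤ E * θ^2) (h2 : |L - e * x - y * θ| ≤ E * θ^2) :
    |x| ≤ 10 * θ ∧ |L| ≤ 29 * θ ∧
      |k * L - σ * x - W * x * L - k * θ * (e * g / 2 * (1 - ω * y) + y)| ≤ (2 * k * E + 290 * Wm) * θ^2 := by
  have hω0 : 0 < ω := by
    by_contra h; push Not at h; nlinarith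
  have hω1 : ω ≤ 1 := by nlinarith
  have hEθ : E * θ^2 ≤ θ := by nlinarith
  have hE0 : 0 ≤ E * θ^2 := le_trans (abs_nonneg _) h1
  have hωy : |ω * y| ≤ 8 := by
    rw [abs_mul, abs_of_pos hω0]; nlinarith [abs_nonneg y]
  have hwyθ : |ω * (y * θ)| ≤ 8 * θ := by
    rw [← mul_assoc, abs_mul, abs_of_pos hθ]; exact mul_le_mul_of_nonneg_right hωy hθ.le
  have hyθ : |y * θ| ≤ 8 * θ := by
    rw [abs_mul, abs_of_pos hθ]; exact mul_le_mul_of_nonneg_right hy hθ.le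
  have hx : |x| ≤ 10 * θ := by
    rw [abs_le] at *; constructor <;> linarith [h1.1, h1.2, hwyθ.1, hwyθ.2]
  have hex : |e * x| ≤ 20 * θ := by
    rw [abs_mul, abs_of_pos he]; nlinarith [abs_nonneg x]
  have hL : |L| ≤ 29 * θ := by
    rw [abs_le] at *; constructor <;> linarith [h2.1, h2.2, hyθ.1, hyθ.2, hex.1, hex.2]
  refine ⟨hx, hL, ?_⟩
  have id : k * L - σ * x - W * x * L - k * θ * (e * g / 2 * (1 - ω * y) + y) =
      k * (L - e * x - y * θ) + (k * (e * g / 2)) * (x - θ + ω * (y * θ)) - W * (x * L) := by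
    linear_combination (-(1/2)) * x * hσ
  rw [id]
  have t1 : |k * (L - e * x - y * θ)| ≤ k * (E * θ^2) := by
    rw [abs_mul, abs_of_pos hk]; exact mul_le_mul_of_nonneg_left h2 hk.le
  have heg2 : e * g / 2 ≤ 1 := by nlinarith
  have t2 : |(k * (e * g / 2)) * (x - θ + ω * (y * θ))| ≤ k * (E * θ^2) := by
    rw [abs_mul, abs_of_pos (by positivity)]
    exact mul_le_mul (by nlinarith) h1 (abs_nonneg _) hk.le
  have t3 : |W * (x * L)| ≤ Wm * (290 * θ^2) := by
    rw [abs_mul, abs_mul]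
    have : |x| * |L| ≤ (10 * θ) * (29 * θ) := mul_le_mul hx hL (abs_nonneg _) (by linarith)
    exact mul_le_mul hW (by nlinarith) (by positivity) (le_trans (abs_nonneg _) hW)
  have := abs_sub (k * (L - e * x - y * θ) + (k * (e * g / 2)) * (x - θ + ω * (y * θ))) (W * (x * L))
  have := abs_add_le (k * (L - e * x - y * θ)) ((k * (e * g / 2)) * (x - θ + ω * (y * θ)))
  linarith

lemma WIN.bds {k τ m3 m4 m : ℝ} (w : WIN k τ m3 m4) (hm : m ∈ Icc m3 m4) :
    0 < m ∧ m < k ∧ 0 < τ ∧ τ < 1 ∧ 0 < eF k τ m ∧ 1/2 ≤ gF k τ m ∧ gF k τ m ≤ 1 ∧ eF k τ m + gF k τ m ≤ 2 ∧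
      3 * gF k τ m ≤ 2 + eF k τ m ∧ 2 + eF k τ m ≤ 4 * gF k τ m := by
  have P := w.pp m hm
  unfold PPm at P
  have h3 : 3 * gF k τ m ≤ 2 + eF k τ m := by
    rcases hm.1.lt_or_eq with h | h
    · linarith [w.p3 m ⟨h, hm.2⟩]
    · rw [← h]; linarith [w.z3]
  have h4 : 2 + eF k τ m ≤ 4 * gF k τ m := by
    rcases hm.2.lt_or_eq with h | h
    · linarith [w.p4 m ⟨hm.1, h⟩]
    · rw [h]; linarith [w.z4]
  have := P.he
  have := w.eg m hm
  refine ⟨P.hm, by linarith [P.hq0], P.hτ0, P.hτ1, P.he, by linarith, by linarith, w.eg m hm, h3, h4⟩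

/-- Local expansion data. -/
def LOC (k τ m C : ℝ) (n0 : ℕ) (x L : PowerSeries ℝ) : Prop :=
  ∀ c, c = coeff n0 L - eF k τ m * coeff n0 x → ∀ θ1, 0 < θ1 → C * θ1 ≤ 1 → |c| * θ1^(n0-1) ≤ 8 →
    AS x (2 * θ1) ∧ AS L (2 * θ1) ∧
    (∀ n, |coeff n x| * (2 * θ1)^n ≤ 2 ∧ |coeff n L| * (2 * θ1)^n ≤ 2) ∧ ∀ θ ∈ Ioc 0 θ1,
      |pev x θ - θ * (1 - (2 + eF k τ m - gF k τ m)⁻¹ * (c * θ^(n0-1)))| ≤ C * θ^2 ∧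
      |pev L θ - eF k τ m * pev x θ - c * θ^(n0-1) * θ| ≤ C * θ^2 ∧ |pev x θ| ≤ 10 * θ ∧ |pev L θ| ≤ 29 * θ ∧
      |Dq k τ m (pev x θ) (pev L θ) - k * θ * (eF k τ m * gF k τ m / 2 * (1 - (2 + eF k τ m - gF k τ m)⁻¹ * (c * θ^(n0-1))) + c * θ^(n0-1))|
        ≤ C * θ^2

theorem winseries {k τ m3 m4 : ℝ} (w : WIN k τ m3 m4) {K : Set ℝ} (hK : K ⊆ Icc m3 m4) (n0 : ℕ) (h3 : 2 ≤ n0) (h4 : n0 ≤ 4)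
    (κ : ℝ) (hκ : 0 ≤ κ)
    (hR : ∀ m ∈ K, ∀ n : ℕ, 2 ≤ n → n ≠ n0 → 1 ≤ κ * |(n:ℝ) - (2 + eF k τ m) * (gF k τ m)⁻¹|)
    (hR0 : ∀ m ∈ K, (n0:ℝ) ≠ (2 + eF k τ m) * (gF k τ m)⁻¹) :
    ∃ x L : ℝ → PowerSeries ℝ, (∀ n, ContinuousOn (fun m => coeff n (x m)) K) ∧
     (∀ n, ContinuousOn (fun m => coeff n (L m)) K) ∧
     (∀ m ∈ K, SERm k τ m (x m) (L m)) ∧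
     ∃ C > 2, ∀ m ∈ K, (∀ i < n0, |coeff i (x m)| ≤ C ∧ |coeff i (L m)| ≤ C) ∧
      LOC k τ m C n0 (x m) (L m) := by
  have hc := eF_cont k τ
  have hgc := gF_cont k τ
  obtain ⟨-, hb2, hτ0, hτ1, -⟩ := w.bds (left_mem_Icc.2 w.lt.le)
  have hk : 0 < k := (w.pp m3 (left_mem_Icc.2 w.lt.le)).hk
  have bc : ∀ f : ℝ → ℝ, Continuous f → BC K f := fun f hf => BC.of_compact isCompact_Icc hK hf.continuousOn
  have hgi : BC K fun m => (gF k τ m)⁻¹ := by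
    refine BC.of_compact isCompact_Icc hK (hgc.continuousOn.inv₀ fun m hm => ?_)
    have := (w.bds hm).2.2.2.2.2.1; linarith
  have hd : ∀ m ∈ Icc m3 m4, 2 + eF k τ m - gF k τ m ≠ 0 := by
    intro m hm
    obtain ⟨-, -, -, -, h5, h6, h7, -⟩ := w.bds hm
    linarith
  have hωc : BC K fun m => (2 + eF k τ m - gF k τ m)⁻¹ :=
    BC.of_compact isCompact_Icc hK (ContinuousOn.inv₀ (by fun_prop) hd)
  obtain ⟨x, L, c1, c2, h1, C, hC, h2⟩ := P1series (K := K) hk (e := eF k τ) (g := gF k τ) (T := fun m => τ * m)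
    (W := fun m => m + (k - m) * (τ * m)) (σ := fun m => m * (k - m) * (1 - τ)) (ω := fun m => (2 + eF k τ m - gF k τ m)⁻¹)
    (bc _ hc) (bc _ hgc) hgi (bc _ (by fun_prop)) (bc _ (by fun_prop)) (bc _ (by fun_prop)) hωc (bc _ continuous_id)
    (fun m hm => by have := (w.bds (hK hm)).2.2.2.2.2.1; linarith) (fun m hm => inv_mul_cancel₀ (hd m (hK hm)))
    (fun m hm => by have := (w.pp m (hK hm)).hσe; linarith) n0 h3 κ hκ hR hR0
  have hWm : ∀ m ∈ Icc m3 m4, |m + (k - m) * (τ * m)| ≤ k + k * k := by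
    intro m hm
    obtain ⟨b1, b2, b3, b4, -⟩ := w.bds hm
    have : τ * m ≤ k := by nlinarith
    have t0 : 0 < τ * m := mul_pos b3 b1
    rw [abs_of_pos (by nlinarith)]
    nlinarith
  set E := C * 65^2 with hE
  have hE0 : 0 < E := by positivity
  refine ⟨x, L, c1, c2, fun m hm => ?_, 2 * k * E + 290 * (k + k * k) + E + 130 * C + 2, by nlinarith [mul_pos hk hE0, mul_pos hk hk], fun m hm => ⟨fun i hi => ?_, ?_⟩⟩
  · obtain ⟨a1, a2, a3, a4, a5, a6⟩ := h1 m hm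
    exact ⟨a1, a2, a3, a4, a5, a6⟩
  · obtain ⟨a1, a2⟩ := (h2 m hm).1 i hi
    have : 0 < 2 * k * E + 290 * (k + k * k) + E + 130 * C + 2 - C := by
      have := mul_pos hk hE0
      have := mul_pos hk hk
      linarith
    constructor <;> linarith
  intro c hcc θ1 hθ1 hCθ hcθ
  set C' := 2 * k * E + 290 * (k + k * k) + E + 130 * C + 2 with hC'
  have q1 := mul_pos hk hE0
  have q2 := mul_pos hk hk
  have b1 : 2 * θ1 ≤ 1 := by nlinarith
  have b2 : C * (2 * θ1 * 65) ≤ 1 := by nlinarith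
  have b3 : E * θ1 ≤ 1 := by nlinarith
  have e1 : (2 * θ1)^n0 = 2^(n0-1) * θ1^(n0-1) * (2 * θ1) := by
    obtain ⟨j, rfl⟩ : ∃ j, n0 = j + 1 := ⟨n0 - 1, by lia⟩
    simp only [Nat.add_sub_cancel]; ring
  have e2 : (2:ℝ)^(n0-1) ≤ 8 := by
    calc (2:ℝ)^(n0-1) ≤ 2^3 := pow_le_pow_right₀ (by norm_num) (by lia)
      _ = 8 := by norm_num
  have e3 : |c| * (2 * θ1)^n0 ≤ 64 * (2 * θ1) := by
    rw [e1]
    have : |c| * (2^(n0-1) * θ1^(n0-1)) ≤ 64 := by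
      calc |c| * (2^(n0-1) * θ1^(n0-1)) = 2^(n0-1) * (|c| * θ1^(n0-1)) := by ring
        _ ≤ 8 * 8 := mul_le_mul e2 hcθ (by positivity) (by norm_num)
        _ = 64 := by norm_num
    calc _ = |c| * (2^(n0-1) * θ1^(n0-1)) * (2 * θ1) := by ring
      _ ≤ _ := mul_le_mul_of_nonneg_right this (by linarith)
  obtain ⟨ax, aL, hnr, hθ⟩ := (h2 m hm).2 c hcc (2 * θ1) ⟨by linarith, b1⟩ (2 * θ1 * 65) (by linarith) b2
  refine ⟨ax, aL, fun n => ?_, fun θ ht => ?_⟩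
  · have hle : ∀ p : PowerSeries ℝ, |coeff n p| * (2 * θ1)^n ≤ nrm (2 * θ1) n p := fun p =>
      Finset.single_le_sum (f := fun n => |coeff n p| * (2 * θ1)^n) (fun i _ => by positivity) (Finset.self_mem_range_succ n)
    exact ⟨(hle _).trans (hnr n).1, (hle _).trans (hnr n).2⟩
  obtain ⟨u1, u2⟩ := hθ θ (by rw [abs_of_pos ht.1]; linarith [ht.2])
  have e4 : 2 * θ1 * 65 / (2 * θ1) = 65 := by field_simp
  rw [e4, ← hE] at u1 u2
  have e5 : c * θ^n0 = c * θ^(n0-1) * θ := by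
    obtain ⟨j, rfl⟩ : ∃ j, n0 = j + 1 := ⟨n0 - 1, by lia⟩
    simp only [Nat.add_sub_cancel]; ring
  rw [e5] at u1 u2
  have e6 : |c * θ^(n0-1)| ≤ 8 := by
    rw [abs_mul, abs_of_pos (pow_pos ht.1 _)]
    exact le_trans (mul_le_mul_of_nonneg_left (pow_le_pow_left₀ ht.1.le ht.2 _) (abs_nonneg _)) hcθ
  have hEC : E ≤ C' := by nlinarith
  have ht2 : 0 < θ^2 := pow_pos ht.1 2
  obtain ⟨-, -, -, -, d5, d6, d7, d8, -⟩ := w.bds (hK hm)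
  obtain ⟨v1, v2, v3⟩ := est (E := E) hk d5 d6 d7 d8 (inv_mul_cancel₀ (hd m (hK hm))) (w.pp m (hK hm)).hσe
    (hWm m (hK hm)) ht.1 (by nlinarith [ht.2]) e6 u1 u2
  refine ⟨?_, ?_, v1, v2, ?_⟩
  · refine le_trans (le_of_eq ?_) (le_trans u1 (mul_le_mul_of_nonneg_right hEC ht2.le))
    congr 1; ring
  · exact le_trans u2 (mul_le_mul_of_nonneg_right hEC ht2.le)
  · unfold Dq
    exact le_trans v3 (mul_le_mul_of_nonneg_right (by linarith) ht2.le)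

lemma root_exists {c A s : ℝ} (n : ℕ) (hn : n ≠ 0) (hA : 0 < A) (hs : 0 < s) (h : A / s^n ≤ c) :
    ∃ t ∈ Ioc 0 s, c * t^n = A := by
  have hc : 0 < c := lt_of_lt_of_le (by positivity) h
  have ht : ((A/c) ^ ((n:ℝ)⁻¹))^n = A/c := Real.rpow_inv_natCast_pow (by positivity) hn
  have hle : A / c ≤ s^n := by
    rw [div_le_iff₀ (by positivity)] at h ⊢; linarith
  refine ⟨(A/c) ^ ((n:ℝ)⁻¹), ⟨by positivity, ?_⟩, by rw [ht]; field_simp⟩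
  rw [← ht] at hle
  exact (pow_le_pow_iff_left₀ (by positivity) hs.le hn).1 hle

lemma om_bd {e g : ℝ} (he : 0 < e) (hg : 1/2 ≤ g) (hg1 : g ≤ 1) (heg : e + g ≤ 2) :
    1/4 ≤ (2 + e - g)⁻¹ ∧ e * g / 2 * (2 + e - g)⁻¹ ≤ 1/2 ∧ e * g / 2 ≤ 1/2 ∧ 0 < e * g / 2 := by
  have h : 0 < 2 + e - g := by linarith
  have hi : 0 < (2 + e - g)⁻¹ := inv_pos.2 h
  refine ⟨?_, ?_, by nlinarith [sq_nonneg (e - g)], by positivity⟩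
  · rw [le_inv_comm₀ (by norm_num) h]; norm_num; linarith
  · rw [← div_eq_mul_inv, div_le_iff₀ h]; nlinarith

section conts
variable {k τ m3 m4 : ℝ}

lemma ca_cont (w : WIN k τ m3 m4) : ContinuousOn (fun m => ca k (k-m) (eF k τ m) (gF k τ m)) (Icc m3 m4) := by
  have hc := eF_cont k τ
  have hgc := gF_cont k τ
  unfold ca
  refine ContinuousOn.div (by fun_prop) (by fun_prop) fun m hm => ?_
  obtain ⟨a1, a2, -, -, a5, a6, a7, -, a9, -⟩ := w.bds hm
  exact (mul_pos (by linarith) (by linarith)).ne'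

lemma cB_cont (w : WIN k τ m3 m4) : ContinuousOn (fun m => cB k (k-m) (eF k τ m) (gF k τ m)) (Icc m3 m4) := by
  have hc := eF_cont k τ
  have hgc := gF_cont k τ
  have := ca_cont w
  unfold cB
  exact ContinuousOn.sub (by fun_prop) (ContinuousOn.div (by fun_prop) this fun m hm => (w.iq m hm).1.ne')

lemma rh_cont (w : WIN k τ m3 m4) : ContinuousOn (fun m => rh k (k-m) (eF k τ m) (gF k τ m)) (Ioc m3 m4) := by
  have hc := eF_cont k τ
  have hgc := gF_cont k τ
  have := (cB_cont w).mono Ioc_subset_Icc_self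
  unfold rh
  refine ContinuousOn.div this (by fun_prop) fun m hm => ?_
  obtain ⟨a1, a2, -⟩ := w.bds (Ioc_subset_Icc_self hm)
  exact (mul_pos (by linarith) (w.p3 m hm)).ne'

lemma pp_cont (w : WIN k τ m3 m4) : ContinuousOn (fun m => pp k (k-m) (eF k τ m) (gF k τ m)) (Ioc m3 m4) := by
  have hc := eF_cont k τ
  have := (ca_cont w).mono Ioc_subset_Icc_self
  have := rh_cont w
  unfold pp
  fun_prop

/-- The quantity `Q3` along the window. -/
noncomputable def Q3m (k τ m : ℝ) : ℝ := Q3 k (gF k τ m) m (eF k τ m) (τ*m) (m + (k-m)*(τ*m))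
  (rh k (k-m) (eF k τ m) (gF k τ m)) (pp k (k-m) (eF k τ m) (gF k τ m))

lemma Q3m_cont (w : WIN k τ m3 m4) : ContinuousOn (Q3m k τ) (Ioc m3 m4) := by
  have hc := eF_cont k τ
  have hgc := gF_cont k τ
  have := rh_cont w
  have := pp_cont w
  unfold Q3m Q3
  fun_prop

/-- All sign informations for the barrier. -/
lemma signs (w : WIN k τ m3 m4) {m : ℝ} (hm : m ∈ Ioc m3 m4) :
    ∃ ρ p, ρ = rh k (k-m) (eF k τ m) (gF k τ m) ∧ p = pp k (k-m) (eF k τ m) (gF k τ m) ∧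
    0 < ca k (k-m) (eF k τ m) (gF k τ m) ∧ 0 < ρ ∧ p < 0 ∧ p = eF k τ m*(ca k (k-m) (eF k τ m) (gF k τ m) - ρ) ∧
    Q1 k (gF k τ m) m (eF k τ m) (τ*m) (m + (k-m)*(τ*m)) ρ p = 0 ∧ Q2 k (gF k τ m) m (eF k τ m) (τ*m) (m + (k-m)*(τ*m)) ρ p = 0 ∧
    0 < Q3 k (gF k τ m) m (eF k τ m) (τ*m) (m + (k-m)*(τ*m)) ρ p ∧
    Q4 k (gF k τ m) m (eF k τ m) (τ*m) (m + (k-m)*(τ*m)) ρ p ≤ 0 ∧ 0 ≤ Q5 k m (eF k τ m) (τ*m) (m + (k-m)*(τ*m)) ρ p ∧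
    Q6 m (τ*m) ρ p ≤ 0 ∧ ∀ x ≤ 0, 0 < k*eF k τ m*gF k τ m/2 + (k*p+k*eF k τ m*(2-gF k τ m)/2*ρ-(m + (k-m)*(τ*m))*eF k τ m)*x
      - (m + (k-m)*(τ*m))*p*x^2 := by
  have hm' := Ioc_subset_Icc_self hm
  obtain ⟨a1, a2, a3, a4, a5, a6, a7, a8, a9, a10⟩ := w.bds hm'
  have P := w.pp m hm'
  unfold PPm at P
  obtain ⟨h1, h2, h3, h4, h5, h6, h7, h8, h9, h10, h11, h12⟩ := Qsigns (w.iq m hm') (by linarith) a5 (by linarith [w.p3 m hm]) a10 (T := τ * m)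
    (mul_pos a3 a1).le (by linarith) (by linarith) a8 (m := m) (by ring) (by linarith [P.heg]) rfl rfl rfl
  exact ⟨_, _, rfl, rfl, h1, h3, h4, h5, h6, h7, h8, h9, h10, h11, h12⟩

lemma SERm.G {m : ℝ} (w : WIN k τ m3 m4) (hm : m ∈ Ioc m3 m4) {x L : PowerSeries ℝ} (h : SERm k τ m x L) {ρ p : ℝ}
    (q1 : Q1 k (gF k τ m) m (eF k τ m) (τ*m) (m + (k-m)*(τ*m)) ρ p = 0) (q2 : Q2 k (gF k τ m) m (eF k τ m) (τ*m) (m + (k-m)*(τ*m)) ρ p = 0) :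
    (∀ i < 4, coeff i (GG (PowerSeries.C (eF k τ m)) (PowerSeries.C ρ) (PowerSeries.C p) x L) = 0) ∧
    (k*(4 * gF k τ m - 2 - eF k τ m)) * coeff 4 (GG (PowerSeries.C (eF k τ m)) (PowerSeries.C ρ) (PowerSeries.C p) x L)
      = - Q3 k (gF k τ m) m (eF k τ m) (τ*m) (m + (k-m)*(τ*m)) ρ p := by
  have hm' := Ioc_subset_Icc_self hm
  have P := w.pp m hm'
  unfold PPm at P
  obtain ⟨a1, a2, a3, a4, a5, a6, a7, a8, a9, a10⟩ := w.bds hm'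
  have hk := P.hk
  have h3 := w.p3 m hm
  obtain ⟨g1, g2⟩ := G_series P.hσe h.x0 h.x1 h.l0 h.l1 h.hx h.hL q1 q2 (by nlinarith) (by nlinarith)
  exact ⟨g1, by rw [← g2]; ring⟩
end conts

lemma bdd_on {f : ℝ → ℝ} {a b : ℝ} (hf : ContinuousOn f (Icc a b)) : ∃ M > 0, ∀ x ∈ Icc a b, |f x| ≤ M := by
  obtain ⟨C, hC⟩ := isCompact_Icc.exists_bound_of_continuousOn hf
  exact ⟨|C| + 1, by positivity, fun x hx => le_trans (hC x hx) (by linarith [le_abs_self C])⟩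

lemma pos_on {f : ℝ → ℝ} {a b : ℝ} (hf : ContinuousOn f (Icc a b)) (hp : ∀ x ∈ Icc a b, 0 < f x) :
    ∃ ν > 0, ∀ x ∈ Icc a b, ν ≤ f x := by
  rcases (Icc a b).eq_empty_or_nonempty with h | h
  · exact ⟨1, one_pos, fun x hx => by rw [h] at hx; exact absurd hx (notMem_empty _)⟩
  obtain ⟨x0, hx0, hmin⟩ := isCompact_Icc.exists_isMinOn h hf
  exact ⟨f x0, hp _ hx0, fun x hx => hmin hx⟩

lemma nl1 {C θ : ℝ} (hC : 2 < C) (hθ : 0 < θ) (h : 30 * C * θ ≤ 1) : C * θ^2 < θ ∧ 29 * θ < 1 ∧ C * θ ≤ 1 := by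
  refine ⟨by nlinarith, by nlinarith, by nlinarith⟩

lemma nl2 {C θ k : ℝ} (hk : 0 < k) (hθ : 0 < θ) (h : 4 * C * θ ≤ k) : C * θ^2 < k * θ * (1/2) := by
  nlinarith [mul_pos hk hθ]

lemma nl3 {ψ A B ν G : ℝ} (hψ : 0 < ψ) (h : ψ * A < ν) (hG : ψ * G = -B) (hB : ν ≤ B) : G ≤ -A := by
  by_contra hcon
  push Not at hcon
  nlinarith

set_option maxHeartbeats 1000000 in
theorem endB {k τ m3 m4 : ℝ} (w : WIN k τ m3 m4) : ∃ mb ∈ Ioo m3 m4, ∃ (x L : PowerSeries ℝ) (θ1 : ℝ), 0 < θ1 ∧ SERm k τ mb x L ∧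
    AS x (2 * θ1) ∧ AS L (2 * θ1) ∧ (∀ θ ∈ Ioc 0 θ1, 0 < pev x θ ∧ pev L θ < 1) ∧
    Dq k τ mb (pev x θ1) (pev L θ1) < 0 := by
  have hc := eF_cont k τ
  have hgc := gF_cont k τ
  have hlt := w.lt
  have hm4 : m4 ∈ Icc m3 m4 := right_mem_Icc.2 hlt.le
  have hk : 0 < k := (w.pp m4 hm4).hk
  -- choose a left endpoint
  obtain ⟨ms, hms, hms1⟩ : ∃ ms ∈ Ioo m3 m4, ∀ m ∈ Icc ms m4, 1/4 ≤ 2 + eF k τ m - 3 * gF k τ m := by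
    have h1 : ∀ᶠ m in 𝓝 m4, 1/4 < 2 + eF k τ m - 3 * gF k τ m := by
      refine ContinuousAt.eventually_lt (by fun_prop) (by fun_prop) ?_
      linarith [w.z4, (w.bds hm4).2.2.2.2.1]
    obtain ⟨l, hl, hl'⟩ := exists_Ioc_subset_of_mem_nhds h1 ⟨m3, hlt⟩
    refine ⟨max ((l + m4) / 2) ((m3 + m4) / 2), ⟨lt_max_of_lt_right (by linarith), max_lt (by linarith [hl]) (by linarith)⟩, fun m hm => ?_⟩
    have : m ∈ Ioc l m4 := ⟨by linarith [le_trans (le_max_left _ _) hm.1, hl], hm.2⟩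
    exact (hl' this).le
  have hsub : Icc ms m4 ⊆ Ioc m3 m4 := fun m hm => ⟨by linarith [hm.1, hms.1], hm.2⟩
  have hKs : Ico ms m4 ⊆ Icc m3 m4 := fun m hm => ⟨by linarith [hm.1, hms.1], hm.2.le⟩
  have hRR : ∀ m ∈ Ico ms m4, 3 + 1/4 ≤ (2 + eF k τ m) * (gF k τ m)⁻¹ ∧ (2 + eF k τ m) * (gF k τ m)⁻¹ < 4 := by
    intro m hm
    obtain ⟨a1, a2, a3, a4, a5, a6, a7, a8, a9, a10⟩ := w.bds (hKs hm)
    rw [← div_eq_mul_inv, le_div_iff₀ (by linarith), div_lt_iff₀ (by linarith)]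
    have := hms1 m ⟨hm.1, hm.2.le⟩
    have := w.p4 m ⟨(hKs hm).1, hm.2⟩
    constructor <;> linarith
  obtain ⟨x, L, -, -, hS, C, hC, hloc⟩ := winseries w hKs 4 (by norm_num) le_rfl 4 (by norm_num)
    (by
      intro m hm n hn hn4
      obtain ⟨r1, r2⟩ := hRR m hm
      rcases Nat.lt_or_gt_of_ne hn4 with h | h
      · have : (n:ℝ) ≤ 3 := by exact_mod_cast (by lia : n ≤ 3)
        rw [abs_of_neg (by linarith)]; linarith
      · have : (5:ℝ) ≤ n := by exact_mod_cast h
        rw [abs_of_pos (by linarith)]; linarith)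
    (fun m hm => by have := (hRR m hm).2; push_cast; exact this.ne')
  obtain ⟨ν, hν, hQ⟩ := pos_on ((Q3m_cont w).mono hsub) (fun m hm => by
    obtain ⟨ρ, p, h1, h2, -, -, -, -, -, -, h3, -⟩ := signs w (hsub hm)
    unfold Q3m; rw [← h1, ← h2]; exact h3)
  obtain ⟨M1, hM1, hr⟩ := bdd_on ((rh_cont w).mono hsub)
  obtain ⟨M2, hM2, hp⟩ := bdd_on ((pp_cont w).mono hsub)
  -- small scale
  set s := min (1 / (30 * C)) (k / (4 * C)) with hs
  have hC0 : 0 < C := by linarith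
  have hs0 : 0 < s := lt_min (by positivity) (by positivity)
  have hs1 : 30 * C * s ≤ 1 := by
    have := min_le_left (1 / (30 * C)) (k / (4 * C))
    rw [← hs, le_div_iff₀ (by positivity)] at this; linarith
  have hs2 : 4 * C * s ≤ k := by
    have := min_le_right (1 / (30 * C)) (k / (4 * C))
    rw [← hs, le_div_iff₀ (by positivity)] at this; linarith
  set N := 2 / s^3 with hN
  set B0 := M1 * (C + C * C + 2 * C) + M2 * (2 * C + C * C) with hB0
  have hNB : 0 < N + B0 := by positivity
  obtain ⟨mb, hmb, hmb1⟩ : ∃ m ∈ Ioo ms m4, k * (4 * gF k τ m - 2 - eF k τ m) * (N + B0) < ν := by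
    have h1 : ∀ᶠ m in 𝓝[<] m4, k * (4 * gF k τ m - 2 - eF k τ m) * (N + B0) < ν := by
      apply Filter.Eventually.filter_mono nhdsWithin_le_nhds
      refine ContinuousAt.eventually_lt (by fun_prop) (by fun_prop) ?_
      rw [w.z4]; simpa using hν
    have h2 : ∀ᶠ m in 𝓝[<] m4, m ∈ Ioo ms m4 := Ioo_mem_nhdsLT hms.2
    obtain ⟨m, hm⟩ := (h1.and h2).exists
    exact ⟨m, hm.2, hm.1⟩
  have hmK : mb ∈ Ico ms m4 := ⟨hmb.1.le, hmb.2⟩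
  have hmI : mb ∈ Icc ms m4 := ⟨hmb.1.le, hmb.2.le⟩
  have hmO : mb ∈ Ioc m3 m4 := hsub hmI
  obtain ⟨hcf, hl⟩ := hloc mb hmK
  have S := hS mb hmK
  obtain ⟨a1, a2, a3, a4, a5, a6, a7, a8, a9, a10⟩ := w.bds (Ioc_subset_Icc_self hmO)
  obtain ⟨ρ, p, e1, e2, -, -, -, -, q1, q2, q3, -⟩ := signs w hmO
  obtain ⟨G0, G4⟩ := SERm.G w hmO S q1 q2
  obtain ⟨-, -, xi⟩ := xi_formulas S.x0 S.x1 S.l0 S.l1 G0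
  have hψ : 0 < 4 * gF k τ mb - 2 - eF k τ mb := w.p4 mb ⟨hmO.1.le, hmb.2⟩
  have hQ' := hQ mb hmI
  unfold Q3m at hQ'
  rw [← e1, ← e2] at hQ'
  have hρ := hr mb hmI
  have hpb := hp mb hmI
  rw [← e1] at hρ
  rw [← e2] at hpb
  set G := coeff 4 (GG (PowerSeries.C (eF k τ mb)) (PowerSeries.C ρ) (PowerSeries.C p) (x mb) (L mb)) with hG
  have hGN : G ≤ -(N + B0) := by
    exact nl3 (mul_pos hk hψ) hmb1 G4 hQ'
  have x2 := (hcf 2 (by norm_num)).1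
  have x3 := (hcf 3 (by norm_num)).1
  have l2 := (hcf 2 (by norm_num)).2
  have l3 := (hcf 3 (by norm_num)).2
  have t1 : |ρ * (coeff 3 (L mb) + coeff 2 (L mb) * coeff 2 (x mb) + eF k τ mb * coeff 3 (x mb))| ≤ M1 * (C + C * C + 2 * C) := by
    rw [abs_mul]
    refine mul_le_mul hρ ?_ (abs_nonneg _) hM1.le
    refine le_trans (abs_add_three _ _ _) ?_
    rw [abs_mul, abs_mul, abs_of_pos a5]
    have := mul_le_mul l2 x2 (abs_nonneg _) hC0.le
    have := mul_le_mul (show eF k τ mb ≤ 2 by linarith) x3 (abs_nonneg _) (by norm_num)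
    linarith
  have t2 : |p * (2 * coeff 3 (x mb) + (coeff 2 (x mb))^2)| ≤ M2 * (2 * C + C * C) := by
    rw [abs_mul]
    refine mul_le_mul hpb ?_ (abs_nonneg _) hM2.le
    refine le_trans (abs_add_le _ _) ?_
    rw [abs_mul, abs_two, pow_two, abs_mul]
    have := mul_le_mul x2 x2 (abs_nonneg _) hC0.le
    linarith
  set c := coeff 4 (L mb) - eF k τ mb * coeff 4 (x mb) with hcdef
  have hcN : c ≤ -N := by
    rw [xi]
    linarith [le_abs_self (ρ * (coeff 3 (L mb) + coeff 2 (L mb) * coeff 2 (x mb) + eF k τ mb * coeff 3 (x mb))), le_abs_self (p * (2 * coeff 3 (x mb) + (coeff 2 (x mb))^2))]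
  obtain ⟨θ1, hθ1, hcθ⟩ := root_exists (c := -c) (A := 2) 3 (by norm_num) (by norm_num) hs0 (by linarith)
  have hc0 : c < 0 := by
    have : 0 < N := by positivity
    linarith
  have hCθ : 30 * C * θ1 ≤ 1 := by
    have := mul_le_mul_of_nonneg_left hθ1.2 (show 0 ≤ 30 * C by positivity)
    linarith
  have hCθ2 : 4 * C * θ1 ≤ k := by
    have := mul_le_mul_of_nonneg_left hθ1.2 (show 0 ≤ 4 * C by positivity)
    linarith
  obtain ⟨ax, aL, -, hθ⟩ := hl c hcdef θ1 hθ1.1 (nl1 hC hθ1.1 hCθ).2.2 (by rw [abs_of_neg hc0]; norm_num; linarith)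
  obtain ⟨o1, o2, o3, o4⟩ := om_bd a5 a6 a7 a8
  refine ⟨mb, ⟨hmO.1, hmb.2⟩, x mb, L mb, θ1, hθ1.1, S, ax, aL, fun θ ht => ?_, ?_⟩
  · obtain ⟨u1, -, -, u4, -⟩ := hθ θ ht
    have hCt : 30 * C * θ ≤ 1 := by
      have := mul_le_mul_of_nonneg_left ht.2 (show 0 ≤ 30 * C by positivity)
      linarith
    have y0 : c * θ^(4-1) ≤ 0 := mul_nonpos_of_nonpos_of_nonneg hc0.le (pow_nonneg ht.1.le _)
    constructor
    · have := (abs_le.1 u1).1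
      have h5 : (2 + eF k τ mb - gF k τ mb)⁻¹ * (c * θ^(4-1)) ≤ 0 := mul_nonpos_of_nonneg_of_nonpos (by linarith) y0
      have h6 : θ * 1 ≤ θ * (1 - (2 + eF k τ mb - gF k τ mb)⁻¹ * (c * θ^(4-1))) := mul_le_mul_of_nonneg_left (by linarith) ht.1.le
      have h7 : C * θ^2 < θ := (nl1 hC ht.1 hCt).1
      linarith
    · have := (abs_le.1 u4).2
      linarith only [this, (nl1 hC ht.1 hCt).2.1]
  · obtain ⟨-, -, -, -, u5⟩ := hθ θ1 ⟨hθ1.1, le_rfl⟩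
    have y0 : c * θ1^(4-1) = -2 := by norm_num; linarith
    rw [y0] at u5
    have h1 := (abs_le.1 u5).2
    have h2 : eF k τ mb * gF k τ mb / 2 * (1 - (2 + eF k τ mb - gF k τ mb)⁻¹ * -2) + -2 ≤ -1/2 := by linarith only [o2, o3]
    have h3 := mul_le_mul_of_nonneg_left h2 (mul_pos hk hθ1.1).le
    have h4 : C * θ1^2 < k * θ1 * (1/2) := nl2 hk hθ1.1 hCθ2
    linarith

/-- a-priori bounds at small parameter, bounded coefficient -/
lemma midest {k e g e0 C θ x L D y : ℝ} (hk : 0 < k) (he0 : 0 < e0) (he : e0 ≤ e) (hg : 1/2 ≤ g) (hg1 : g ≤ 1) (heg : e + g ≤ 2)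
    (hC : 2 < C) (hθ : 0 < θ) (h1 : 30 * C * θ ≤ 1) (h2 : 8 * C * θ ≤ e0) (h3 : 16 * (k + C) * θ ≤ k * e0) (hy : |y| ≤ θ)
    (u1 : |x - θ * (1 - (2 + e - g)⁻¹ * y)| ≤ C * θ^2) (u2 : |L - e * x - y * θ| ≤ C * θ^2) (u3 : |x| ≤ 10 * θ) (u4 : |L| ≤ 29 * θ)
    (u5 : |D - k * θ * (e * g / 2 * (1 - (2 + e - g)⁻¹ * y) + y)| ≤ C * θ^2) :
    0 < x ∧ x < 1 ∧ 0 < L ∧ L < 1 ∧ 0 < D := by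
  obtain ⟨o1, o2, o3, o4⟩ := om_bd (by linarith) hg hg1 heg
  set ω := (2 + e - g)⁻¹ with hω
  have hω1 : ω ≤ 1 := by rw [hω]; exact inv_le_one_of_one_le₀ (by linarith)
  obtain ⟨n1, n2, n3⟩ := nl1 hC hθ h1
  have hθs : θ ≤ 1/60 := by nlinarith
  have hωy : |ω * y| ≤ θ := by
    rw [abs_mul, abs_of_pos (by linarith)]; nlinarith [abs_nonneg y]
  rw [abs_le] at *
  have c1 : C * θ^2 ≤ θ / 30 := by linarith only [mul_le_mul_of_nonneg_right h1 hθ.le]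
  have c2 : C * θ^2 ≤ θ * (e0 / 8) := by linarith only [mul_le_mul_of_nonneg_right h2 hθ.le]
  have c3 : θ^2 ≤ θ * (e0/16) := by
    have := mul_le_mul_of_nonneg_right hC.le (sq_nonneg θ)
    linarith only [this, c2]
  have hx : θ / 2 ≤ x := by
    have t1 := mul_le_mul_of_nonneg_left hωy.2 hθ.le
    have t2 := mul_le_mul_of_nonneg_left hθs hθ.le
    linarith only [t1, t2, u1.1, c1, hθ]
  have hex : e0 * (θ / 2) ≤ e * x := mul_le_mul he hx (by linarith) (by linarith)
  have hyt : -θ^2 ≤ y * θ := by linarith only [mul_le_mul_of_nonneg_right hy.1 hθ.le]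
  have h0e := mul_pos he0 hθ
  refine ⟨by linarith, by linarith, by linarith only [h0e, c2, c3, hex, hyt, u2.1], by linarith, ?_⟩
  have e1 : e0 / 4 ≤ e * g / 2 := by nlinarith
  have e2 : e0 / 4 * (1/2) ≤ e * g / 2 * (1 - ω * y) := mul_le_mul e1 (by linarith) (by norm_num) (by linarith)
  have e3 : e0 / 8 - θ ≤ e * g / 2 * (1 - ω * y) + y := by linarith
  have e4 := mul_le_mul_of_nonneg_left e3 (mul_pos hk hθ).le
  have e5 : 16 * (k + C) * θ * θ ≤ k * e0 * θ := mul_le_mul_of_nonneg_right h3 hθ.le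
  have : 0 < k * e0 * θ := by positivity
  have h00 := mul_pos hk (mul_pos hθ hθ)
  linarith only [this, h00, e4, e5, u5.1, mul_pos (show 0 < C by linarith) (mul_pos hθ hθ)]

lemma aest {k e g e0 C θ D y : ℝ} (hk : 0 < k) (he0 : 0 < e0) (he : e0 ≤ e) (hg : 1/2 ≤ g) (hg1 : g ≤ 1) (heg : e + g ≤ 2)
    (hθ : 0 < θ) (h3 : 16 * (k + C) * θ ≤ k * e0) (hy : 0 ≤ y)
    (u5 : |D - k * θ * (e * g / 2 * (1 - (2 + e - g)⁻¹ * y) + y)| ≤ C * θ^2) : 0 < D := by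
  obtain ⟨o1, o2, o3, o4⟩ := om_bd (by linarith) hg hg1 heg
  set ω := (2 + e - g)⁻¹ with hω
  have e1 : e0 / 4 ≤ e * g / 2 := by nlinarith
  have e3 : e0 / 4 ≤ e * g / 2 * (1 - ω * y) + y := by nlinarith
  have e4 := mul_le_mul_of_nonneg_left e3 (mul_pos hk hθ).le
  have e5 : 16 * (k + C) * θ * θ ≤ k * e0 * θ := mul_le_mul_of_nonneg_right h3 hθ.le
  have : 0 < k * e0 * θ := by positivity
  have := (abs_le.1 u5).1
  nlinarith [mul_pos hk (mul_pos hθ hθ)]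

theorem endA {k τ m3 m4 mb : ℝ} (w : WIN k τ m3 m4) (hmb : mb ∈ Ioo m3 m4) : ∃ x L : ℝ → PowerSeries ℝ,
    (∀ n, ContinuousOn (fun m => coeff n (x m)) (Ioc m3 mb)) ∧
    (∀ n, ContinuousOn (fun m => coeff n (L m)) (Ioc m3 mb)) ∧
    (∀ m ∈ Ioc m3 mb, SERm k τ m (x m) (L m)) ∧ ∃ C > 2, (∀ m ∈ Ioc m3 mb, LOC k τ m C 3 (x m) (L m)) ∧
    ∀ s > 0, ∃ ma ∈ Ioo m3 mb, 8 / s^2 ≤ coeff 3 (L ma) - eF k τ ma * coeff 3 (x ma) := by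
  have hc := eF_cont k τ
  have hgc := gF_cont k τ
  have hm3 : m3 ∈ Icc m3 m4 := left_mem_Icc.2 w.lt.le
  have hk : 0 < k := (w.pp m3 hm3).hk
  have hKs : Ioc m3 mb ⊆ Icc m3 m4 := fun m hm => ⟨hm.1.le, hm.2.trans hmb.2.le⟩
  obtain ⟨δ, hδ, hδ1⟩ := pos_on (f := fun m => 4 * gF k τ m - 2 - eF k τ m) (a := m3) (b := mb) (by fun_prop)
    (fun m hm => w.p4 m ⟨hm.1, lt_of_le_of_lt hm.2 hmb.2⟩)
  have hRR : ∀ m ∈ Ioc m3 mb, 3 < (2 + eF k τ m) * (gF k τ m)⁻¹ ∧ (2 + eF k τ m) * (gF k τ m)⁻¹ ≤ 4 - δ := by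
    intro m hm
    obtain ⟨a1, a2, a3, a4, a5, a6, a7, a8, a9, a10⟩ := w.bds (hKs hm)
    rw [← div_eq_mul_inv, lt_div_iff₀ (by linarith), div_le_iff₀ (by linarith)]
    have := hδ1 m ⟨hm.1.le, hm.2⟩
    have := w.p3 m ⟨hm.1, (hKs hm).2⟩
    constructor
    · linarith
    · nlinarith
  obtain ⟨x, L, c1, c2, hS, C, hC, hloc⟩ := winseries w hKs 3 (by norm_num) (by norm_num) (1 + 1/δ) (by positivity)
    (by
      intro m hm n hn hn4
      obtain ⟨r1, r2⟩ := hRR m hm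
      have hd : 0 < 1 / δ := by positivity
      have hd2 : 1 / δ * δ = 1 := by field_simp
      rcases Nat.lt_or_gt_of_ne hn4 with h | h
      · have : (n:ℝ) ≤ 2 := by exact_mod_cast (by lia : n ≤ 2)
        rw [abs_of_neg (by linarith)]; nlinarith
      · have : (4:ℝ) ≤ n := by exact_mod_cast h
        rw [abs_of_pos (by linarith)]
        have h5 : δ ≤ n - (2 + eF k τ m) * (gF k τ m)⁻¹ := by linarith
        have := mul_le_mul_of_nonneg_left h5 hd.le
        linarith)
    (fun m hm => by have := (hRR m hm).1; push_cast; exact this.ne)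
  refine ⟨x, L, c1, c2, hS, C, hC, fun m hm => (hloc m hm).2, fun s hs => ?_⟩
  have hsubI : Icc m3 mb ⊆ Icc m3 m4 := Icc_subset_Icc_right hmb.2.le
  obtain ⟨ν, hν, hν1⟩ := pos_on (f := fun m => eF k τ m * ca k (k-m) (eF k τ m) (gF k τ m)) (a := m3) (b := mb)
    (hc.continuousOn.mul ((ca_cont w).mono hsubI)) (fun m hm => mul_pos (w.bds (hsubI hm)).2.2.2.2.1 (w.iq m (hsubI hm)).1)
  obtain ⟨ν2, hν2, hν3⟩ := pos_on (f := fun m => cB k (k-m) (eF k τ m) (gF k τ m)) (a := m3) (b := mb)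
    ((cB_cont w).mono hsubI) (fun m hm => (w.iq m (hsubI hm)).2.1)
  have hC0 : 0 < C := by linarith
  set A := 8 / s^2 / ν + 2 * C with hA
  have hA0 : 0 < A := by positivity
  obtain ⟨ma, hma, hma1⟩ : ∃ m ∈ Ioo m3 mb, A * (k * (2 + eF k τ m - 3 * gF k τ m)) < ν2 := by
    have h1 : ∀ᶠ m in 𝓝[>] m3, A * (k * (2 + eF k τ m - 3 * gF k τ m)) < ν2 := by
      apply Filter.Eventually.filter_mono nhdsWithin_le_nhds
      refine ContinuousAt.eventually_lt (by fun_prop) (by fun_prop) ?_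
      rw [w.z3]; simpa using hν2
    have h2 : ∀ᶠ m in 𝓝[>] m3, m ∈ Ioo m3 mb := Ioo_mem_nhdsGT hmb.1
    obtain ⟨m, hm⟩ := (h1.and h2).exists
    exact ⟨m, hm.2, hm.1⟩
  refine ⟨ma, hma, ?_⟩
  have hmK : ma ∈ Ioc m3 mb := ⟨hma.1, hma.2.le⟩
  have hmO : ma ∈ Ioc m3 m4 := ⟨hma.1, (hKs hmK).2⟩
  have S := hS ma hmK
  obtain ⟨ρ, p, e1, e2, -, -, -, e3, q1, q2, q3, -⟩ := signs w hmO
  obtain ⟨G0, -⟩ := SERm.G w hmO S q1 q2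
  obtain ⟨l2, xi, -⟩ := xi_formulas S.x0 S.x1 S.l0 S.l1 G0
  have hψ : 0 < k * (2 + eF k τ ma - 3 * gF k τ ma) := mul_pos hk (w.p3 ma hmO)
  have hρA : A ≤ ρ := by
    rw [e1, rh, le_div_iff₀ hψ]
    linarith [hν3 ma ⟨hma.1.le, hma.2.le⟩]
  have x2 := ((hloc ma hmK).1 2 (by norm_num)).1
  have hxi : coeff 3 (L ma) - eF k τ ma * coeff 3 (x ma) =
      (eF k τ ma * ca k (k-ma) (eF k τ ma) (gF k τ ma)) * (ρ + 2 * coeff 2 (x ma)) := by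
    rw [xi, l2, e3]; ring
  rw [hxi]
  have h5 : 8 / s^2 / ν ≤ ρ + 2 * coeff 2 (x ma) := by
    have := (abs_le.1 x2).1
    linarith
  calc 8 / s^2 = ν * (8 / s^2 / ν) := by field_simp
    _ ≤ _ := mul_le_mul (hν1 ma ⟨hma.1.le, hma.2.le⟩) h5 (by positivity) (le_trans hν.le (hν1 ma ⟨hma.1.le, hma.2.le⟩))

lemma mneg_iff {a b : ℝ} (ha : 0 < a) : a * b < 0 ↔ b < 0 := by
  constructor
  · intro h; by_contra hb; push Not at hb; nlinarith [mul_nonneg ha.le hb]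
  · intro h; exact mul_neg_of_pos_of_neg ha h

section
variable {k τ m : ℝ} {x L : PowerSeries ℝ} {θ : ℝ}

lemma cP_N (P : PPm k τ m) : NN k m (cP m (k-m) x L θ).1 (cP m (k-m) x L θ).2 = m * (cP m (k-m) x L θ).1 * pev x θ := by
  have h := qN_eq (a := (cP m (k-m) x L θ).1) (b := (cP m (k-m) x L θ).2) (x := pev x θ) P (by rfl)
  have := P.hq0
  rw [mul_assoc, mul_assoc] at h
  rw [mul_left_cancel₀ this.ne' h]; ring

lemma cP_D (P : PPm k τ m) (hL : pev L θ < 1) :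
    (k-m) * DD k τ m (cP m (k-m) x L θ).1 (cP m (k-m) x L θ).2 = (cP m (k-m) x L θ).1 * Dq k τ m (pev x θ) (pev L θ) := by
  have := qD_eq (a := (cP m (k-m) x L θ).1) (b := (cP m (k-m) x L θ).2) (x := pev x θ) (L := pev L θ) P
    (by simp only [cP]; rw [Real.sq_sqrt (by linarith)]; ring) (by rfl)
  rw [this]; rfl

lemma cP_a (hL : pev L θ < 1) : 0 < (cP m (k-m) x L θ).1 := Real.sqrt_pos.2 (by linarith)

lemma cP_a1 (hL : 0 < pev L θ) : (cP m (k-m) x L θ).1 < 1 := by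
  simp only [cP]; rw [Real.sqrt_lt' one_pos]; linarith

lemma cP_b (P : PPm k τ m) (hL : pev L θ < 1) (hx : pev x θ < 1) : 0 < (cP m (k-m) x L θ).2 := by
  have h1 := P.hm
  have h2 := P.hq0
  have h3 : 0 < √(1 - pev L θ) := Real.sqrt_pos.2 (by linarith)
  have h4 : 0 < 1 - pev x θ := by linarith
  simp only [cP]; positivity

lemma cP_Npos (P : PPm k τ m) (hL : pev L θ < 1) : (0 < NN k m (cP m (k-m) x L θ).1 (cP m (k-m) x L θ).2 ↔ 0 < pev x θ) ∧
    (NN k m (cP m (k-m) x L θ).1 (cP m (k-m) x L θ).2 < 0 ↔ pev x θ < 0) := by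
  rw [cP_N P]
  have h : 0 < m * (cP m (k-m) x L θ).1 := mul_pos P.hm (cP_a hL)
  exact ⟨mul_pos_iff_of_pos_left h, mneg_iff h⟩

lemma cP_Dpos (P : PPm k τ m) (hL : pev L θ < 1) : (0 < DD k τ m (cP m (k-m) x L θ).1 (cP m (k-m) x L θ).2 ↔ 0 < Dq k τ m (pev x θ) (pev L θ)) ∧
    (DD k τ m (cP m (k-m) x L θ).1 (cP m (k-m) x L θ).2 < 0 ↔ Dq k τ m (pev x θ) (pev L θ) < 0) := by
  have h := cP_D P (x := x) hL
  have h1 : 0 < (cP m (k-m) x L θ).1 := cP_a hL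
  rw [← mul_pos_iff_of_pos_left P.hq0, ← mneg_iff P.hq0, h, mul_pos_iff_of_pos_left h1, mneg_iff h1]
  exact ⟨Iff.rfl, Iff.rfl⟩

lemma cP_curve (P : PPm k τ m) (h : SERm k τ m x L) {r r0 θ1 : ℝ} (ax : AS x r) (aL : AS L r) (h0 : 0 < r0) (h1 : r0 ≤ θ1) (h2 : θ1 < r)
    (hL : ∀ θ ∈ Icc r0 θ1, pev L θ < 1) : ∃ c : ℝ → ℝ × ℝ, ∃ T, 0 ≤ T ∧ c 0 = cP m (k-m) x L r0 ∧ c T = cP m (k-m) x L θ1 ∧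
    ∀ t ∈ Icc 0 T, HasDerivAt c (bF k τ (m, c t)) t ∧ ∃ θ ∈ Icc r0 θ1, c t = cP m (k-m) x L θ := by
  have hkg : 0 < k * gF k τ m := mul_pos P.hk P.hg
  have h01 : 0 < θ1 / r0 := div_pos (by linarith) h0
  refine ⟨fun t => cP m (k-m) x L (r0 * exp (k * gF k τ m * t)), log (θ1 / r0) / (k * gF k τ m), ?_, ?_, ?_, ?_⟩
  · exact div_nonneg (log_nonneg ((one_le_div h0).2 h1)) hkg.le
  · simp
  · simp only
    rw [mul_div_cancel₀ _ hkg.ne', exp_log h01, mul_div_cancel₀ _ h0.ne']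
  · intro t ht
    have hm : r0 * exp (k * gF k τ m * t) ∈ Icc r0 θ1 := by
      constructor
      · have : 1 ≤ exp (k * gF k τ m * t) := one_le_exp (mul_nonneg hkg.le ht.1)
        nlinarith
      · have : exp (k * gF k τ m * t) ≤ θ1 / r0 := by
          rw [← exp_log h01, exp_le_exp, mul_comm, ← le_div_iff₀ hkg]; exact ht.2
        rw [le_div_iff₀ h0] at this; linarith
    refine ⟨cP_flow P h ax aL ?_ (hL _ hm), _, hm, rfl⟩
    rw [abs_of_pos (by positivity)]; linarith [hm.2]

end

lemma pev_cont {x : ℝ → PowerSeries ℝ} {K : Set ℝ} (hc : ∀ n, ContinuousOn (fun m => coeff n (x m)) K) {r : ℝ} (hr : 0 < r)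
    (hb : ∀ m ∈ K, ∀ n, |coeff n (x m)| * (2 * r)^n ≤ 2) : ContinuousOn (fun m => pev (x m) r) K := by
  unfold pev
  refine continuousOn_tsum (u := fun n => 2 * (1/2:ℝ)^n) (fun n => (hc n).mul continuousOn_const)
    (summable_geometric_two.mul_left 2) fun n m hm => ?_
  have := hb m hm n
  rw [Real.norm_eq_abs, abs_mul, abs_of_pos (pow_pos hr n)]
  have e : |coeff n (x m)| * r^n = |coeff n (x m)| * (2*r)^n * (1/2)^n := by
    rw [mul_pow]
    have : (2:ℝ)^n * (1/2)^n = 1 := by rw [← mul_pow]; norm_num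
    linear_combination (-|coeff n (x m)| * r^n) * this
  rw [e]
  exact mul_le_mul_of_nonneg_right this (by positivity)

/-- Data at the sonic point together with the left orbit. -/
structure LEFT (k τ m : ℝ) (x L : PowerSeries ℝ) (r0 : ℝ) (c : ℝ → ℝ × ℝ) : Prop where
  rpos : 0 < r0
  S : SERm k τ m x L
  ax : AS x (2 * r0)
  aL : AS L (2 * r0)
  loc : ∀ θ ∈ Ioc 0 r0, 0 < pev x θ ∧ pev x θ < 1 ∧ 0 < pev L θ ∧ pev L θ < 1 ∧ 0 < Dq k τ m (pev x θ) (pev L θ)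
  c0 : c 0 = cP m (k-m) x L r0
  orb : ∀ t, 0 ≤ t → HasDerivAt c (bF k τ (m, c t)) t ∧ 0 < NN k m (c t).1 (c t).2 ∧
      0 < DD k τ m (c t).1 (c t).2 ∧ 0 < (c t).2 ∧ (c t).1 < 1

set_option maxHeartbeats 1000000 in
theorem left_exists {k τ m3 m4 : ℝ} (w : WIN k τ m3 m4) : ∃ m ∈ Ioo m3 m4, ∃ x L r0 c, LEFT k τ m x L r0 c := by
  obtain ⟨mb, hmb, xb, Lb, θb, hθb, Sb, axb, aLb, hb1, hb2⟩ := endB w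
  obtain ⟨x, L, cx, cL, hS, C, hC, hloc, hA⟩ := endA w hmb
  have hc := eF_cont k τ
  have hm3 : m3 ∈ Icc m3 m4 := left_mem_Icc.2 w.lt.le
  have hk : 0 < k := (w.pp m3 hm3).hk
  have hC0 : 0 < C := by linarith
  obtain ⟨e0, he0, he⟩ := pos_on (f := eF k τ) hc.continuousOn (fun m hm => (w.bds (m3 := m3) (m4 := m4) hm).2.2.2.2.1)
  -- the scale
  have hs' : ∃ s > 0, 30 * C * s ≤ 1 ∧ 8 * C * s ≤ e0 ∧ 16 * (k + C) * s ≤ k * e0 := by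
    refine ⟨min (1 / (30 * C)) (min (e0 / (8 * C)) (k * e0 / (16 * (k + C)))), by positivity, ?_, ?_, ?_⟩
    · rw [mul_comm, ← le_div_iff₀ (by positivity)]; exact min_le_left _ _
    · rw [mul_comm, ← le_div_iff₀ (by positivity)]; exact (min_le_right _ _).trans (min_le_left _ _)
    · rw [mul_comm, ← le_div_iff₀ (by positivity)]; exact (min_le_right _ _).trans (min_le_right _ _)
  obtain ⟨s, hs0, hs1, hs2, hs3⟩ := hs'
  have hss : ∀ θ ∈ Ioc 0 s, 30 * C * θ ≤ 1 ∧ 8 * C * θ ≤ e0 ∧ 16 * (k + C) * θ ≤ k * e0 := by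
    intro θ hθ
    have i1 := mul_le_mul_of_nonneg_left hθ.2 (show 0 ≤ 30 * C by positivity)
    have i2 := mul_le_mul_of_nonneg_left hθ.2 (show 0 ≤ 8 * C by positivity)
    have i3 := mul_le_mul_of_nonneg_left hθ.2 (show 0 ≤ 16 * (k + C) by positivity)
    exact ⟨by linarith, by linarith, by linarith⟩
  obtain ⟨ma, hma, hca⟩ := hA s hs0
  have hmaK : ma ∈ Ioc m3 mb := ⟨hma.1, hma.2.le⟩
  have hKI : Ioc m3 mb ⊆ Icc m3 m4 := fun m hm => ⟨hm.1.le, hm.2.trans hmb.2.le⟩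
  have hIK : Icc ma mb ⊆ Ioc m3 mb := fun m hm => ⟨lt_of_lt_of_le hma.1 hm.1, hm.2⟩
  set ca := coeff 3 (L ma) - eF k τ ma * coeff 3 (x ma) with hcad
  obtain ⟨θa, hθa, hcθa⟩ := root_exists 2 (by norm_num) (by norm_num) hs0 hca
  have hca0 : 0 < ca := lt_of_lt_of_le (by positivity) hca
  have Pa := w.pp ma (hKI hmaK)
  obtain ⟨axa, aLa, -, hla⟩ := hloc ma hmaK ca hcad θa hθa.1 (nl1 hC hθa.1 (hss _ hθa).1).2.2
    (by rw [abs_of_pos hca0]; norm_num; linarith)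
  obtain ⟨-, -, hτ0, hτ1, e5a, e6a, e7a, e8a, -⟩ := w.bds (hKI hmaK)
  -- properties at the left end
  have hAp : ∀ θ ∈ Ioc 0 θa, 0 < Dq k τ ma (pev (x ma) θ) (pev (L ma) θ) ∧ pev (x ma) θ < 1 ∧ pev (L ma) θ < 1 := by
    intro θ hθ
    have hθs : θ ∈ Ioc 0 s := ⟨hθ.1, hθ.2.trans hθa.2⟩
    obtain ⟨i1, i2, i3⟩ := hss θ hθs
    obtain ⟨-, -, u3, u4, u5⟩ := hla θ hθ
    have n2 := (nl1 hC hθ.1 i1).2.1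
    have n3 := hθ.1
    refine ⟨aest hk he0 (he ma (hKI hmaK)) e6a e7a e8a hθ.1 i3 (mul_nonneg hca0.le (pow_nonneg hθ.1.le _)) u5, ?_, ?_⟩
    · linarith [le_abs_self (pev (x ma) θ)]
    · linarith [le_abs_self (pev (L ma) θ)]
  have hAx : pev (x ma) θa < 0 := by
    obtain ⟨u1, -⟩ := hla θa ⟨hθa.1, le_rfl⟩
    have hy : ca * θa^(3-1) = 8 := by norm_num; linarith
    rw [hy] at u1
    obtain ⟨o1, -⟩ := om_bd e5a e6a e7a e8a
    have n1 := (nl1 hC hθa.1 (hss _ hθa).1).1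
    have n2 := (abs_le.1 u1).2
    have n3 := mul_le_mul_of_nonneg_left o1 hθa.1.le
    have n4 := hθa.1
    linarith only [n1, n2, n3, n4]
  -- uniform bounds in the middle
  obtain ⟨Mc, hMc, hMc1⟩ := bdd_on (a := ma) (b := mb) (f := fun m => coeff 3 (L m) - eF k τ m * coeff 3 (x m))
    (((cL 3).mono hIK).sub (hc.continuousOn.mul ((cx 3).mono hIK)))
  set r0 := min s (min (1 / Mc) (min θa θb)) with hr0
  have hr0p : 0 < r0 := by
    have := hθa.1
    positivity
  have r1 : r0 ≤ s := min_le_left _ _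
  have r2 : r0 ≤ 1 / Mc := (min_le_right _ _).trans (min_le_left _ _)
  have r3 : r0 ≤ θa := (min_le_right _ _).trans ((min_le_right _ _).trans (min_le_left _ _))
  have r4 : r0 ≤ θb := (min_le_right _ _).trans ((min_le_right _ _).trans (min_le_right _ _))
  have hmid : ∀ m ∈ Icc ma mb, AS (x m) (2 * r0) ∧ AS (L m) (2 * r0) ∧
      (∀ n, |coeff n (x m)| * (2 * r0)^n ≤ 2 ∧ |coeff n (L m)| * (2 * r0)^n ≤ 2) ∧
      ∀ θ ∈ Ioc 0 r0, 0 < pev (x m) θ ∧ pev (x m) θ < 1 ∧ 0 < pev (L m) θ ∧ pev (L m) θ < 1 ∧ 0 < Dq k τ m (pev (x m) θ) (pev (L m) θ) := by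
    intro m hm
    have hcm := hMc1 m hm
    set cm := coeff 3 (L m) - eF k τ m * coeff 3 (x m) with hcm'
    obtain ⟨i1, i2, i3⟩ := hss r0 ⟨hr0p, r1⟩
    have hcr : ∀ θ ∈ Ioc 0 r0, |cm * θ^(3-1)| ≤ θ := by
      intro θ hθ
      have : θ * Mc ≤ 1 := by rw [← le_div_iff₀ hMc]; exact hθ.2.trans r2
      rw [abs_mul, abs_of_pos (pow_pos hθ.1 _)]
      calc |cm| * θ^2 ≤ Mc * θ^2 := mul_le_mul_of_nonneg_right hcm (sq_nonneg _)
        _ = (θ * Mc) * θ := by ring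
        _ ≤ 1 * θ := mul_le_mul_of_nonneg_right this hθ.1.le
        _ = θ := one_mul _
    obtain ⟨ax, aL, hb, hl⟩ := hloc m (hIK hm) cm hcm' r0 hr0p (nl1 hC hr0p i1).2.2 (by
      have := hcr r0 ⟨hr0p, le_rfl⟩
      rw [abs_mul, abs_of_pos (pow_pos hr0p _)] at this
      have n2 := (nl1 hC hr0p i1).2.1
      linarith)
    refine ⟨ax, aL, hb, fun θ hθ => ?_⟩
    obtain ⟨u1, u2, u3, u4, u5⟩ := hl θ hθ
    obtain ⟨j1, j2, j3⟩ := hss θ ⟨hθ.1, hθ.2.trans r1⟩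
    obtain ⟨-, -, -, -, e5, e6, e7, e8, -⟩ := w.bds (hKI (hIK hm))
    exact midest hk he0 (he m (hKI (hIK hm))) e6 e7 e8 hC hθ.1 j1 j2 j3 (hcr θ hθ) u1 u2 u3 u4 u5
  have hab : ma ≤ mb := hma.2.le
  set y0 : ℝ → ℝ × ℝ := fun m => cP m (k-m) (x m) (L m) r0 with hy0
  have hy0c : ContinuousOn y0 (Icc ma mb) := by
    have h1 := pev_cont (fun n => (cx n).mono hIK) hr0p (fun m hm n => ((hmid m hm).2.2.1 n).1)
    have h2 := pev_cont (fun n => (cL n).mono hIK) hr0p (fun m hm n => ((hmid m hm).2.2.1 n).2)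
    have h3 : ContinuousOn (fun m => √(1 - pev (L m) r0)) (Icc ma mb) := (continuousOn_const.sub h2).sqrt
    have h4 : ContinuousOn (fun m => m / (k - m)) (Icc ma mb) :=
      ContinuousOn.div (by fun_prop) (by fun_prop) (fun m hm => (w.pp m (hKI (hIK hm))).hq0.ne')
    simp only [hy0, cP]
    exact h3.prodMk ((h4.mul h3).mul (continuousOn_const.sub h1))
  set yc : ℝ → ℝ × ℝ := IccExtend hab ((Icc ma mb).restrict y0) with hyc
  have hycc : Continuous yc := hy0c.restrict.Icc_extend'
  have hyce : ∀ m ∈ Icc ma mb, yc m = cP m (k-m) (x m) (L m) r0 := by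
    intro m hm
    rw [hyc, IccExtend_of_mem hab _ hm]; rfl
  have hr00 : r0 ∈ Ioc 0 r0 := ⟨hr0p, le_rfl⟩
  have hmbI : mb ∈ Icc ma mb := right_mem_Icc.2 hab
  have hmaI : ma ∈ Icc ma mb := left_mem_Icc.2 hab
  have hmax : (hKI hmaK) = (hKI hmaK) := rfl
  have Pb := w.pp mb (hKI (hIK hmbI))
  have hmak := (w.bds (hKI hmaK)).1
  have hmbk := (w.bds (hKI (hIK hmbI))).2.1
  have huniq : x mb = xb ∧ L mb = Lb := by
    refine SER.unique hk.ne' Pb.hg.ne' Pb.hσe (fun n hn => ?_) (hS mb (hIK hmbI)) Sb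
    have g3 := w.p3 mb ⟨hmb.1, hmb.2.le⟩
    have g4 := w.p4 mb ⟨hmb.1.le, hmb.2⟩
    have g0 := Pb.hg
    rcases Nat.lt_or_ge n 4 with h | h
    · have : (n:ℝ) ≤ 3 := by exact_mod_cast (by lia : n ≤ 3)
      have := mul_le_mul_of_nonneg_left this g0.le
      intro h; linarith
    · have : (4:ℝ) ≤ n := by exact_mod_cast h
      have := mul_le_mul_of_nonneg_left this g0.le
      intro h; linarith
  obtain ⟨m, hm, c, hc0, horb⟩ := shooting k τ ma mb hτ0 hτ1 hab hmak hmbk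
    (fun m hm => by
      have P := w.pp m (hKI (hIK hm))
      have := P.hgg
      have : 0 < gF k τ m * (2 + eF k τ m) * k := mul_pos (mul_pos P.hg (by linarith [P.he])) hk
      linarith) yc hycc
    (fun m hm => by
      have P := w.pp m (hKI (hIK hm))
      obtain ⟨l1, l2, l3, l4, l5⟩ := (hmid m hm).2.2.2 r0 hr00
      rw [hyce m hm]
      exact ⟨(cP_Npos P l4).1.2 l1, (cP_Dpos P l4).1.2 l5, cP_b P l4 l2, cP_a1 l3⟩)
    (by
      obtain ⟨c, T, hT, h0, h1, h2⟩ := cP_curve Pa (hS ma hmaK) axa aLa hr0p r3 (by linarith [hθa.1])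
        (fun θ hθ => (hAp θ ⟨lt_of_lt_of_le hr0p hθ.1, hθ.2⟩).2.2)
      refine ⟨c, T, hT, by rw [h0, hyce ma hmaI], fun t ht => ?_, ?_⟩
      · obtain ⟨d1, θ, hθ, d2⟩ := h2 t ht
        obtain ⟨v1, v2, v3⟩ := hAp θ ⟨lt_of_lt_of_le hr0p hθ.1, hθ.2⟩
        refine ⟨d1, ?_, ?_⟩
        · rw [d2]; exact (cP_Dpos Pa v3).1.2 v1
        · rw [d2]; exact cP_b Pa v3 v2
      · rw [h1]; exact (cP_Npos Pa (hAp θa ⟨hθa.1, le_rfl⟩).2.2).2.2 hAx)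
    (by
      obtain ⟨c, T, hT, h0, h1, h2⟩ := cP_curve Pb Sb axb aLb hr0p r4 (by linarith)
        (fun θ hθ => (hb1 θ ⟨lt_of_lt_of_le hr0p hθ.1, hθ.2⟩).2)
      refine ⟨c, T, hT, by rw [h0, hyce mb hmbI, huniq.1, huniq.2], fun t ht => ?_, Or.inl ?_⟩
      · obtain ⟨d1, θ, hθ, d2⟩ := h2 t ht
        obtain ⟨v1, v3⟩ := hb1 θ ⟨lt_of_lt_of_le hr0p hθ.1, hθ.2⟩
        refine ⟨d1, ?_⟩
        rw [d2]; exact (cP_Npos Pb v3).1.2 v1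
      · rw [h1]; exact (cP_Dpos Pb (hb1 θb ⟨hθb, le_rfl⟩).2).2.2 hb2)
  obtain ⟨ax, aL, -, hl⟩ := hmid m hm
  exact ⟨m, ⟨(hIK hm).1, lt_of_le_of_lt hm.2 hmb.2⟩, x m, L m, r0, c, hr0p, hS m (hIK hm), ax, aL, hl, by rw [hc0, hyce m hm], horb⟩

theorem graph_local {n : WithTop ℕ∞} (hn : 1 ≤ n) {v Zc w : ℝ → ℝ} {s0 dz dw : ℝ} (hZ : ContDiffAt ℝ n Zc s0)
    (hw : ContDiffAt ℝ n w s0) (hz : HasDerivAt Zc dz s0) (hw' : HasDerivAt w dw s0) (hd : dz ≠ 0)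
    (h : ∀ᶠ s in 𝓝 s0, v (Zc s) = w s) :
    ContDiffAt ℝ n v (Zc s0) ∧ HasDerivAt v (dw / dz) (Zc s0) := by
  have hn0 : n ≠ 0 := by rintro rfl; simp at hn
  have hs : HasStrictDerivAt Zc dz s0 := by
    have := hZ.hasStrictDerivAt hn0
    rwa [hz.deriv] at this
  have hf := hs.hasStrictFDerivAt_equiv hd
  have hF : HasFDerivAt Zc ((ContinuousLinearEquiv.unitsEquivAut ℝ (Units.mk0 dz hd) : ℝ ≃L[ℝ] ℝ) : ℝ →L[ℝ] ℝ) s0 := hf.hasFDerivAt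
  set g := hZ.localInverse hF hn0 with hg
  have hgc : ContDiffAt ℝ n g (Zc s0) := hZ.to_localInverse hF hn0
  have hg0 : g (Zc s0) = s0 := hZ.localInverse_apply_image hF hn0
  have hri : ∀ᶠ y in 𝓝 (Zc s0), Zc (g y) = y := by
    exact (hZ.hasStrictFDerivAt' hF hn0).eventually_right_inverse
  have hgt : Tendsto g (𝓝 (Zc s0)) (𝓝 s0) := by
    have := hgc.continuousAt.tendsto
    rwa [hg0] at this
  have hev : v =ᶠ[𝓝 (Zc s0)] fun y => w (g y) := by
    filter_upwards [hri, hgt.eventually h] with y h1 h2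
    rw [← h2, h1]
  have hv : ContDiffAt ℝ n v (Zc s0) := by
    refine ContDiffAt.congr_of_eventuallyEq ?_ hev
    exact ContDiffAt.comp (Zc s0) (by rw [hg0]; exact hw) hgc
  refine ⟨hv, ?_⟩
  have hvd := (hv.differentiableAt hn0).hasDerivAt
  have h2 := hvd.comp s0 hz
  have h3 : HasDerivAt (v ∘ Zc) dw s0 := hw'.congr_of_eventuallyEq (by filter_upwards [h] with s hs using hs)
  have h4 := h2.unique h3
  rw [← h4, mul_div_assoc, div_self hd, mul_one] at *
  exact hvd

theorem glue_deriv {E : Type*} [NormedAddCommGroup E] [NormedSpace ℝ E] {v f g : ℝ → E} {z : ℝ} {d : E} (hf : HasDerivAt f d z)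
    (hg : HasDerivAt g d z) (h1 : ∀ᶠ y in 𝓝[≤] z, v y = f y) (h2 : ∀ᶠ y in 𝓝[≥] z, v y = g y) : HasDerivAt v d z := by
  have e1 : v z = f z := h1.self_of_nhdsWithin (by simp)
  have e2 : v z = g z := h2.self_of_nhdsWithin (by simp)
  have a1 : HasDerivWithinAt v d (Iic z) z := hf.hasDerivWithinAt.congr_of_eventuallyEq h1 e1
  have a2 : HasDerivWithinAt v d (Ici z) z := hg.hasDerivWithinAt.congr_of_eventuallyEq h2 e2
  have := a1.union a2
  rwa [Iic_union_Ici, hasDerivWithinAt_univ] at this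

/-- bootstrap -/
theorem bootstrap {F : ℝ → ℝ → ℝ} {U : Set ℝ} (hU : IsOpen U) {v : ℝ → ℝ}
    (hF : ∀ z ∈ U, ContDiffAt ℝ (⊤:ℕ∞) (fun p : ℝ × ℝ => F p.1 p.2) (z, v z))
    (hv : ∀ z ∈ U, HasDerivAt v (F z (v z)) z) : ContDiffOn ℝ (⊤:ℕ∞) v U := by
  have hn : ∀ n : ℕ, ContDiffOn ℝ n v U := by
    intro n
    induction n with
    | zero =>
      simp only [Nat.cast_zero]
      exact contDiffOn_zero.2 (fun z hz => (hv z hz).continuousAt.continuousWithinAt)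
    | succ n ih =>
      push_cast
      rw [contDiffOn_succ_iff_deriv_of_isOpen hU]
      refine ⟨fun z hz => (hv z hz).differentiableAt.differentiableWithinAt, by simp, ?_⟩
      have : ContDiffOn ℝ n (fun z => F z (v z)) U := by
        intro z hz
        have h1 := (hF z hz).of_le (m := n) (by exact_mod_cast le_top)
        exact (ContDiffAt.comp (f := fun z => (z, v z)) z h1 (contDiffAt_id.prodMk ((ih z hz).contDiffAt (hU.mem_nhds hz)))).contDiffWithinAt
      exact this.congr (fun z hz => (hv z hz).deriv)
  exact contDiffOn_infty.2 hn

/-- a function with a limit whose derivative has a limit -/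
theorem lim_deriv_zero {f f' : ℝ → ℝ} {l d : ℝ} (h : ∀ t, 0 ≤ t → HasDerivAt f (f' t) t) (hl : Tendsto f atTop (𝓝 l))
    (hd : Tendsto f' atTop (𝓝 d)) : d = 0 := by
  have hx : ∀ n : ℕ, ∃ c ∈ Ioo (n:ℝ) (n+1), f' c = f (n+1) - f n := by
    intro n
    have hn : (0:ℝ) ≤ n := Nat.cast_nonneg n
    obtain ⟨c, hc, he⟩ := exists_hasDerivAt_eq_slope f f' (a := n) (b := n+1) (by linarith)
      (fun t ht => (h t (hn.trans ht.1)).continuousAt.continuousWithinAt) (fun t ht => h t (hn.trans ht.1.le))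
    exact ⟨c, hc, by rw [he]; simp⟩
  choose c hc he using hx
  have hct : Tendsto c atTop atTop := tendsto_atTop_mono (fun n => (hc n).1.le) tendsto_natCast_atTop_atTop
  have a1 : Tendsto (fun n => f' (c n)) atTop (𝓝 d) := hd.comp hct
  have a2 : Tendsto (fun n:ℕ => f ((n:ℝ)+1) - f n) atTop (𝓝 (l - l)) :=
    (hl.comp (tendsto_atTop_add_const_right _ _ tendsto_natCast_atTop_atTop)).sub (hl.comp tendsto_natCast_atTop_atTop)
  rw [sub_self] at a2
  refine tendsto_nhds_unique a1 (a2.congr (fun n => (he n).symm))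

/-- a bounded antitone function on the half line converges -/
theorem anti_lim {f : ℝ → ℝ} {b : ℝ} (h : AntitoneOn f (Ici 0)) (hb : ∀ t, 0 ≤ t → b ≤ f t) :
    ∃ l, b ≤ l ∧ (∀ t, 0 ≤ t → l ≤ f t) ∧ Tendsto f atTop (𝓝 l) := by
  set g : ℝ → ℝ := fun t => f (max t 0)
  have hg : Antitone g := fun s t hst => h (by simp) (by simp) (max_le_max_right 0 hst)
  have hbd : BddBelow (range g) := ⟨b, by rintro _ ⟨t, rfl⟩; exact hb _ (by simp)⟩
  have ht := tendsto_atTop_ciInf hg hbd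
  refine ⟨_, le_ciInf (fun t => hb _ (by simp)), fun t ht => ?_, ht.congr' ?_⟩
  · have := ciInf_le hbd t
    simpa [g, ht] using this
  · filter_upwards [eventually_ge_atTop 0] with t ht
    simp [g, ht]

structure BR (k τ m e g ρ p : ℝ) : Prop where
  hk : 0 < k
  hm : 0 < m
  hmk : m < k
  hτ0 : 0 < τ
  hτ1 : τ < 1
  he : 0 < e
  hρ : 0 < ρ
  hp : p < 0
  heg : e + g = (k - m) - τ * m
  hσ : 2 * (m * (k - m) * (1 - τ)) = k * e * (2 - g)
  q1 : Q1 k g m e (τ*m) (m + (k-m)*(τ*m)) ρ p = 0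
  q2 : Q2 k g m e (τ*m) (m + (k-m)*(τ*m)) ρ p = 0
  q3 : 0 < Q3 k g m e (τ*m) (m + (k-m)*(τ*m)) ρ p
  q4 : Q4 k g m e (τ*m) (m + (k-m)*(τ*m)) ρ p ≤ 0
  q5 : 0 ≤ Q5 k m e (τ*m) (m + (k-m)*(τ*m)) ρ p
  q6 : Q6 m (τ*m) ρ p ≤ 0
  H : ∀ x ≤ 0, 0 < k*e*g/2 + (k*p + k*e*(2-g)/2*ρ - (m + (k-m)*(τ*m))*e)*x - (m + (k-m)*(τ*m))*p*x^2

theorem xL_deriv {k τ m e g : ℝ} (hm : m ≠ 0) (hkm : k - m ≠ 0) (heg : e + g = (k - m) - τ * m) {c : ℝ → ℝ × ℝ} {t : ℝ}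
    (hc : HasDerivAt c (bF k τ (m, c t)) t) (ha : (c t).1 ≠ 0) :
    HasDerivAt (fun t => 1 - (k-m)*(c t).2/(m*(c t).1))
      (FX k m (e+g) (τ*m) (1 - (k-m)*(c t).2/(m*(c t).1)) (1 - (c t).1^2)) t ∧
    HasDerivAt (fun t => 1 - (c t).1^2)
      (FL k (m * (k - m) * (1 - τ)) (m + (k-m)*(τ*m)) (1 - (k-m)*(c t).2/(m*(c t).1)) (1 - (c t).1^2)) t := by
  have h1 := hd_fst hc
  have h2 := hd_snd hc
  constructor
  · have := (((h2.const_mul (k-m)).div (h1.const_mul m) (mul_ne_zero hm ha)).const_sub 1)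
    refine this.congr_deriv ?_
    simp only [bF, FX, DD, NN, heg]
    generalize (c t).1 = a at *
    generalize (c t).2 = b at *
    field_simp
    ring
  · have := ((h1.pow 2).const_sub 1)
    refine this.congr_deriv ?_
    simp only [bF, FL, DD, NN]
    generalize (c t).1 = a at *
    generalize (c t).2 = b at *
    push_cast
    field_simp
    ring

theorem GG_deriv {e ρ p x' L' t : ℝ} {x L : ℝ → ℝ} (hx : HasDerivAt x x' t) (hL : HasDerivAt L L' t) :
    HasDerivAt (fun t => GG e ρ p (x t) (L t)) (L' * (1 - ρ * x t) - x' * (ρ * L t + e + 2 * p * x t)) t := by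
  unfold GG
  have := (hL.mul ((hx.const_mul ρ).const_sub 1)).sub (hx.mul ((hx.const_mul p).const_add e))
  refine this.congr_deriv ?_
  ring

theorem BR.dneg {k τ m e g ρ p : ℝ} (B : BR k τ m e g ρ p) {x L : ℝ} (hx : x < 0) (hG : GG e ρ p x L = 0) :
    FL k (m * (k - m) * (1 - τ)) (m + (k-m)*(τ*m)) x L * (1 - ρ * x) - FX k m (e+g) (τ*m) x L * (ρ * L + e + 2 * p * x) < 0 := by
  have id := G_ident k g m e (τ*m) (m + (k-m)*(τ*m)) (m * (k - m) * (1 - τ)) ρ p x L B.hσ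
  rw [hG, B.q1, B.q2, zero_mul] at id
  have h1 : 0 < 1 - ρ * x := by nlinarith [B.hρ]
  have h3 : Q3 k g m e (τ*m) (m + (k-m)*(τ*m)) ρ p * x^3 < 0 := mul_neg_of_pos_of_neg B.q3 (Odd.pow_neg (by decide) hx)
  have h4 : Q4 k g m e (τ*m) (m + (k-m)*(τ*m)) ρ p * x^4 ≤ 0 := mul_nonpos_of_nonpos_of_nonneg B.q4 (by positivity)
  have h5 : Q5 k m e (τ*m) (m + (k-m)*(τ*m)) ρ p * x^5 ≤ 0 := mul_nonpos_of_nonneg_of_nonpos B.q5 (Odd.pow_neg (by decide) hx).le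
  have h6 : Q6 m (τ*m) ρ p * x^6 ≤ 0 := mul_nonpos_of_nonpos_of_nonneg B.q6 (by positivity)
  by_contra hcon
  push Not at hcon
  have := mul_nonneg (sq_nonneg (1 - ρ * x)) hcon
  have h7 := mul_pos_of_neg_of_neg hx (add_neg_of_neg_of_nonpos (add_neg_of_neg_of_nonpos (add_neg_of_neg_of_nonpos h3 h4) h5) h6)
  generalize Q3 k g m e (τ*m) (m + (k-m)*(τ*m)) ρ p = a3 at *
  generalize Q4 k g m e (τ*m) (m + (k-m)*(τ*m)) ρ p = a4 at *
  generalize Q5 k m e (τ*m) (m + (k-m)*(τ*m)) ρ p = a5 at *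
  generalize Q6 m (τ*m) ρ p = a6 at *
  linarith only [this, h7, id]

theorem BR.Dneg {k τ m e g ρ p : ℝ} (B : BR k τ m e g ρ p) {a b : ℝ} (ha : 1 < a) (hN : NN k m a b ≤ 0)
    (hG : GG e ρ p (1 - (k-m)*b/(m*a)) (1 - a^2) ≤ 0) : DD k τ m a b < 0 := by
  have hm := B.hm
  have hq : 0 < k - m := by linarith [B.hmk]
  have ha0 : 0 < a := by linarith
  obtain ⟨x, hx⟩ : ∃ x, x = 1 - (k-m)*b/(m*a) := ⟨_, rfl⟩
  obtain ⟨L, hL⟩ : ∃ L, L = 1 - a^2 := ⟨_, rfl⟩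
  have hNx : NN k m a b = m * a * x := by rw [hx, NN]; field_simp
  have hx0 : x ≤ 0 := by
    rw [hNx] at hN
    by_contra h; push Not at h
    have : 0 < m * a * x := by positivity
    linarith
  have hDx : (k-m) * DD k τ m a b = a * (k * L - m*(k-m)*(1-τ)*x - (m + (k-m)*(τ*m))*x*L) := by
    rw [hL, hx, DD, NN]; field_simp; ring
  rw [← hx, ← hL] at hG
  have hL0 : L < 0 := by rw [hL]; nlinarith
  have H := B.H x hx0
  have hW : 0 < m + (k-m)*(τ*m) := by have := B.hτ0; positivity
  have h1 : 0 < 1 - ρ * x := by nlinarith [B.hρ]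
  have h2 : 0 < k - (m + (k-m)*(τ*m)) * x := by nlinarith [B.hk]
  have id : (1 - ρ*x) * (k * L - m*(k-m)*(1-τ)*x - (m + (k-m)*(τ*m))*x*L) = (k - (m + (k-m)*(τ*m)) * x) * GG e ρ p x L
     + x * (k*e*g/2 + (k*p + k*e*(2-g)/2*ρ - (m + (k-m)*(τ*m))*e)*x - (m + (k-m)*(τ*m))*p*x^2) := by
    unfold GG
    linear_combination (-x*(1-ρ*x)/2) * B.hσ
  have key : (1 - ρ*x) * (k * L - m*(k-m)*(1-τ)*x - (m + (k-m)*(τ*m))*x*L) < 0 := by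
    rw [id]
    rcases hx0.lt_or_eq with h | h
    · have := mul_neg_of_neg_of_pos h H
      have := mul_nonpos_of_nonneg_of_nonpos h2.le hG
      linarith
    · have : GG e ρ p x L = L := by rw [h]; unfold GG; ring
      rw [this, h]; nlinarith [B.hk]
  have k2 : k * L - m*(k-m)*(1-τ)*x - (m + (k-m)*(τ*m))*x*L < 0 := (mneg_iff h1).1 key
  have := mul_neg_of_pos_of_neg ha0 k2
  rw [← hDx] at this
  exact (mneg_iff hq).1 this

/-- barrier lemma on a half open interval -/
theorem barrier {h : ℝ → ℝ} {T : ℝ} (hc : ContinuousOn h (Ico 0 T)) (h0 : 0 < h 0)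
    (hd : ∀ t ∈ Ioo 0 T, h t = 0 → ∃ d > 0, HasDerivAt h d t) : ∀ t ∈ Ico 0 T, 0 < h t := by
  intro t ht
  by_contra hn
  push Not at hn
  have hcc : ContinuousOn h (Icc 0 t) := hc.mono (fun s hs => ⟨hs.1, hs.2.trans_lt ht.2⟩)
  have hcont : Continuous (IccExtend ht.1 ((Icc 0 t).restrict h)) := (continuousOn_iff_continuous_restrict.1 hcc).Icc_extend'
  have hE : ∀ s ∈ Icc 0 t, IccExtend ht.1 ((Icc 0 t).restrict h) s = h s := fun s hs => by
    rw [IccExtend_of_mem _ _ hs]; rfl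
  obtain ⟨t1, h1, h2, h3⟩ := first_exit _ hcont (by rw [hE 0 ⟨le_rfl, ht.1⟩]; exact h0) ⟨t, ht.1, by rw [hE t ⟨ht.1, le_rfl⟩]; exact hn⟩
  have ht1 : t1 ≤ t := by
    by_contra hlt; push Not at hlt
    have := h3 t ⟨ht.1, hlt⟩
    rw [hE t ⟨ht.1, le_rfl⟩] at this
    linarith
  rw [hE t1 ⟨h1.le, ht1⟩] at h2
  obtain ⟨d, hd0, hd⟩ := hd t1 ⟨h1, ht1.trans_lt ht.2⟩ h2
  have hs := hd.tendsto_slope.mono_left (nhdsWithin_mono t1 (fun s (hs : s ∈ Iio t1) => ne_of_lt hs))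
  have : ∀ᶠ s in 𝓝[<] t1, False := by
    filter_upwards [hs.eventually (lt_mem_nhds hd0), Ioo_mem_nhdsLT h1] with s a1 a2
    have a3 := h3 s ⟨a2.1.le, a2.2⟩
    rw [hE s ⟨a2.1.le, a2.2.le.trans ht1⟩] at a3
    rw [slope_def_field, h2] at a1
    have : (h s - 0) / (s - t1) < 0 := div_neg_of_pos_of_neg (by linarith) (by linarith [a2.2])
    linarith
  exact this.exists.elim (fun _ h => h)

theorem le_at_end {f : ℝ → ℝ} {T α : ℝ} (hT : 0 < T) (hc : ContinuousAt f T) (h : ∀ t ∈ Ico 0 T, α ≤ f t) : α ≤ f T := by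
  have h1 : Tendsto f (𝓝[<] T) (𝓝 (f T)) := hc.tendsto.mono_left nhdsWithin_le_nhds
  refine ge_of_tendsto h1 ?_
  filter_upwards [Ioo_mem_nhdsLT hT] with s hs using h s ⟨hs.1.le, hs.2⟩

theorem mono_Ico {f f' : ℝ → ℝ} {T : ℝ} (h : ∀ t ∈ Ico 0 T, HasDerivAt f (f' t) t) (h0 : ∀ t ∈ Ico 0 T, 0 ≤ f' t) :
    ∀ s ∈ Ico 0 T, ∀ t ∈ Ico 0 T, s ≤ t → f s ≤ f t := by
  have : MonotoneOn f (Ico 0 T) := by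
    refine monotoneOn_of_deriv_nonneg (convex_Ico 0 T) (fun t ht => (h t ht).continuousAt.continuousWithinAt)
      (fun t ht => (h t (interior_subset ht)).differentiableAt.differentiableWithinAt) (fun t ht => ?_)
    rw [(h t (interior_subset ht)).deriv]; exact h0 t (interior_subset ht)
  exact fun s hs t ht hst => this hs ht hst

theorem lin_pos {y α : ℝ → ℝ} {T C : ℝ} (hT : 0 < T) (hd : ∀ t ∈ Ico 0 T, HasDerivAt y (α t * y t) t) (hα : ∀ t ∈ Ico 0 T, -C ≤ α t)
    (hy : ∀ t ∈ Ico 0 T, 0 ≤ y t) (hc : ContinuousAt y T) (h0 : 0 < y 0) : 0 < y T := by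
  have hd2 : ∀ t ∈ Ico 0 T, HasDerivAt (fun t => y t * exp (C * t)) ((α t + C) * y t * exp (C * t)) t := by
    intro t ht
    have h1 : HasDerivAt (fun t => exp (C * t)) (exp (C * t) * (C * 1)) t := ((hasDerivAt_id t).const_mul C).exp
    refine ((hd t ht).mul h1).congr_deriv (by ring)
  have hm := mono_Ico hd2 (fun t ht => mul_nonneg (mul_nonneg (by linarith [hα t ht]) (hy t ht)) (exp_pos _).le)
  have := le_at_end (f := fun t => y t * exp (C * t)) (α := y 0) hT (by fun_prop) (fun t ht => by
    have := hm 0 ⟨le_rfl, hT⟩ t ht ht.1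
    simpa using this)
  have h3 : 0 < y T * exp (C * T) := lt_of_lt_of_le h0 this
  exact (pos_iff_pos_of_mul_pos h3).2 (exp_pos _)

set_option maxHeartbeats 1000000 in
theorem right_ab {k τ m e g ρ p : ℝ} (B : BR k τ m e g ρ p) {a0 b0 : ℝ} (ha0 : 1 < a0) (hb0 : 0 < b0) (hτb : τ * b0^2 < 1)
    (hN0 : NN k m a0 b0 < 0) (hG0 : GG e ρ p (1 - (k-m)*b0/(m*a0)) (1 - a0^2) < 0) :
    ∃ (c : ℝ → ℝ × ℝ) (t1 : ℝ), 0 < t1 ∧ c 0 = (a0, b0) ∧ (∀ t ∈ Icc 0 t1, HasDerivAt c (bF k τ (m, c t)) t ∧ 1 < (c t).1 ∧ 0 < (c t).2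
      ∧ τ * (c t).2^2 < 1 ∧ DD k τ m (c t).1 (c t).2 < 0) ∧ (∀ t ∈ Ico 0 t1, NN k m (c t).1 (c t).2 < 0) ∧ NN k m (c t1).1 (c t1).2 = 0
      ∧ ContDiff ℝ 1 c := by
  have hm := B.hm
  have hq : 0 < k - m := by linarith [B.hmk]
  have hτ0 := B.hτ0
  have hτ1 := B.hτ1
  obtain ⟨M, hM⟩ : ∃ M, M = m + 1/τ + (k-m)/(m*τ) + 1 := ⟨_, rfl⟩
  have e1 : 0 < 1/τ := by positivity
  have e2 : 0 < (k-m)/(m*τ) := by positivity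
  obtain ⟨F, K, Φ, hF, hFe, hΦ0, hΦ, -⟩ := planar_flow (bF k τ) (bF_contDiff k τ) M (by linarith)
  obtain ⟨c, hc⟩ : ∃ c, c = Φ m (a0, b0) := ⟨_, rfl⟩
  have c0 : c 0 = (a0, b0) := by rw [hc]; exact hΦ0 _ _
  have cd : ∀ t, HasDerivAt c (F m (c t)) t := by intro t; rw [hc]; exact hΦ _ _ t
  have cc : Continuous c := continuous_iff_continuousAt.2 (fun t => (cd t).continuousAt)
  have c1 : ContDiff ℝ 1 c := by
    rw [contDiff_one_iff_deriv]
    refine ⟨fun t => (cd t).differentiableAt, ?_⟩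
    have : deriv c = fun t => F m (c t) := funext (fun t => (cd t).deriv)
    rw [this]; exact (hF m).continuous.comp cc
  have acont : Continuous fun t => (c t).1 := cc.fst
  have bcont : Continuous fun t => (c t).2 := cc.snd
  have Nc : Continuous fun t => NN k m (c t).1 (c t).2 := by unfold NN; fun_prop
  have Dc : Continuous fun t => DD k τ m (c t).1 (c t).2 := by unfold DD NN; fun_prop
  -- the box
  have box : ∀ a b : ℝ, 0 ≤ a → 0 ≤ b → τ * b^2 ≤ 1 → NN k m a b ≤ 0 → F m (a, b) = bF k τ (m, a, b) := by
    intro a b ha hb h1 h2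
    have hb1 : b ≤ 1/τ := by
      rw [le_div_iff₀ hτ0]
      by_contra h; push Not at h
      have : b * 1 < b * (b * τ) := mul_lt_mul_of_pos_left h (by nlinarith)
      have : 1 < b := by nlinarith
      nlinarith
    have ha1 : a ≤ (k-m)/(m*τ) := by
      unfold NN at h2
      have : (k-m) * b ≤ (k-m) * (1/τ) := mul_le_mul_of_nonneg_left hb1 hq.le
      have h3 : m * a ≤ (k-m) * (1/τ) := by linarith
      rw [le_div_iff₀ (by positivity)]
      calc a * (m*τ) = (m*a)*τ := by ring
        _ ≤ ((k-m) * (1/τ)) * τ := mul_le_mul_of_nonneg_right h3 hτ0.le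
        _ = k - m := by field_simp
    refine hFe m a b ?_ ?_ ?_
    · rw [abs_of_pos hm]; linarith
    · rw [abs_of_nonneg ha]; linarith
    · rw [abs_of_nonneg hb]; linarith
  set h : ℝ → ℝ := fun t => min (-NN k m (c t).1 (c t).2) (min (1 - τ*(c t).2^2) (min (-DD k τ m (c t).1 (c t).2) (min (c t).1 (c t).2))) with hh
  have hhc : Continuous h := by rw [hh]; fun_prop
  have hpos : ∀ t, 0 < h t ↔ (NN k m (c t).1 (c t).2 < 0 ∧ τ*(c t).2^2 < 1 ∧ DD k τ m (c t).1 (c t).2 < 0 ∧ 0 < (c t).1 ∧ 0 < (c t).2) := by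
    intro t; simp only [hh, lt_min_iff, neg_pos, sub_pos]
  have hh0 : 0 < h 0 := by
    rw [hpos, c0]
    exact ⟨hN0, hτb, B.Dneg ha0 hN0.le hG0.le, by simp; linarith, hb0⟩
  -- along the good part
  have good : ∀ T, 0 < T → (∀ s ∈ Ico 0 T, 0 < h s) → ∀ s ∈ Ico 0 T, HasDerivAt c (bF k τ (m, c s)) s ∧ a0 ≤ (c s).1 ∧ b0 ≤ (c s).2 ∧
      GG e ρ p (1 - (k-m)*(c s).2/(m*(c s).1)) (1 - (c s).1^2) < 0 := by
    intro T hT hp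
    have der : ∀ s ∈ Ico 0 T, HasDerivAt c (bF k τ (m, c s)) s := by
      intro s hs
      obtain ⟨p1, p2, p3, p4, p5⟩ := (hpos s).1 (hp s hs)
      have := box _ _ p4.le p5.le p2.le p1.le
      have h2 := cd s
      rw [show c s = ((c s).1, (c s).2) from rfl, this] at h2
      exact h2
    have ma : ∀ s ∈ Ico 0 T, a0 ≤ (c s).1 := by
      intro s hs
      have := mono_Ico (fun s hs => hd_fst (der s hs)) (fun s hs => by
        obtain ⟨p1, p2, p3, p4, p5⟩ := (hpos s).1 (hp s hs)
        simp only [bF]; nlinarith) 0 ⟨le_rfl, hT⟩ s hs hs.1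
      simpa [c0] using this
    have mb : ∀ s ∈ Ico 0 T, b0 ≤ (c s).2 := by
      intro s hs
      have := mono_Ico (fun s hs => hd_snd (der s hs)) (fun s hs => by
        obtain ⟨p1, p2, p3, p4, p5⟩ := (hpos s).1 (hp s hs)
        simp only [bF]
        have i1 : 0 < (1 - τ*(c s).2^2) * (-NN k m (c s).1 (c s).2) := mul_pos (by linarith) (by linarith)
        have := mul_pos hq i1
        linarith) 0 ⟨le_rfl, hT⟩ s hs hs.1
      simpa [c0] using this
    have xneg : ∀ s ∈ Ico 0 T, 1 - (k-m)*(c s).2/(m*(c s).1) < 0 := by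
      intro s hs
      obtain ⟨p1, p2, p3, p4, p5⟩ := (hpos s).1 (hp s hs)
      unfold NN at p1
      rw [sub_neg, lt_div_iff₀ (by positivity)]; linarith
    have Gd : ∀ s ∈ Ico 0 T, HasDerivAt (fun s => -GG e ρ p (1 - (k-m)*(c s).2/(m*(c s).1)) (1 - (c s).1^2))
       (-(FL k (m * (k - m) * (1 - τ)) (m + (k-m)*(τ*m)) (1 - (k-m)*(c s).2/(m*(c s).1)) (1 - (c s).1^2) * (1 - ρ * (1 - (k-m)*(c s).2/(m*(c s).1)))
        - FX k m (e+g) (τ*m) (1 - (k-m)*(c s).2/(m*(c s).1)) (1 - (c s).1^2) * (ρ * (1 - (c s).1^2) + e + 2 * p * (1 - (k-m)*(c s).2/(m*(c s).1))))) s := by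
      intro s hs
      obtain ⟨x1, x2⟩ := xL_deriv hm.ne' hq.ne' B.heg (der s hs) (by linarith [ma s hs])
      exact (GG_deriv x1 x2).neg
    have bar := barrier (T := T) (h := fun s => -GG e ρ p (1 - (k-m)*(c s).2/(m*(c s).1)) (1 - (c s).1^2))
      (fun s hs => (Gd s hs).continuousAt.continuousWithinAt) (by simp only [c0]; linarith)
      (fun s hs hz => ⟨_, neg_pos.2 (B.dneg (xneg s ⟨hs.1.le, hs.2⟩) (neg_eq_zero.1 hz)), Gd s ⟨hs.1.le, hs.2⟩⟩)
    exact fun s hs => ⟨der s hs, ma s hs, mb s hs, neg_pos.1 (bar s hs)⟩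
  by_cases hex : ∃ t, 0 ≤ t ∧ h t ≤ 0
  · obtain ⟨t1, ht1, hz, hp⟩ := first_exit h hhc hh0 hex
    have gd := good t1 ht1 hp
    have a1 : a0 ≤ (c t1).1 := le_at_end ht1 acont.continuousAt (fun s hs => (gd s hs).2.1)
    have b1 : b0 ≤ (c t1).2 := le_at_end ht1 bcont.continuousAt (fun s hs => (gd s hs).2.2.1)
    have n1 : 0 ≤ -NN k m (c t1).1 (c t1).2 := le_at_end (f := fun t => -NN k m (c t).1 (c t).2) ht1 Nc.neg.continuousAt (fun s hs => by linarith [((hpos s).1 (hp s hs)).1])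
    have y1 : 0 ≤ 1 - τ * (c t1).2^2 := le_at_end (f := fun t => 1 - τ * (c t).2^2) ht1 (by fun_prop) (fun s hs => by linarith [((hpos s).1 (hp s hs)).2.1])
    have g1 : 0 ≤ -GG e ρ p (1 - (k-m)*(c t1).2/(m*(c t1).1)) (1 - (c t1).1^2) := by
      refine le_at_end (f := fun s => -GG e ρ p (1 - (k-m)*(c s).2/(m*(c s).1)) (1 - (c s).1^2)) ht1 ?_ (fun s hs => by linarith [(gd s hs).2.2.2])
      have : m * (c t1).1 ≠ 0 := mul_ne_zero hm.ne' (by linarith)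
      unfold GG; fun_prop (disch := assumption)
    have D1 : DD k τ m (c t1).1 (c t1).2 < 0 := B.Dneg (by linarith) (by linarith) (by linarith)
    have der1 : HasDerivAt c (bF k τ (m, c t1)) t1 := by
      have := box (c t1).1 (c t1).2 (by linarith) (by linarith) (by linarith) (by linarith)
      have h2 := cd t1
      rw [show c t1 = ((c t1).1, (c t1).2) from rfl, this] at h2
      exact h2
    have Y1 : 0 < 1 - τ * (c t1).2^2 := by
      obtain ⟨C, hC⟩ := (isCompact_Icc (a := 0) (b := t1)).exists_bound_of_continuousOn
        (f := fun t => 2*τ*(k-m)*(c t).2 * NN k m (c t).1 (c t).2) (by fun_prop)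
      refine lin_pos (y := fun t => 1 - τ * (c t).2^2) (α := fun t => 2*τ*(k-m)*(c t).2 * NN k m (c t).1 (c t).2) (C := C) ht1 ?_ ?_ ?_ (by fun_prop) (by simp only [c0]; linarith)
      · intro t ht
        have := (((hd_snd (gd t ht).1).pow 2).const_mul τ).const_sub 1
        refine this.congr_deriv ?_
        simp only [bF]; push_cast; ring
      · intro t ht
        have := hC t ⟨ht.1, ht.2.le⟩
        rw [Real.norm_eq_abs, abs_le] at this
        exact this.1
      · intro t ht
        linarith [((hpos t).1 (hp t ht)).2.1]
    have N1 : NN k m (c t1).1 (c t1).2 = 0 := by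
      by_contra hne
      have : 0 < h t1 := (hpos t1).2 ⟨lt_of_le_of_ne (by linarith) hne, by linarith, D1, by linarith, by linarith⟩
      linarith
    refine ⟨c, t1, ht1, c0, ?_, fun t ht => ((hpos t).1 (hp t ht)).1, N1, c1⟩
    intro t ht
    rcases ht.2.lt_or_eq with hlt | rfl
    · have g := gd t ⟨ht.1, hlt⟩
      have p := (hpos t).1 (hp t ⟨ht.1, hlt⟩)
      exact ⟨g.1, by linarith, p.2.2.2.2, p.2.1, p.2.2.1⟩
    · exact ⟨der1, by linarith, by linarith, by linarith, D1⟩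
  · exfalso
    push Not at hex
    have gd : ∀ s, 0 ≤ s → HasDerivAt c (bF k τ (m, c s)) s ∧ a0 ≤ (c s).1 ∧ b0 ≤ (c s).2 ∧
      GG e ρ p (1 - (k-m)*(c s).2/(m*(c s).1)) (1 - (c s).1^2) < 0 := fun s hs =>
      good (s+1) (by linarith) (fun t ht => hex t ht.1) s ⟨hs, by linarith⟩
    have hp := fun (t : ℝ) (ht : 0 ≤ t) => (hpos t).1 (hex t ht)
    have bb : ∀ t, 0 ≤ t → (c t).2 ≤ 1/τ ∧ (c t).1 ≤ (k-m)/(m*τ) := by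
      intro t ht
      obtain ⟨p1, p2, p3, p4, p5⟩ := hp t ht
      have hb1 : (c t).2 ≤ 1/τ := by
        rw [le_div_iff₀ hτ0]
        by_contra h; push Not at h
        have : 1 < (c t).2 := by nlinarith
        nlinarith
      refine ⟨hb1, ?_⟩
      unfold NN at p1
      have : (k-m) * (c t).2 ≤ (k-m) * (1/τ) := mul_le_mul_of_nonneg_left hb1 hq.le
      have h3 : m * (c t).1 ≤ (k-m) * (1/τ) := by linarith
      rw [le_div_iff₀ (by positivity)]
      calc (c t).1 * (m*τ) = (m*(c t).1)*τ := by ring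
        _ ≤ ((k-m) * (1/τ)) * τ := mul_le_mul_of_nonneg_right h3 hτ0.le
        _ = k - m := by field_simp
    have lim : ∀ f : ℝ → ℝ, ∀ f' : ℝ → ℝ, ∀ M, (∀ t, 0 ≤ t → HasDerivAt f (f' t) t) → (∀ t, 0 ≤ t → 0 ≤ f' t) → (∀ t, 0 ≤ t → f t ≤ M) → ∃ l, Tendsto f atTop (𝓝 l) := by
      intro f f' M h1 h2 h3
      obtain ⟨l, -, -, hl⟩ := anti_lim (f := fun t => - f t) (b := -M) (fun s hs t ht hst => by
        have := mono_Ico (f := f) (f' := f') (T := t+1) (fun u hu => h1 u hu.1) (fun u hu => h2 u hu.1) s ⟨hs, by linarith⟩ t ⟨ht, by linarith⟩ hst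
        simp only; linarith) (fun t ht => by linarith [h3 t ht])
      refine ⟨-l, ?_⟩
      have := hl.neg
      simpa using this
    obtain ⟨al, hal⟩ := lim _ _ _ (fun t ht => hd_fst (gd t ht).1) (fun t ht => by
        obtain ⟨p1, p2, p3, p4, p5⟩ := hp t ht
        simp only [bF]; nlinarith) (fun t ht => (bb t ht).2)
    obtain ⟨bl, hbl⟩ := lim _ _ _ (fun t ht => hd_snd (gd t ht).1) (fun s hs => by
        obtain ⟨p1, p2, p3, p4, p5⟩ := hp s hs
        simp only [bF]
        have i1 : 0 < (1 - τ*(c s).2^2) * (-NN k m (c s).1 (c s).2) := mul_pos (by linarith) (by linarith)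
        have := mul_pos hq i1
        linarith) (fun t ht => (bb t ht).1)
    have hDl : Tendsto (fun t => DD k τ m (c t).1 (c t).2) atTop (𝓝 (DD k τ m al bl)) := by
      have hcont : Continuous fun q : ℝ × ℝ => DD k τ m q.1 q.2 := by unfold DD NN; fun_prop
      exact (hcont.tendsto (al, bl)).comp (hal.prodMk_nhds hbl)
    have hNl : Tendsto (fun t => NN k m (c t).1 (c t).2) atTop (𝓝 (NN k m al bl)) := by
      have hcont : Continuous fun q : ℝ × ℝ => NN k m q.1 q.2 := by unfold NN; fun_prop
      exact (hcont.tendsto (al, bl)).comp (hal.prodMk_nhds hbl)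
    have hal1 : a0 ≤ al := ge_of_tendsto hal (by filter_upwards [eventually_ge_atTop 0] with t ht using (gd t ht).2.1)
    have hGl : Tendsto (fun s => GG e ρ p (1 - (k-m)*(c s).2/(m*(c s).1)) (1 - (c s).1^2)) atTop (𝓝 (GG e ρ p (1 - (k-m)*bl/(m*al)) (1 - al^2))) := by
      have hne : m * al ≠ 0 := mul_ne_zero hm.ne' (by linarith)
      have hcont : ContinuousAt (fun q : ℝ × ℝ => GG e ρ p (1 - (k-m)*q.2/(m*q.1)) (1 - q.1^2)) (al, bl) := by
        unfold GG; fun_prop (disch := assumption)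
      exact (hcont.tendsto).comp (hal.prodMk_nhds hbl)
    have hD0 := lim_deriv_zero (fun t ht => hd_fst (gd t ht).1) hal ((hDl.const_mul (k-m)).neg)
    have := B.Dneg (a := al) (b := bl) (by linarith) (le_of_tendsto hNl (by filter_upwards [eventually_ge_atTop 0] with t ht using (hp t ht).1.le))
      (le_of_tendsto hGl (by filter_upwards [eventually_ge_atTop 0] with t ht using (gd t ht).2.2.2.le))
    nlinarith

theorem pev_sign4 {q : PowerSeries ℝ} {r : ℝ} (hr : 0 < r) (hq : AS q r) (h0 : ∀ i < 4, coeff i q = 0) (h4 : coeff 4 q < 0) :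
    ∀ᶠ θ in 𝓝 0, θ ≠ 0 → pev q θ < 0 := by
  set p : PowerSeries ℝ := PowerSeries.mk (fun n => coeff (n+4) q) with hp
  have hpA : AS p r := by
    unfold AS at hq ⊢
    have := ((summable_nat_add_iff 4).2 hq).mul_left (r^4)⁻¹
    refine this.congr (fun n => ?_)
    rw [hp, PowerSeries.coeff_mk, pow_add]
    field_simp
  have hc : ContinuousAt (pev p) 0 := (pev_analytic hpA (by simpa using hr)).continuousAt
  have hp0 : pev p 0 < 0 := by rw [pev_zero, hp, PowerSeries.coeff_mk]; exact h4
  have hb : ∀ᶠ θ in 𝓝 (0:ℝ), |θ| < r := by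
    have : Tendsto (fun θ : ℝ => |θ|) (𝓝 0) (𝓝 |0|) := continuous_abs.tendsto 0
    rw [abs_zero] at this
    exact this.eventually (gt_mem_nhds hr)
  filter_upwards [hc.tendsto.eventually (gt_mem_nhds hp0), hb] with θ h1 h2 h3
  have hs := (hq.sum h2.le).of_norm
  have : pev q θ = θ^4 * pev p θ := by
    unfold pev
    rw [← hs.sum_add_tsum_nat_add 4, ← tsum_mul_left]
    rw [Finset.sum_eq_zero (fun i hi => by rw [h0 i (Finset.mem_range.1 hi), zero_mul]), zero_add]
    refine tsum_congr (fun n => ?_)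
    rw [hp, PowerSeries.coeff_mk]; ring
  rw [this]
  have : 0 < θ^4 := by positivity
  nlinarith

theorem pev_GG {x L : PowerSeries ℝ} {e ρ p r θ : ℝ} (hr : 0 ≤ r) (ax : AS x r) (aL : AS L r) (hθ : |θ| ≤ r) :
   AS (GG (PowerSeries.C e) (PowerSeries.C ρ) (PowerSeries.C p) x L) r ∧
   pev (GG (PowerSeries.C e) (PowerSeries.C ρ) (PowerSeries.C p) x L) θ = GG e ρ p (pev x θ) (pev L θ) := by
  unfold GG
  have e1 : (1 : PowerSeries ℝ) = PowerSeries.C 1 := by simp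
  rw [e1]
  have a1 : AS (PowerSeries.C 1 - PowerSeries.C ρ * x) r := (AS.C _ _).sub (ax.C_mul _) hr
  have a2 : AS (PowerSeries.C e + PowerSeries.C p * x) r := (AS.C _ _).add (ax.C_mul _) hr
  refine ⟨(aL.mul a1 hr).sub (ax.mul a2 hr) hr, ?_⟩
  rw [pev_sub (aL.mul a1 hr) (ax.mul a2 hr) hθ, pev_mul aL a1 hθ, pev_mul ax a2 hθ, pev_sub (AS.C _ _) (ax.C_mul _) hθ,
    pev_add (AS.C _ _) (ax.C_mul _) hθ, pev_C_mul, pev_C_mul, pev_C, pev_C]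

theorem BR_of {k τ m3 m4 m : ℝ} (w : WIN k τ m3 m4) (hm : m ∈ Ioo m3 m4) {x L : PowerSeries ℝ} (S : SERm k τ m x L) :
    ∃ ρ p, BR k τ m (eF k τ m) (gF k τ m) ρ p ∧
    (∀ i < 4, coeff i (GG (PowerSeries.C (eF k τ m)) (PowerSeries.C ρ) (PowerSeries.C p) x L) = 0) ∧
    coeff 4 (GG (PowerSeries.C (eF k τ m)) (PowerSeries.C ρ) (PowerSeries.C p) x L) < 0 := by
  obtain ⟨ρ, p, e1, e2, h1, h2, h3, h4, q1, q2, q3, q4, q5, q6, H⟩ := signs w ⟨hm.1, hm.2.le⟩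
  have P := w.pp m ⟨hm.1.le, hm.2.le⟩
  unfold PPm at P
  obtain ⟨g0, g4⟩ := SERm.G w ⟨hm.1, hm.2.le⟩ S q1 q2
  refine ⟨ρ, p, ⟨P.hk, P.hm, by linarith [P.hq0], P.hτ0, P.hτ1, P.he, h2, h3, P.heg, P.hσe, q1, q2, q3, q4, q5, q6, H⟩, g0, ?_⟩
  have := mul_pos P.hk (w.p4 m ⟨hm.1.le, hm.2⟩)
  rw [← mneg_iff this, g4]; linarith

/-- the data to the right of the sonic point -/
structure RIGHT (k τ m : ℝ) (x L : PowerSeries ℝ) (s0 : ℝ) (c : ℝ → ℝ × ℝ) (t1 : ℝ) : Prop where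
  spos : 0 < s0
  loc : ∀ θ ∈ Ico (-s0) 0, pev x θ < 0 ∧ pev L θ < 0 ∧ 0 < (cP m (k-m) x L θ).2 ∧ τ * (cP m (k-m) x L θ).2^2 < 1 ∧
    DD k τ m (cP m (k-m) x L θ).1 (cP m (k-m) x L θ).2 < 0
  tpos : 0 < t1
  c0 : c 0 = cP m (k-m) x L (-s0)
  orb : ∀ t ∈ Icc 0 t1, HasDerivAt c (bF k τ (m, c t)) t ∧ 1 < (c t).1 ∧ 0 < (c t).2 ∧ τ * (c t).2^2 < 1 ∧ DD k τ m (c t).1 (c t).2 < 0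
  Nneg : ∀ t ∈ Ico 0 t1, NN k m (c t).1 (c t).2 < 0
  N1 : NN k m (c t1).1 (c t1).2 = 0
  c1 : ContDiff ℝ 1 c

theorem right_exists {k τ m3 m4 m : ℝ} (w : WIN k τ m3 m4) (hm : m ∈ Ioo m3 m4) {x L : PowerSeries ℝ} (S : SERm k τ m x L)
    {r : ℝ} (hr : 0 < r) (ax : AS x r) (aL : AS L r) : ∃ s0 c t1, s0 < r ∧ RIGHT k τ m x L s0 c t1 := by
  obtain ⟨ρ, p, B, g0, g4⟩ := BR_of w hm S
  have P := w.pp m ⟨hm.1.le, hm.2.le⟩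
  unfold PPm at P
  have hm0 := B.hm
  have hq : 0 < k - m := P.hq0
  have hG := pev_sign4 hr (pev_GG (e := eF k τ m) (ρ := ρ) (p := p) (θ := 0) hr.le ax aL (by simpa using hr.le)).1 g0 g4
  have cx : ContinuousAt (pev x) 0 := (pev_analytic ax (by simpa using hr)).continuousAt
  have cL : ContinuousAt (pev L) 0 := (pev_analytic aL (by simpa using hr)).continuousAt
  have x0 : pev x 0 = 0 := by rw [pev_zero, S.x0]
  have L0 : pev L 0 = 0 := by rw [pev_zero, S.l0]
  have hb : ∀ᶠ θ in 𝓝 (0:ℝ), |θ| < r := by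
    have : Tendsto (fun θ : ℝ => |θ|) (𝓝 0) (𝓝 |0|) := continuous_abs.tendsto 0
    rw [abs_zero] at this
    exact this.eventually (gt_mem_nhds hr)
  have hx : ∀ᶠ θ in 𝓝 (0:ℝ), θ < 0 → pev x θ < 0 := by
    have hd := pev_deriv_zero hr ax
    rw [S.x1] at hd
    have h1 := hd.tendsto_slope
    have h2 := eventually_nhdsWithin_iff.1 (h1.eventually (lt_mem_nhds (show (0:ℝ) < 1 by norm_num)))
    filter_upwards [h2] with θ h3 h4
    have h5 := h3 (by simpa using h4.ne)
    rw [slope_def_field, x0] at h5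
    by_contra h6
    push Not at h6
    have := div_nonpos_of_nonneg_of_nonpos (show 0 ≤ pev x θ - 0 by linarith) (show θ - 0 ≤ 0 by linarith)
    linarith
  have hx1 : ∀ᶠ θ in 𝓝 (0:ℝ), τ * (cP m (k-m) x L θ).2^2 < 1 := by
    have hc : ContinuousAt (fun θ => τ * (cP m (k-m) x L θ).2^2) 0 := by unfold cP; fun_prop
    refine hc.tendsto.eventually (gt_mem_nhds ?_)
    simp only [cP, x0, L0, sub_zero, sqrt_one, mul_one]
    have h1 : 0 < gF k τ m * (2 + eF k τ m) * k := mul_pos (mul_pos P.hg (by linarith [P.he])) P.hk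
    rw [P.hgg] at h1
    rw [div_pow, ← mul_div_assoc, div_lt_one (by positivity)]
    linarith
  obtain ⟨δ, hδ, hall⟩ := Metric.eventually_nhds_iff.1 (hG.and (hb.and (hx.and hx1)))
  have loc : ∀ θ ∈ Ico (-(δ/2)) 0, pev x θ < 0 ∧ pev L θ < 0 ∧ 0 < (cP m (k-m) x L θ).2 ∧ τ * (cP m (k-m) x L θ).2^2 < 1 ∧
    DD k τ m (cP m (k-m) x L θ).1 (cP m (k-m) x L θ).2 < 0 ∧ 1 < (cP m (k-m) x L θ).1 ∧ NN k m (cP m (k-m) x L θ).1 (cP m (k-m) x L θ).2 < 0 ∧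
    GG (eF k τ m) ρ p (1 - (k-m)*(cP m (k-m) x L θ).2/(m*(cP m (k-m) x L θ).1)) (1 - (cP m (k-m) x L θ).1^2) < 0 ∧ |θ| < r := by
    intro θ hθ
    obtain ⟨h1, h2, h3, h4⟩ := hall (y := θ) (by rw [Real.dist_eq, sub_zero, abs_of_neg hθ.2]; linarith [hθ.1])
    have h1 := h1 hθ.2.ne
    have h3 := h3 hθ.2
    rw [(pev_GG hr.le ax aL h2.le).2] at h1
    have hρ := B.hρ
    have hp := B.hp
    have he := B.he
    have hL : pev L θ < 0 := by
      unfold GG at h1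
      have i1 : 0 < 1 - ρ * pev x θ := by nlinarith
      have i2 : 0 < eF k τ m + p * pev x θ := by nlinarith
      by_contra h5; push Not at h5
      have := mul_nonneg h5 i1.le
      have := mul_neg_of_neg_of_pos h3 i2
      linarith
    have ha : 1 < (cP m (k-m) x L θ).1 := by
      simp only [cP]; rw [Real.lt_sqrt (by norm_num)]; linarith
    have hN : NN k m (cP m (k-m) x L θ).1 (cP m (k-m) x L θ).2 < 0 := (cP_Npos (w.pp m ⟨hm.1.le, hm.2.le⟩) (by linarith)).2.2 h3
    have hb := cP_b (w.pp m ⟨hm.1.le, hm.2.le⟩) (L := L) (x := x) (θ := θ) (by linarith) (by linarith)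
    have ea : 1 - (cP m (k-m) x L θ).1^2 = pev L θ := by
      simp only [cP]; rw [Real.sq_sqrt (by linarith)]; ring
    have eb : 1 - (k-m)*(cP m (k-m) x L θ).2/(m*(cP m (k-m) x L θ).1) = pev x θ := by
      have : (cP m (k-m) x L θ).1 ≠ 0 := by linarith
      have e2 : (cP m (k-m) x L θ).2 = m/(k-m) * (cP m (k-m) x L θ).1 * (1 - pev x θ) := rfl
      rw [e2]; field_simp; ring
    have hGG : GG (eF k τ m) ρ p (1 - (k-m)*(cP m (k-m) x L θ).2/(m*(cP m (k-m) x L θ).1)) (1 - (cP m (k-m) x L θ).1^2) < 0 := by rw [ea, eb]; exact h1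
    exact ⟨h3, hL, hb, h4, B.Dneg ha hN.le hGG.le, ha, hN, hGG, h2⟩
  obtain ⟨u1, u2, u3, u4, u5, u6, u7, u8, u9⟩ := loc (-(δ/2)) ⟨le_rfl, by linarith⟩
  obtain ⟨c, t1, ht1, c0, orb, Nn, N1, c1⟩ := right_ab B u6 u3 u4 u7 u8
  refine ⟨δ/2, c, t1, ?_, by linarith, fun θ hθ => ?_, ht1, c0, orb, Nn, N1, c1⟩
  · rwa [abs_neg, abs_of_pos (by linarith)] at u9
  · obtain ⟨v1, v2, v3, v4, v5, -⟩ := loc θ hθ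
    exact ⟨v1, v2, v3, v4, v5⟩

/-- the sonic curve followed by an orbit -/
noncomputable def cg (κ m q : ℝ) (x L : PowerSeries ℝ) (s : ℝ) (c : ℝ → ℝ × ℝ) (t : ℝ) : ℝ × ℝ :=
  if t ≤ 0 then cP m q x L (s * exp (κ * t)) else c t

theorem cg_deriv {k τ m : ℝ} (P : PPm k τ m) {x L : PowerSeries ℝ} (S : SERm k τ m x L) {r s : ℝ} (ax : AS x r) (aL : AS L r) (hs : |s| < r)
    (hL : ∀ t ≤ 0, pev L (s * exp (k * gF k τ m * t)) < 1) {c : ℝ → ℝ × ℝ} (c0 : c 0 = cP m (k-m) x L s) {T : ℝ} (hT : 0 ≤ T)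
    (hc : ∀ t ∈ Icc 0 T, HasDerivAt c (bF k τ (m, c t)) t) (t : ℝ) (ht : t ≤ T) :
    HasDerivAt (cg (k * gF k τ m) m (k-m) x L s c) (bF k τ (m, cg (k * gF k τ m) m (k-m) x L s c t)) t := by
  unfold PPm at P
  have hkg : 0 < k * gF k τ m := mul_pos P.hk P.hg
  have cf : ∀ t ≤ 0, HasDerivAt (fun t => cP m (k-m) x L (s * exp (k * gF k τ m * t))) (bF k τ (m, cP m (k-m) x L (s * exp (k * gF k τ m * t)))) t := by
    intro t ht
    refine cP_flow P S ax aL ?_ (hL t ht)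
    rw [abs_mul, abs_of_pos (exp_pos _)]
    have : exp (k * gF k τ m * t) ≤ 1 := exp_le_one_iff.2 (by nlinarith)
    exact lt_of_le_of_lt (mul_le_of_le_one_right (abs_nonneg s) this) hs
  rcases lt_trichotomy t 0 with h | h | h
  · have e : cg (k * gF k τ m) m (k-m) x L s c =ᶠ[𝓝 t] fun t => cP m (k-m) x L (s * exp (k * gF k τ m * t)) := by
      filter_upwards [gt_mem_nhds h] with u hu
      simp [cg, hu.le]
    rw [e.eq_of_nhds]
    exact (cf t h.le).congr_of_eventuallyEq e
  · subst h
    have e : cg (k * gF k τ m) m (k-m) x L s c 0 = cP m (k-m) x L s := by simp [cg]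
    rw [e]
    have h1 := cf 0 le_rfl
    simp only [mul_zero, exp_zero, mul_one] at h1
    have h2 := hc 0 ⟨le_rfl, hT⟩
    rw [c0] at h2
    refine glue_deriv h1 h2 ?_ ?_
    · filter_upwards [self_mem_nhdsWithin] with u hu
      simp [cg, show u ≤ 0 from hu]
    · filter_upwards [self_mem_nhdsWithin] with u hu
      rcases (show (0:ℝ) ≤ u from hu).eq_or_lt with h | h
      · rw [← h, e, c0]
      · simp [cg, h]
  · have e : cg (k * gF k τ m) m (k-m) x L s c =ᶠ[𝓝 t] c := by
      filter_upwards [lt_mem_nhds h] with u hu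
      simp [cg, hu]
    rw [e.eq_of_nhds]
    exact (hc t ⟨h.le, ht⟩).congr_of_eventuallyEq e

theorem cg_lim {κ m q r s : ℝ} (hκ : 0 < κ) {x L : PowerSeries ℝ} (x0 : coeff 0 x = 0) (l0 : coeff 0 L = 0) (hr : 0 < r) (ax : AS x r) (aL : AS L r)
    (c : ℝ → ℝ × ℝ) : Tendsto (cg κ m q x L s c) atBot (𝓝 (1, m/q)) := by
  have cx : ContinuousAt (pev x) 0 := (pev_analytic ax (by simpa using hr)).continuousAt
  have cL : ContinuousAt (pev L) 0 := (pev_analytic aL (by simpa using hr)).continuousAt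
  have hc : ContinuousAt (cP m q x L) 0 := by unfold cP; fun_prop
  have h0 : cP m q x L 0 = (1, m/q) := by simp [cP, pev_zero, x0, l0]
  have ht : Tendsto (fun t => s * exp (κ * t)) atBot (𝓝 0) := by
    have : Tendsto (fun t => exp (κ * t)) atBot (𝓝 0) := tendsto_exp_atBot.comp (tendsto_id.const_mul_atBot hκ)
    simpa using this.const_mul s
  have := hc.tendsto.comp ht
  rw [h0] at this
  refine this.congr' ?_
  filter_upwards [eventually_le_atBot 0] with t ht
  simp [cg, ht]

/-- physical coordinates -/
noncomputable def Zo (τ : ℝ) (p : ℝ × ℝ) : ℝ := √τ * (p.1 + p.2) / (1 + τ * p.1 * p.2)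
noncomputable def Vo (τ : ℝ) (p : ℝ × ℝ) : ℝ := √τ * p.2

theorem Zo_deriv {k τ m : ℝ} {c : ℝ → ℝ × ℝ} {t : ℝ}
    (hc : HasDerivAt c (bF k τ (m, c t)) t) (h1 : 1 + τ * (c t).1 * (c t).2 ≠ 0) :
    HasDerivAt (fun t => Zo τ (c t)) (-((k-m) * √τ * (1 - τ * (c t).2^2) * ((c t).1 + (c t).2) * (1 - (c t).1^2) / (1 + τ * (c t).1 * (c t).2)^2)) t ∧
    HasDerivAt (fun t => Vo τ (c t)) (-((k-m) * √τ * (1 - τ * (c t).2^2) * NN k m (c t).1 (c t).2)) t := by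
  have a1 := hd_fst hc
  have a2 := hd_snd hc
  constructor
  · have := ((a1.add a2).const_mul √τ).div (((a1.const_mul τ).mul a2).const_add 1) h1
    refine this.congr_deriv ?_
    simp only [bF, DD, NN]
    simp only [Pi.add_apply, Pi.mul_apply] at *
    generalize (c t).1 = a at *
    generalize (c t).2 = b at *
    field_simp
    ring
  · refine (a2.const_mul √τ).congr_deriv ?_
    simp only [bF]; ring

theorem Zo_delta {k τ m ℓ a b : ℝ} (hτ : 0 < τ) (hℓ : ℓ = 1/τ) (h1 : 1 + τ * a * b ≠ 0) :
    DeltaZ ℓ (Zo τ (a,b)) (Vo τ (a,b)) = Zo τ (a,b) * (1 - τ * b^2)^2 * (1 - a^2) / (1 + τ * a * b)^2 ∧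
    Deltav m k (Zo τ (a,b)) (Vo τ (a,b)) = (1 - τ * b^2)^2 * √τ * NN k m a b / (1 + τ * a * b) := by
  obtain ⟨r, hr⟩ : ∃ r, r = √τ := ⟨_, rfl⟩
  have hr2 : τ = r^2 := by rw [hr, Real.sq_sqrt hτ.le]
  have hr0 : r ≠ 0 := by rw [hr]; exact (Real.sqrt_pos.2 hτ).ne'
  simp only [Zo, Vo, DeltaZ, Deltav, NN, ← hr, hℓ]
  rw [hr2] at h1 ⊢
  constructor
  · field_simp
    ring
  · have hZ : r * (a + b) / (1 + r^2*a*b) * (1 + r^2*a*b) = r * (a + b) := div_mul_cancel₀ _ h1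
    rw [eq_div_iff h1]
    generalize r * (a + b) / (1 + r^2*a*b) = Z at *
    linear_combination (1 - (r*b)^2) * (m*(1-(r*b)^2) + k*(r*b)^2) * hZ

theorem c1_of {E : Type*} [NormedAddCommGroup E] [NormedSpace ℝ E] {I : Set ℝ} (hI : IsOpen I) {f f' : ℝ → E} (h : ∀ t ∈ I, HasDerivAt f (f' t) t)
    (hc : ContinuousOn f' I) : ∀ t ∈ I, ContDiffAt ℝ 1 f t := by
  have : ContDiffOn ℝ 1 f I := by
    have := (contDiffOn_succ_iff_deriv_of_isOpen (𝕜 := ℝ) (n := 0) (f := f) hI)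
    rw [zero_add] at this
    rw [this]
    refine ⟨fun t ht => (h t ht).differentiableAt.differentiableWithinAt, by simp, ?_⟩
    rw [contDiffOn_zero]
    exact hc.congr (fun t ht => (h t ht).deriv)
  exact fun t ht => this.contDiffAt (hI.mem_nhds ht)

theorem graph_fn {I : Set ℝ} (hI : IsOpen I) {Zc w dz dw : ℝ → ℝ} (hj : InjOn Zc I) (hZ : ∀ t ∈ I, ContDiffAt ℝ 1 Zc t) (hw : ∀ t ∈ I, ContDiffAt ℝ 1 w t)
    (h1 : ∀ t ∈ I, HasDerivAt Zc (dz t) t) (h2 : ∀ t ∈ I, HasDerivAt w (dw t) t) (h0 : ∀ t ∈ I, dz t ≠ 0) :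
    ∃ v : ℝ → ℝ, ∀ t ∈ I, v (Zc t) = w t ∧ HasDerivAt v (dw t / dz t) (Zc t) := by
  have e : ∀ t ∈ I, (fun z => w (Function.invFunOn Zc I z)) (Zc t) = w t := by
    intro t ht
    simp only
    rw [hj.leftInvOn_invFunOn ht]
  refine ⟨fun z => w (Function.invFunOn Zc I z), fun t ht => ⟨e t ht, ?_⟩⟩
  refine (graph_local le_rfl (hZ t ht) (hw t ht) (h1 t ht) (h2 t ht) (h0 t ht) ?_).2
  filter_upwards [hI.mem_nhds ht] with u hu using e u hu

/-- regular points of an orbit -/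
theorem bF_C1 {k τ m : ℝ} {I : Set ℝ} (hI : IsOpen I) {c : ℝ → ℝ × ℝ} (h : ∀ t ∈ I, HasDerivAt c (bF k τ (m, c t)) t) : ∀ t ∈ I, ContDiffAt ℝ 1 c t := by
  refine c1_of hI h ?_
  have hc : ContinuousOn c I := fun t ht => (h t ht).continuousAt.continuousWithinAt
  exact (bF_contDiff k τ).continuous.comp_continuousOn (continuousOn_const.prodMk hc)

theorem PPm.tmq {k τ m : ℝ} (P : PPm k τ m) : τ * m^2 < (k-m)^2 := by
  unfold PPm at P
  have h := P.hgg
  have := mul_pos (mul_pos P.hg (show 0 < 2 + eF k τ m by linarith [P.he])) P.hk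
  linarith

theorem left_tb {k τ m a b : ℝ} (P : PPm k τ m) (hN : 0 < NN k m a b) (hb : 0 < b) (ha : a < 1) : 0 < a ∧ τ * b^2 < 1 := by
  have hq := P.hq0
  have hm := P.hm
  have h := P.tmq
  unfold NN at hN
  have h1 := mul_pos hq hb
  have a0 : 0 < a := by
    by_contra h2; push Not at h2
    nlinarith
  refine ⟨a0, ?_⟩
  have h2 : (k-m)*b < m := by nlinarith
  have h3 : ((k-m)*b)^2 < m^2 := by nlinarith
  have h4 : τ * ((k-m)*b)^2 < τ * m^2 := mul_lt_mul_of_pos_left h3 P.hτ0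
  have h5 : (k-m)^2 * (τ * b^2) < (k-m)^2 * 1 := by linarith
  exact lt_of_mul_lt_mul_left h5 (by positivity)

set_option maxHeartbeats 1000000 in
theorem left_curve {k τ m : ℝ} (P : PPm k τ m) {x L : PowerSeries ℝ} {r0 : ℝ} {c : ℝ → ℝ × ℝ} (H : LEFT k τ m x L r0 c) :
    ∃ cl : ℝ → ℝ × ℝ, (∀ t, HasDerivAt cl (bF k τ (m, cl t)) t ∧ 0 < NN k m (cl t).1 (cl t).2 ∧ 0 < DD k τ m (cl t).1 (cl t).2 ∧
      0 < (cl t).2 ∧ (cl t).1 < 1) ∧ Tendsto cl atBot (𝓝 (1, m/(k-m))) ∧ Tendsto cl atTop (𝓝 (0,0)) ∧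
      ∀ θ ∈ Ioc 0 r0, ∃ t, cl t = cP m (k-m) x L θ := by
  have hr := H.rpos
  have hkg : 0 < k * gF k τ m := mul_pos P.hk P.hg
  have hθ : ∀ t ≤ 0, r0 * exp (k * gF k τ m * t) ∈ Ioc 0 r0 := by
    intro t ht
    have : exp (k * gF k τ m * t) ≤ 1 := exp_le_one_iff.2 (by nlinarith)
    exact ⟨mul_pos hr (exp_pos _), mul_le_of_le_one_right hr.le this⟩
  set cl := cg (k * gF k τ m) m (k-m) x L r0 c with hcl
  have hd : ∀ t, HasDerivAt cl (bF k τ (m, cl t)) t := by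
    intro t
    refine cg_deriv P H.S H.ax H.aL (by rw [abs_of_pos hr]; linarith) (fun t ht => (H.loc _ (hθ t ht)).2.2.2.1) H.c0 (abs_nonneg t) (fun t ht => (H.orb t ht.1).1) t (le_abs_self t)
  have hs : ∀ t, 0 < NN k m (cl t).1 (cl t).2 ∧ 0 < DD k τ m (cl t).1 (cl t).2 ∧ 0 < (cl t).2 ∧ (cl t).1 < 1 := by
    intro t
    by_cases ht : t ≤ 0
    · have e : cl t = cP m (k-m) x L (r0 * exp (k * gF k τ m * t)) := by simp [hcl, cg, ht]
      obtain ⟨h1, h2, h3, h4, h5⟩ := H.loc _ (hθ t ht)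
      rw [e]
      exact ⟨(cP_Npos P h4).1.2 h1, (cP_Dpos P h4).1.2 h5, cP_b P h4 h2, cP_a1 h3⟩
    · have e : cl t = c t := by simp [hcl, cg, ht]
      rw [e]
      exact (H.orb t (by linarith)).2
  refine ⟨cl, fun t => ⟨hd t, hs t⟩, ?_, ?_, ?_⟩
  · exact cg_lim hkg H.S.x0 H.S.l0 (by linarith) H.ax H.aL c
  · have ha : ∀ t, HasDerivAt (fun t => (cl t).1) (-((k-m) * DD k τ m (cl t).1 (cl t).2)) t := fun t => hd_fst (hd t)
    have hb : ∀ t, HasDerivAt (fun t => (cl t).2) (-((k-m) * ((1 - τ * (cl t).2^2) * NN k m (cl t).1 (cl t).2))) t := fun t => hd_snd (hd t)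
    have hq := P.hq0
    have pos : ∀ t, 0 < (cl t).1 ∧ τ * (cl t).2^2 < 1 := fun t => left_tb P (hs t).1 (hs t).2.2.1 (hs t).2.2.2
    have aa : Antitone (fun t => (cl t).1) := by
      refine antitone_of_deriv_nonpos (fun t => (ha t).differentiableAt) (fun t => ?_)
      rw [(ha t).deriv]
      have := mul_pos hq (hs t).2.1
      linarith
    have ab : Antitone (fun t => (cl t).2) := by
      refine antitone_of_deriv_nonpos (fun t => (hb t).differentiableAt) (fun t => ?_)
      rw [(hb t).deriv]
      have := mul_pos hq (mul_pos (sub_pos.2 (pos t).2) (hs t).1)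
      linarith
    obtain ⟨A, A0, A1, tA⟩ := anti_lim (b := 0) (aa.antitoneOn _) (fun t _ => (pos t).1.le)
    obtain ⟨B, B0, B1, tB⟩ := anti_lim (b := 0) (ab.antitoneOn _) (fun t _ => (hs t).2.2.1.le)
    have cD : Continuous (fun p : ℝ × ℝ => -((k-m) * DD k τ m p.1 p.2)) := by unfold DD NN; fun_prop
    have cN : Continuous (fun p : ℝ × ℝ => -((k-m) * ((1 - τ * p.2^2) * NN k m p.1 p.2))) := by unfold NN; fun_prop
    have tp := tA.prodMk_nhds tB
    have e1 := lim_deriv_zero (fun t _ => ha t) tA ((cD.tendsto (A,B)).comp tp)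
    have e2 := lim_deriv_zero (fun t _ => hb t) tB ((cN.tendsto (A,B)).comp tp)
    simp only at e1 e2
    have hA : A < 1 := lt_of_le_of_lt (A1 0 le_rfl) (hs 0).2.2.2
    have hB : τ * B^2 < 1 := by
      have h1 := B1 0 le_rfl
      have h2 := (pos 0).2
      have h3 : B^2 ≤ (cl 0).2^2 := by nlinarith
      have := mul_le_mul_of_nonneg_left h3 P.hτ0.le
      linarith
    have n0 : NN k m A B = 0 := by
      have : (k-m) * ((1 - τ * B^2) * NN k m A B) = 0 := by linarith
      rcases mul_eq_zero.1 this with h | h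
      · linarith
      · rcases mul_eq_zero.1 h with h | h
        · linarith
        · exact h
    have d0 : DD k τ m A B = 0 := by
      have : (k-m) * DD k τ m A B = 0 := by linarith
      rcases mul_eq_zero.1 this with h | h
      · linarith
      · exact h
    have s0 : A + B = 0 := by
      unfold DD at d0
      rw [n0] at d0
      have : (A + B) * (1 - A^2) = 0 := by linarith
      rcases mul_eq_zero.1 this with h | h
      · exact h
      · nlinarith
    have a0 : A = 0 := by linarith
    have b0 : B = 0 := by linarith
    rw [a0, b0] at tp
    exact tp
  · intro θ h
    refine ⟨log (θ / r0) / (k * gF k τ m), ?_⟩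
    have h1 : log (θ / r0) / (k * gF k τ m) ≤ 0 :=
      div_nonpos_of_nonpos_of_nonneg (log_nonpos (div_nonneg h.1.le hr.le) ((div_le_one hr).2 h.2)) hkg.le
    simp only [hcl, cg, h1, if_true]
    rw [mul_div_cancel₀ _ hkg.ne', exp_log (div_pos h.1 hr), mul_div_cancel₀ _ hr.ne']

theorem pt_facts {τ a b : ℝ} (hτ : 0 < τ) (ha : 0 < a) (hb : 0 < b) (h : τ * b^2 < 1) :
    0 < 1 + τ * a * b ∧ 0 < Zo τ (a,b) ∧ 0 < Vo τ (a,b) ∧ Vo τ (a,b) < Zo τ (a,b) ∧ Vo τ (a,b) < 1 := by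
  have hr : 0 < √τ := Real.sqrt_pos.2 hτ
  have h1 : 0 < 1 + τ * a * b := by positivity
  have h2 : 0 < Zo τ (a,b) := by unfold Zo; positivity
  have h3 : 0 < Vo τ (a,b) := by unfold Vo; positivity
  refine ⟨h1, h2, h3, ?_, ?_⟩
  · unfold Zo Vo
    rw [lt_div_iff₀ h1, mul_assoc]
    refine mul_lt_mul_of_pos_left ?_ hr
    have := mul_lt_mul_of_pos_left h ha
    simp only
    linarith
  · have : (Vo τ (a,b))^2 < 1 := by
      unfold Vo; rw [mul_pow, Real.sq_sqrt hτ.le]; exact h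
    nlinarith

theorem pt_ratio {k τ m ℓ a b : ℝ} (hq : 0 < k - m) (hτ : 0 < τ) (hℓ : ℓ = 1/τ) (ha : 0 < a) (hb : 0 < b) (h : τ * b^2 < 1) (ha1 : 1 - a^2 ≠ 0) :
    -((k-m) * √τ * (1 - τ * b^2) * NN k m a b) / -((k-m) * √τ * (1 - τ * b^2) * (a + b) * (1 - a^2) / (1 + τ * a * b)^2)
     = Deltav m k (Zo τ (a,b)) (Vo τ (a,b)) / DeltaZ ℓ (Zo τ (a,b)) (Vo τ (a,b)) := by
  obtain ⟨h1, h2, h3, h4, h5⟩ := pt_facts hτ ha hb h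
  obtain ⟨e1, e2⟩ := Zo_delta (k := k) (m := m) hτ hℓ h1.ne'
  rw [e1, e2]
  have hr : 0 < √τ := Real.sqrt_pos.2 hτ
  have h6 : 0 < 1 - τ * b^2 := by linarith
  have h7 : 0 < a + b := by linarith
  have e3 : Zo τ (a,b) = √τ * (a + b) / (1 + τ * a * b) := rfl
  rw [e3]
  generalize NN k m a b = N at *
  generalize 1 + τ * a * b = D at *
  generalize 1 - τ * b^2 = E at *
  generalize 1 - a^2 = F at *
  generalize √τ = r at *
  field_simp

theorem Zo_cont {τ : ℝ} {p : ℝ × ℝ} (h : 1 + τ * p.1 * p.2 ≠ 0) : ContinuousAt (Zo τ) p := by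
  unfold Zo
  exact ContinuousAt.div (by fun_prop) (by fun_prop) h
theorem Zo_C1 {τ : ℝ} {n : WithTop ℕ∞} {c : ℝ → ℝ × ℝ} {t : ℝ} (hc : ContDiffAt ℝ n c t) (h : 1 + τ * (c t).1 * (c t).2 ≠ 0) :
    ContDiffAt ℝ n (fun t => Zo τ (c t)) t ∧ ContDiffAt ℝ n (fun t => Vo τ (c t)) t := by
  have h1 : ContDiffAt ℝ n (fun t => (c t).1) t := hc.fst
  have h2 : ContDiffAt ℝ n (fun t => (c t).2) t := hc.snd
  unfold Zo Vo
  constructor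
  · exact (contDiffAt_const.mul (h1.add h2)).div (contDiffAt_const.add ((contDiffAt_const.mul h1).mul h2)) h
  · exact contDiffAt_const.mul h2

set_option maxHeartbeats 1000000 in
theorem left_V {k τ m ℓ : ℝ} (P : PPm k τ m) (hℓ : ℓ = 1/τ) {x L : PowerSeries ℝ} {r0 : ℝ} {c : ℝ → ℝ × ℝ} (H : LEFT k τ m x L r0 c) :
    ∃ v : ℝ → ℝ, (∀ Z ∈ Ioo 0 (Zo τ (1, m/(k-m))), HasDerivAt v (Deltav m k Z (v Z) / DeltaZ ℓ Z (v Z)) Z ∧ 0 < v Z ∧ v Z < Z ∧ v Z < 1 ∧ 0 < DeltaZ ℓ Z (v Z)) ∧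
      ∀ θ ∈ Ioc 0 r0, Zo τ (cP m (k-m) x L θ) ∈ Ioo 0 (Zo τ (1, m/(k-m))) ∧ v (Zo τ (cP m (k-m) x L θ)) = Vo τ (cP m (k-m) x L θ) := by
  obtain ⟨cl, h, t1, t2, h3⟩ := left_curve P H
  have hτ := P.hτ0
  have hq := P.hq0
  have hm := P.hm
  have pos : ∀ t, 0 < (cl t).1 ∧ τ * (cl t).2^2 < 1 := fun t => left_tb P (h t).2.1 (h t).2.2.2.1 (h t).2.2.2.2
  have pf : ∀ t, _ := fun t => pt_facts hτ (pos t).1 (h t).2.2.2.1 (pos t).2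
  have a1 : ∀ t, 0 < 1 - (cl t).1^2 := fun t => by nlinarith [(pos t).1, (h t).2.2.2.2]
  have dZ : ∀ t, _ := fun t => (Zo_deriv (h t).1 (pf t).1.ne').1
  have dV : ∀ t, _ := fun t => (Zo_deriv (h t).1 (pf t).1.ne').2
  have neg : ∀ t, -((k-m) * √τ * (1 - τ * (cl t).2^2) * ((cl t).1 + (cl t).2) * (1 - (cl t).1^2) / (1 + τ * (cl t).1 * (cl t).2)^2) < 0 := by
    intro t
    have h1 := a1 t
    have h2 := (pos t).1
    have h3 := (h t).2.2.2.1
    have h4 := sub_pos.2 (pos t).2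
    have h5 := (pf t).1
    have hr : 0 < √τ := Real.sqrt_pos.2 hτ
    have : 0 < ((k-m) * √τ * (1 - τ * (cl t).2^2) * ((cl t).1 + (cl t).2) * (1 - (cl t).1^2) / (1 + τ * (cl t).1 * (cl t).2)^2) := by positivity
    linarith
  have anti : StrictAnti (fun t => Zo τ (cl t)) := strictAnti_of_deriv_neg (fun t => by rw [(dZ t).deriv]; exact neg t)
  have C1 : ∀ t ∈ (univ : Set ℝ), ContDiffAt ℝ 1 cl t := bF_C1 isOpen_univ (fun t _ => (h t).1)
  obtain ⟨v, hv⟩ := graph_fn (I := univ) isOpen_univ anti.injective.injOn (fun t ht => (Zo_C1 (C1 t ht) (pf t).1.ne').1) (fun t ht => (Zo_C1 (C1 t ht) (pf t).1.ne').2)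
    (fun t _ => dZ t) (fun t _ => dV t) (fun t _ => (neg t).ne)
  have l1 : Tendsto (fun t => Zo τ (cl t)) atBot (𝓝 (Zo τ (1, m/(k-m)))) :=
    (Zo_cont (p := (1, m/(k-m))) (by simp only; positivity)).tendsto.comp t1
  have l2 : Tendsto (fun t => Zo τ (cl t)) atTop (𝓝 0) := by
    have := (Zo_cont (τ := τ) (p := ((0:ℝ), (0:ℝ))) (by simp)).tendsto.comp t2
    have e : Zo τ ((0:ℝ), (0:ℝ)) = 0 := by simp [Zo]
    rw [e] at this
    exact this
  have lt1 : ∀ t, Zo τ (cl t) < Zo τ (1, m/(k-m)) := by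
    intro t
    have h1 : Zo τ (cl t) < Zo τ (cl (t-1)) := anti (by linarith)
    refine lt_of_lt_of_le h1 (ge_of_tendsto l1 ?_)
    filter_upwards [eventually_le_atBot (t-1)] with u hu using anti.antitone hu
  refine ⟨v, ?_, ?_⟩
  · intro Z hZ
    obtain ⟨t, ht⟩ : ∃ t, Zo τ (cl t) = Z := by
      obtain ⟨s, hs⟩ := (l1.eventually (lt_mem_nhds hZ.2)).exists
      obtain ⟨s', hs'⟩ := (l2.eventually (gt_mem_nhds hZ.1)).exists
      have cont : Continuous (fun t => Zo τ (cl t)) := continuous_iff_continuousAt.2 (fun t => (dZ t).continuousAt)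
      exact mem_range_of_exists_le_of_exists_ge cont ⟨s', hs'.le⟩ ⟨s, hs.le⟩
    obtain ⟨e1, e2⟩ := hv t (mem_univ t)
    rw [← ht, e1]
    obtain ⟨f1, f2, f3, f4, f5⟩ := pf t
    refine ⟨?_, f3, f4, f5, ?_⟩
    · rw [pt_ratio hq hτ hℓ (pos t).1 (h t).2.2.2.1 (pos t).2 (a1 t).ne'] at e2
      exact e2
    · have := (Zo_delta (k := k) (m := m) hτ hℓ f1.ne').1
      refine lt_of_lt_of_eq ?_ this.symm
      have g1 := a1 t
      have g2 := sub_pos.2 (pos t).2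
      positivity
  · intro θ hθ
    obtain ⟨t, ht⟩ := h3 θ hθ
    rw [← ht]
    exact ⟨⟨(pf t).2.1, lt1 t⟩, (hv t (mem_univ t)).1⟩

theorem C1_ext {f : ℝ → ℝ} {t : ℝ} (h : ContDiffAt ℝ 1 f t) (hd : 0 < deriv f t) : ∃ ε > 0, ∀ s ∈ Ioo (t-ε) (t+ε), ContDiffAt ℝ 1 f s ∧ 0 < deriv f s := by
  have h1 : ∀ᶠ s in 𝓝 t, ContDiffAt ℝ 1 f s := h.eventually (by simp)
  have h2 : ContinuousAt (deriv f) t := by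
    have := h.continuousAt_fderiv (by simp)
    exact (this.clm_apply continuousAt_const)
  have h3 := h1.and (h2.eventually (lt_mem_nhds hd))
  obtain ⟨ε, e0, he⟩ := Metric.eventually_nhds_iff_ball.1 h3
  exact ⟨ε, e0, fun s hs => he s (by rwa [Real.ball_eq_Ioo])⟩

set_option maxHeartbeats 1000000 in
theorem right_V {k τ m ℓ : ℝ} (P : PPm k τ m) (hℓ : ℓ = 1/τ) {x L : PowerSeries ℝ} (S : SERm k τ m x L) {r : ℝ} (ax : AS x r) (aL : AS L r) {s0 t1 : ℝ} {c : ℝ → ℝ × ℝ}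
    (hs : s0 < r) (H : RIGHT k τ m x L s0 c t1) :
    ∃ v : ℝ → ℝ, ∃ Ze, Zo τ (1, m/(k-m)) < Ze ∧ (∀ Z ∈ Ioc (Zo τ (1, m/(k-m))) Ze, HasDerivAt v (Deltav m k Z (v Z) / DeltaZ ℓ Z (v Z)) Z ∧ 0 < v Z ∧ v Z < Z ∧ v Z < 1 ∧ DeltaZ ℓ Z (v Z) < 0) ∧
      Deltav m k Ze (v Ze) = 0 ∧
      ∀ θ ∈ Ico (-s0) 0, Zo τ (cP m (k-m) x L θ) ∈ Ioc (Zo τ (1, m/(k-m))) Ze ∧ v (Zo τ (cP m (k-m) x L θ)) = Vo τ (cP m (k-m) x L θ) := by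
  have hτ := P.hτ0
  have hq := P.hq0
  have hm := P.hm
  have hs0 := H.spos
  have ht1 := H.tpos
  have hkg : 0 < k * gF k τ m := mul_pos P.hk P.hg
  have hθ : ∀ t ≤ 0, -s0 * exp (k * gF k τ m * t) ∈ Ico (-s0) 0 := by
    intro t ht
    have : exp (k * gF k τ m * t) ≤ 1 := exp_le_one_iff.2 (by nlinarith)
    have h2 := exp_pos (k * gF k τ m * t)
    constructor <;> nlinarith
  set cl := cg (k * gF k τ m) m (k-m) x L (-s0) c with hcl
  have hd : ∀ t ≤ t1, HasDerivAt cl (bF k τ (m, cl t)) t := by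
    intro t ht
    exact cg_deriv P S ax aL (by rw [abs_neg, abs_of_pos hs0]; exact hs) (fun t ht => by linarith [(H.loc _ (hθ t ht)).2.1]) H.c0 ht1.le (fun t ht => (H.orb t ht).1) t ht
  have hs : ∀ t ≤ t1, 1 < (cl t).1 ∧ 0 < (cl t).2 ∧ τ * (cl t).2^2 < 1 := by
    intro t ht'
    by_cases ht : t ≤ 0
    · have e : cl t = cP m (k-m) x L (-s0 * exp (k * gF k τ m * t)) := by simp [hcl, cg, ht]
      obtain ⟨h1, h2, h3, h4, h5⟩ := H.loc _ (hθ t ht)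
      rw [e]
      refine ⟨?_, h3, h4⟩
      simp only [cP]
      rw [Real.lt_sqrt zero_le_one]; linarith
    · have e : cl t = c t := by simp [hcl, cg, ht]
      rw [e]
      have := H.orb t ⟨by linarith, ht'⟩
      exact ⟨this.2.1, this.2.2.1, this.2.2.2.1⟩
  have tl : Tendsto cl atBot (𝓝 (1, m/(k-m))) := cg_lim hkg S.x0 S.l0 (by linarith) ax aL c
  have pos : ∀ t ≤ t1, 0 < (cl t).1 := fun t ht => by linarith [(hs t ht).1]
  have pf : ∀ t ≤ t1, _ := fun t ht => pt_facts hτ (pos t ht) (hs t ht).2.1 (hs t ht).2.2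
  have a1 : ∀ t ≤ t1, 1 - (cl t).1^2 < 0 := fun t ht => by nlinarith [(hs t ht).1]
  have dZ : ∀ t ≤ t1, _ := fun t ht => (Zo_deriv (hd t ht) (pf t ht).1.ne').1
  have dV : ∀ t ≤ t1, _ := fun t ht => (Zo_deriv (hd t ht) (pf t ht).1.ne').2
  have dpos : ∀ t ≤ t1, 0 < -((k-m) * √τ * (1 - τ * (cl t).2^2) * ((cl t).1 + (cl t).2) * (1 - (cl t).1^2) / (1 + τ * (cl t).1 * (cl t).2)^2) := by
    intro t ht
    have h1 := a1 t ht
    have h1' : 0 < (cl t).1^2 - 1 := by linarith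
    have h2 := pos t ht
    have h3 := (hs t ht).2.1
    have h4 := sub_pos.2 (hs t ht).2.2
    have h5 := (pf t ht).1
    have hr : 0 < √τ := Real.sqrt_pos.2 hτ
    have : 0 < ((k-m) * √τ * (1 - τ * (cl t).2^2) * ((cl t).1 + (cl t).2) * ((cl t).1^2 - 1) / (1 + τ * (cl t).1 * (cl t).2)^2) := by positivity
    have e : -((k-m) * √τ * (1 - τ * (cl t).2^2) * ((cl t).1 + (cl t).2) * (1 - (cl t).1^2) / (1 + τ * (cl t).1 * (cl t).2)^2) = ((k-m) * √τ * (1 - τ * (cl t).2^2) * ((cl t).1 + (cl t).2) * ((cl t).1^2 - 1) / (1 + τ * (cl t).1 * (cl t).2)^2) := by ring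
    rw [e]; exact this
  have C1 : ∀ t, ContDiffAt ℝ 1 cl t := by
    intro t
    rcases lt_or_ge t t1 with h | h
    · exact bF_C1 isOpen_Iio (fun t ht => hd t (le_of_lt ht)) t h
    · refine H.c1.contDiffAt.congr_of_eventuallyEq (f := c) ?_
      filter_upwards [lt_mem_nhds (ht1.trans_le h)] with u hu
      simp [hcl, cg, hu]
  have q1 := Zo_C1 (C1 t1) (pf t1 le_rfl).1.ne'
  obtain ⟨ε, e0, hε⟩ := C1_ext q1.1 (by rw [(dZ t1 le_rfl).deriv]; exact dpos t1 le_rfl)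
  have all : ∀ t ∈ Iio (t1 + ε), ContDiffAt ℝ 1 (fun t => Zo τ (cl t)) t ∧ 0 < deriv (fun t => Zo τ (cl t)) t := by
    intro t ht
    rcases le_or_gt t t1 with h | h
    · exact ⟨(Zo_C1 (C1 t) (pf t h).1.ne').1, by rw [(dZ t h).deriv]; exact dpos t h⟩
    · exact hε t ⟨by linarith, ht⟩
  have CV : ∀ t, ContDiffAt ℝ 1 (fun t => Vo τ (cl t)) t := by
    intro t
    unfold Vo
    exact contDiffAt_const.mul (C1 t).snd
  have mono : StrictMonoOn (fun t => Zo τ (cl t)) (Iio (t1 + ε)) := by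
    refine strictMonoOn_of_deriv_pos (convex_Iio _) (fun t ht => (all t ht).1.continuousAt.continuousWithinAt) ?_
    intro t ht
    rw [interior_Iio] at ht
    exact (all t ht).2
  obtain ⟨v, hv⟩ := graph_fn isOpen_Iio mono.injOn (fun t ht => (all t ht).1) (fun t _ => CV t)
    (fun t ht => ((all t ht).1.differentiableAt (by simp)).hasDerivAt) (fun t ht => ((CV t).differentiableAt (by simp)).hasDerivAt) (fun t ht => (all t ht).2.ne')
  have sub : ∀ t ≤ t1, t ∈ Iio (t1 + ε) := fun t ht => lt_of_le_of_lt ht (by linarith)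
  have l1 : Tendsto (fun t => Zo τ (cl t)) atBot (𝓝 (Zo τ (1, m/(k-m)))) :=
    (Zo_cont (p := (1, m/(k-m))) (by simp only; positivity)).tendsto.comp tl
  have lt1 : ∀ t ≤ t1, Zo τ (1, m/(k-m)) < Zo τ (cl t) := by
    intro t ht
    have h1 : Zo τ (cl (t-1)) < Zo τ (cl t) := mono (sub _ (by linarith)) (sub _ ht) (by linarith)
    refine lt_of_le_of_lt (le_of_tendsto l1 ?_) h1
    filter_upwards [eventually_le_atBot (t-1)] with u hu using mono.monotoneOn (sub _ (by linarith)) (sub _ (by linarith)) hu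
  refine ⟨v, Zo τ (cl t1), lt1 t1 le_rfl, ?_, ?_, ?_⟩
  · intro Z hZ
    obtain ⟨t, htt, ht⟩ : ∃ t ≤ t1, Zo τ (cl t) = Z := by
      obtain ⟨s, hs1, hs2⟩ := ((l1.eventually (gt_mem_nhds hZ.1)).and (eventually_le_atBot t1)).exists
      have cont : ContinuousOn (fun t => Zo τ (cl t)) (Icc s t1) := fun t ht => (dZ t ht.2).continuousAt.continuousWithinAt
      obtain ⟨t, ht, e⟩ := intermediate_value_Icc hs2 cont ⟨hs1.le, hZ.2⟩
      exact ⟨t, ht.2, e⟩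
    obtain ⟨e1, e2⟩ := hv t (sub t htt)
    rw [(dZ t htt).deriv, (dV t htt).deriv] at e2
    rw [← ht, e1]
    obtain ⟨f1, f2, f3, f4, f5⟩ := pf t htt
    refine ⟨?_, f3, f4, f5, ?_⟩
    · rw [pt_ratio hq hτ hℓ (pos t htt) (hs t htt).2.1 (hs t htt).2.2 (a1 t htt).ne] at e2
      exact e2
    · have := (Zo_delta (k := k) (m := m) hτ hℓ f1.ne').1
      refine lt_of_eq_of_lt this ?_
      have g1 := a1 t htt
      have g2 := sub_pos.2 (hs t htt).2.2
      exact div_neg_of_neg_of_pos (mul_neg_of_pos_of_neg (by positivity) g1) (by positivity)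
  · rw [(hv t1 (sub t1 le_rfl)).1]
    have := (Zo_delta (k := k) (m := m) hτ hℓ (pf t1 le_rfl).1.ne').2
    refine this.trans ?_
    have e : cl t1 = c t1 := by simp [hcl, cg, ht1]
    rw [e, H.N1]; simp
  · intro θ h
    obtain ⟨t, htt, ht⟩ : ∃ t ≤ t1, cl t = cP m (k-m) x L θ := by
      have hp : 0 < θ / (-s0) := div_pos_of_neg_of_neg h.2 (by linarith)
      have h1 : log (θ / (-s0)) / (k * gF k τ m) ≤ 0 :=
        div_nonpos_of_nonpos_of_nonneg (log_nonpos hp.le ((div_le_one_of_neg (by linarith)).2 h.1)) hkg.le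
      refine ⟨log (θ / (-s0)) / (k * gF k τ m), by linarith, ?_⟩
      simp only [hcl, cg, h1, if_true]
      rw [mul_div_cancel₀ _ hkg.ne', exp_log hp, mul_div_cancel₀ _ (by linarith)]
    rw [← ht]
    exact ⟨⟨lt1 t htt, mono.monotoneOn (sub _ htt) (sub _ le_rfl) htt⟩, (hv t (sub t htt)).1⟩

/-- far-field coordinates -/
def PF (ℓ z V : ℝ) : ℝ := ℓ * (1 - V * z)^2 - (z - V)^2
def nF (k m z V : ℝ) : ℝ := m + (k - m) * V^2 - k * V * z

theorem PF_pos {ℓ ze Ve z V : ℝ} (hℓ : 1 < ℓ) (h0 : 0 ≤ z) (h1 : z ≤ ze) (h2 : -1 ≤ V) (h3 : V ≤ Ve) (hv0 : 0 < Ve) (hv1 : Ve < 1) (hve : Ve * ze < 1)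
    (hP : 0 < PF ℓ ze Ve) : 0 < PF ℓ z V := by
  obtain ⟨s, hs0, hs⟩ : ∃ s : ℝ, 0 < s ∧ ℓ = s^2 := ⟨√ℓ, Real.sqrt_pos.2 (by linarith), (Real.sq_sqrt (by linarith)).symm⟩
  have hs1 : 1 < s := by nlinarith
  have ft : ∀ z V, PF ℓ z V = (s * (1 - V*z) - (z - V)) * (s * (1 - V*z) + (z - V)) := by
    intro z V; unfold PF; rw [hs]; ring
  have hVz : ∀ z V : ℝ, 0 ≤ z → z ≤ ze → V ≤ Ve → V * z < 1 := by
    intro z V a b c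
    have := mul_le_mul_of_nonneg_right c a
    have := mul_le_mul_of_nonneg_left b hv0.le
    linarith
  have B : ∀ z V, 0 ≤ z → z ≤ ze → V ≤ Ve → 0 < s * (1 - V*z) + (z - V) := by
    intro z V a b c
    have e1 := mul_pos (show 0 < s - 1 by linarith) (show 0 < 1 - V*z by linarith [hVz z V a b c])
    have e2 := mul_pos (show 0 < 1 + z by linarith) (show 0 < 1 - V by linarith)
    linarith
  rw [ft] at hP ⊢
  refine mul_pos ?_ (B z V h0 h1 h3)
  have A1 : 0 < s * (1 - Ve*ze) - (ze - Ve) := by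
    by_contra h
    push Not at h
    have := mul_nonpos_of_nonpos_of_nonneg h (B ze Ve (h0.trans h1) le_rfl le_rfl).le
    linarith
  have A2 : 0 < s * (1 - Ve*z) - (z - Ve) := by
    have := mul_nonneg (show 0 ≤ ze - z by linarith) (show 0 ≤ s * Ve + 1 by positivity)
    linarith
  have A3 : 0 < (s - 1) * (1 + z) := mul_pos (by linarith) (by linarith)
  have key : (1 + Ve) * (s * (1 - V*z) - (z - V)) = (V + 1) * (s * (1 - Ve*z) - (z - Ve)) + (Ve - V) * ((s-1)*(1+z)) := by ring
  have hpos : 0 < (V + 1) * (s * (1 - Ve*z) - (z - Ve)) + (Ve - V) * ((s-1)*(1+z)) := by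
    rcases h3.eq_or_lt with h | h
    · have := mul_pos (show 0 < V + 1 by linarith) A2
      have := mul_nonneg (show 0 ≤ Ve - V by linarith) A3.le
      linarith
    · have := mul_nonneg (show 0 ≤ V + 1 by linarith) A2.le
      have := mul_pos (show 0 < Ve - V by linarith) A3
      linarith
  rw [← key] at hpos
  exact pos_of_mul_pos_right hpos (by linarith)

theorem nF_zero {k m z V : ℝ} (hk : 0 < k) (hm : 0 < m) (hq : 0 < k - m) (hz : 0 ≤ z) (h : nF k m z V = 0) : 0 < V := by
  unfold nF at h
  by_contra hV
  push Not at hV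
  have := mul_nonneg hk.le (mul_nonneg (neg_nonneg.2 hV) hz)
  have := mul_nonneg hq.le (sq_nonneg V)
  linarith

theorem pos_before {f : ℝ → ℝ} {d T : ℝ} (hf : HasDerivAt f d T) (h0 : f T = 0) (hd : 0 < d) : ∃ᶠ s in 𝓝[<] T, f s < 0 := by
  have h := hf.hasDerivWithinAt (s := Iio T)
  rw [hasDerivWithinAt_iff_tendsto_slope' (by simp)] at h
  have := h.eventually (lt_mem_nhds hd)
  refine Eventually.frequently ?_
  filter_upwards [this, self_mem_nhdsWithin] with s hs hs'
  rw [slope_def_field, h0, sub_zero] at hs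
  have hs'' : s - T < 0 := sub_neg.2 hs'
  by_contra hh
  push Not at hh
  have := div_nonpos_of_nonneg_of_nonpos hh hs''.le
  linarith

theorem nF_deriv {k m ℓ : ℝ} {z V : ℝ → ℝ} {t : ℝ} (h1 : HasDerivAt z (-PF ℓ (z t) (V t)) t) (h2 : HasDerivAt V (-((1 - (V t)^2) * nF k m (z t) (V t))) t) :
    HasDerivAt (fun t => nF k m (z t) (V t)) (-((1 - (V t)^2) * nF k m (z t) (V t)) * (2*(k-m)*(V t) - k * z t) + k * V t * PF ℓ (z t) (V t)) t := by
  unfold nF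
  have := (((h2.pow 2).const_mul (k-m)).const_add m).sub ((h2.const_mul k).mul h1)
  refine this.congr_deriv ?_
  simp only [nF]
  push_cast
  ring

/-- good region for the far-field orbit -/
noncomputable def hF (ℓ k m ze z V : ℝ) : ℝ := min z (min (nF k m z V) (min (PF ℓ z V) (min (1 + V) (min (1 - V) (ze + 1 - z)))))

theorem hF_pos {ℓ k m ze z V : ℝ} : 0 < hF ℓ k m ze z V ↔ 0 < z ∧ 0 < nF k m z V ∧ 0 < PF ℓ z V ∧ 0 < 1 + V ∧ 0 < 1 - V ∧ 0 < ze + 1 - z := by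
  simp [hF]

structure FAR (ℓ k m ze Ve : ℝ) (z V : ℝ → ℝ) : Prop where
  hℓ : 1 < ℓ
  hk : 0 < k
  hm : 0 < m
  hq : 0 < k - m
  z0 : z 0 = ze
  V0 : V 0 = Ve
  ze0 : 0 < ze
  v0 : 0 < Ve
  v1 : Ve < 1
  vz : Ve * ze < 1
  P0 : 0 < PF ℓ ze Ve
  n0 : nF k m ze Ve = 0
  cz : Continuous z
  cV : Continuous V
  ode : ∀ t, |z t| ≤ ze + 1 → |V t| ≤ ze + 1 → HasDerivAt z (-PF ℓ (z t) (V t)) t ∧ HasDerivAt V (-((1 - (V t)^2) * nF k m (z t) (V t))) t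

section
variable {ℓ k m ze Ve : ℝ} {z V : ℝ → ℝ}

theorem FAR.ode' (F : FAR ℓ k m ze Ve z V) {t : ℝ} (h1 : 0 ≤ z t) (h2 : z t ≤ ze + 1) (h3 : -1 ≤ V t) (h4 : V t ≤ 1) :
    HasDerivAt z (-PF ℓ (z t) (V t)) t ∧ HasDerivAt V (-((1 - (V t)^2) * nF k m (z t) (V t))) t := by
  have := F.ze0
  exact F.ode t (by rw [abs_of_nonneg h1]; exact h2) (abs_le.2 ⟨by linarith, by linarith⟩)

theorem FAR.dec (F : FAR ℓ k m ze Ve z V) {T : ℝ} (h : ∀ t ∈ Ioo 0 T, 0 < hF ℓ k m ze (z t) (V t)) :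
    ∀ t ∈ Ico 0 T, (HasDerivAt z (-PF ℓ (z t) (V t)) t ∧ HasDerivAt V (-((1 - (V t)^2) * nF k m (z t) (V t))) t) ∧ z t ≤ ze ∧ V t ≤ Ve := by
  have od : ∀ t ∈ Ico 0 T, (HasDerivAt z (-PF ℓ (z t) (V t)) t ∧ HasDerivAt V (-((1 - (V t)^2) * nF k m (z t) (V t))) t) ∧ 0 ≤ PF ℓ (z t) (V t) ∧ 0 ≤ (1 - (V t)^2) * nF k m (z t) (V t) := by
    intro t ht
    rcases ht.1.eq_or_lt with e | e
    · subst e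
      have := F.v0
      have := F.v1
      have := F.ze0
      have a1 := F.z0
      have a2 := F.V0
      refine ⟨F.ode' (by linarith) (by linarith) (by linarith) (by linarith), ?_, ?_⟩
      · rw [a1, a2]; exact F.P0.le
      · rw [a1, a2, F.n0]; simp
    · obtain ⟨b1, b2, b3, b4, b5, b6⟩ := hF_pos.1 (h t ⟨e, ht.2⟩)
      exact ⟨F.ode' b1.le (by linarith) (by linarith) (by linarith), b3.le, mul_nonneg (by nlinarith) b2.le⟩
  intro t ht
  have h0 : (0:ℝ) ∈ Ico 0 T := ⟨le_rfl, lt_of_le_of_lt ht.1 ht.2⟩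
  have m1 := mono_Ico (f := fun t => -z t) (fun t ht => (od t ht).1.1.neg) (fun t ht => by simpa using (od t ht).2.1) 0 h0 t ht ht.1
  have m2 := mono_Ico (f := fun t => -V t) (fun t ht => (od t ht).1.2.neg) (fun t ht => by simpa using (od t ht).2.2) 0 h0 t ht ht.1
  simp only [F.z0, F.V0] at m1 m2
  exact ⟨(od t ht).1, by linarith, by linarith⟩

theorem FAR.exit (F : FAR ℓ k m ze Ve z V) {T : ℝ} (hT : 0 < T) (h : ∀ t ∈ Ioo 0 T, 0 < hF ℓ k m ze (z t) (V t)) (hz : hF ℓ k m ze (z T) (V T) = 0) :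
    z T = 0 ∧ -1 < V T := by
  have d := F.dec h
  have pos : ∀ t ∈ Ico 0 T, 0 < z t ∧ 0 ≤ nF k m (z t) (V t) ∧ 0 < 1 + V t := by
    intro t ht
    rcases ht.1.eq_or_lt with e | e
    · subst e; rw [F.z0, F.V0]; exact ⟨F.ze0, F.n0.ge, by linarith [F.v0]⟩
    · obtain ⟨b1, b2, b3, b4, b5, b6⟩ := hF_pos.1 (h t ⟨e, ht.2⟩)
      exact ⟨b1, b2.le, b4⟩
  have z1 : 0 ≤ z T := le_at_end hT F.cz.continuousAt (fun t ht => (pos t ht).1.le)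
  have z2 : z T ≤ ze := by
    have := le_at_end (f := fun t => -z t) (α := -ze) hT F.cz.neg.continuousAt (fun t ht => by linarith [(d t ht).2.1])
    linarith
  have V2 : V T ≤ Ve := by
    have := le_at_end (f := fun t => -V t) (α := -Ve) hT F.cV.neg.continuousAt (fun t ht => by linarith [(d t ht).2.2])
    linarith
  have V1 : 0 < 1 + V T := by
    refine lin_pos (y := fun t => 1 + V t) (α := fun t => -((1 - V t) * nF k m (z t) (V t))) (C := 2 * (m + (k-m) + k * ze)) hT ?_ ?_ (fun t ht => (pos t ht).2.2.le) (by have := F.cV; fun_prop) (pos 0 ⟨le_rfl, hT⟩).2.2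
    · intro t ht
      exact ((d t ht).1.2.const_add 1).congr_deriv (by ring)
    · intro t ht
      obtain ⟨p1, p2, p3⟩ := pos t ht
      obtain ⟨-, d1, d2⟩ := d t ht
      have v1 := F.v1
      have hk := F.hk
      have hq := F.hq
      have e1 : (V t)^2 ≤ 1 := by nlinarith
      have e2 : nF k m (z t) (V t) ≤ m + (k-m) + k * ze := by
        unfold nF
        have := mul_le_mul_of_nonneg_left e1 hq.le
        have : -(V t * z t) ≤ 1 * ze := by nlinarith
        have := mul_le_mul_of_nonneg_left this hk.le
        linarith
      have e3 : (1 - V t) * nF k m (z t) (V t) ≤ 2 * (m + (k-m) + k * ze) := mul_le_mul (by linarith) e2 p2 (by norm_num)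
      linarith
  have Pp : 0 < PF ℓ (z T) (V T) := PF_pos F.hℓ z1 z2 (by linarith) V2 F.v0 F.v1 F.vz F.P0
  have n1 : 0 ≤ nF k m (z T) (V T) := le_at_end (f := fun t => nF k m (z t) (V t)) hT (by unfold nF; have := F.cz; have := F.cV; fun_prop) (fun t ht => (pos t ht).2.1)
  have n2 : 0 < nF k m (z T) (V T) := by
    rcases n1.eq_or_lt with e | e
    · exfalso
      obtain ⟨o1, o2⟩ := F.ode' (t := T) z1 (by linarith) (by linarith) (by linarith [F.v1])
      have := nF_deriv o1 o2
      have Vp := nF_zero F.hk F.hm F.hq z1 e.symm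
      rw [← e] at this
      have fr := pos_before this e.symm (by
        have := mul_pos (mul_pos F.hk Vp) Pp
        linarith)
      refine fr ?_
      filter_upwards [Ioo_mem_nhdsLT hT] with s hs hn
      linarith [(pos s ⟨hs.1.le, hs.2⟩).2.1]
    · exact e
  refine ⟨?_, by linarith⟩
  by_contra hne
  have : 0 < hF ℓ k m ze (z T) (V T) := hF_pos.2 ⟨lt_of_le_of_ne z1 (Ne.symm hne), n2, Pp, V1, by linarith [F.v1], by linarith⟩
  linarith

theorem FAR.start (F : FAR ℓ k m ze Ve z V) : ∃ δ > 0, ∀ t ∈ Ioc 0 δ, 0 < hF ℓ k m ze (z t) (V t) := by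
  have hv := F.v0
  have hv1 := F.v1
  have hz := F.ze0
  have a1 := F.z0
  have a2 := F.V0
  obtain ⟨o1, o2⟩ := F.ode' (t := 0) (by linarith) (by linarith) (by linarith) (by linarith)
  have hn := (nF_deriv o1 o2).neg
  have n0 : nF k m (z 0) (V 0) = 0 := by rw [a1, a2, F.n0]
  have P0 : 0 < PF ℓ (z 0) (V 0) := by rw [a1, a2]; exact F.P0
  have V0 : 0 < V 0 := by rw [a2]; exact hv
  have na := neg_after hn (by simp [n0]) (by
    rw [n0]
    have := mul_pos (mul_pos F.hk V0) P0
    linarith)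
  have c1 := F.cz
  have c2 := F.cV
  have cP : Continuous (fun t => PF ℓ (z t) (V t)) := by unfold PF; fun_prop
  have e1 : ∀ᶠ t in 𝓝 (0:ℝ), 0 < z t := c1.continuousAt.eventually (lt_mem_nhds (by linarith))
  have e2 : ∀ᶠ t in 𝓝 (0:ℝ), 0 < PF ℓ (z t) (V t) := cP.continuousAt.eventually (lt_mem_nhds P0)
  have e3 : ∀ᶠ t in 𝓝 (0:ℝ), 0 < V t := c2.continuousAt.eventually (lt_mem_nhds V0)
  have e4 : ∀ᶠ t in 𝓝 (0:ℝ), V t < 1 := c2.continuousAt.eventually (gt_mem_nhds (by linarith))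
  have e5 : ∀ᶠ t in 𝓝 (0:ℝ), z t < ze + 1 := c1.continuousAt.eventually (gt_mem_nhds (by linarith))
  have key : ∀ᶠ t in 𝓝[>] (0:ℝ), 0 < hF ℓ k m ze (z t) (V t) := by
    filter_upwards [na, e1.filter_mono nhdsWithin_le_nhds, e2.filter_mono nhdsWithin_le_nhds, e3.filter_mono nhdsWithin_le_nhds, e4.filter_mono nhdsWithin_le_nhds, e5.filter_mono nhdsWithin_le_nhds] with t b1 b2 b3 b4 b5 b6
    exact hF_pos.2 ⟨b2, by simpa using b1, b3, by linarith, by linarith, by linarith⟩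
  obtain ⟨δ, d0, hδ⟩ := mem_nhdsGT_iff_exists_Ioc_subset.1 key
  exact ⟨δ, d0, fun t ht => hδ ht⟩

theorem FAR.main (F : FAR ℓ k m ze Ve z V) : ∃ T > 0, z T = 0 ∧ (∀ t ∈ Ioo 0 T, 0 < hF ℓ k m ze (z t) (V t)) := by
  obtain ⟨δ, d0, hδ⟩ := F.start
  have c1 := F.cz
  have c2 := F.cV
  have ch : Continuous (fun t => hF ℓ k m ze (z (δ + t)) (V (δ + t))) := by unfold hF nF PF; fun_prop
  by_cases hex : ∃ t, 0 ≤ t ∧ hF ℓ k m ze (z (δ + t)) (V (δ + t)) ≤ 0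
  · obtain ⟨t1, p1, p2, p3⟩ := first_exit _ ch (by simpa using hδ δ ⟨d0, le_rfl⟩) hex
    have hh : ∀ t ∈ Ioo 0 (δ + t1), 0 < hF ℓ k m ze (z t) (V t) := by
      intro t ht
      rcases le_or_gt t δ with h | h
      · exact hδ t ⟨ht.1, h⟩
      · have := p3 (t - δ) ⟨by linarith, by linarith [ht.2]⟩
        simpa using this
    exact ⟨δ + t1, by linarith, (F.exit (by linarith) hh p2).1, hh⟩
  · exfalso
    push Not at hex
    have hh : ∀ t, 0 < t → 0 < hF ℓ k m ze (z t) (V t) := by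
      intro t ht
      rcases le_or_gt t δ with h | h
      · exact hδ t ⟨ht, h⟩
      · have := hex (t - δ) (by linarith)
        simpa using this
    have d : ∀ t : ℝ, 0 ≤ t → _ := fun t ht => F.dec (T := t + 1) (fun s hs => hh s hs.1) t ⟨ht, by linarith⟩
    have z0 : ∀ t, 0 ≤ t → 0 ≤ z t ∧ -1 ≤ V t ∧ 0 ≤ PF ℓ (z t) (V t) ∧ 0 ≤ (1 - (V t)^2) * nF k m (z t) (V t) := by
      intro t ht
      rcases ht.eq_or_lt with e | e
      · subst e; rw [F.z0, F.V0, F.n0]; exact ⟨F.ze0.le, by linarith [F.v0], F.P0.le, by simp⟩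
      · obtain ⟨b1, b2, b3, b4, b5, b6⟩ := hF_pos.1 (hh t e)
        exact ⟨b1.le, by linarith, b3.le, mul_nonneg (by nlinarith) b2.le⟩
    have az : AntitoneOn z (Ici 0) := by
      refine antitoneOn_of_deriv_nonpos (convex_Ici 0) c1.continuousOn (fun t ht => (d t (interior_subset ht)).1.1.differentiableAt.differentiableWithinAt) (fun t ht => ?_)
      rw [(d t (interior_subset ht)).1.1.deriv]
      linarith [(z0 t (interior_subset ht)).2.2.1]
    have aV : AntitoneOn V (Ici 0) := by
      refine antitoneOn_of_deriv_nonpos (convex_Ici 0) c2.continuousOn (fun t ht => (d t (interior_subset ht)).1.2.differentiableAt.differentiableWithinAt) (fun t ht => ?_)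
      rw [(d t (interior_subset ht)).1.2.deriv]
      linarith [(z0 t (interior_subset ht)).2.2.2]
    obtain ⟨A, A0, A1, tA⟩ := anti_lim (b := 0) az (fun t ht => (z0 t ht).1)
    obtain ⟨B, B0, B1, tB⟩ := anti_lim (b := -1) aV (fun t ht => (z0 t ht).2.1)
    have tP : Tendsto (fun t => -PF ℓ (z t) (V t)) atTop (𝓝 (-PF ℓ A B)) := by
      unfold PF; exact ((tendsto_const_nhds.mul ((tendsto_const_nhds.sub (tB.mul tA)).pow 2)).sub ((tA.sub tB).pow 2)).neg
    have e1 := lim_deriv_zero (f := z) (f' := fun t => -PF ℓ (z t) (V t)) (fun t ht => (d t ht).1.1) tA tP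
    have := PF_pos F.hℓ A0 (by have := A1 0 le_rfl; rwa [F.z0] at this) B0 (by have := B1 0 le_rfl; rwa [F.V0] at this) F.v0 F.v1 F.vz F.P0
    linarith
end

theorem far_flow {ℓ k m ze Ve : ℝ} (hze : 0 < ze) : ∃ z V : ℝ → ℝ, z 0 = ze ∧ V 0 = Ve ∧ (∀ t, ContDiffAt ℝ 1 z t) ∧ (∀ t, ContDiffAt ℝ 1 V t) ∧
    ∀ t, |z t| ≤ ze + 1 → |V t| ≤ ze + 1 → HasDerivAt z (-PF ℓ (z t) (V t)) t ∧ HasDerivAt V (-((1 - (V t)^2) * nF k m (z t) (V t))) t := by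
  obtain ⟨G, K, Φ, h1, h2, h3, h4, -⟩ := planar_flow (fun p => (-PF ℓ p.2.1 p.2.2, -((1 - p.2.2^2) * nF k m p.2.1 p.2.2))) (by unfold PF nF; fun_prop) (ze + 1) (by linarith)
  have C : ∀ t, ContDiffAt ℝ 1 (Φ 0 (ze, Ve)) t := by
    intro t
    refine c1_of isOpen_univ (fun t _ => h4 0 (ze,Ve) t) ?_ t (mem_univ t)
    have hc : Continuous (Φ 0 (ze, Ve)) := continuous_iff_continuousAt.2 (fun t => (h4 0 (ze,Ve) t).continuousAt)
    exact ((h1 0).continuous.comp hc).continuousOn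
  refine ⟨fun t => (Φ 0 (ze,Ve) t).1, fun t => (Φ 0 (ze,Ve) t).2, by simp [h3], by simp [h3], fun t => (C t).fst, fun t => (C t).snd, ?_⟩
  intro t a b
  have := h4 0 (ze,Ve) t
  have e : G 0 (Φ 0 (ze,Ve) t) = _ := h2 0 _ _ (by simp; linarith) a b
  rw [e] at this
  exact ⟨hd_fst this, hd_snd this⟩

set_option maxHeartbeats 1000000 in
theorem far_V {ℓ k m Ze Ve : ℝ} (hℓ : 1 < ℓ) (hk : 0 < k) (hm : 0 < m) (hq : 0 < k - m) (v0 : 0 < Ve) (v1 : Ve < 1) (vZ : Ve < Ze)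
    (hD : DeltaZ ℓ Ze Ve < 0) (hN : Deltav m k Ze Ve = 0) :
    ∃ v : ℝ → ℝ, v Ze = Ve ∧ ∀ Z ∈ Ici Ze, HasDerivAt v (Deltav m k Z (v Z) / DeltaZ ℓ Z (v Z)) Z ∧ |v Z| < 1 ∧ v Z < Z ∧ DeltaZ ℓ Z (v Z) < 0 := by
  have hZ : 0 < Ze := by linarith
  have dz : ∀ z V : ℝ, 0 < z → DeltaZ ℓ (1/z) V = - (PF ℓ z V / z^3) := by
    intro z V hz; unfold DeltaZ PF; field_simp; ring
  have dv : ∀ z V : ℝ, 0 < z → Deltav m k (1/z) V = (1 - V^2) * nF k m z V / z := by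
    intro z V hz; unfold Deltav nF; field_simp; ring
  have ze0 : 0 < 1 / Ze := by positivity
  have e0 : 1 / (1 / Ze) = Ze := by simp
  obtain ⟨z, V, z0, V0, cz, cV, od⟩ := far_flow (ℓ := ℓ) (k := k) (m := m) (Ve := Ve) ze0
  have V1 : 0 < 1 - Ve^2 := by nlinarith
  have F : FAR ℓ k m (1/Ze) Ve z V := by
    refine ⟨hℓ, hk, hm, hq, z0, V0, ze0, v0, v1, ?_, ?_, ?_, continuous_iff_continuousAt.2 (fun t => (cz t).continuousAt), continuous_iff_continuousAt.2 (fun t => (cV t).continuousAt), od⟩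
    · rw [mul_one_div, div_lt_one hZ]; exact vZ
    · have := dz (1/Ze) Ve ze0
      rw [e0] at this
      rw [this] at hD
      have h : 0 < PF ℓ (1/Ze) Ve / (1/Ze)^3 := by linarith
      have := mul_pos h (pow_pos ze0 3)
      rwa [div_mul_cancel₀ _ (pow_pos ze0 3).ne'] at this
    · have := dv (1/Ze) Ve ze0
      rw [e0, hN] at this
      have h := (div_eq_zero_iff.1 this.symm).resolve_right ze0.ne'
      exact (mul_eq_zero.1 h).resolve_left V1.ne'
  obtain ⟨T, hT, zT, hh⟩ := F.main
  have d := F.dec hh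
  have pos : ∀ t ∈ Ico 0 T, 0 < z t ∧ 0 < PF ℓ (z t) (V t) ∧ -1 < V t := by
    intro t ht
    rcases ht.1.eq_or_lt with e | e
    · subst e; rw [z0, V0]; exact ⟨F.ze0, F.P0, by linarith [F.v0]⟩
    · obtain ⟨b1, b2, b3, b4, b5, b6⟩ := hF_pos.1 (hh t ⟨e, ht.2⟩)
      exact ⟨b1, b3, by linarith⟩
  have dZ : ∀ t ∈ Ico 0 T, HasDerivAt (fun t => 1 / z t) (PF ℓ (z t) (V t) / (z t)^2) t := by
    intro t ht
    have := (d t ht).1.1.inv (pos t ht).1.ne'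
    simp only [one_div]
    refine this.congr_deriv (by ring)
  have CZ : ∀ t, 0 < z t → ContDiffAt ℝ 1 (fun t => 1 / z t) t := fun t ht => contDiffAt_const.div (cz t) ht.ne'
  have h00 : (0:ℝ) ∈ Ico 0 T := ⟨le_rfl, hT⟩
  have dpos : ∀ t ∈ Ico 0 T, 0 < PF ℓ (z t) (V t) / (z t)^2 := fun t ht => div_pos (pos t ht).2.1 (pow_pos (pos t ht).1 2)
  obtain ⟨ε, ep, hε⟩ := C1_ext (CZ 0 (pos 0 h00).1) (by rw [(dZ 0 h00).deriv]; exact dpos 0 h00)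
  have all : ∀ t ∈ Ioo (-ε) T, ContDiffAt ℝ 1 (fun t => 1 / z t) t ∧ 0 < deriv (fun t => 1 / z t) t := by
    intro t ht
    rcases le_or_gt 0 t with h | h
    · have h' : t ∈ Ico 0 T := ⟨h, ht.2⟩
      exact ⟨CZ t (pos t h').1, by rw [(dZ t h').deriv]; exact dpos t h'⟩
    · exact hε t ⟨by linarith [ht.1], by linarith⟩
  have mono : StrictMonoOn (fun t => 1 / z t) (Ioo (-ε) T) := by
    refine strictMonoOn_of_deriv_pos (convex_Ioo _ _) (fun t ht => (all t ht).1.continuousAt.continuousWithinAt) ?_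
    intro t ht
    rw [interior_Ioo] at ht
    exact (all t ht).2
  obtain ⟨v, hv⟩ := graph_fn isOpen_Ioo mono.injOn (fun t ht => (all t ht).1) (fun t _ => cV t)
    (fun t ht => ((all t ht).1.differentiableAt (by simp)).hasDerivAt) (fun t ht => ((cV t).differentiableAt (by simp)).hasDerivAt) (fun t ht => (all t ht).2.ne')
  have sub : ∀ t ∈ Ico 0 T, t ∈ Ioo (-ε) T := fun t ht => ⟨by linarith [ht.1], ht.2⟩
  refine ⟨v, ?_, ?_⟩
  · have := (hv 0 (sub 0 h00)).1
    rwa [z0, e0, V0] at this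
  · intro Z hZe
    have hZ0 : 0 < Z := lt_of_lt_of_le hZ hZe
    obtain ⟨t, ht, e⟩ : ∃ t ∈ Ico 0 T, z t = 1 / Z := by
      have h1 : 1 / Z ∈ Icc (z T) (z 0) := by
        rw [zT, z0]
        exact ⟨by positivity, one_div_le_one_div_of_le hZ hZe⟩
      obtain ⟨t, ht, e⟩ := intermediate_value_Icc' hT.le F.cz.continuousOn h1
      refine ⟨t, ⟨ht.1, lt_of_le_of_ne ht.2 ?_⟩, e⟩
      rintro rfl
      rw [zT] at e
      have : 0 < 1 / Z := by positivity
      linarith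
    have eZ : Z = 1 / z t := by rw [e]; simp
    obtain ⟨f1, f2⟩ := hv t (sub t ht)
    rw [(dZ t ht).deriv, (d t ht).1.2.deriv] at f2
    obtain ⟨p1, p2, p3⟩ := pos t ht
    have p4 := (d t ht).2.2
    rw [eZ, f1]
    refine ⟨?_, abs_lt.2 ⟨p3, by linarith⟩, ?_, ?_⟩
    · rw [dz _ _ p1, dv _ _ p1]
      refine f2.congr_deriv ?_
      field_simp
    · rw [← eZ]
      have : Ze ≤ Z := hZe
      linarith
    · rw [dz _ _ p1]
      have : 0 < PF ℓ (z t) (V t) / (z t)^3 := by positivity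
      linarith

theorem PPm.tb {k τ m : ℝ} (P : PPm k τ m) : τ * (m/(k-m))^2 < 1 := by
  have h := P.tmq
  have hq := P.hq0
  rw [div_pow, ← mul_div_assoc, div_lt_one (by positivity)]
  exact h

set_option maxHeartbeats 1000000 in
theorem cP_sonic {k τ m : ℝ} (P : PPm k τ m) {x L : PowerSeries ℝ} (S : SERm k τ m x L) {r : ℝ} (hr : 0 < r) (ax : AS x r) (aL : AS L r) :
    ContDiffAt ℝ (⊤:ℕ∞) (cP m (k-m) x L) 0 ∧ cP m (k-m) x L 0 = (1, m/(k-m)) ∧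
    ∃ d dw, d < 0 ∧ HasDerivAt (fun θ => Zo τ (cP m (k-m) x L θ)) d 0 ∧ HasDerivAt (fun θ => Vo τ (cP m (k-m) x L θ)) dw 0 := by
  have hτ := P.hτ0
  have hτ1 := P.hτ1
  have hq := P.hq0
  have hm := P.hm
  have he := P.he
  have x0 : pev x 0 = 0 := by rw [pev_zero, S.x0]
  have l0 : pev L 0 = 0 := by rw [pev_zero, S.l0]
  have e0 : cP m (k-m) x L 0 = (1, m/(k-m)) := by simp [cP, x0, l0]
  have Cx : ContDiffAt ℝ (⊤:ℕ∞) (pev x) 0 := (pev_analytic ax (by simpa using hr)).contDiffAt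
  have CL : ContDiffAt ℝ (⊤:ℕ∞) (pev L) 0 := (pev_analytic aL (by simpa using hr)).contDiffAt
  have Cs : ContDiffAt ℝ (⊤:ℕ∞) (fun θ => √(1 - pev L θ)) 0 := (contDiffAt_const.sub CL).sqrt (by simp [l0])
  have dx := pev_deriv_zero hr ax
  have dL := pev_deriv_zero hr aL
  rw [S.x1] at dx
  rw [S.l1] at dL
  have da : HasDerivAt (fun θ => (cP m (k-m) x L θ).1) (-eF k τ m / 2) 0 := by
    have := (dL.const_sub 1).sqrt (by simp [l0])
    simp only [l0] at this
    refine this.congr_deriv (by simp)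
  have db : HasDerivAt (fun θ => (cP m (k-m) x L θ).2) (m/(k-m) * (-eF k τ m / 2 - 1)) 0 := by
    have := (da.const_mul (m/(k-m))).mul (dx.const_sub 1)
    refine this.congr_deriv ?_
    simp [cP, x0, l0]; ring
  refine ⟨?_, e0, ?_⟩
  · unfold cP
    exact Cs.prodMk ((contDiffAt_const.mul Cs).mul (contDiffAt_const.sub Cx))
  · have hb : 0 < m/(k-m) := by positivity
    have h1 : 0 < 1 + τ * 1 * (m/(k-m)) := by positivity
    have tb := P.tb
    generalize m/(k-m) = b at *
    refine ⟨√τ * ((-eF k τ m / 2) * (1 - τ * b^2) + (b * (-eF k τ m / 2 - 1)) * (1 - τ)) / (1 + τ * 1 * b)^2, _, ?_, ?_, db.const_mul √τ⟩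
    · refine div_neg_of_neg_of_pos (mul_neg_of_pos_of_neg (Real.sqrt_pos.2 hτ) ?_) (by positivity)
      have := mul_pos (half_pos he) (sub_pos.2 tb)
      have := mul_pos (mul_pos hb (show 0 < eF k τ m / 2 + 1 by linarith)) (sub_pos.2 hτ1)
      linarith
    · have := ((da.add db).const_mul √τ).div (((da.const_mul τ).mul db).const_add 1) (by simp only [Pi.mul_apply, e0]; exact h1.ne')
      refine this.congr_deriv ?_
      simp only [Pi.mul_apply, Pi.add_apply, e0]
      congr 1
      ring

set_option maxHeartbeats 1000000 in
theorem mid_V {k τ m3 m4 ℓ : ℝ} (w : WIN k τ m3 m4) (hℓ : ℓ = 1/τ) : ∃ m, PPm k τ m ∧ ∃ v : ℝ → ℝ,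
    (∀ Z, 0 < Z → Z ≠ Zo τ (1, m/(k-m)) → HasDerivAt v (Deltav m k Z (v Z) / DeltaZ ℓ Z (v Z)) Z) ∧
    (∀ Z ∈ Ioo 0 (Zo τ (1, m/(k-m))), 0 < v Z ∧ v Z < Z ∧ v Z < 1 ∧ 0 < DeltaZ ℓ Z (v Z)) ∧
    (∀ Z ∈ Ioi (Zo τ (1, m/(k-m))), |v Z| < 1 ∧ v Z < Z ∧ DeltaZ ℓ Z (v Z) < 0) ∧
    v (Zo τ (1, m/(k-m))) = Vo τ (1, m/(k-m)) ∧ ContDiffAt ℝ (⊤:ℕ∞) v (Zo τ (1, m/(k-m))) := by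
  obtain ⟨m, hm, x, L, r0, c, H⟩ := left_exists w
  have P : PPm k τ m := w.pp m ⟨hm.1.le, hm.2.le⟩
  have hr0 := H.rpos
  have S := H.S
  obtain ⟨s0, cr, t1, hs, R⟩ := right_exists w hm S (by linarith) H.ax H.aL
  obtain ⟨vl, l1, l2⟩ := left_V P hℓ H
  obtain ⟨vr, Ze, z1, r1, r2, r3⟩ := right_V P hℓ S H.ax H.aL hs R
  have hτ := P.hτ0
  have hτ1 := P.hτ1
  have hℓ1 : 1 < ℓ := by rw [hℓ, lt_div_iff₀ hτ]; linarith
  obtain ⟨-, g1, g2, g3, g4⟩ := r1 Ze ⟨z1, le_rfl⟩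
  obtain ⟨vf, f0, f1⟩ := far_V hℓ1 P.hk P.hm P.hq0 g1 g3 g2 g4 r2
  refine ⟨m, P, ?_⟩
  obtain ⟨C, e0, d, dw, dn, hdz, hdw⟩ := cP_sonic P S (by linarith) H.ax H.aL
  have z0 : 0 < Zo τ (1, m/(k-m)) := (pt_facts hτ one_pos (div_pos P.hm P.hq0) P.tb).2.1
  have q1 : 0 < 1 + τ * (1:ℝ) * (m/(k-m)) := (pt_facts hτ one_pos (div_pos P.hm P.hq0) P.tb).1
  set Z1 := Zo τ (1, m/(k-m)) with hZ1
  set v : ℝ → ℝ := fun Z => if Z < Z1 then vl Z else if Z = Z1 then Vo τ (1, m/(k-m)) else if Z ≤ Ze then vr Z else vf Z with hv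
  have vL : ∀ Z, Z < Z1 → v Z = vl Z := fun Z h => by simp [hv, h]
  have vR : ∀ Z, Z1 < Z → Z ≤ Ze → v Z = vr Z := fun Z h h' => by simp [hv, h', not_lt.2 h.le, h.ne']
  have vF : ∀ Z, Ze ≤ Z → v Z = vf Z := fun Z h => by
    rcases h.eq_or_lt with e | e
    · rw [← e, vR Ze z1 le_rfl, f0]
    · have : Z1 < Z := z1.trans e
      simp [hv, not_lt.2 this.le, this.ne', not_le.2 e]
  have v1 : v Z1 = Vo τ (1, m/(k-m)) := by simp [hv]
  refine ⟨v, ?_, ?_, ?_, v1, ?_⟩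
  · intro Z hZ hne
    rcases lt_or_gt_of_ne hne with h | h
    · have := (l1 Z ⟨hZ, h⟩).1
      rw [vL Z h]
      refine this.congr_of_eventuallyEq ?_
      filter_upwards [gt_mem_nhds h] with u hu using vL u hu
    · rcases lt_trichotomy Z Ze with h' | h' | h'
      · have := (r1 Z ⟨h, h'.le⟩).1
        rw [vR Z h h'.le]
        refine this.congr_of_eventuallyEq ?_
        filter_upwards [gt_mem_nhds h', lt_mem_nhds h] with u hu hu' using vR u hu' hu.le
      · subst h'
        rw [vR Z h le_rfl]
        refine glue_deriv (r1 Z ⟨h, le_rfl⟩).1 (by have := (f1 Z self_mem_Ici).1; rwa [f0] at this) ?_ ?_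
        · filter_upwards [self_mem_nhdsWithin, nhdsWithin_le_nhds (lt_mem_nhds h)] with u hu hu' using vR u hu' hu
        · filter_upwards [self_mem_nhdsWithin] with u hu using vF u hu
      · have := (f1 Z h'.le).1
        rw [vF Z h'.le]
        refine this.congr_of_eventuallyEq ?_
        filter_upwards [lt_mem_nhds h'] with u hu using vF u hu.le
  · intro Z hZ
    rw [vL Z hZ.2]
    exact (l1 Z hZ).2
  · intro Z hZ
    rcases le_total Z Ze with h' | h'
    · rw [vR Z hZ h']
      obtain ⟨-, a1, a2, a3, a4⟩ := r1 Z ⟨hZ, h'⟩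
      exact ⟨abs_lt.2 ⟨by linarith, a3⟩, a2, a4⟩
    · rw [vF Z h']
      exact (f1 Z h').2
  · have h1 : 1 + τ * (cP m (k-m) x L 0).1 * (cP m (k-m) x L 0).2 ≠ 0 := by rw [e0]; exact q1.ne'
    have zc := Zo_C1 C h1
    have := (graph_local (v := v) (by exact_mod_cast le_top) zc.1 zc.2 hdz hdw dn.ne ?_).1
    · simp only [e0] at this
      exact this
    · filter_upwards [lt_mem_nhds (show -s0 < 0 by linarith [R.spos]), gt_mem_nhds hr0] with θ h2 h3
      rcases lt_trichotomy θ 0 with h | h | h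
      · obtain ⟨a, b⟩ := r3 θ ⟨h2.le, h⟩
        rw [vR _ a.1 a.2, b]
      · subst h; rw [e0, ← hZ1, v1]
      · obtain ⟨a, b⟩ := l2 θ ⟨h, h3.le⟩
        rw [vL _ a.2, b]

section OR
variable (k τ m : ℝ)
noncomputable def rA : POp := fun _ p q => PowerSeries.C (k-m+1) * p + q
noncomputable def rB : POp := fun _ p q => PowerSeries.C m * p + PowerSeries.C (-1) * q
noncomputable def rN : POp := fun x p q => PowerSeries.C m * rA k m x p q + PowerSeries.C (-(k-m)) * rB m x p q
noncomputable def rfa : POp := fun x p q => (rA k m x p q * rA k m x p q) *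
  (PowerSeries.C (-1) * (rA k m x p q + rB m x p q) + PowerSeries.C τ * rN k m x p q)
noncomputable def rfb : POp := fun x p q => PowerSeries.C (-τ) * ((rB m x p q * rB m x p q) * rN k m x p q)
noncomputable def rUf : POp := fun x p q => PowerSeries.C ((k+1)⁻¹) * (rfa k τ m x p q + rfb k τ m x p q)
noncomputable def rUh : POp := fun x p q => PowerSeries.C ((k+1)⁻¹) *
  (PowerSeries.C m * rfa k τ m x p q + PowerSeries.C (-(k-m+1)) * rfb k τ m x p q)
lemma rA_L1 (K) : ∃ u, L1 K (rA k m) u := ⟨_, ((L1.fst K).smul (BC.const K _).1 (BC.const K _).2).add (L1.snd K)⟩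
lemma rB_L1 (K) : ∃ u, L1 K (rB m) u := ⟨_, ((L1.fst K).smul (BC.const K _).1 (BC.const K _).2).add ((L1.snd K).smul (BC.const K _).1 (BC.const K _).2)⟩
lemma rN_L1 (K) : ∃ u, L1 K (rN k m) u := by
  obtain ⟨u, hu⟩ := rA_L1 k m K
  obtain ⟨v, hv⟩ := rB_L1 m K
  exact ⟨_, (hu.smul (BC.const K _).1 (BC.const K _).2).add (hv.smul (BC.const K _).1 (BC.const K _).2)⟩
lemma rfa_L2 (K) : ∃ u, L2 K (rfa k τ m) u := by
  obtain ⟨u, hu⟩ := rA_L1 k m K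
  obtain ⟨v, hv⟩ := rB_L1 m K
  obtain ⟨w, hw⟩ := rN_L1 k m K
  exact ⟨_, (hu.mul hu).l1.mul (((hu.add hv).smul (BC.const K _).1 (BC.const K _).2).add (hw.smul (BC.const K _).1 (BC.const K _).2))⟩
lemma rfb_L2 (K) : ∃ u, L2 K (rfb k τ m) u := by
  obtain ⟨v, hv⟩ := rB_L1 m K
  obtain ⟨w, hw⟩ := rN_L1 k m K
  exact ⟨_, ((hv.mul hv).l1.mul hw).smul (BC.const K _).1 (BC.const K _).2⟩
lemma rUf_L2 (K) : ∃ u, L2 K (rUf k τ m) u := by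
  obtain ⟨v, hv⟩ := rfa_L2 k τ m K
  obtain ⟨w, hw⟩ := rfb_L2 k τ m K
  exact ⟨_, (hv.add hw).smul (BC.const K _).1 (BC.const K _).2⟩
lemma rUh_L2 (K) : ∃ u, L2 K (rUh k τ m) u := by
  obtain ⟨v, hv⟩ := rfa_L2 k τ m K
  obtain ⟨w, hw⟩ := rfb_L2 k τ m K
  exact ⟨_, ((hv.smul (BC.const K _).1 (BC.const K _).2).add (hw.smul (BC.const K _).1 (BC.const K _).2)).smul (BC.const K _).1 (BC.const K _).2⟩

lemma ring_o {A : Type*} [CommRing A] {k m τ i p q a b fa fb tp tq : A} (h1 : (k+1)*i = 1)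
    (ha : a = (k-m+1)*p+q) (hb : b = m*p+(-1)*q)
    (hfa : fa = (a*a)*((-1)*(a+b)+τ*(m*a+(-(k-m))*b))) (hfb : fb = (-τ)*((b*b)*(m*a+(-(k-m))*b)))
    (hp : tp = p + i*(fa+fb)) (hq : tq = (-k)*q + i*(m*fa+(-(k-m+1))*fb)) :
    (k-m+1)*tp+tq = (1-m)*a+(1+k-m)*b + fa ∧ m*tp+(-1)*tq = (m*a+(-(k-m))*b) + fb := by
  constructor
  · rw [hp, hq, ha, hb]; linear_combination fa * h1
  · rw [hp, hq, ha, hb]; linear_combination fb * h1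

theorem origin_curve (hk : 0 < k) :
    ∃ r > 0, ∃ A B : ℝ → ℝ, (∀ θ, |θ| < r → AnalyticAt ℝ A θ ∧ AnalyticAt ℝ B θ ∧
      θ * deriv A θ = DD k τ m (A θ) (B θ) ∧ θ * deriv B θ = (1-τ*(B θ)^2)*NN k m (A θ) (B θ)) ∧
      A 0 = 0 ∧ B 0 = 0 ∧ HasDerivAt A (k-m+1) 0 ∧ HasDerivAt B m 0 := by
  obtain ⟨uf, hf⟩ := rUf_L2 k τ m {0}
  obtain ⟨uh, hh⟩ := rUh_L2 k τ m {0}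
  obtain ⟨η, ξ, -, -, h3, C, hC, h4⟩ := PSmain (R := fun _ => -k) hf hh continuousOn_const 2 le_rfl 1 zero_le_one
    (by intro x _ n hn _
        have : (2:ℝ) ≤ n := by exact_mod_cast hn
        rw [one_mul, abs_of_pos (by linarith)]; linarith)
    (by intro x _; push_cast; linarith)
  obtain ⟨e0, e1, x0, x1, hη, hξ⟩ := h3 0 rfl
  obtain ⟨-, h4⟩ := h4 0 rfl
  generalize η 0 = p at *
  generalize ξ 0 = q at *
  set c := |coeff 2 q| with hc
  have hc0 : 0 ≤ c := abs_nonneg _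
  set r := 1/(C*(1+c)) with hr
  have hC0 : 0 < C := by linarith
  have hCc : 0 < C*(1+c) := by positivity
  have hr0 : 0 < r := by positivity
  have hr1 : r ≤ 1 := by rw [hr, div_le_one hCc]; nlinarith [mul_nonneg hC0.le hc0]
  have key := h4 r ⟨hr0, hr1⟩ (r*(1+c)) (by nlinarith [mul_nonneg (mul_nonneg hc0 hr0.le) (sub_nonneg.2 hr1)]) (by rw [hr]; field_simp; rfl)
  have Sp : AS p r := AS_of_nrm (A := 2*(r*(1+c))) hr0.le fun N => by linarith [(key N).1, nrm_nonneg hr0.le N q]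
  have Sq : AS q r := AS_of_nrm (A := 2*(r*(1+c))) hr0.le fun N => by linarith [(key N).1, nrm_nonneg hr0.le N p]
  have Sa : AS (rA k m 0 p q) r := (Sp.C_mul _).add Sq hr0.le
  have Sb : AS (rB m 0 p q) r := (Sp.C_mul _).add (Sq.C_mul _) hr0.le
  have Sn : AS (rN k m 0 p q) r := (Sa.C_mul _).add (Sb.C_mul _) hr0.le
  have Sl : AS (PowerSeries.C (-1) * (rA k m 0 p q + rB m 0 p q) + PowerSeries.C τ * rN k m 0 p q) r :=
    ((Sa.add Sb hr0.le).C_mul _).add (Sn.C_mul _) hr0.le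
  have Saa := Sa.mul Sa hr0.le
  have Sbb := Sb.mul Sb hr0.le
  have Sfa : AS (rfa k τ m 0 p q) r := Saa.mul Sl hr0.le
  have Sfb : AS (rfb k τ m 0 p q) r := (Sbb.mul Sn hr0.le).C_mul _
  have hki : (PowerSeries.C k + 1) * PowerSeries.C ((k+1)⁻¹) = (1 : PowerSeries ℝ) := by
    rw [← map_one (PowerSeries.C (R := ℝ)), ← map_add, ← map_mul, mul_inv_cancel₀ (by positivity)]
  have ro := ring_o (k := PowerSeries.C k) (m := PowerSeries.C m) (τ := PowerSeries.C τ) (p := p) (q := q) (a := rA k m 0 p q) (b := rB m 0 p q)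
    (fa := rfa k τ m 0 p q) (fb := rfb k τ m 0 p q) (tp := Th p) (tq := Th q) hki
    (by simp [rA]) (by simp [rB]) (by simp only [rfa, rN]; simp only [map_neg, map_sub, map_one])
    (by simp only [rfb, rN]; simp only [map_neg, map_sub])
    (by rw [hη]; simp only [rUf]) (by rw [hξ]; simp only [rUh, map_neg, map_sub, map_add, map_one])
  have Ta : Th (rA k m 0 p q) = PowerSeries.C (1-m) * rA k m 0 p q + PowerSeries.C (1+k-m) * rB m 0 p q + rfa k τ m 0 p q := by
    simp only [map_sub, map_add, map_one]; rw [← ro.1]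
    simp only [rA]; rw [Th_add, Th_C_mul]; simp only [map_sub, map_add, map_one]
  have Tb : Th (rB m 0 p q) = rN k m 0 p q + rfb k τ m 0 p q := by
    have := ro.2
    rw [show rN k m 0 p q = PowerSeries.C m * rA k m 0 p q + -(PowerSeries.C k - PowerSeries.C m) * rB m 0 p q from by
      simp only [rN, map_neg, map_sub], ← this]
    simp only [rB]; rw [Th_add, Th_C_mul, Th_C_mul]; simp only [map_neg, map_one]
  have Sl1 := ((Sa.C_mul (1-m)).add (Sb.C_mul (1+k-m)) hr0.le)
  have STa : AS (Th (rA k m 0 p q)) r := by rw [Ta]; exact Sl1.add Sfa hr0.le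
  have STb : AS (Th (rB m 0 p q)) r := by rw [Tb]; exact Sn.add Sfb hr0.le
  refine ⟨r, hr0, pev (rA k m 0 p q), pev (rB m 0 p q), ?_, ?_, ?_, ?_, ?_⟩
  · intro θ hθ
    have pn : pev (rN k m 0 p q) θ = NN k m (pev (rA k m 0 p q) θ) (pev (rB m 0 p q) θ) := by
      rw [show rN k m 0 p q = PowerSeries.C m * rA k m 0 p q + PowerSeries.C (-(k-m)) * rB m 0 p q from rfl,
        pev_add (Sa.C_mul _) (Sb.C_mul _) hθ.le, pev_C_mul, pev_C_mul]; unfold NN; ring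
    refine ⟨pev_analytic Sa hθ, pev_analytic Sb hθ, ?_, ?_⟩
    · rw [pev_deriv Sa STa hθ, Ta, pev_add Sl1 Sfa hθ.le, pev_add (Sa.C_mul _) (Sb.C_mul _) hθ.le, pev_C_mul, pev_C_mul,
        show rfa k τ m 0 p q = (rA k m 0 p q * rA k m 0 p q) *
         (PowerSeries.C (-1) * (rA k m 0 p q + rB m 0 p q) + PowerSeries.C τ * rN k m 0 p q) from rfl, pev_mul Saa Sl hθ.le, pev_mul Sa Sa hθ.le,
        pev_add ((Sa.add Sb hr0.le).C_mul _) (Sn.C_mul _) hθ.le, pev_C_mul, pev_C_mul, pev_add Sa Sb hθ.le, pn]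
      unfold DD NN; ring
    · rw [pev_deriv Sb STb hθ, Tb, pev_add Sn Sfb hθ.le,
        show rfb k τ m 0 p q = PowerSeries.C (-τ) * ((rB m 0 p q * rB m 0 p q) * rN k m 0 p q) from rfl, pev_C_mul, pev_mul Sbb Sn hθ.le, pev_mul Sb Sb hθ.le, pn]
      ring
  · rw [pev_zero]; simp only [rA]; rw [map_add, PowerSeries.coeff_C_mul, e0, x0]; ring
  · rw [pev_zero]; simp only [rB, map_add, PowerSeries.coeff_C_mul, e0, x0]; ring
  · have := pev_deriv_zero hr0 Sa
    have h : coeff 1 (rA k m 0 p q) = k-m+1 := by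
      simp only [rA]; rw [map_add, PowerSeries.coeff_C_mul, e1, x1]; ring
    rwa [h] at this
  · have := pev_deriv_zero hr0 Sb
    have h : coeff 1 (rB m 0 p q) = m := by
      simp only [rB, map_add, PowerSeries.coeff_C_mul, e1, x1]; ring
    rwa [h] at this
end OR

theorem mono_of_C1 {f : ℝ → ℝ} {ε : ℝ} (h : ∀ s ∈ Ioo (0-ε) (0+ε), ContDiffAt ℝ 1 f s ∧ 0 < deriv f s) : StrictMonoOn f (Ioo (0-ε) (0+ε)) :=
  strictMonoOn_of_deriv_pos (convex_Ioo _ _) (fun s hs => (h s hs).1.continuousAt.continuousWithinAt) (by rw [interior_Ioo]; exact fun s hs => (h s hs).2)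

set_option maxHeartbeats 1000000 in
theorem origin_V {k τ m ℓ : ℝ} (hq : 0 < k - m) (hm : 0 < m) (hτ : 0 < τ) (hℓ : ℓ = 1/τ) :
    ∃ δ > 0, ∃ V : ℝ → ℝ, ContDiffAt ℝ (⊤:ℕ∞) V 0 ∧ V 0 = 0 ∧ ∀ Z ∈ Ioo 0 δ, 0 < V Z ∧ V Z < Z ∧
      HasDerivAt V (Deltav m k Z (V Z) / DeltaZ ℓ Z (V Z)) Z := by
  obtain ⟨r, hr, A, B, h1, A0, B0, dA, dB⟩ := origin_curve k τ m (by linarith)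
  have hs : 0 < √τ := Real.sqrt_pos.2 hτ
  set c : ℝ → ℝ × ℝ := fun θ => (A θ, B θ) with hc
  have hcC : ∀ θ, |θ| < r → ContDiffAt ℝ (⊤:ℕ∞) c θ := fun θ hθ => (h1 θ hθ).1.contDiffAt.prodMk (h1 θ hθ).2.1.contDiffAt
  have r0 : |(0:ℝ)| < r := by simpa using hr
  have hn0 : 1 + τ * (c 0).1 * (c 0).2 ≠ 0 := by simp [hc, A0]
  obtain ⟨Z0, W0⟩ := Zo_C1 (τ := τ) (hcC 0 r0) hn0
  have dZ0 : HasDerivAt (fun θ => Zo τ (c θ)) (√τ*(k+1)) 0 := by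
    have := ((dA.add dB).const_mul (√τ)).div (((dA.const_mul τ).mul dB).const_add 1) (by simp [A0])
    exact this.congr_deriv (by simp [A0, B0]; left; ring)
  have dV0 : HasDerivAt (fun θ => Vo τ (c θ)) (√τ*m) 0 := dB.const_mul (√τ)
  have one_le : (1 : WithTop ℕ∞) ≤ ((⊤:ℕ∞) : WithTop ℕ∞) := by exact_mod_cast (le_top : (1:ℕ∞) ≤ ⊤)
  obtain ⟨εZ, hεZ, mZ⟩ := C1_ext (Z0.of_le one_le) (by rw [dZ0.deriv]; have : 0 < k := by linarith
                                                       positivity)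
  obtain ⟨εA, hεA, mA⟩ := C1_ext ((hcC 0 r0).fst.of_le one_le) (by
    have : deriv A 0 = k-m+1 := dA.deriv
    show 0 < deriv A 0
    rw [this]; linarith)
  obtain ⟨εB, hεB, mB⟩ := C1_ext ((hcC 0 r0).snd.of_le one_le) (by
    have : deriv B 0 = m := dB.deriv
    show 0 < deriv B 0
    rw [this]; exact hm)
  have e1 : ∀ᶠ θ in 𝓝 (0:ℝ), A θ < 1 := dA.continuousAt.eventually (gt_mem_nhds (by simp [A0]))
  have e2 : ∀ᶠ θ in 𝓝 (0:ℝ), τ*(B θ)^2 < 1 :=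
    ((continuousAt_const.mul (dB.continuousAt.pow 2))).eventually (gt_mem_nhds (by simp [B0]))
  have e3 : ∀ᶠ θ in 𝓝 (0:ℝ), 0 < 1 + τ * A θ * B θ :=
    (continuousAt_const.add ((continuousAt_const.mul dA.continuousAt).mul dB.continuousAt)).eventually (lt_mem_nhds (by simp [B0]))
  obtain ⟨ε1, hε1, e4⟩ := Metric.eventually_nhds_iff.1 (e1.and (e2.and e3))
  obtain ⟨ε, hε, l1, l2, l3, l4, l5⟩ : ∃ ε > 0, ε ≤ εZ ∧ ε ≤ εA ∧ ε ≤ εB ∧ ε ≤ ε1 ∧ ε ≤ r :=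
    ⟨min εZ (min εA (min εB (min ε1 r))), by positivity, by simp, by simp, by simp, by simp, by simp⟩
  have mZ' : ∀ s ∈ Ioo (0-ε) (0+ε), ContDiffAt ℝ 1 (fun θ => Zo τ (c θ)) s ∧ 0 < deriv (fun θ => Zo τ (c θ)) s :=
    fun s hs => mZ s (Ioo_subset_Ioo (by linarith) (by linarith) hs)
  have fZ := mono_of_C1 mZ'
  have fA : StrictMonoOn A (Ioo (0-ε) (0+ε)) := mono_of_C1 fun s hs => mA s (Ioo_subset_Ioo (by linarith) (by linarith) hs)
  have fB : StrictMonoOn B (Ioo (0-ε) (0+ε)) := mono_of_C1 fun s hs => mB s (Ioo_subset_Ioo (by linarith) (by linarith) hs)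
  have ab : ∀ s ∈ Ioo (0-ε) (0+ε), |s| < ε := fun s hs => abs_lt.2 ⟨by linarith [hs.1], by linarith [hs.2]⟩
  have loc : ∀ s ∈ Ioo (0-ε) (0+ε), A s < 1 ∧ τ*(B s)^2 < 1 ∧ 0 < 1 + τ * A s * B s := fun s hs => e4 (by
    rw [Real.dist_eq, sub_zero]; linarith [ab s hs])
  have cI : ∀ s ∈ Ioo (0-ε) (0+ε), ContDiffAt ℝ (⊤:ℕ∞) (fun θ => Zo τ (c θ)) s ∧ ContDiffAt ℝ (⊤:ℕ∞) (fun θ => Vo τ (c θ)) s :=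
    fun s hs => Zo_C1 (hcC s (by linarith [ab s hs])) (loc s hs).2.2.ne'
  obtain ⟨V, hV⟩ := graph_fn isOpen_Ioo fZ.injOn (fun s hs => (cI s hs).1.of_le one_le) (fun s hs => (cI s hs).2.of_le one_le)
    (fun s hs => ((cI s hs).1.differentiableAt (by simp)).hasDerivAt) (fun s hs => ((cI s hs).2.differentiableAt (by simp)).hasDerivAt)
    (fun s hs => (mZ' s hs).2.ne')
  have I0 : (0:ℝ) ∈ Ioo (0-ε) (0+ε) := ⟨by linarith, by linarith⟩
  have Zc0 : Zo τ (c 0) = 0 := by simp [Zo, hc, A0, B0]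
  have V0 := (hV 0 I0).1
  refine ⟨Zo τ (c (ε/2)), ?_, V, ?_, ?_, ?_⟩
  · rw [← Zc0]; exact fZ I0 ⟨by linarith, by linarith⟩ (by linarith)
  · have := (graph_local one_le Z0 W0 dZ0 dV0 (by have : 0 < k := by linarith
                                                  positivity) (v := V) (by
      filter_upwards [isOpen_Ioo.mem_nhds I0] with s hs using (hV s hs).1)).1
    simpa only [Zc0] using this
  · rw [Zc0] at V0; rw [V0]; simp [Vo, hc, B0]
  · intro Z hZ
    have hcont : ContinuousOn (fun θ => Zo τ (c θ)) (Icc 0 (ε/2)) := fun s hs =>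
      (cI s ⟨by linarith [hs.1], by linarith [hs.2]⟩).1.continuousAt.continuousWithinAt
    obtain ⟨θ, hθ, rfl⟩ := intermediate_value_Ioo (by linarith) hcont (show Z ∈ _ from by simpa only [Zc0] using hZ)
    have θI : θ ∈ Ioo (0-ε) (0+ε) := ⟨by linarith [hθ.1], by linarith [hθ.2]⟩
    have Ap : 0 < A θ := by rw [← A0]; exact fA I0 θI hθ.1
    have Bp : 0 < B θ := by rw [← B0]; exact fB I0 θI hθ.1
    obtain ⟨q1, q2, q3⟩ := loc θ θI
    obtain ⟨p1, p2, p3, p4, p5⟩ := pt_facts hτ Ap Bp q2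
    have Vθ := (hV θ θI).1
    simp only at Vθ ⊢
    rw [Vθ]
    refine ⟨p3, p4, ?_⟩
    have hexp : rexp (-(k-m)*(-(Real.log θ)/(k-m))) = θ := by
      rw [show -(k-m)*(-(Real.log θ)/(k-m)) = Real.log θ by field_simp, Real.exp_log hθ.1]
    generalize -(Real.log θ)/(k-m) = t at hexp
    have dexp : HasDerivAt (fun t => rexp (-(k-m)*t)) (-(k-m)*θ) t := by
      have := ((hasDerivAt_id t).const_mul (-(k-m))).exp
      simp only [id] at this
      rw [hexp] at this
      convert this using 1; ring
    obtain ⟨a1, a2, a3, a4⟩ := h1 θ (by linarith [ab θ θI])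
    have dc : HasDerivAt (fun t => c (rexp (-(k-m)*t))) (bF k τ (m, c (rexp (-(k-m)*t)))) t := by
      have b1 : HasDerivAt (fun t => A (rexp (-(k-m)*t))) (deriv A θ * (-(k-m)*θ)) t :=
        HasDerivAt.comp (h₂ := A) t (by rw [hexp]; exact a1.differentiableAt.hasDerivAt) dexp
      have b2 : HasDerivAt (fun t => B (rexp (-(k-m)*t))) (deriv B θ * (-(k-m)*θ)) t :=
        HasDerivAt.comp (h₂ := B) t (by rw [hexp]; exact a2.differentiableAt.hasDerivAt) dexp
      convert b1.prodMk b2 using 1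
      rw [hexp]
      simp only [bF, hc]
      rw [← a3, ← a4]
      ext <;> simp only <;> ring
    have cc : ContDiffAt ℝ 1 (fun t => c (rexp (-(k-m)*t))) t :=
      ContDiffAt.comp (g := c) t (by rw [hexp]; exact (hcC θ (by linarith [ab θ θI])).of_le one_le) (by fun_prop)
    obtain ⟨z1, z2⟩ := Zo_deriv dc (by rw [hexp]; exact q3.ne')
    obtain ⟨y1, y2⟩ := Zo_C1 cc (by rw [hexp]; exact q3.ne')
    have ev : ∀ᶠ s in 𝓝 t, V (Zo τ (c (rexp (-(k-m)*s)))) = Vo τ (c (rexp (-(k-m)*s))) := by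
      have := dexp.continuousAt.eventually (by simp only [hexp]; exact isOpen_Ioo.mem_nhds θI : Ioo (0-ε) (0+ε) ∈ 𝓝 _)
      filter_upwards [this] with s hs using (hV _ hs).1
    have ha1 : 1 - (A θ)^2 ≠ 0 := by nlinarith
    have fin := (graph_local le_rfl y1 y2 z1 z2 (by
      rw [hexp]
      have : 0 < 1 - τ * (B θ)^2 := by linarith
      have h5 : 0 < A θ + B θ := by linarith
      have h6 : 0 < 1 - (A θ)^2 := by nlinarith
      simp only [hc]
      exact (neg_neg_of_pos (by positivity)).ne) (v := V) ev).2
    rw [hexp] at fin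
    simp only [hc] at fin
    rw [pt_ratio hq hτ hℓ Ap Bp q2 ha1] at fin
    exact fin

set_option maxHeartbeats 2000000 in
theorem cross_mono {k m ℓ Z y1 y2 : ℝ} (hm : 0 < m) (hmk : m < k) (hℓ : 0 < ℓ) (hZ : 0 < Z) (h1 : 0 ≤ y1) (h12 : y1 ≤ y2) (h2 : y2 ≤ Z)
    (hs : 16*(ℓ+2)*Z^2 ≤ 1) : Deltav m k Z y2 * DeltaZ ℓ Z y1 ≤ Deltav m k Z y1 * DeltaZ ℓ Z y2 ∧ 0 < DeltaZ ℓ Z y1 ∧ 0 < DeltaZ ℓ Z y2 := by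
  have hZ2 : 0 < Z^2 := by positivity
  have hℓZ : 0 < ℓ*Z^2 := by positivity
  have a1 : Z^2 ≤ 1/32 := by nlinarith
  have a2 : (ℓ+2)*Z^2 ≤ 1/16 := by nlinarith
  have hZ1 : Z ≤ 1 := by nlinarith
  have g : ∀ y, 0 ≤ y → y ≤ Z → 1/2 ≤ (1-Z*y)^2 - ℓ*(y-Z)^2 := by
    intro y h0 hy
    have b1 : Z*y ≤ Z^2 := by nlinarith
    have b2 : (y-Z)^2 ≤ Z^2 := by nlinarith
    have b3 : ℓ*(y-Z)^2 ≤ ℓ*Z^2 := mul_le_mul_of_nonneg_left b2 hℓ.le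
    nlinarith [sq_nonneg (Z*y)]
  have g1 := g y1 h1 (by linarith)
  have g2 := g y2 (by linarith) h2
  refine ⟨?_, mul_pos hZ (by linarith), mul_pos hZ (by linarith)⟩
  have hd : 0 ≤ y2 - y1 := by linarith
  have s1 : y1^2 ≤ y2^2 := pow_le_pow_left₀ h1 h12 2
  have s2 : y2^2 ≤ Z^2 := pow_le_pow_left₀ (h1.trans h12) h2 2
  have p1 : (y1+y2)*Z ≤ 2*Z^2 := by linarith [mul_le_mul_of_nonneg_right (show y1+y2 ≤ 2*Z by linarith) hZ.le]
  have hh : (y2-y1)/2 ≤ (1-y2^2)*(y2*(1-y2*Z)) - (1-y1^2)*(y1*(1-y1*Z)) := by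
    have e : (1-y2^2)*(y2*(1-y2*Z)) - (1-y1^2)*(y1*(1-y1*Z)) - (y2-y1)/2
      = (y2-y1)*(1/2 - (y1+y2)*Z - (y2^2+y1*y2+y1^2) + Z*(y2^2+y1^2)*(y1+y2)) := by ring
    have p2 : y1*y2 ≤ Z^2 := by linarith [mul_le_mul_of_nonneg_right h12 (h1.trans h12)]
    have p3 : 0 ≤ Z*(y2^2+y1^2)*(y1+y2) := by have : 0 ≤ y2 := by linarith
                                              positivity
    have := mul_nonneg hd (show 0 ≤ 1/2 - (y1+y2)*Z - (y2^2+y1*y2+y1^2) + Z*(y2^2+y1^2)*(y1+y2) by linarith)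
    linarith
  have hm2 : (1-y2^2)^2*Z ≤ (1-y1^2)^2*Z := by
    apply mul_le_mul_of_nonneg_right _ hZ.le
    exact pow_le_pow_left₀ (by linarith) (by linarith) 2
  set f1 := (1-y1^2)*(m*(1-y1^2)*Z - k*y1*(1-y1*Z)) with hf1
  set f2 := (1-y2^2)*(m*(1-y2^2)*Z - k*y2*(1-y2*Z)) with hf2
  have hk : 0 < k := by linarith
  have F : k*((y2-y1)/2) ≤ f1 - f2 := by
    have := mul_le_mul_of_nonneg_left hh hk.le
    have := mul_le_mul_of_nonneg_left hm2 hm.le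
    rw [hf1, hf2]; linarith
  have F2 : |f2| ≤ 2*k*Z := by
    have y0 : 0 ≤ y2 := by linarith
    have t1 : 0 ≤ 1 - y2^2 := by linarith
    have t2 : 0 ≤ 1 - y2*Z := by linarith [mul_le_mul_of_nonneg_right h2 hZ.le]
    have u1 : 0 ≤ m*((1-y2^2)*(1-y2^2)*Z) ∧ (1-y2^2)*(1-y2^2)*Z ≤ Z := ⟨by positivity, by
      have : (1-y2^2)*(1-y2^2) ≤ 1 := mul_le_one₀ (by linarith [sq_nonneg y2]) t1 (by linarith [sq_nonneg y2])
      linarith [mul_le_mul_of_nonneg_right this hZ.le]⟩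
    have u2 : 0 ≤ k*((1-y2^2)*(y2*(1-y2*Z))) ∧ (1-y2^2)*(y2*(1-y2*Z)) ≤ Z := ⟨by positivity, by
      have c1 : y2*(1-y2*Z) ≤ y2 := by linarith [mul_nonneg (mul_nonneg y0 y0) hZ.le]
      have c2 : 0 ≤ y2*(1-y2*Z) := by positivity
      linarith [mul_nonneg (sq_nonneg y2) c2]⟩
    have u3 := mul_le_mul_of_nonneg_left u1.2 hm.le
    have u4 := mul_le_mul_of_nonneg_left u2.2 hk.le
    have e : f2 = m*((1-y2^2)*(1-y2^2)*Z) - k*((1-y2^2)*(y2*(1-y2*Z))) := by rw [hf2]; ring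
    have u5 : m*Z ≤ k*Z := mul_le_mul_of_nonneg_right hmk.le hZ.le
    rw [e, abs_le]; constructor <;> linarith [u1.1, u2.1, mul_pos hk hZ]
  have G : |((1-Z*y2)^2 - ℓ*(y2-Z)^2) - ((1-Z*y1)^2 - ℓ*(y1-Z)^2)| ≤ (2+2*ℓ)*Z*(y2-y1) := by
    have e : ((1-Z*y2)^2 - ℓ*(y2-Z)^2) - ((1-Z*y1)^2 - ℓ*(y1-Z)^2) = (y2-y1)*(ℓ*(2*Z-y1-y2) - Z*(2-Z*(y1+y2))) := by ring
    rw [e, abs_mul, abs_of_nonneg hd]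
    have : |ℓ*(2*Z-y1-y2) - Z*(2-Z*(y1+y2))| ≤ (2+2*ℓ)*Z := by
      have p1 : Z*(y1+y2) ≤ 2*Z^2 := by linarith
      have p2 : 0 ≤ Z*(y1+y2) := mul_nonneg hZ.le (by linarith)
      have p3 : 0 ≤ Z*(2-Z*(y1+y2)) := mul_nonneg hZ.le (by linarith)
      have p4 : 0 ≤ Z*(Z*(y1+y2)) := mul_nonneg hZ.le p2
      have p5 : 0 ≤ ℓ*(2*Z-y1-y2) := mul_nonneg hℓ.le (by linarith)
      have p6 : 0 ≤ ℓ*(y1+y2) := mul_nonneg hℓ.le (by linarith)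
      have p7 := mul_pos hℓ hZ
      rw [abs_le]; constructor <;> linarith
    linarith [mul_le_mul_of_nonneg_left this hd]
  unfold Deltav DeltaZ
  rw [← hf1, ← hf2]
  set G1 := (1-Z*y1)^2 - ℓ*(y1-Z)^2
  set G2 := (1-Z*y2)^2 - ℓ*(y2-Z)^2
  have prod : |f2*(G2-G1)| ≤ 2*k*Z*((2+2*ℓ)*Z*(y2-y1)) := by
    rw [abs_mul]; exact mul_le_mul F2 G (abs_nonneg _) (by positivity)
  have p2 : 2*k*Z*((2+2*ℓ)*Z*(y2-y1)) ≤ k*((y2-y1)/4) := by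
    have : 2*k*Z*((2+2*ℓ)*Z*(y2-y1)) = (4*((1+ℓ)*Z^2))*(k*(y2-y1)) := by ring
    rw [this]
    have := mul_le_mul_of_nonneg_right (show 4*((1+ℓ)*Z^2) ≤ 1/4 by linarith) (show 0 ≤ k*(y2-y1) by positivity)
    linarith
  have p3 : k*((y2-y1)/4) ≤ (f1-f2)*G2 := by
    have c0 : 0 ≤ k*((y2-y1)/2) := by positivity
    have := mul_le_mul F g2 (by norm_num) (c0.trans F)
    linarith
  have p4 := neg_abs_le (f2*(G2-G1))
  have := mul_nonneg hZ.le (show 0 ≤ f1*G2 - f2*G1 by linarith)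
  linarith

theorem phi_anti {k m ℓ Z y1 y2 : ℝ} (hm : 0 < m) (hmk : m < k) (hℓ : 0 < ℓ) (hZ : 0 < Z) (h1 : 0 ≤ y1) (h2 : 0 ≤ y2) (h1' : y1 ≤ Z) (h2' : y2 ≤ Z)
    (hs : 16*(ℓ+2)*Z^2 ≤ 1) : (y1 - y2)*(Deltav m k Z y1 / DeltaZ ℓ Z y1 - Deltav m k Z y2 / DeltaZ ℓ Z y2) ≤ 0 := by
  rcases le_total y1 y2 with h | h
  · obtain ⟨c, d1, d2⟩ := cross_mono hm hmk hℓ hZ h1 h h2' hs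
    apply mul_nonpos_of_nonpos_of_nonneg (by linarith)
    rw [sub_nonneg, div_le_div_iff₀ d2 d1]; exact c
  · obtain ⟨c, d1, d2⟩ := cross_mono hm hmk hℓ hZ h2 h h1' hs
    apply mul_nonpos_of_nonneg_of_nonpos (by linarith)
    rw [sub_nonpos, div_le_div_iff₀ d2 d1]; exact c

theorem origin_unique {k m ℓ δ : ℝ} {v V : ℝ → ℝ} (hm : 0 < m) (hmk : m < k) (hℓ : 0 < ℓ) (hδ : 16*(ℓ+2)*δ^2 ≤ 1)
    (hv : ∀ Z ∈ Ioo 0 δ, 0 < v Z ∧ v Z < Z ∧ HasDerivAt v (Deltav m k Z (v Z) / DeltaZ ℓ Z (v Z)) Z)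
    (hV : ∀ Z ∈ Ioo 0 δ, 0 < V Z ∧ V Z < Z ∧ HasDerivAt V (Deltav m k Z (V Z) / DeltaZ ℓ Z (V Z)) Z) :
    ∀ Z ∈ Ioo 0 δ, v Z = V Z := by
  have dD : ∀ Z ∈ Ioo 0 δ, HasDerivAt (fun Z => (v Z - V Z)^2) (2*((v Z - V Z)*(Deltav m k Z (v Z) / DeltaZ ℓ Z (v Z) - Deltav m k Z (V Z) / DeltaZ ℓ Z (V Z)))) Z := by
    intro Z hZ
    have := ((hv Z hZ).2.2.sub (hV Z hZ).2.2).pow 2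
    exact this.congr_deriv (by simp; ring)
  have an : AntitoneOn (fun Z => (v Z - V Z)^2) (Ioo 0 δ) := by
    apply antitoneOn_of_deriv_nonpos (convex_Ioo _ _) (fun Z hZ => (dD Z hZ).continuousAt.continuousWithinAt)
    · rw [interior_Ioo]; exact fun Z hZ => (dD Z hZ).differentiableAt.differentiableWithinAt
    · rw [interior_Ioo]; intro Z hZ
      rw [(dD Z hZ).deriv]
      have hZδ : Z^2 ≤ δ^2 := by nlinarith [hZ.1, hZ.2]
      have := phi_anti hm hmk hℓ hZ.1 (hv Z hZ).1.le (hV Z hZ).1.le (hv Z hZ).2.1.le (hV Z hZ).2.1.le (by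
        have := mul_le_mul_of_nonneg_left hZδ (show 0 ≤ 16*(ℓ+2) by linarith)
        linarith)
      linarith
  intro Z hZ
  have key : ∀ s ∈ Ioo 0 Z, (v Z - V Z)^2 ≤ s^2 := by
    intro s hs
    have hs' : s ∈ Ioo 0 δ := ⟨hs.1, hs.2.trans hZ.2⟩
    have h1 := an hs' hZ hs.2.le
    simp only at h1
    have h2 := hv s hs'
    have h3 := hV s hs'
    nlinarith
  have le0 : (v Z - V Z)^2 ≤ 0 := by
    by_contra h
    push Not at h
    set d := |v Z - V Z| with hd
    have d0 : 0 < d := by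
      rw [hd]; apply abs_pos.2; intro h0; rw [h0] at h; simp at h
    have hdd : (v Z - V Z)^2 = d^2 := (sq_abs _).symm
    have hm' : 0 < min (d/2) (Z/2) := lt_min (by linarith) (by linarith [hZ.1])
    have := key (min (d/2) (Z/2)) ⟨hm', (min_le_right _ _).trans_lt (by linarith [hZ.1])⟩
    have h4 : min (d/2) (Z/2) ≤ d/2 := min_le_left _ _
    nlinarith
  have := pow_eq_zero_iff (two_ne_zero) |>.1 (le_antisymm le0 (sq_nonneg _))
  linarith

set_option maxHeartbeats 1000000 in
theorem final_core {k τ m3 m4 ℓ : ℝ} (w : WIN k τ m3 m4) (hℓ : ℓ = 1/τ) :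
    ∃ β m Z₁ : ℝ, 0 < β ∧ β < k ∧ m = β * ℓ / (ℓ + 1) ∧ Z₁ = k * Real.sqrt ℓ / (ℓ * (k - m) + m) ∧
        ∃ v : ℝ → ℝ, ContDiffOn ℝ (⊤ : ℕ∞) v (Ici 0) ∧ v 0 = 0 ∧ (∀ Z : ℝ, 0 ≤ Z → |v Z| < 1) ∧ (∀ Z : ℝ, 0 < Z → v Z < Z) ∧
          (∀ Z : ℝ, 0 ≤ Z → DeltaZ ℓ Z (v Z) * deriv v Z = Deltav m k Z (v Z)) ∧
          (∀ Z ∈ Ioo (0 : ℝ) Z₁, 0 < DeltaZ ℓ Z (v Z)) ∧ (∀ Z ∈ Ioi Z₁, DeltaZ ℓ Z (v Z) < 0) ∧ v Z₁ = m / ((k - m) * Real.sqrt ℓ) := by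
  obtain ⟨m, P, v, h1, h2, h3, h4, h5⟩ := mid_V w hℓ
  have hτ := P.hτ0
  have hm := P.hm
  have hq := P.hq0
  have hk := P.hk
  have hℓ0 : 0 < ℓ := by rw [hℓ]; positivity
  have hb : 0 < m/(k-m) := div_pos hm hq
  obtain ⟨p1, p2, p3, p4, p5⟩ := pt_facts hτ one_pos hb P.tb
  have htm : τ*m < k - m := by
    have := P.heg
    rw [← P.hT]; linarith [P.he, P.hg]
  have hs : 0 < √τ := Real.sqrt_pos.2 hτ
  have hss : √τ*√τ = τ := Real.mul_self_sqrt hτ.le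
  have hsl : √ℓ = 1/√τ := by rw [hℓ, Real.sqrt_div zero_le_one, Real.sqrt_one]
  have hZ1 : Zo τ (1, m/(k-m)) = k * √ℓ / (ℓ * (k - m) + m) := by
    rw [hsl, hℓ]; unfold Zo
    have : 0 < τ*m := by positivity
    have e2 : (k-m)+τ*m ≠ 0 := by positivity
    simp only [mul_one]
    rw [show 1 + m/(k-m) = k/(k-m) by field_simp; ring, show 1 + τ*(m/(k-m)) = (k-m+τ*m)/(k-m) by field_simp,
      show 1/τ*(k-m)+m = (k-m+τ*m)/τ by field_simp]
    field_simp
    rw [sq]; linarith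
  have hV1 : Vo τ (1, m/(k-m)) = m / ((k - m) * √ℓ) := by
    rw [hsl]; unfold Vo; field_simp
  set Z1 := Zo τ (1, m/(k-m)) with hZ1d
  set u : ℝ → ℝ := fun Z => if Z ≤ 0 then 0 else v Z with hu
  have u0 : u 0 = 0 := by simp [hu]
  have up : ∀ Z, 0 < Z → u Z = v Z := fun Z hZ => by simp [hu, not_le.2 hZ]
  have ue : ∀ Z, 0 < Z → u =ᶠ[𝓝 Z] v := fun Z hZ => by
    filter_upwards [isOpen_Ioi.mem_nhds hZ] with s hs' using up s hs'
  have D0 : ∀ Z, 0 < Z → Z ≠ Z1 → DeltaZ ℓ Z (v Z) ≠ 0 := by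
    intro Z hZ hne
    rcases lt_or_gt_of_ne hne with h | h
    · exact (h2 Z ⟨hZ, h⟩).2.2.2.ne'
    · exact (h3 Z h).2.2.ne
  have sm : ∀ Z, 0 < Z → ContDiffAt ℝ (⊤:ℕ∞) v Z := by
    intro Z hZ
    by_cases hne : Z = Z1
    · rw [hne]; exact h5
    have hU : IsOpen (Ioi (0:ℝ) ∩ {Z1}ᶜ) := isOpen_Ioi.inter isOpen_compl_singleton
    have := bootstrap (F := fun z y => Deltav m k z y / DeltaZ ℓ z y) hU (v := v) (fun z hz => by
      apply ContDiffAt.div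
      · unfold Deltav; fun_prop
      · unfold DeltaZ; fun_prop
      · exact D0 z hz.1 hz.2) (fun z hz => h1 z hz.1 hz.2)
    exact this.contDiffAt (hU.mem_nhds ⟨hZ, hne⟩)
  have ode : ∀ Z, 0 < Z → DeltaZ ℓ Z (v Z) * deriv v Z = Deltav m k Z (v Z) := by
    have gen : ∀ Z, 0 < Z → Z ≠ Z1 → DeltaZ ℓ Z (v Z) * deriv v Z = Deltav m k Z (v Z) := by
      intro Z hZ hne
      rw [(h1 Z hZ hne).deriv, mul_div_cancel₀ _ (D0 Z hZ hne)]
    intro Z hZ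
    by_cases hne : Z = Z1
    · rw [hne]
      have cv : ContinuousAt v Z1 := h5.continuousAt
      have cd : ContinuousAt (deriv v) Z1 := by
        have := h5.continuousAt_fderiv (by simp)
        exact (this.clm_apply continuousAt_const)
      have cl : ContinuousAt (fun Z => DeltaZ ℓ Z (v Z) * deriv v Z) Z1 := by
        unfold DeltaZ; fun_prop
      have cr : ContinuousAt (fun Z => Deltav m k Z (v Z)) Z1 := by
        unfold Deltav; fun_prop
      have t1 := cl.tendsto.mono_left (nhdsWithin_le_nhds (s := {Z1}ᶜ))
      have t2 := cr.tendsto.mono_left (nhdsWithin_le_nhds (s := {Z1}ᶜ))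
      refine tendsto_nhds_unique (t1.congr' ?_) t2
      filter_upwards [self_mem_nhdsWithin, mem_nhdsWithin_of_mem_nhds (isOpen_Ioi.mem_nhds p2)] with s hs1 hs2 using gen s hs2 hs1
    · exact gen Z hZ hne
  have vl : ∀ Z, 0 < Z → v Z < Z ∧ |v Z| < 1 := by
    intro Z hZ
    rcases lt_trichotomy Z Z1 with h | h | h
    · obtain ⟨a1, a2, a3, a4⟩ := h2 Z ⟨hZ, h⟩
      exact ⟨a2, by rw [abs_of_pos a1]; exact a3⟩
    · rw [h, h4]; exact ⟨p4, by rw [abs_of_pos p3]; exact p5⟩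
    · exact ⟨(h3 Z h).2.1, (h3 Z h).1⟩
  refine ⟨m*(1+τ), m, Z1, by positivity, by linarith, ?_, hZ1, u, ?_, u0, ?_, ?_, ?_, ?_, ?_, ?_⟩
  · rw [hℓ]; field_simp
  · intro Z hZ
    rcases (mem_Ici.1 hZ).eq_or_lt with h | h
    · rw [← h]
      obtain ⟨δ, hδ, V, V1, V2, V3⟩ := origin_V hq hm hτ hℓ
      set δ' := min δ (min Z1 (1/(4*(ℓ+2)))) with hδ'
      have q1 : δ' ≤ δ := min_le_left _ _
      have q2 : δ' ≤ Z1 := (min_le_right _ _).trans (min_le_left _ _)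
      have q3 : δ' ≤ 1/(4*(ℓ+2)) := (min_le_right _ _).trans (min_le_right _ _)
      have q0 : 0 < δ' := lt_min hδ (lt_min p2 (by positivity))
      have q4 : 16*(ℓ+2)*δ'^2 ≤ 1 := by
        have e : δ'*(4*(ℓ+2)) ≤ 1 := by rwa [le_div_iff₀ (by positivity)] at q3
        have e' : 0 ≤ δ'*(4*(ℓ+2)) := by positivity
        have e2 : (δ'*(4*(ℓ+2)))^2 ≤ 1 := pow_le_one₀ e' e
        have e3 : 0 ≤ δ'^2*(16*(ℓ+2)*(ℓ+1)) := by positivity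
        linarith
      have un := origin_unique (v := v) (V := V) hm (by linarith : m < k) hℓ0 q4
        (fun Z hZ => by
          have := h2 Z ⟨hZ.1, hZ.2.trans_le q2⟩
          exact ⟨this.1, this.2.1, h1 Z hZ.1 (hZ.2.trans_le q2).ne⟩)
        (fun Z hZ => V3 Z ⟨hZ.1, hZ.2.trans_le q1⟩)
      refine V1.contDiffWithinAt.congr_of_eventuallyEq ?_ (by rw [u0, V2])
      filter_upwards [self_mem_nhdsWithin, mem_nhdsWithin_of_mem_nhds (isOpen_Iio.mem_nhds q0)] with s hs1 hs2
      rcases (mem_Ici.1 hs1).eq_or_lt with h' | h'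
      · rw [← h', u0, V2]
      · rw [up s h', un s ⟨h', hs2⟩]
    · exact ((sm Z h).congr_of_eventuallyEq (ue Z h)).contDiffWithinAt
  · intro Z hZ
    rcases hZ.eq_or_lt with h | h
    · rw [← h, u0]; simp
    · rw [up Z h]; exact (vl Z h).2
  · intro Z hZ
    rw [up Z hZ]; exact (vl Z hZ).1
  · intro Z hZ
    rcases hZ.eq_or_lt with h | h
    · rw [← h, u0]; simp [DeltaZ, Deltav]
    · rw [(ue Z h).deriv_eq, up Z h]; exact ode Z h
  · intro Z hZ
    rw [up Z hZ.1]; exact (h2 Z hZ).2.2.2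
  · intro Z hZ
    rw [up Z (p2.trans hZ)]; exact (h3 Z hZ).2.2
  · rw [up Z1 p2, h4, hV1]

/-- Existence of a global smooth solution of the self-similar ODE crossing the sonic
point `P₁ = (Z₁, v₁)`. -/
theorem global_smooth_solution_self_similar_ODE :
    ∀ k : ℕ, 1 ≤ k →
    ∃ ℓstar : ℝ, 1 < ℓstar ∧
      ∀ ℓ : ℝ, 1 < ℓ → (ℓ < ℓstar ∨ k = 1 ∨ k = 2) →
      ∃ β m Z₁ : ℝ, 0 < β ∧ β < (k : ℝ) ∧
        m = β * ℓ / (ℓ + 1) ∧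
        Z₁ = (k : ℝ) * Real.sqrt ℓ / (ℓ * ((k : ℝ) - m) + m) ∧
        ∃ v : ℝ → ℝ,
          ContDiffOn ℝ (⊤ : ℕ∞) v (Ici 0) ∧
          v 0 = 0 ∧
          (∀ Z : ℝ, 0 ≤ Z → |v Z| < 1) ∧
          (∀ Z : ℝ, 0 < Z → v Z < Z) ∧
          (∀ Z : ℝ, 0 ≤ Z → DeltaZ ℓ Z (v Z) * deriv v Z = Deltav m (k : ℝ) Z (v Z)) ∧
          (∀ Z ∈ Ioo (0 : ℝ) Z₁, 0 < DeltaZ ℓ Z (v Z)) ∧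
          (∀ Z ∈ Ioi Z₁, DeltaZ ℓ Z (v Z) < 0) ∧
          v Z₁ = m / (((k : ℝ) - m) * Real.sqrt ℓ) := by
  intro k hk
  obtain ⟨δ, hδ, hδ1, H⟩ := win_exists k hk
  have h1δ : 0 < 1 - δ := by linarith
  refine ⟨1/(1-δ), by rw [lt_div_iff₀ h1δ]; linarith, ?_⟩
  intro ℓ hℓ hor
  have hℓ0 : 0 < ℓ := by linarith
  obtain ⟨m3, m4, w⟩ := H (1/ℓ) (by positivity) (by rw [div_lt_one hℓ0]; exact hℓ) (by
    rcases hor with h | h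
    · left
      rw [lt_div_iff₀ h1δ] at h
      rw [lt_div_iff₀ hℓ0]; linarith
    · right; exact h)
  exact final_core w (by simp)
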